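/- Assume Assumption (*). For every η > 0 there exist C(η) > 0 and n_0 such that for all n ≥ n_0 and all γ ∈ [γ_crit − 10^{−25}, γ_crit + 10^{−25}] with γ√n ∈ ℤ: E[X_γ²] ≤ C(η) · ( (1+η)^n · E[X_γ] + 16^{−n} · C(2n,n)² · exp(n · sup_{β∈[0,1], α_1,α_2∈ℝ} F_2(β,α_1,α_2)) ), where the expectations are over G ∼ G(2n,1/2) and F_1, F_2 are defined with parameter γ. -/

import Mathlib

open MeasureTheory ProbabilityTheory

/-- `P[Z ≥ t]` for a standard Gaussian `Z`. -/
noncomputable def gaussTail (t : ℝ) : ℝ :=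
  ((gaussianReal 0 1) {x | t ≤ x}).toReal

/-- The law of a pair of independent standard Gaussians. -/
noncomputable def gauss2 : Measure (ℝ × ℝ) :=
  (gaussianReal 0 1).prod (gaussianReal 0 1)

/-- `F₁(α) = log 2 − α² + log P[Z ≥ (γ+α)√2]`. -/
noncomputable def F1 (γ α : ℝ) : ℝ :=
  Real.log 2 - α ^ 2 + Real.log (gaussTail ((γ + α) * Real.sqrt 2))

/-- `f(β,α) = P[√(β/2)Z₁ + √((1−β)/2)Z₂ ≥ γ+α ∧ √(β/2)Z₁ − √((1−β)/2)Z₂ ≥ γ+α]`. -/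
noncomputable def fB (γ β α : ℝ) : ℝ :=
  (gauss2 {p : ℝ × ℝ |
      γ + α ≤ Real.sqrt (β / 2) * p.1 + Real.sqrt ((1 - β) / 2) * p.2 ∧
      γ + α ≤ Real.sqrt (β / 2) * p.1 - Real.sqrt ((1 - β) / 2) * p.2}).toReal

/-- The two-partition exponent function `F₂`. -/
noncomputable def F2 (γ β α₁ α₂ : ℝ) : ℝ :=
  2 * Real.log 2 - 2 * β * Real.log β - 2 * (1 - β) * Real.log (1 - β)
    - 2 * α₁ ^ 2 - 2 * α₂ ^ 2
    + 2 * β * Real.log (fB γ β α₁) + 2 * (1 - β) * Real.log (fB γ (1 - β) α₂)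

/-- `γ` is the critical constant: `γ > 0` and
`log 2 + sup_α (−α² + log P[Z ≥ (γ+α)√2]) = 0`. -/
def IsGammaCrit (γ : ℝ) : Prop :=
  0 < γ ∧
    Real.log 2 +
      (⨆ α : ℝ, (-α ^ 2 + Real.log (gaussTail ((γ + α) * Real.sqrt 2)))) = 0

/-- Assumption (*) from the paper, with `ε₀ = 10⁻²⁵`: for every
`γ ∈ [γ_crit − ε₀, γ_crit + ε₀]`, (i) the sup of `F₂` over `β ∈ [0,.001]` is `2 sup F₁`,
(ii) the sup of `F₂` over `β ∈ [.001,.999]` is `4 sup F₁`, and (iii) writing `α(γ)` for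
the maximizer of `F₁`, the Hessian of `F₂` at `(1/2, α(γ), α(γ))` is strictly negative
definite and this point is the unique maximizer of `F₂` over `β ∈ [.001,.999]`. -/
def AssumptionStar (γcrit : ℝ) : Prop :=
  ∀ γ ∈ Set.Icc (γcrit - (10 : ℝ) ^ (-25 : ℤ)) (γcrit + (10 : ℝ) ^ (-25 : ℤ)),
    sSup {x : ℝ | ∃ β ∈ Set.Icc (0 : ℝ) 0.001, ∃ α₁ α₂ : ℝ, x = F2 γ β α₁ α₂}
        = 2 * (⨆ α : ℝ, F1 γ α) ∧
    sSup {x : ℝ | ∃ β ∈ Set.Icc (0.001 : ℝ) 0.999, ∃ α₁ α₂ : ℝ, x = F2 γ β α₁ α₂}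
        = 4 * (⨆ α : ℝ, F1 γ α) ∧
    ∀ αγ : ℝ, (∀ α : ℝ, F1 γ α ≤ F1 γ αγ) →
      ((∀ v : ℝ × ℝ × ℝ, v ≠ 0 →
          iteratedFDeriv ℝ 2 (fun p : ℝ × ℝ × ℝ => F2 γ p.1 p.2.1 p.2.2)
            (1 / 2, αγ, αγ) ![v, v] < 0) ∧
       (∀ β ∈ Set.Icc (0.001 : ℝ) 0.999, ∀ α₁ α₂ : ℝ,
          F2 γ β α₁ α₂ ≤ F2 γ (1 / 2) αγ αγ ∧
          (F2 γ β α₁ α₂ = F2 γ (1 / 2) αγ αγ → (β, α₁, α₂) = (1 / 2, αγ, αγ))))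

/-- The probability, under the uniform measure on labeled graphs on `Fin n`
(equivalently under `G(n,1/2)`), of a graph property `P`. -/
noncomputable def graphProb (n : ℕ) (P : SimpleGraph (Fin n) → Prop) : ℝ :=
  (Nat.card {G : SimpleGraph (Fin n) // P G} : ℝ) / 2 ^ n.choose 2

/-- `deg(v,S)`: the number of neighbors of `v` inside the vertex set `S`. -/
noncomputable def degIn {n : ℕ} (G : SimpleGraph (Fin n)) (v : Fin n)
    (S : Finset (Fin n)) : ℕ :=
  Nat.card {w : Fin n // w ∈ S ∧ G.Adj v w}

/-- `X_γ`: the number of bisections `[2n] = A ∪ Aᶜ` with `|A| = n` such that every vertex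
has at least `γ√n` more neighbours in its own part than in the other part. -/
noncomputable def Xgamma (n : ℕ) (γ : ℝ) (G : SimpleGraph (Fin (2 * n))) : ℕ :=
  Nat.card {A : Finset (Fin (2 * n)) //
    A.card = n ∧
    (∀ v ∈ A, (degIn G v Aᶜ : ℝ) + γ * Real.sqrt n ≤ (degIn G v A : ℝ)) ∧
    (∀ v ∈ (Aᶜ : Finset (Fin (2 * n))),
      (degIn G v A : ℝ) + γ * Real.sqrt n ≤ (degIn G v Aᶜ : ℝ))}

/-- `E[X_γ]` over `G ∼ G(2n, 1/2)`. -/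
noncomputable def EXgamma (n : ℕ) (γ : ℝ) : ℝ :=
  (∑ G : SimpleGraph (Fin (2 * n)), (Xgamma n γ G : ℝ)) / 2 ^ (2 * n).choose 2

/-- `E[X_γ²]` over `G ∼ G(2n, 1/2)`. -/
noncomputable def EXgammaSq (n : ℕ) (γ : ℝ) : ℝ :=
  (∑ G : SimpleGraph (Fin (2 * n)), (Xgamma n γ G : ℝ) ^ 2) / 2 ^ (2 * n).choose 2

open Real in
lemma cosh_le_exp_sub {x : ℝ} (hx : |x| ≤ 4) :
    cosh x ≤ exp (x ^ 2 / 2 - exp (-8) / 16 * x ^ 4) := by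
  have h1 : cosh (x / 2) ≤ exp (x ^ 2 / 8) := by
    have := Real.cosh_le_exp_half_sq (x / 2)
    convert this using 2; ring
  have h2 : cosh x = 2 * cosh (x / 2) ^ 2 - 1 := by
    have := Real.cosh_two_mul (x / 2)
    rw [show 2 * (x / 2) = x by ring] at this
    rw [this, Real.sinh_sq]; ring
  set y := x ^ 2 / 4 with hy
  have h3 : cosh (x / 2) ^ 2 ≤ exp y := by
    have : exp y = exp (x ^ 2 / 8) ^ 2 := by
      rw [← Real.exp_nat_mul]; congr 1; push_cast; ring
    rw [this]
    exact pow_le_pow_left₀ (by positivity) h1 2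
  have hy0 : 0 ≤ y := by positivity
  have h4 : y ^ 2 ≤ (exp y - 1) ^ 2 := by
    apply pow_le_pow_left₀ hy0
    have := Real.add_one_le_exp y
    linarith
  have h5 : exp (x ^ 2 / 2) = exp y ^ 2 := by
    rw [← Real.exp_nat_mul]; congr 1; push_cast; ring
  have h6 : cosh x ≤ exp (x ^ 2 / 2) - y ^ 2 := by
    rw [h5, h2]; nlinarith
  have hx2 : x ^ 2 ≤ 16 := by
    have := sq_le_sq' (by linarith [abs_nonneg x]) hx
    rw [sq_abs] at this; linarith
  have h7 : exp (x ^ 2 / 2) * (1 - exp (-8) / 16 * x ^ 4) ≤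
      exp (x ^ 2 / 2 - exp (-8) / 16 * x ^ 4) := by
    rw [sub_eq_add_neg (x ^ 2 / 2), Real.exp_add]
    apply mul_le_mul_of_nonneg_left _ (exp_pos _).le
    have := Real.add_one_le_exp (-(exp (-8) / 16 * x ^ 4))
    linarith
  have h8 : exp (x ^ 2 / 2) * exp (-8) ≤ 1 := by
    rw [← Real.exp_add, Real.exp_le_one_iff]; linarith
  have h9 : y ^ 2 = x ^ 4 / 16 := by rw [hy]; ring
  have hx4 : 0 ≤ x ^ 4 := by positivity
  nlinarith

/-- The constant governing the loss in the comparison of `cosh² x - u` with a Gaussian. -/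
noncomputable def coshLoss : ℝ := 4 * Real.exp 24

lemma coshLoss_pos : 0 < coshLoss := by unfold coshLoss; positivity

open Real in
lemma cosh_sq_sub_le {x u : ℝ} (hx : |x| ≤ 4) (hu0 : 0 ≤ u) (hu1 : u ≤ 1) :
    cosh x ^ 2 - u ≤ exp (x ^ 2 - u / (1 + coshLoss * u)) := by
  set c := exp (-8) / 16 with hc
  have hc0 : 0 < c := by positivity
  have hK : coshLoss * (4 * c) = exp 16 := by
    rw [hc, coshLoss]
    have : exp 24 * exp (-8) = exp 16 := by rw [← exp_add]; norm_num
    linear_combination this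
  have hKpos := coshLoss_pos
  have h16 : (1 : ℝ) ≤ exp 16 := Real.one_le_exp (by norm_num)
  have hcosh : cosh x ^ 2 ≤ exp (x ^ 2 - 2 * c * x ^ 4) := by
    have : exp (x ^ 2 - 2 * c * x ^ 4) = exp (x ^ 2 / 2 - c * x ^ 4) ^ 2 := by
      rw [← Real.exp_nat_mul]; congr 1; push_cast; ring
    rw [this]
    exact pow_le_pow_left₀ (cosh_pos x).le (cosh_le_exp_sub hx) 2
  have hx2 : x ^ 2 ≤ 16 := by
    have := sq_le_sq' (by linarith [abs_nonneg x]) hx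
    rw [sq_abs] at this; linarith
  have hden : 0 < 1 + coshLoss * u := by positivity
  rcases le_total u (4 * c) with h | h
  · have hcs : cosh x ^ 2 - u = cosh x ^ 2 * (1 - u / cosh x ^ 2) := by
      have := (cosh_pos x).ne'
      field_simp
    have hle : 1 - u / cosh x ^ 2 ≤ exp (-(u * (1 - x ^ 2))) := by
      have h1 : 1 - x ^ 2 ≤ 1 / cosh x ^ 2 := by
        have h2 : cosh x ^ 2 ≤ exp (x ^ 2) :=
          hcosh.trans (exp_le_exp.2 (by nlinarith [pow_nonneg (sq_nonneg x) 2]))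
        have h3 : exp (-x ^ 2) ≤ 1 / cosh x ^ 2 := by
          rw [exp_neg, one_div]
          exact inv_anti₀ (pow_pos (cosh_pos x) 2) h2
        have := Real.add_one_le_exp (-x ^ 2)
        linarith
      have h4 := Real.add_one_le_exp (-(u / cosh x ^ 2))
      have h5 : exp (-(u / cosh x ^ 2)) ≤ exp (-(u * (1 - x ^ 2))) := by
        apply exp_le_exp.2
        have := mul_le_mul_of_nonneg_left h1 hu0
        rw [mul_one_div] at this
        linarith
      linarith
    rw [hcs]
    calc cosh x ^ 2 * (1 - u / cosh x ^ 2)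
        ≤ cosh x ^ 2 * exp (-(u * (1 - x ^ 2))) := by gcongr
      _ ≤ exp (x ^ 2 - 2 * c * x ^ 4) * exp (-(u * (1 - x ^ 2))) := by gcongr
      _ = exp (x ^ 2 - 2 * c * x ^ 4 - u * (1 - x ^ 2)) := by rw [← exp_add]; ring_nf
      _ ≤ _ := by
        apply exp_le_exp.2
        have h1 : u / (1 + coshLoss * u) = u - coshLoss * u ^ 2 / (1 + coshLoss * u) := by
          field_simp; ring
        have h2 : u ^ 2 / (8 * c) ≤ coshLoss * u ^ 2 / (1 + coshLoss * u) := by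
          rw [div_le_div_iff₀ (by positivity) hden]
          have : 1 + coshLoss * u ≤ coshLoss * (8 * c) := by nlinarith
          nlinarith [sq_nonneg u]
        have h3 : u * x ^ 2 - 2 * c * x ^ 4 ≤ u ^ 2 / (8 * c) := by
          rw [le_div_iff₀ (by positivity)]
          nlinarith [sq_nonneg (u - 4 * c * x ^ 2)]
        rw [h1]; linarith
  · have h1 : u / (1 + coshLoss * u) ≤ 1 / coshLoss := by
      rw [div_le_div_iff₀ hden hKpos]; linarith
    have h2 : cosh x ^ 2 ≤ exp (x ^ 2) :=
      hcosh.trans (exp_le_exp.2 (by nlinarith [pow_nonneg (sq_nonneg x) 2]))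
    have h3 : exp (x ^ 2) * (1 - 1 / coshLoss) ≤ exp (x ^ 2 - u / (1 + coshLoss * u)) := by
      rw [sub_eq_add_neg (x ^ 2), exp_add]
      apply mul_le_mul_of_nonneg_left _ (exp_pos _).le
      have := Real.add_one_le_exp (-(u / (1 + coshLoss * u)))
      linarith
    have h4 : exp (x ^ 2) * (1 / coshLoss) ≤ 4 * c := by
      rw [mul_one_div, div_le_iff₀ hKpos, mul_comm, hK]
      exact exp_le_exp.2 hx2
    linarith

/-- A concave saturating version of the identity. -/
noncomputable def satur (L u : ℝ) : ℝ := u / (1 + L * u)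

lemma satur_nonneg {L u : ℝ} (hL : 0 ≤ L) (hu : 0 ≤ u) : 0 ≤ satur L u := by
  unfold satur; positivity

lemma satur_le {L u : ℝ} (hL : 0 ≤ L) (hu : 0 ≤ u) : satur L u ≤ u := by
  unfold satur
  apply div_le_self hu
  nlinarith [mul_nonneg hL hu]

lemma satur_mono {L u v : ℝ} (hL : 0 ≤ L) (hu : 0 ≤ u) (huv : u ≤ v) :
    satur L u ≤ satur L v := by
  unfold satur
  rw [div_le_div_iff₀ (by positivity) (by nlinarith [mul_nonneg hL hu, mul_nonneg hL (hu.trans huv)])]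
  nlinarith

lemma satur_ge {L u : ℝ} (hL : 0 ≤ L) (hu : 0 ≤ u) (hu1 : u ≤ 1) :
    u / (1 + L) ≤ satur L u := by
  unfold satur
  apply div_le_div_of_nonneg_left hu (by positivity)
  nlinarith

lemma satur_ge_sub {L u : ℝ} (hL : 0 ≤ L) (hu : 0 ≤ u) : u - L * u ^ 2 ≤ satur L u := by
  unfold satur
  rw [le_div_iff₀ (by positivity)]
  have : 0 ≤ L ^ 2 * u ^ 3 := by positivity
  nlinarith

lemma continuous_satur_sin_sq {L : ℝ} (hL : 0 ≤ L) :
    Continuous fun θ : ℝ => satur L (Real.sin θ ^ 2) := by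
  unfold satur
  refine Continuous.div (by fun_prop) (by fun_prop) fun θ => ?_
  have : 0 ≤ L * Real.sin θ ^ 2 := by positivity
  linarith

open Real in
lemma sq_sub_le_sin_sq (θ : ℝ) : θ ^ 2 - θ ^ 4 ≤ sin θ ^ 2 := by
  wlog h : 0 ≤ θ generalizing θ
  · have := this (-θ) (by linarith)
    simpa [sin_neg, even_two, Even.neg_pow, show Even 4 by decide] using this
  rcases le_total θ 1 with h1 | h1
  · rcases h.eq_or_lt with h0 | h0
    · simp [← h0]
    have h2 : θ - θ ^ 3 / 4 ≤ sin θ := by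
      have := sin_gt_sub_cube h0
      have : 0 ≤ θ ^ 3 := by positivity
      linarith
    have h3 : 0 ≤ θ - θ ^ 3 / 4 := by nlinarith [mul_nonneg h (by nlinarith : 0 ≤ 1 - θ ^ 2 / 4)]
    have h4 : (θ - θ ^ 3 / 4) ^ 2 ≤ sin θ ^ 2 := pow_le_pow_left₀ h3 h2 2
    have : 0 ≤ θ ^ 6 := by positivity
    have : 0 ≤ θ ^ 4 := by positivity
    nlinarith
  · have h2 : θ ^ 2 * 1 ≤ θ ^ 2 * θ ^ 2 := by gcongr; nlinarith
    nlinarith [sq_nonneg (sin θ)]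

open Real in
lemma mul_sq_le_sin_sq {θ : ℝ} (h : |θ| ≤ π / 2) : 4 / π ^ 2 * θ ^ 2 ≤ sin θ ^ 2 := by
  have := mul_abs_le_abs_sin h
  have h2 := pow_le_pow_left₀ (by positivity) this 2
  rw [sq_abs, mul_pow, sq_abs, div_pow] at h2
  linarith

open Real in
lemma exp_satur_sin_le {L N θ : ℝ} (hL : 0 ≤ L) (hN : 0 < N) (h : |θ| ≤ π / 2) :
    exp (-(N / 2 * satur L (sin θ ^ 2))) ≤ exp (-(N / 2) * θ ^ 2) +
      4 * (1 + L) / ((2 / (π ^ 2 * (1 + L))) ^ 2 * N) *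
        exp (-((2 / (π ^ 2 * (1 + L))) * N / 2) * θ ^ 2) := by
  set c := 2 / (π ^ 2 * (1 + L)) with hc
  have hc0 : 0 < c := by positivity
  have hu0 : 0 ≤ sin θ ^ 2 := sq_nonneg _
  have hu1 : sin θ ^ 2 ≤ 1 := sin_sq_le_one θ
  have huθ : sin θ ^ 2 ≤ θ ^ 2 := sin_sq_le_sq
  set a := N / 2 * satur L (sin θ ^ 2) with ha
  have h1 : c * N * θ ^ 2 ≤ a := by
    have h2 := satur_ge hL hu0 hu1
    have h3 := mul_sq_le_sin_sq h
    have h4 : 4 / π ^ 2 * θ ^ 2 / (1 + L) ≤ satur L (sin θ ^ 2) :=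
      le_trans (by gcongr) h2
    have h5 : c * N * θ ^ 2 = N / 2 * (4 / π ^ 2 * θ ^ 2 / (1 + L)) := by
      rw [hc]; field_simp; ring
    rw [h5]
    exact mul_le_mul_of_nonneg_left h4 (by positivity)
  have h2 : N / 2 * θ ^ 2 - a ≤ N / 2 * (1 + L) * θ ^ 4 := by
    have h3 := satur_ge_sub hL hu0
    have h4 := sq_sub_le_sin_sq θ
    have h5 : (sin θ ^ 2) ^ 2 ≤ θ ^ 4 := by
      calc (sin θ ^ 2) ^ 2 ≤ (θ ^ 2) ^ 2 := by gcongr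
        _ = θ ^ 4 := by ring
    have h6 : θ ^ 2 - (1 + L) * θ ^ 4 ≤ satur L (sin θ ^ 2) := by nlinarith
    have := mul_le_mul_of_nonneg_left h6 (by positivity : 0 ≤ N / 2)
    rw [ha]; nlinarith
  have h3 : exp (-a) ≤ exp (-(N / 2) * θ ^ 2) + N / 2 * (1 + L) * θ ^ 4 * exp (-a) := by
    have h4 : exp (-(N / 2) * θ ^ 2) = exp (-a) * exp (a - N / 2 * θ ^ 2) := by
      rw [← exp_add]; ring_nf
    have h5 := add_one_le_exp (a - N / 2 * θ ^ 2)
    rw [h4]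
    have := exp_pos (-a)
    nlinarith
  refine h3.trans (add_le_add le_rfl ?_)
  set x := c * N * θ ^ 2 with hx
  have hx0 : 0 ≤ x := by positivity
  have h6 : x ^ 2 ≤ 8 * exp (x / 2) := by
    have := quadratic_le_exp_of_nonneg (by positivity : 0 ≤ x / 2)
    nlinarith
  have h7 : exp (-a) ≤ exp (-x) := exp_le_exp.2 (by linarith)
  have h8 : N / 2 * (1 + L) * θ ^ 4 = (1 + L) / (2 * c ^ 2 * N) * x ^ 2 := by
    rw [hx]; field_simp
  rw [h8]
  have h9 : exp (x / 2) * exp (-x) = exp (-(c * N / 2) * θ ^ 2) := by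
    rw [← exp_add, hx]; ring_nf
  calc (1 + L) / (2 * c ^ 2 * N) * x ^ 2 * exp (-a)
      ≤ (1 + L) / (2 * c ^ 2 * N) * (8 * exp (x / 2)) * exp (-x) := by gcongr
    _ = (1 + L) / (2 * c ^ 2 * N) * 8 * (exp (x / 2) * exp (-x)) := by ring
    _ = _ := by rw [h9]; field_simp; ring

open Real MeasureTheory in
lemma integral_exp_satur_le {L : ℝ} (hL : 0 ≤ L) : ∃ C : ℝ, 0 < C ∧ ∀ N : ℝ, 0 < N →
    ∫ θ in Set.Ioc (-(π / 2)) (π / 2), exp (-(N / 2 * satur L (sin θ ^ 2))) ≤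
      sqrt (2 * π / N) * (1 + C / N) := by
  set c := 2 / (π ^ 2 * (1 + L)) with hc
  have hc0 : 0 < c := by positivity
  refine ⟨4 * (1 + L) / c ^ 2 * sqrt (1 / c), by positivity, fun N hN => ?_⟩
  have hi1 : Integrable (fun θ : ℝ => exp (-(N / 2) * θ ^ 2)) :=
    integrable_exp_neg_mul_sq (by positivity)
  have hi2 : Integrable (fun θ : ℝ => 4 * (1 + L) / (c ^ 2 * N) * exp (-(c * N / 2) * θ ^ 2)) :=
    (integrable_exp_neg_mul_sq (by positivity)).const_mul _
  calc ∫ θ in Set.Ioc (-(π / 2)) (π / 2), exp (-(N / 2 * satur L (sin θ ^ 2)))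
      ≤ ∫ θ in Set.Ioc (-(π / 2)) (π / 2), (exp (-(N / 2) * θ ^ 2) +
          4 * (1 + L) / (c ^ 2 * N) * exp (-(c * N / 2) * θ ^ 2)) := by
        refine setIntegral_mono_on ?_ (hi1.add hi2).integrableOn measurableSet_Ioc ?_
        · apply Continuous.integrableOn_Ioc
          have := continuous_satur_sin_sq hL
          fun_prop
        · intro θ hθ
          exact exp_satur_sin_le hL hN (abs_le.2 ⟨hθ.1.le, hθ.2⟩)
    _ ≤ ∫ θ : ℝ, (exp (-(N / 2) * θ ^ 2) +
          4 * (1 + L) / (c ^ 2 * N) * exp (-(c * N / 2) * θ ^ 2)) := by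
        refine setIntegral_le_integral (hi1.add hi2) (Filter.Eventually.of_forall fun θ => ?_)
        dsimp; positivity
    _ = sqrt (2 * π / N) * (1 + 4 * (1 + L) / c ^ 2 * sqrt (1 / c) / N) := by
        rw [integral_add hi1 hi2, integral_const_mul, integral_gaussian, integral_gaussian]
        have h1 : π / (N / 2) = 2 * π / N := by field_simp
        have h2 : π / (c * N / 2) = (2 * π / N) * (1 / c) := by field_simp
        rw [h1, h2, sqrt_mul (by positivity)]
        field_simp

/-- The sign `±1` attached to a Boolean. -/
def bsign (b : Bool) : ℤ := if b then 1 else -1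

lemma bsign_sub_even (a b : Bool) : Even (bsign a - bsign b) := by
  cases a <;> cases b <;> decide

section Fourier

variable {E I : Type*} [Fintype E] [DecidableEq E] [Fintype I] [DecidableEq I]

/-- The signed degree at `i` of a signing `b` of the edges of a multigraph with endpoint maps
`c₁`, `c₂`. -/
def signedDeg (c₁ c₂ : E → I) (b : E → Bool) (i : I) : ℤ :=
  ∑ e, bsign (b e) * ((if c₁ e = i then 1 else 0) + (if c₂ e = i then 1 else 0))

/-- Lebesgue measure on the box `(-π/2, π/2]^I`. -/
noncomputable def halfBox (I : Type*) [Fintype I] : Measure (I → ℝ) :=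
  Measure.pi fun _ => volume.restrict (Set.Ioc (-(Real.pi / 2)) (Real.pi / 2))

instance : IsFiniteMeasure (halfBox I) := by unfold halfBox; infer_instance

lemma signedDeg_sub_even {E I : Type*} [Fintype E] [DecidableEq I] (c₁ c₂ : E → I) (b b' : E → Bool) (i : I) :
    Even (signedDeg c₁ c₂ b i - signedDeg c₁ c₂ b' i) := by
  unfold signedDeg
  rw [← Finset.sum_sub_distrib]
  refine Finset.even_sum _ fun e _ => ?_
  rw [← sub_mul]
  exact (bsign_sub_even _ _).mul_right _

open Complex in
lemma integral_exp_int_even {m : ℤ} (hm : Even m) :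
    ∫ θ in Set.Ioc (-(Real.pi / 2)) (Real.pi / 2), cexp (Complex.I * θ * m) =
      if m = 0 then (Real.pi : ℂ) else 0 := by
  split_ifs with h
  · subst h
    have : Real.pi / 2 + Real.pi / 2 = Real.pi := by ring
    simp [this, Real.pi_pos.le]
  · have hle : -(Real.pi / 2) ≤ Real.pi / 2 := by linarith [Real.pi_pos]
    rw [← intervalIntegral.integral_of_le hle]
    have hc : Complex.I * (m : ℂ) ≠ 0 := by simp [h]
    have h1 : ∀ θ : ℝ, cexp (Complex.I * θ * m) = cexp ((Complex.I * m) * θ) := fun θ => by ring_nf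
    simp_rw [h1]
    rw [integral_exp_mul_complex hc]
    obtain ⟨k, rfl⟩ := hm
    have : cexp (Complex.I * ((k + k : ℤ) : ℂ) * ((Real.pi / 2 : ℝ) : ℂ)) =
        cexp (Complex.I * ((k + k : ℤ) : ℂ) * ((-(Real.pi / 2) : ℝ) : ℂ)) := by
      rw [Complex.exp_eq_exp_iff_exists_int]
      exact ⟨k, by push_cast; ring⟩
    rw [this]; simp

lemma sum_exp_signedDeg (c₁ c₂ : E → I) (z : I → ℂ) :
    ∑ b : E → Bool, Complex.exp (∑ i, z i * signedDeg c₁ c₂ b i) =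
      ∏ e, (2 * Complex.cosh (z (c₁ e) + z (c₂ e))) := by
  have h1 : ∀ b : E → Bool, ∑ i, z i * (signedDeg c₁ c₂ b i : ℂ) =
      ∑ e, (bsign (b e) : ℂ) * (z (c₁ e) + z (c₂ e)) := by
    intro b
    unfold signedDeg
    push_cast
    simp_rw [Finset.mul_sum]
    rw [Finset.sum_comm]
    refine Finset.sum_congr rfl fun e _ => ?_
    simp_rw [mul_add, Finset.sum_add_distrib]
    simp [mul_comm]
  simp_rw [h1, Complex.exp_sum]
  have h2 : ∀ e, 2 * Complex.cosh (z (c₁ e) + z (c₂ e)) =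
      ∑ t : Bool, Complex.exp ((bsign t : ℂ) * (z (c₁ e) + z (c₂ e))) := by
    intro e
    rw [Complex.two_cosh]
    simp [bsign]
  simp_rw [h2]
  rw [Finset.prod_univ_sum]
  rfl

lemma norm_cosh_sq (x θ : ℝ) :
    ‖Complex.cosh (x + Complex.I * θ)‖ ^ 2 = Real.cosh x ^ 2 - Real.sin θ ^ 2 := by
  have h : Complex.cosh (x + Complex.I * θ) =
      ((Real.cosh x * Real.cos θ : ℝ) : ℂ) + ((Real.sinh x * Real.sin θ : ℝ) : ℂ) * Complex.I := by
    rw [Complex.cosh_add, mul_comm Complex.I, Complex.cosh_mul_I, Complex.sinh_mul_I]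
    push_cast; ring
  rw [h, ← Complex.normSq_eq_norm_sq, Complex.normSq_add_mul_I]
  have h1 := Real.cosh_sq x
  have h2 := Real.sin_sq_add_cos_sq θ
  linear_combination (Real.cosh x ^ 2) * h2 - Real.sin θ ^ 2 * h1

lemma norm_cosh_le {x θ : ℝ} (hx : |x| ≤ 4) :
    ‖Complex.cosh (x + Complex.I * θ)‖ ≤
      Real.exp (x ^ 2 / 2 - satur coshLoss (Real.sin θ ^ 2) / 2) := by
  apply le_of_sq_le_sq _ (Real.exp_pos _).le
  rw [norm_cosh_sq, ← Real.exp_nat_mul]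
  have := cosh_sq_sub_le hx (sq_nonneg (Real.sin θ)) (Real.sin_sq_le_one θ)
  refine this.trans (le_of_eq ?_)
  congr 1; unfold satur; push_cast; ring

lemma card_signedDeg_eq_le (c₁ c₂ : E → I) (d : I → ℤ) (l : I → ℝ)
    (hl : ∀ e, |l (c₁ e) + l (c₂ e)| ≤ 4) :
    ((Finset.univ.filter fun b : E → Bool => ∀ i, signedDeg c₁ c₂ b i = d i).card : ℝ) /
        2 ^ Fintype.card E ≤
      Real.exp (-(∑ i, l i * d i) + (∑ e, (l (c₁ e) + l (c₂ e)) ^ 2) / 2) *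
        ((Real.pi ^ Fintype.card I)⁻¹ * ∫ θ, Real.exp (-(∑ e, satur coshLoss
          (Real.sin (θ (c₁ e) + θ (c₂ e)) ^ 2)) / 2) ∂(halfBox I)) := by
  set S := Finset.univ.filter fun b : E → Bool => ∀ i, signedDeg c₁ c₂ b i = d i with hS
  have hint0 : 0 ≤ ∫ θ, Real.exp (-(∑ e, satur coshLoss
          (Real.sin (θ (c₁ e) + θ (c₂ e)) ^ 2)) / 2) ∂(halfBox I) :=
    integral_nonneg fun θ => (Real.exp_pos _).le
  rcases S.eq_empty_or_nonempty with h0 | ⟨b0, hb0⟩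
  · rw [h0]; simp; positivity
  have hb0' : ∀ i, signedDeg c₁ c₂ b0 i = d i := by simpa [hS] using hb0
  have hev : ∀ b i, Even (signedDeg c₁ c₂ b i - d i) := fun b i => by
    rw [← hb0' i]; exact signedDeg_sub_even _ _ _ _ _
  -- the Fourier integrand
  set f : (E → Bool) → (I → ℝ) → ℂ := fun b θ =>
    ∏ i, (Complex.exp (l i * (signedDeg c₁ c₂ b i - d i : ℤ)) *
      Complex.exp (Complex.I * θ i * (signedDeg c₁ c₂ b i - d i : ℤ))) with hf
  have hfi : ∀ b, ∫ θ, f b θ ∂(halfBox I) =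
      if b ∈ S then (Real.pi : ℂ) ^ Fintype.card I else 0 := by
    intro b
    rw [hf, halfBox]
    rw [integral_fintype_prod_eq_prod (fun i (t : ℝ) =>
      Complex.exp (l i * (signedDeg c₁ c₂ b i - d i : ℤ)) *
      Complex.exp (Complex.I * t * (signedDeg c₁ c₂ b i - d i : ℤ)))]
    simp_rw [integral_const_mul, integral_exp_int_even (hev b _)]
    split_ifs with h
    · have h' : ∀ i, signedDeg c₁ c₂ b i = d i := by simpa [hS] using h
      simp [h']
    · have h' : ∃ i, signedDeg c₁ c₂ b i ≠ d i := by simpa [hS] using h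
      obtain ⟨i, hi⟩ := h'
      refine Finset.prod_eq_zero (Finset.mem_univ i) ?_
      rw [if_neg (sub_ne_zero.2 hi)]; simp
  have hfint : ∀ b, Integrable (f b) (halfBox I) := by
    intro b
    rw [hf, halfBox]
    refine Integrable.fintype_prod (f := fun i (t : ℝ) =>
      Complex.exp (l i * (signedDeg c₁ c₂ b i - d i : ℤ)) *
      Complex.exp (Complex.I * t * (signedDeg c₁ c₂ b i - d i : ℤ))) fun i => ?_
    exact (Continuous.integrableOn_Ioc (by fun_prop))
  have hsum : ∫ θ, ∑ b, f b θ ∂(halfBox I) = (S.card : ℂ) * (Real.pi : ℂ) ^ Fintype.card I := by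
    rw [integral_finsetSum _ fun b _ => hfint b]
    simp_rw [hfi]
    simp
  have hprod : ∀ θ : I → ℝ, ∑ b, f b θ =
      Complex.exp (-∑ i, (l i + Complex.I * θ i) * d i) *
        ∏ e, (2 * Complex.cosh (((l (c₁ e) + l (c₂ e) : ℝ) : ℂ) +
          Complex.I * ((θ (c₁ e) + θ (c₂ e) : ℝ) : ℂ))) := by
    intro θ
    have h1 := sum_exp_signedDeg c₁ c₂ (fun i => (l i : ℂ) + Complex.I * θ i)
    have h2 : ∀ e, (((l (c₁ e) + l (c₂ e) : ℝ) : ℂ) +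
          Complex.I * ((θ (c₁ e) + θ (c₂ e) : ℝ) : ℂ)) =
        ((l (c₁ e) : ℂ) + Complex.I * θ (c₁ e)) + ((l (c₂ e) : ℂ) + Complex.I * θ (c₂ e)) := by
      intro e; push_cast; ring
    simp_rw [h2]
    rw [← h1, Finset.mul_sum]
    refine Finset.sum_congr rfl fun b _ => ?_
    rw [hf]
    simp_rw [← Complex.exp_add]
    rw [← Complex.exp_sum]
    congr 1
    rw [← Finset.sum_neg_distrib, ← Finset.sum_add_distrib]
    refine Finset.sum_congr rfl fun i _ => ?_
    push_cast; ring
  have hnorm : ∀ θ : I → ℝ, ‖∑ b, f b θ‖ ≤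
      Real.exp (-(∑ i, l i * d i) + (∑ e, (l (c₁ e) + l (c₂ e)) ^ 2) / 2) *
        2 ^ Fintype.card E * Real.exp (-(∑ e, satur coshLoss
          (Real.sin (θ (c₁ e) + θ (c₂ e)) ^ 2)) / 2) := by
    intro θ
    rw [hprod, norm_mul, Complex.norm_exp, norm_prod]
    have h1 : (-∑ i, ((l i : ℂ) + Complex.I * θ i) * d i).re = -∑ i, l i * d i := by
      simp
    rw [h1, Real.exp_add]
    have h2 : ∏ e, ‖2 * Complex.cosh (((l (c₁ e) + l (c₂ e) : ℝ) : ℂ) +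
          Complex.I * ((θ (c₁ e) + θ (c₂ e) : ℝ) : ℂ))‖ ≤
        ∏ e, (2 * Real.exp ((l (c₁ e) + l (c₂ e)) ^ 2 / 2 -
          satur coshLoss (Real.sin (θ (c₁ e) + θ (c₂ e)) ^ 2) / 2)) := by
      refine Finset.prod_le_prod (fun _ _ => norm_nonneg _) fun e _ => ?_
      rw [norm_mul]
      have := norm_cosh_le (θ := θ (c₁ e) + θ (c₂ e)) (hl e)
      simpa using this
    have h3 : ∏ e, (2 * Real.exp ((l (c₁ e) + l (c₂ e)) ^ 2 / 2 -
          satur coshLoss (Real.sin (θ (c₁ e) + θ (c₂ e)) ^ 2) / 2)) =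
        2 ^ Fintype.card E * (Real.exp ((∑ e, (l (c₁ e) + l (c₂ e)) ^ 2) / 2) *
          Real.exp (-(∑ e, satur coshLoss (Real.sin (θ (c₁ e) + θ (c₂ e)) ^ 2)) / 2)) := by
      rw [Finset.prod_mul_distrib, ← Real.exp_add, ← Real.exp_sum]
      simp only [Finset.prod_const, Finset.card_univ]
      congr 2
      rw [Finset.sum_sub_distrib, ← Finset.sum_div, ← Finset.sum_div]; ring
    rw [h3] at h2
    calc _ ≤ Real.exp (-∑ i, l i * d i) * (2 ^ Fintype.card E *
          (Real.exp ((∑ e, (l (c₁ e) + l (c₂ e)) ^ 2) / 2) *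
          Real.exp (-(∑ e, satur coshLoss (Real.sin (θ (c₁ e) + θ (c₂ e)) ^ 2)) / 2))) := by
          gcongr
      _ = _ := by ring
  have hmain : (S.card : ℝ) * Real.pi ^ Fintype.card I ≤
      Real.exp (-(∑ i, l i * d i) + (∑ e, (l (c₁ e) + l (c₂ e)) ^ 2) / 2) *
        2 ^ Fintype.card E * ∫ θ, Real.exp (-(∑ e, satur coshLoss
          (Real.sin (θ (c₁ e) + θ (c₂ e)) ^ 2)) / 2) ∂(halfBox I) := by
    have h1 : ‖∫ θ, ∑ b, f b θ ∂(halfBox I)‖ = (S.card : ℝ) * Real.pi ^ Fintype.card I := by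
      rw [hsum]
      simp [abs_of_pos Real.pi_pos]
    rw [← h1, ← integral_const_mul]
    refine norm_integral_le_of_norm_le (Integrable.const_mul ?_ _)
      (Filter.Eventually.of_forall hnorm)
    refine Integrable.of_bound (C := 1) ?_ (Filter.Eventually.of_forall fun θ => ?_)
    · apply Continuous.aestronglyMeasurable
      have := continuous_satur_sin_sq coshLoss_pos.le
      have h : ∀ e, Continuous fun θ : I → ℝ =>
          satur coshLoss (Real.sin (θ (c₁ e) + θ (c₂ e)) ^ 2) := fun e =>
        this.comp (f := fun θ : I → ℝ => θ (c₁ e) + θ (c₂ e)) (by fun_prop)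
      fun_prop
    · rw [Real.norm_eq_abs, abs_of_pos (Real.exp_pos _), Real.exp_le_one_iff]
      have : 0 ≤ ∑ e, satur coshLoss (Real.sin (θ (c₁ e) + θ (c₂ e)) ^ 2) :=
        Finset.sum_nonneg fun e _ => satur_nonneg coshLoss_pos.le (sq_nonneg _)
      linarith
  rw [div_le_iff₀ (by positivity)]
  have hpi : 0 < Real.pi ^ Fintype.card I := by positivity
  rw [← mul_le_mul_iff_left₀ hpi]
  refine hmain.trans (le_of_eq ?_)
  field_simp

end Fourier

lemma sq_sin_add_le (a b : ℝ) :
    Real.sin (a + b) ^ 2 ≤ 2 * (Real.sin a ^ 2 + Real.sin b ^ 2) := by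
  rw [Real.sin_add]
  have h1 := Real.sin_sq_add_cos_sq a
  have h2 := Real.sin_sq_add_cos_sq b
  nlinarith [sq_nonneg (Real.sin a * Real.cos b - Real.cos a * Real.sin b),
    sq_nonneg (Real.sin a), sq_nonneg (Real.sin b), sq_nonneg (Real.sin a * Real.sin b)]

lemma satur_sin_add_ge {K : ℝ} (hK : 0 ≤ K) (a b : ℝ) :
    (1 + 2 * K * Real.sin a ^ 2)⁻¹ * (1 + 2 * K * Real.sin b ^ 2)⁻¹ * Real.sin (a + b) ^ 2 ≤
      satur K (Real.sin (a + b) ^ 2) := by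
  unfold satur
  rw [← mul_inv, div_eq_inv_mul]
  apply mul_le_mul_of_nonneg_right _ (sq_nonneg _)
  apply inv_anti₀ (by positivity)
  have h := mul_le_mul_of_nonneg_left (sq_sin_add_le a b) hK
  have : 0 ≤ K * K * (Real.sin a ^ 2 * Real.sin b ^ 2) := by positivity
  nlinarith

/-- The edges of the complete graph on `Fin N`. -/
abbrev CEdge (N : ℕ) := {p : Fin N × Fin N // p.1 < p.2}

lemma sum_CEdge {N : ℕ} (f : Fin N → Fin N → ℝ) (hf : ∀ i j, f i j = f j i) :
    ∑ e : CEdge N, f e.1.1 e.1.2 = (∑ i, ∑ j, f i j - ∑ i, f i i) / 2 := by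
  have h1 : ∑ e : CEdge N, f e.1.1 e.1.2 = ∑ i, ∑ j, if i < j then f i j else 0 := by
    rw [← Finset.sum_product', ← Finset.sum_filter]
    exact (Finset.sum_subtype (Finset.univ.filter fun p : Fin N × Fin N => p.1 < p.2)
      (by simp) (fun p => f p.1 p.2)).symm
  have h2 : ∑ i, ∑ j, (if i < j then f i j else 0) = ∑ i, ∑ j, if j < i then f i j else 0 := by
    rw [Finset.sum_comm]
    refine Finset.sum_congr rfl fun i _ => Finset.sum_congr rfl fun j _ => ?_
    rw [hf]
  have h3 : ∑ i, f i i = ∑ i, ∑ j, if i = j then f i j else 0 := by simp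
  have h4 : ∑ i, ∑ j, f i j = ∑ i, ∑ j, (if i < j then f i j else 0) +
      ∑ i, ∑ j, (if j < i then f i j else 0) + ∑ i, ∑ j, if i = j then f i j else 0 := by
    rw [← Finset.sum_add_distrib, ← Finset.sum_add_distrib]
    refine Finset.sum_congr rfl fun i _ => ?_
    rw [← Finset.sum_add_distrib, ← Finset.sum_add_distrib]
    refine Finset.sum_congr rfl fun j _ => ?_
    rcases lt_trichotomy i j with h | h | h
    · simp [h, h.not_gt, h.ne]
    · simp [h]
    · simp [h, h.not_gt, h.ne']
  rw [h1, h4, h3, ← h2]; ring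

lemma sum_mul_sin_add_sq {A B : Type*} [Fintype A] [Fintype B] (w x : A → ℝ) (v y : B → ℝ) :
    ∑ i, ∑ j, w i * v j * Real.sin (x i + y j) ^ 2 =
      ((∑ i, w i) * (∑ j, v j) - (∑ i, w i * Real.cos (2 * x i)) * (∑ j, v j * Real.cos (2 * y j)) +
        (∑ i, w i * Real.sin (2 * x i)) * (∑ j, v j * Real.sin (2 * y j))) / 2 := by
  simp_rw [Finset.sum_mul_sum]
  rw [← Finset.sum_sub_distrib, ← Finset.sum_add_distrib, Finset.sum_div]
  refine Finset.sum_congr rfl fun i _ => ?_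
  rw [← Finset.sum_sub_distrib, ← Finset.sum_add_distrib, Finset.sum_div]
  refine Finset.sum_congr rfl fun j _ => ?_
  have h1 : Real.sin (x i + y j) ^ 2 = (1 - Real.cos (2 * x i + 2 * y j)) / 2 := by
    rw [Real.sin_sq_eq_half_sub]; ring_nf
  rw [h1, Real.cos_add]; ring

lemma weight_cos (x w : ℝ) :
    w * Real.cos (2 * x) = w - 2 * (w * Real.sin x ^ 2) := by
  rw [Real.cos_two_mul, Real.cos_sq']; ring

lemma inv_eq_one_sub_satur {L u : ℝ} (hL : 0 ≤ L) (hu : 0 ≤ u) :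
    (1 + L * u)⁻¹ = 1 - L * satur L u := by
  unfold satur
  have : 0 < 1 + L * u := by positivity
  field_simp; ring

lemma inv_mul_eq_satur (L u : ℝ) : (1 + L * u)⁻¹ * u = satur L u := by
  unfold satur; rw [div_eq_inv_mul]

lemma weighted_cos_nonneg {A : Type*} [Fintype A] {L : ℝ} (hL : 0 ≤ L) (x : A → ℝ)
    (h : 0 ≤ ∑ j, Real.cos (2 * x j)) :
    0 ≤ ∑ j, (1 + L * Real.sin (x j) ^ 2)⁻¹ * Real.cos (2 * x j) := by
  have h1 : ∀ j, (1 + L / 2)⁻¹ * Real.cos (2 * x j) ≤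
      (1 + L * Real.sin (x j) ^ 2)⁻¹ * Real.cos (2 * x j) := by
    intro j
    rw [Real.sin_sq_eq_half_sub]
    set c := Real.cos (2 * x j)
    have hc1 : c ≤ 1 := Real.cos_le_one _
    have hp : 0 < 1 + L * (1 / 2 - c / 2) := by nlinarith
    rw [← div_eq_inv_mul, ← div_eq_inv_mul, div_le_div_iff₀ (by positivity) hp]
    nlinarith [sq_nonneg c]
  refine le_trans ?_ (Finset.sum_le_sum fun j _ => h1 j)
  rw [← Finset.mul_sum]
  positivity

lemma complete_quadratic_ge {N : ℕ} {K : ℝ} (hK : 0 ≤ K) (x : Fin N → ℝ)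
    (h : 0 ≤ ∑ j, Real.cos (2 * x j)) :
    (∑ j, satur (2 * K) (Real.sin (x j) ^ 2)) *
        (N - (2 * K + 1) * (∑ j, satur (2 * K) (Real.sin (x j) ^ 2)) - 2) ≤
      ∑ e : CEdge N, satur K (Real.sin (x e.1.1 + x e.1.2) ^ 2) ∧
    (∑ j, satur (2 * K) (Real.sin (x j) ^ 2)) * (N / (2 * (1 + 2 * K)) - 2) ≤
      ∑ e : CEdge N, satur K (Real.sin (x e.1.1 + x e.1.2) ^ 2) := by
  set w : Fin N → ℝ := fun j => (1 + 2 * K * Real.sin (x j) ^ 2)⁻¹ with hw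
  set T := ∑ j, satur (2 * K) (Real.sin (x j) ^ 2) with hT
  have hT0 : 0 ≤ T := Finset.sum_nonneg fun j _ => satur_nonneg (by positivity) (sq_nonneg _)
  have hTw : T = ∑ j, w j * Real.sin (x j) ^ 2 := by
    rw [hT]; exact Finset.sum_congr rfl fun j _ => (inv_mul_eq_satur _ _).symm
  have hO : ∑ j, w j = N - 2 * K * T := by
    rw [hT, Finset.mul_sum]
    have : ∀ j, w j = 1 - 2 * K * satur (2 * K) (Real.sin (x j) ^ 2) := fun j =>
      inv_eq_one_sub_satur (by positivity) (sq_nonneg _)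
    simp_rw [this, Finset.sum_sub_distrib]; simp
  have hX : ∑ j, w j * Real.cos (2 * x j) = ∑ j, w j - 2 * T := by
    simp_rw [weight_cos, Finset.sum_sub_distrib, ← Finset.mul_sum]; rw [hTw]
  have hX0 : 0 ≤ ∑ j, w j - 2 * T := by
    rw [← hX]; exact weighted_cos_nonneg (by positivity) x h
  have hle : ∑ e : CEdge N, w e.1.1 * w e.1.2 * Real.sin (x e.1.1 + x e.1.2) ^ 2 ≤
      ∑ e : CEdge N, satur K (Real.sin (x e.1.1 + x e.1.2) ^ 2) :=
    Finset.sum_le_sum fun e _ => satur_sin_add_ge hK _ _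
  rw [sum_CEdge (fun i j => w i * w j * Real.sin (x i + x j) ^ 2)
    (fun i j => by rw [add_comm (x i)]; ring), sum_mul_sin_add_sq, hX] at hle
  have hdiag : ∑ i, w i * w i * Real.sin (x i + x i) ^ 2 ≤ 4 * T := by
    rw [hTw, Finset.mul_sum]
    refine Finset.sum_le_sum fun i _ => ?_
    have hw0 : 0 < w i := by simp only [hw]; positivity
    have hw1 : w i ≤ 1 := by
      simp only [hw]
      apply inv_le_one_of_one_le₀
      have : 0 ≤ 2 * K * Real.sin (x i) ^ 2 := by positivity
      linarith
    have h1 : Real.sin (x i + x i) ^ 2 ≤ 4 * Real.sin (x i) ^ 2 := by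
      have := sq_sin_add_le (x i) (x i); linarith
    calc w i * w i * Real.sin (x i + x i) ^ 2 ≤ w i * 1 * (4 * Real.sin (x i) ^ 2) := by gcongr
      _ = _ := by ring
  have hOlb : (N : ℝ) / (1 + 2 * K) ≤ ∑ j, w j := by
    have : ∀ j, (1 + 2 * K)⁻¹ ≤ w j := fun j => by
      apply inv_anti₀ (by positivity)
      have := Real.sin_sq_le_one (x j)
      nlinarith
    calc (N : ℝ) / (1 + 2 * K) = ∑ j : Fin N, (1 + 2 * K)⁻¹ := by simp [div_eq_mul_inv]
      _ ≤ _ := Finset.sum_le_sum fun j _ => this j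
  have hY := sq_nonneg (∑ i, w i * Real.sin (2 * x i))
  set O := ∑ j, w j
  have hmain : T * (O - T - 2) ≤ ∑ e : CEdge N, satur K (Real.sin (x e.1.1 + x e.1.2) ^ 2) := by
    nlinarith
  refine ⟨le_trans (le_of_eq ?_) hmain, le_trans ?_ hmain⟩
  · rw [hO]; ring
  · apply mul_le_mul_of_nonneg_left _ hT0
    have : (N : ℝ) / (2 * (1 + 2 * K)) = N / (1 + 2 * K) / 2 := by field_simp
    rw [this]; linarith

lemma setIntegral_shift_of_periodic {f : ℝ → ℝ} (hf : Function.Periodic f Real.pi) (t : ℝ) :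
    ∫ θ in Set.Ioc (-(Real.pi / 2)) (Real.pi / 2), f (θ + t) =
      ∫ θ in Set.Ioc (-(Real.pi / 2)) (Real.pi / 2), f θ := by
  have hle : -(Real.pi / 2) ≤ Real.pi / 2 := by linarith [Real.pi_pos]
  rw [← intervalIntegral.integral_of_le hle, ← intervalIntegral.integral_of_le hle,
    intervalIntegral.integral_comp_add_right]
  have h1 : Real.pi / 2 + t = (-(Real.pi / 2) + t) + Real.pi := by ring
  have h2 : Real.pi / 2 = -(Real.pi / 2) + Real.pi := by ring
  rw [h1, hf.intervalIntegral_add_eq (-(Real.pi / 2) + t) (-(Real.pi / 2))]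
  rw [← h2]

/-- The one-dimensional integral controlling the Fourier bounds. -/
noncomputable def saturInt (L a : ℝ) : ℝ :=
  ∫ θ in Set.Ioc (-(Real.pi / 2)) (Real.pi / 2), Real.exp (-(a * satur L (Real.sin θ ^ 2)))

lemma saturInt_nonneg (L a : ℝ) : 0 ≤ saturInt L a :=
  integral_nonneg fun _ => (Real.exp_pos _).le

lemma saturInt_shift (L a t : ℝ) :
    ∫ θ in Set.Ioc (-(Real.pi / 2)) (Real.pi / 2),
      Real.exp (-(a * satur L (Real.sin (θ + t) ^ 2))) = saturInt L a := by
  refine setIntegral_shift_of_periodic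
    (f := fun θ => Real.exp (-(a * satur L (Real.sin θ ^ 2)))) (fun θ => ?_) t
  simp [Real.sin_add_pi]

lemma saturInt_pow_le {L : ℝ} (hL : 0 ≤ L) : ∃ C : ℝ, 0 < C ∧ ∀ (a : ℝ) (n : ℕ), 0 < a →
    saturInt L a ^ n ≤ Real.sqrt (Real.pi / a) ^ n * Real.exp (C * n / a) := by
  obtain ⟨C, hC, h⟩ := integral_exp_satur_le hL
  refine ⟨C / 2, by positivity, fun a n ha => ?_⟩
  have h1 := h (2 * a) (by positivity)
  have h2 : saturInt L a ≤ Real.sqrt (Real.pi / a) * Real.exp (C / (2 * a)) := by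
    have h3 : 2 * Real.pi / (2 * a) = Real.pi / a := by field_simp
    rw [h3] at h1
    have h4 : 2 * a / 2 = a := by ring
    simp_rw [h4] at h1
    refine h1.trans (mul_le_mul_of_nonneg_left ?_ (Real.sqrt_nonneg _))
    have := Real.add_one_le_exp (C / (2 * a))
    linarith
  calc saturInt L a ^ n ≤ (Real.sqrt (Real.pi / a) * Real.exp (C / (2 * a))) ^ n :=
        pow_le_pow_left₀ (saturInt_nonneg L a) h2 n
    _ = _ := by
        rw [mul_pow, ← Real.exp_nat_mul]; congr 2; field_simp

lemma integral_halfBox_exp_satur {I : Type*} [Fintype I] (L a t : ℝ) :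
    ∫ θ, Real.exp (-(a * ∑ j, satur L (Real.sin (θ j + t) ^ 2))) ∂(halfBox I) =
      saturInt L a ^ Fintype.card I := by
  have h1 : ∀ θ : I → ℝ, Real.exp (-(a * ∑ j, satur L (Real.sin (θ j + t) ^ 2))) =
      ∏ j, Real.exp (-(a * satur L (Real.sin (θ j + t) ^ 2))) := by
    intro θ
    rw [Finset.mul_sum, ← Finset.sum_neg_distrib, Real.exp_sum]
  simp_rw [h1]
  rw [halfBox, integral_fintype_prod_eq_pow
    (fun θ => Real.exp (-(a * satur L (Real.sin (θ + t) ^ 2)))), saturInt_shift]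

lemma integrable_halfBox_of_continuous_bounded {I : Type*} [Fintype I] {f : (I → ℝ) → ℝ}
    (hf : Continuous f) (h0 : ∀ θ, 0 ≤ f θ) (h1 : ∀ θ, f θ ≤ 1) : Integrable f (halfBox I) :=
  Integrable.of_bound (C := 1) hf.aestronglyMeasurable
    (Filter.Eventually.of_forall fun θ => by
      rw [Real.norm_eq_abs, abs_of_nonneg (h0 θ)]; exact h1 θ)

lemma integrable_halfBox_exp_satur {I A : Type*} [Fintype I] [Fintype A] {L a : ℝ} (hL : 0 ≤ L)
    (ha : 0 ≤ a) (y : A → (I → ℝ) → ℝ) (hy : ∀ j, Continuous (y j)) :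
    Integrable (fun θ : I → ℝ => Real.exp (-(a * ∑ j, satur L (Real.sin (y j θ) ^ 2))))
      (halfBox I) := by
  refine integrable_halfBox_of_continuous_bounded ?_ (fun θ => (Real.exp_pos _).le) fun θ => ?_
  · have h : ∀ j, Continuous fun θ : I → ℝ => satur L (Real.sin (y j θ) ^ 2) := fun j =>
      (continuous_satur_sin_sq hL).comp (hy j)
    fun_prop
  · rw [Real.exp_le_one_iff, neg_nonpos]
    exact mul_nonneg ha (Finset.sum_nonneg fun j _ => satur_nonneg hL (sq_nonneg _))

/-- Splitting an exponential of an almost quadratic form according to the size of `T`. -/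
lemma exp_split {T S N M c T₀ : ℝ} (hT : 0 ≤ T) (hM : 0 ≤ M) (hN : 0 ≤ N)
    (hc : 0 ≤ c) (h1 : N * T - M * (T ^ 2 + T) ≤ S) (h2 : c * N * T ≤ S) :
    Real.exp (-(S / 2)) ≤ Real.exp (M * (T₀ ^ 2 + T₀) / 2) * Real.exp (-(N / 2 * T)) +
      Real.exp (-(c * N / 4 * T₀)) * Real.exp (-(c * N / 4 * T)) := by
  rcases le_total T T₀ with h | h
  · have : Real.exp (-(S / 2)) ≤
        Real.exp (M * (T₀ ^ 2 + T₀) / 2) * Real.exp (-(N / 2 * T)) := by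
      rw [← Real.exp_add]
      apply Real.exp_le_exp.2
      have : M * (T ^ 2 + T) ≤ M * (T₀ ^ 2 + T₀) := by gcongr
      linarith
    have : 0 < Real.exp (-(c * N / 4 * T₀)) * Real.exp (-(c * N / 4 * T)) := by positivity
    linarith
  · have : Real.exp (-(S / 2)) ≤
        Real.exp (-(c * N / 4 * T₀)) * Real.exp (-(c * N / 4 * T)) := by
      rw [← Real.exp_add]
      apply Real.exp_le_exp.2
      have : c * N / 4 * T₀ ≤ c * N / 4 * T := by gcongr
      linarith
    have : 0 < Real.exp (M * (T₀ ^ 2 + T₀) / 2) * Real.exp (-(N / 2 * T)) := by positivity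
    linarith

lemma exists_threshold {c : ℝ} (hc : 0 < c) : ∃ T₀ : ℝ, 0 ≤ T₀ ∧
    Real.sqrt (2 / c) * Real.exp (-(c / 4 * T₀)) ≤ 1 := by
  refine ⟨4 / c * Real.sqrt (2 / c), by positivity, ?_⟩
  have h1 : c / 4 * (4 / c * Real.sqrt (2 / c)) = Real.sqrt (2 / c) := by field_simp
  rw [h1, Real.exp_neg]
  rw [← div_eq_mul_inv, div_le_one (Real.exp_pos _)]
  have := Real.add_one_le_exp (Real.sqrt (2 / c))
  linarith

lemma exists_complete_integral_le {K : ℝ} (hK : 0 ≤ K) : ∃ C : ℝ, 0 < C ∧ ∃ N₀ : ℕ, 0 < N₀ ∧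
    ∀ N : ℕ, N₀ ≤ N →
      ∫ θ, Real.exp (-(∑ e : CEdge N, satur K (Real.sin (θ e.1.1 + θ e.1.2) ^ 2)) / 2)
        ∂(halfBox (Fin N)) ≤ C * Real.sqrt (2 * Real.pi / N) ^ N := by
  obtain ⟨C₁, hC₁, hJ⟩ := saturInt_pow_le (L := 2 * K) (by positivity)
  set c : ℝ := 1 / (4 * (1 + 2 * K)) with hc
  have hc0 : 0 < c := by positivity
  obtain ⟨T₀, hT₀, hthr⟩ := exists_threshold hc0
  set M : ℝ := 2 * K + 2 with hM
  set C₀ := Real.exp (M * (T₀ ^ 2 + T₀) / 2) with hC₀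
  refine ⟨2 * (C₀ * Real.exp (2 * C₁) + Real.exp (4 * C₁ / c)), by positivity,
    ⌈8 * (1 + 2 * K)⌉₊ + 1, by omega, fun N hN => ?_⟩
  have hN8 : 8 * (1 + 2 * K) ≤ N := by
    have h1 : (⌈8 * (1 + 2 * K)⌉₊ : ℝ) ≤ N := by exact_mod_cast (by omega)
    exact (Nat.le_ceil _).trans h1
  have hNpos : (0 : ℝ) < N := by linarith [mul_nonneg (by norm_num : (0:ℝ) ≤ 16) hK]
  -- pointwise bound
  set G : ℝ → (Fin N → ℝ) → ℝ := fun t θ =>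
    C₀ * Real.exp (-(N / 2 * ∑ j, satur (2 * K) (Real.sin (θ j + t) ^ 2))) +
      Real.exp (-(c * N / 4 * T₀)) *
        Real.exp (-(c * N / 4 * ∑ j, satur (2 * K) (Real.sin (θ j + t) ^ 2))) with hG
  have hpt : ∀ x : Fin N → ℝ, 0 ≤ ∑ j, Real.cos (2 * x j) →
      Real.exp (-(∑ e : CEdge N, satur K (Real.sin (x e.1.1 + x e.1.2) ^ 2)) / 2) ≤ G 0 x := by
    intro x hx
    obtain ⟨h1, h2⟩ := complete_quadratic_ge hK x hx
    simp only [hG, add_zero]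
    rw [neg_div]
    set T := ∑ j, satur (2 * K) (Real.sin (x j) ^ 2)
    have hT : 0 ≤ T := Finset.sum_nonneg fun j _ => satur_nonneg (by positivity) (sq_nonneg _)
    refine exp_split (M := M) hT (by positivity) hNpos.le hc0.le ?_ ?_
    · refine le_trans ?_ h1
      rw [hM]; nlinarith [mul_nonneg hK hT, sq_nonneg T]
    · refine le_trans ?_ h2
      have h3 : (N : ℝ) / (2 * (1 + 2 * K)) = 2 * (c * N) := by rw [hc]; field_simp; ring
      have h4 : 2 ≤ c * N := by
        rw [hc, div_mul_eq_mul_div, le_div_iff₀ (by positivity)]; linarith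
      rw [h3]; nlinarith
  have hG0 : ∀ t x, 0 ≤ G t x := fun t x => by simp only [hG]; positivity
  have hpt' : ∀ x : Fin N → ℝ,
      Real.exp (-(∑ e : CEdge N, satur K (Real.sin (x e.1.1 + x e.1.2) ^ 2)) / 2) ≤
        G 0 x + G (Real.pi / 2) x := by
    intro x
    rcases le_total 0 (∑ j, Real.cos (2 * x j)) with h | h
    · have := hpt x h; have := hG0 (Real.pi / 2) x; linarith
    · have h' : 0 ≤ ∑ j, Real.cos (2 * (x j + Real.pi / 2)) := by
        have : ∀ j, Real.cos (2 * (x j + Real.pi / 2)) = -Real.cos (2 * x j) := fun j => by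
          rw [← Real.cos_add_pi]; ring_nf
        simp_rw [this, Finset.sum_neg_distrib]; linarith
      have h2 := hpt (fun j => x j + Real.pi / 2) h'
      have h3 : G 0 (fun j => x j + Real.pi / 2) = G (Real.pi / 2) x := by simp [hG]
      have h4 : ∀ e : CEdge N, Real.sin (x e.1.1 + Real.pi / 2 + (x e.1.2 + Real.pi / 2)) ^ 2 =
          Real.sin (x e.1.1 + x e.1.2) ^ 2 := fun e => by
        rw [show x e.1.1 + Real.pi / 2 + (x e.1.2 + Real.pi / 2) =
          x e.1.1 + x e.1.2 + Real.pi by ring, Real.sin_add_pi]; ring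
      simp_rw [h4] at h2
      rw [h3] at h2
      have := hG0 0 x; linarith
  have hGi : ∀ t, Integrable (G t) (halfBox (Fin N)) := fun t =>
    ((integrable_halfBox_exp_satur (by positivity) (by positivity) (fun j θ => θ j + t)
      (fun j => by fun_prop)).const_mul _).add
    ((integrable_halfBox_exp_satur (by positivity) (by positivity) (fun j θ => θ j + t)
      (fun j => by fun_prop)).const_mul _)
  have hGint : ∀ t, ∫ θ, G t θ ∂(halfBox (Fin N)) ≤
      (C₀ * Real.exp (2 * C₁) + Real.exp (4 * C₁ / c)) * Real.sqrt (2 * Real.pi / N) ^ N := by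
    intro t
    simp only [hG]
    rw [integral_add, integral_const_mul, integral_const_mul, integral_halfBox_exp_satur,
      integral_halfBox_exp_satur, Fintype.card_fin]
    · have h1 := hJ (N / 2) N (by positivity)
      have h2 := hJ (c * N / 4) N (by positivity)
      have e1 : Real.pi / (N / 2 : ℝ) = 2 * Real.pi / N := by field_simp
      have e2 : C₁ * N / (N / 2 : ℝ) = 2 * C₁ := by field_simp
      have e3 : Real.pi / (c * N / 4) = (2 / c) * (2 * Real.pi / N) := by field_simp; ring
      have e4 : C₁ * N / (c * N / 4) = 4 * C₁ / c := by field_simp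
      rw [e1, e2] at h1
      rw [e3, e4, Real.sqrt_mul (by positivity), mul_pow] at h2
      have h3 : Real.exp (-(c * N / 4 * T₀)) * Real.sqrt (2 / c) ^ N ≤ 1 := by
        have : Real.exp (-(c * N / 4 * T₀)) = Real.exp (-(c / 4 * T₀)) ^ N := by
          rw [← Real.exp_nat_mul]; congr 1; ring
        rw [this, ← mul_pow]
        apply pow_le_one₀ (by positivity)
        rw [mul_comm]; exact hthr
      set R := Real.sqrt (2 * Real.pi / N) ^ N
      have hR : 0 ≤ R := by positivity
      calc _ ≤ C₀ * (R * Real.exp (2 * C₁)) + Real.exp (-(c * N / 4 * T₀)) *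
            (Real.sqrt (2 / c) ^ N * R * Real.exp (4 * C₁ / c)) := by gcongr
        _ = C₀ * (R * Real.exp (2 * C₁)) + (Real.exp (-(c * N / 4 * T₀)) *
            Real.sqrt (2 / c) ^ N) * (R * Real.exp (4 * C₁ / c)) := by ring
        _ ≤ C₀ * (R * Real.exp (2 * C₁)) + 1 * (R * Real.exp (4 * C₁ / c)) := by gcongr
        _ = _ := by ring
    · exact (integrable_halfBox_exp_satur (by positivity) (by positivity) (fun j θ => θ j + t)
        (fun j => by fun_prop)).const_mul _
    · exact (integrable_halfBox_exp_satur (by positivity) (by positivity) (fun j θ => θ j + t)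
        (fun j => by fun_prop)).const_mul _
  have hFi : Integrable (fun θ : Fin N → ℝ =>
      Real.exp (-(∑ e : CEdge N, satur K (Real.sin (θ e.1.1 + θ e.1.2) ^ 2)) / 2))
      (halfBox (Fin N)) := by
    have := integrable_halfBox_exp_satur (I := Fin N) (a := 1 / 2) hK (by norm_num)
      (fun (e : CEdge N) θ => θ e.1.1 + θ e.1.2) (fun e => by fun_prop)
    refine this.congr (Filter.Eventually.of_forall fun θ => ?_)
    dsimp only; congr 1; ring
  calc _ ≤ ∫ θ, (G 0 θ + G (Real.pi / 2) θ) ∂(halfBox (Fin N)) :=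
        integral_mono hFi ((hGi 0).add (hGi _)) hpt'
    _ = (∫ θ, G 0 θ ∂(halfBox (Fin N))) + ∫ θ, G (Real.pi / 2) θ ∂(halfBox (Fin N)) :=
        integral_add (hGi 0) (hGi _)
    _ ≤ _ := by
        have := hGint 0; have := hGint (Real.pi / 2); linarith

/-- Twice the density at `x` of a centred Gaussian of variance `p`. -/
noncomputable def dblGauss (p x : ℝ) : ℝ :=
  Real.sqrt (2 / (Real.pi * p)) * Real.exp (-x ^ 2 / (2 * p))

lemma dblGauss_nonneg (p x : ℝ) : 0 ≤ dblGauss p x := by unfold dblGauss; positivity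

@[fun_prop]
lemma continuous_dblGauss (p : ℝ) : Continuous (dblGauss p) := by unfold dblGauss; fun_prop

lemma dblGauss_le {p : ℝ} (hp : 0 ≤ p) (x : ℝ) : dblGauss p x ≤ Real.sqrt (2 / (Real.pi * p)) := by
  unfold dblGauss
  apply mul_le_of_le_one_right (Real.sqrt_nonneg _)
  rw [Real.exp_le_one_iff]
  apply div_nonpos_of_nonpos_of_nonneg <;> nlinarith [sq_nonneg x]

lemma abs_signedDeg_complete_le {N : ℕ} (b : CEdge N → Bool) (i : Fin N) :
    |signedDeg (fun e : CEdge N => e.1.1) (fun e => e.1.2) b i| ≤ N - 1 := by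
  unfold signedDeg
  have h0 : ∀ t : Bool, |bsign t| = 1 := by decide
  have h1 : ∑ e : CEdge N, ((if e.1.1 = i then (1 : ℝ) else 0) + (if e.1.2 = i then 1 else 0)) =
      N - 1 := by
    rw [sum_CEdge (fun a b => (if a = i then (1 : ℝ) else 0) + (if b = i then 1 else 0))
      (fun a b => add_comm _ _)]
    simp [Finset.sum_add_distrib]
    ring
  have h2 : ∑ e : CEdge N, ((if e.1.1 = i then (1 : ℤ) else 0) + (if e.1.2 = i then 1 else 0)) =
      N - 1 := by
    have : ((∑ e : CEdge N, ((if e.1.1 = i then (1 : ℤ) else 0) +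
        (if e.1.2 = i then 1 else 0)) : ℤ) : ℝ) = ((N - 1 : ℤ) : ℝ) := by
      push_cast; exact h1
    exact_mod_cast this
  rw [← h2]
  refine (Finset.abs_sum_le_sum_abs _ _).trans (Finset.sum_le_sum fun e _ => ?_)
  rw [abs_mul, h0, one_mul]
  exact le_of_eq (abs_of_nonneg (by positivity))

lemma two_le_integral_exp_mul (a : ℝ) : 2 ≤ ∫ t in Set.Icc (-1 : ℝ) 1, Real.exp (a * t) := by
  have h : ∫ t in Set.Icc (-1 : ℝ) 1, (a * t + 1) = 2 := by
    rw [integral_Icc_eq_integral_Ioc, ← intervalIntegral.integral_of_le (by norm_num),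
      intervalIntegral.integral_add, intervalIntegral.integral_const_mul, integral_id]
    · norm_num
    · exact (by fun_prop : Continuous fun x : ℝ => a * x).intervalIntegrable _ _
    · exact continuous_const.intervalIntegrable _ _
  rw [← h]
  refine setIntegral_mono_on ?_ ?_ measurableSet_Icc fun t _ => Real.add_one_le_exp _
  · exact (by fun_prop : Continuous fun x : ℝ => a * x + 1).integrableOn_Icc
  · exact (by fun_prop : Continuous fun x : ℝ => Real.exp (a * x)).integrableOn_Icc

lemma integrable_exp_neg_half_sq : Integrable fun z : ℝ => Real.exp (-z ^ 2 / 2) := by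
  have := integrable_exp_neg_mul_sq (b := 1 / 2) (by norm_num)
  refine this.congr (Filter.Eventually.of_forall fun z => ?_)
  dsimp only; congr 1; ring

lemma integrable_exp_mul_prod_dblGauss {I : Type*} [Fintype I] {p : ℝ} (hp : 0 ≤ p) (d : I → ℝ) :
    Integrable fun z : ℝ => Real.exp (-z ^ 2 / 2) * ∏ i, dblGauss p (d i - z) := by
  refine Integrable.mono' (integrable_exp_neg_half_sq.mul_const
    (∏ _i : I, Real.sqrt (2 / (Real.pi * p)))) (by fun_prop)
    (Filter.Eventually.of_forall fun z => ?_)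
  have h0 : 0 ≤ ∏ i, dblGauss p (d i - z) :=
    Finset.prod_nonneg fun i _ => dblGauss_nonneg _ _
  rw [Real.norm_eq_abs, abs_of_nonneg (by positivity)]
  gcongr with i hi
  · intros; exact dblGauss_nonneg _ _
  · exact dblGauss_le hp _

lemma exp_center_le {N : ℕ} (hN : 0 < N) (d : Fin N → ℝ) (z₀ : ℝ) :
    Real.sqrt (2 / (Real.pi * N)) ^ N *
        Real.exp (-(∑ i, (d i - z₀) ^ 2) / (2 * N) - z₀ ^ 2 / 2) ≤
      Real.exp 1 / 2 * ∫ z, Real.exp (-z ^ 2 / 2) * ∏ i, dblGauss N (d i - z) := by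
  have hN' : (0 : ℝ) < N := by exact_mod_cast hN
  have hprod : ∀ z, Real.exp (-z ^ 2 / 2) * ∏ i, dblGauss N (d i - z) =
      Real.sqrt (2 / (Real.pi * N)) ^ N *
        Real.exp (-(∑ i, (d i - z) ^ 2) / (2 * N) - z ^ 2 / 2) := by
    intro z
    unfold dblGauss
    rw [Finset.prod_mul_distrib, Finset.prod_const, Finset.card_univ, Fintype.card_fin,
      ← Real.exp_sum, mul_left_comm, ← Real.exp_add]
    congr 2
    rw [← Finset.sum_div, Finset.sum_neg_distrib]; ring
  set q : ℝ → ℝ := fun z => (∑ i, (d i - z) ^ 2) / (2 * N) + z ^ 2 / 2 with hq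
  set a : ℝ := (∑ i, (d i - z₀)) / N - z₀ with ha
  have hqt : ∀ t, q (t + z₀) = q z₀ - a * t + t ^ 2 := by
    intro t
    simp only [hq, ha]
    have : ∀ i, (d i - (t + z₀)) ^ 2 = (d i - z₀) ^ 2 - 2 * t * (d i - z₀) + t ^ 2 :=
      fun i => by ring
    simp_rw [this, Finset.sum_add_distrib, Finset.sum_sub_distrib, ← Finset.mul_sum]
    simp only [Finset.sum_const, Finset.card_univ, Fintype.card_fin, nsmul_eq_mul]
    rw [Finset.sum_sub_distrib]
    simp only [Finset.sum_const, Finset.card_univ, Fintype.card_fin, nsmul_eq_mul]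
    field_simp; ring
  have hqe : ∀ z, -(∑ i, (d i - z) ^ 2) / (2 * N) - z ^ 2 / 2 = -q z := fun z => by
    simp only [hq]; ring
  have hinteg := integrable_exp_mul_prod_dblGauss hN'.le d
  simp_rw [hprod, hqe] at hinteg ⊢
  rw [integral_const_mul]
  have hR : 0 ≤ Real.sqrt (2 / (Real.pi * N)) ^ N := by positivity
  rw [mul_left_comm]
  apply mul_le_mul_of_nonneg_left _ hR
  have hqi : Integrable fun z => Real.exp (-q z) := by
    have hR' : Real.sqrt (2 / (Real.pi * N)) ^ N ≠ 0 := by positivity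
    exact (integrable_const_mul_iff (IsUnit.mk0 _ hR') _).1 hinteg
  have h1 : ∫ z, Real.exp (-q z) = ∫ t, Real.exp (-q (t + z₀)) :=
    (integral_add_right_eq_self (fun z => Real.exp (-q z)) z₀).symm
  have h2 : ∫ t in Set.Icc (-1 : ℝ) 1, Real.exp (-q (t + z₀)) ≤ ∫ t, Real.exp (-q (t + z₀)) :=
    setIntegral_le_integral (hqi.comp_add_right z₀)
      (Filter.Eventually.of_forall fun t => (Real.exp_pos _).le)
  have h3 : ∫ t in Set.Icc (-1 : ℝ) 1, Real.exp (-q z₀ - 1) * Real.exp (a * t) ≤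
      ∫ t in Set.Icc (-1 : ℝ) 1, Real.exp (-q (t + z₀)) := by
    refine setIntegral_mono_on ?_ (hqi.comp_add_right z₀).integrableOn measurableSet_Icc
      fun t ht => ?_
    · exact (by fun_prop : Continuous fun x : ℝ =>
        Real.exp (-q z₀ - 1) * Real.exp (a * x)).integrableOn_Icc
    · rw [← Real.exp_add, hqt]
      apply Real.exp_le_exp.2
      nlinarith [ht.1, ht.2]
  rw [integral_const_mul] at h3
  have h4 := two_le_integral_exp_mul a
  have h5 : Real.exp (-q z₀) = Real.exp 1 * Real.exp (-q z₀ - 1) := by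
    rw [← Real.exp_add]; ring_nf
  rw [h1, h5]
  have h6 : Real.exp (-q z₀ - 1) * 2 ≤ ∫ t, Real.exp (-q (t + z₀)) :=
    (mul_le_mul_of_nonneg_left h4 (Real.exp_pos _).le).trans (h3.trans h2)
  have := mul_le_mul_of_nonneg_left h6 (Real.exp_pos 1).le
  linarith

/-- Probability that a uniformly random signing of `E` has signed degree sequence `d`. -/
noncomputable def degProb {E I : Type*} [Fintype E] [DecidableEq E] [Fintype I] [DecidableEq I]
    (c₁ c₂ : E → I) (d : I → ℤ) : ℝ :=
  ((Finset.univ.filter fun b : E → Bool => ∀ i, signedDeg c₁ c₂ b i = d i).card : ℝ) /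
    2 ^ Fintype.card E

lemma degProb_nonneg {E I : Type*} [Fintype E] [DecidableEq E] [Fintype I] [DecidableEq I]
    (c₁ c₂ : E → I) (d : I → ℤ) : 0 ≤ degProb c₁ c₂ d := by unfold degProb; positivity

lemma degProb_eq_zero {E I : Type*} [Fintype E] [DecidableEq E] [Fintype I] [DecidableEq I]
    {c₁ c₂ : E → I} {d : I → ℤ} (h : ∀ b, ¬ ∀ i, signedDeg c₁ c₂ b i = d i) :
    degProb c₁ c₂ d = 0 := by
  unfold degProb
  rw [Finset.filter_false_of_mem fun b _ => h b]; simp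

lemma degProb_le {E I : Type*} [Fintype E] [DecidableEq E] [Fintype I] [DecidableEq I]
    (c₁ c₂ : E → I) (d : I → ℤ) (l : I → ℝ) (hl : ∀ e, |l (c₁ e) + l (c₂ e)| ≤ 4) :
    degProb c₁ c₂ d ≤
      Real.exp (-(∑ i, l i * d i) + (∑ e, (l (c₁ e) + l (c₂ e)) ^ 2) / 2) *
        ((Real.pi ^ Fintype.card I)⁻¹ * ∫ θ, Real.exp (-(∑ e, satur coshLoss
          (Real.sin (θ (c₁ e) + θ (c₂ e)) ^ 2)) / 2) ∂(halfBox I)) :=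
  card_signedDeg_eq_le c₁ c₂ d l hl

theorem exists_complete_degProb_le : ∃ C : ℝ, 0 < C ∧ ∃ N₀ : ℕ, 0 < N₀ ∧ ∀ N : ℕ, N₀ ≤ N →
    ∀ d : Fin N → ℤ, degProb (fun e : CEdge N => e.1.1) (fun e => e.1.2) d ≤
      C * ∫ z, Real.exp (-z ^ 2 / 2) * ∏ i, dblGauss N (d i - z) := by
  obtain ⟨C, hC, N₀, -, h⟩ := exists_complete_integral_le coshLoss_pos.le
  refine ⟨C * (Real.exp 1 / 2), by positivity, max N₀ 6, by omega, fun N hN d => ?_⟩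
  have hN6 : (6 : ℝ) ≤ N := by exact_mod_cast (le_max_right _ _).trans hN
  have hNpos : (0 : ℝ) < N := by linarith
  have hI := h N ((le_max_left _ _).trans hN)
  have hrhs : 0 ≤ ∫ z, Real.exp (-z ^ 2 / 2) * ∏ i, dblGauss N (d i - z) :=
    integral_nonneg fun z => mul_nonneg (Real.exp_pos _).le
      (Finset.prod_nonneg fun i _ => dblGauss_nonneg _ _)
  by_cases hd : ∀ i, |d i| ≤ N - 1
  swap
  · rw [degProb_eq_zero]
    · positivity
    · intro b hb
      exact hd fun i => by rw [← hb i]; exact abs_signedDeg_complete_le b i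
  have hd' : ∀ i, |(d i : ℝ)| ≤ N - 1 := fun i => by exact_mod_cast hd i
  set D : ℝ := ∑ i, (d i : ℝ) with hD
  set z₀ : ℝ := D / (2 * N - 2) with hz₀
  have hDz : D = (2 * N - 2) * z₀ := by
    rw [hz₀, mul_div_cancel₀]; linarith
  have hz : |z₀| ≤ N / 2 := by
    have h1 : |D| ≤ N * (N - 1) := by
      refine (Finset.abs_sum_le_sum_abs _ _).trans ?_
      calc ∑ i, |(d i : ℝ)| ≤ ∑ _i : Fin N, ((N : ℝ) - 1) := Finset.sum_le_sum fun i _ => hd' i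
        _ = _ := by simp; ring
    rw [hz₀, abs_div, abs_of_pos (by linarith : 0 < 2 * (N : ℝ) - 2), div_le_iff₀ (by linarith)]
    linarith
  set l : Fin N → ℝ := fun i => (d i - z₀) / (N - 2) with hl
  have hl2 : ∀ i, |l i| ≤ 2 := by
    intro i
    rw [hl, abs_div, abs_of_pos (by linarith : 0 < (N : ℝ) - 2), div_le_iff₀ (by linarith)]
    have := abs_sub (d i : ℝ) z₀
    have := hd' i
    linarith
  have hdl : ∀ i, (d i : ℝ) = (N - 2) * l i + z₀ := fun i => by
    simp only [hl]; field_simp [show ((N : ℝ) - 2) ≠ 0 by linarith]; ring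
  have hLam : ∑ i, l i = z₀ := by
    simp only [hl]
    rw [← Finset.sum_div, Finset.sum_sub_distrib, ← hD, hDz]
    simp only [Finset.sum_const, Finset.card_univ, Fintype.card_fin, nsmul_eq_mul]
    rw [div_eq_iff (by linarith)]; ring
  have hF := degProb_le (fun e : CEdge N => e.1.1) (fun e => e.1.2) d l
    (fun e => (abs_add_le _ _).trans (by linarith [hl2 e.1.1, hl2 e.1.2]))
  have hsq : ∑ e : CEdge N, (l e.1.1 + l e.1.2) ^ 2 = (N - 2) * ∑ i, l i ^ 2 + z₀ ^ 2 := by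
    rw [sum_CEdge (fun i j => (l i + l j) ^ 2) (fun i j => by ring)]
    have h1 : ∑ i, ∑ j, (l i + l j) ^ 2 = 2 * N * ∑ i, l i ^ 2 + 2 * z₀ ^ 2 := by
      simp_rw [add_sq, Finset.sum_add_distrib, ← Finset.mul_sum]
      rw [← Finset.sum_mul, ← Finset.mul_sum, hLam]
      simp only [Finset.sum_const, Finset.card_univ, Fintype.card_fin, nsmul_eq_mul]
      rw [← Finset.mul_sum]
      ring
    have h2 : ∑ i, (l i + l i) ^ 2 = 4 * ∑ i, l i ^ 2 := by
      rw [Finset.mul_sum]; exact Finset.sum_congr rfl fun i _ => by ring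
    rw [h1, h2]; ring
  have hld : ∑ i, l i * d i = (N - 2) * ∑ i, l i ^ 2 + z₀ ^ 2 := by
    simp_rw [hdl, mul_add, Finset.sum_add_distrib]
    rw [← Finset.sum_mul, hLam, Finset.mul_sum]
    congr 1
    · exact Finset.sum_congr rfl fun i _ => by ring
    · ring
  have hexp : Real.exp (-(∑ i, l i * d i) + (∑ e : CEdge N, (l e.1.1 + l e.1.2) ^ 2) / 2) ≤
      Real.exp (-(∑ i, ((d i : ℝ) - z₀) ^ 2) / (2 * N) - z₀ ^ 2 / 2) := by
    apply Real.exp_le_exp.2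
    rw [hsq, hld]
    have h1 : ∑ i, ((d i : ℝ) - z₀) ^ 2 = (N - 2) ^ 2 * ∑ i, l i ^ 2 := by
      rw [Finset.mul_sum]
      exact Finset.sum_congr rfl fun i _ => by rw [hdl]; ring
    have h2 : 0 ≤ ∑ i, l i ^ 2 := Finset.sum_nonneg fun i _ => sq_nonneg _
    have h3 : ((N : ℝ) - 2) ^ 2 * (∑ i, l i ^ 2) / (2 * N) ≤ (N - 2) * (∑ i, l i ^ 2) / 2 := by
      rw [div_le_div_iff₀ (by positivity) (by norm_num)]
      have : 0 ≤ (N - 2) * ∑ i, l i ^ 2 := mul_nonneg (by linarith) h2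
      nlinarith
    rw [h1, neg_div]; linarith
  refine hF.trans ?_
  have hcomb : (Real.pi ^ N)⁻¹ * Real.sqrt (2 * Real.pi / N) ^ N =
      Real.sqrt (2 / (Real.pi * N)) ^ N := by
    rw [← inv_pow, ← mul_pow]; congr 1
    have : 2 * Real.pi / N = Real.pi ^ 2 * (2 / (Real.pi * N)) := by field_simp
    rw [this, Real.sqrt_mul (by positivity), Real.sqrt_sq Real.pi_pos.le]
    field_simp
  rw [Fintype.card_fin]
  have hcen := exp_center_le (by exact_mod_cast hNpos) (fun i => (d i : ℝ)) z₀
  calc _ ≤ Real.exp (-(∑ i, ((d i : ℝ) - z₀) ^ 2) / (2 * N) - z₀ ^ 2 / 2) *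
        ((Real.pi ^ N)⁻¹ * (C * Real.sqrt (2 * Real.pi / N) ^ N)) := by
        gcongr
    _ = C * (((Real.pi ^ N)⁻¹ * Real.sqrt (2 * Real.pi / N) ^ N) *
          Real.exp (-(∑ i, ((d i : ℝ) - z₀) ^ 2) / (2 * N) - z₀ ^ 2 / 2)) := by ring
    _ ≤ C * (Real.exp 1 / 2 * ∫ z, Real.exp (-z ^ 2 / 2) * ∏ i, dblGauss N (d i - z)) := by
        rw [hcomb]; gcongr
    _ = _ := by ring

lemma satur_add_le {L u v : ℝ} (hL : 0 ≤ L) (hu : 0 ≤ u) (hv : 0 ≤ v) :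
    satur L (u + v) ≤ satur L u + satur L v := by
  unfold satur
  rw [add_div]
  apply add_le_add
  · apply div_le_div_of_nonneg_left hu (by positivity); nlinarith
  · apply div_le_div_of_nonneg_left hv (by positivity); nlinarith

lemma satur_midpoint {L u v : ℝ} (hL : 0 ≤ L) (hu : 0 ≤ u) (hv : 0 ≤ v) :
    satur L u + satur L v ≤ 2 * satur L ((u + v) / 2) := by
  unfold satur
  have h1 : 0 < 1 + L * u := by positivity
  have h2 : 0 < 1 + L * v := by positivity
  have h3 : 0 < 1 + L * ((u + v) / 2) := by positivity
  have key : 2 * (((u + v) / 2) / (1 + L * ((u + v) / 2))) - (u / (1 + L * u) + v / (1 + L * v)) =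
      L * (u - v) ^ 2 / (2 * ((1 + L * u) * (1 + L * v) * (1 + L * ((u + v) / 2)))) := by
    field_simp; ring
  have : 0 ≤ L * (u - v) ^ 2 / (2 * ((1 + L * u) * (1 + L * v) * (1 + L * ((u + v) / 2)))) := by
    positivity
  linarith

lemma satur_sin_sub_add_le {L : ℝ} (hL : 0 ≤ L) (x t : ℝ) :
    satur L (Real.sin (x - t) ^ 2) + satur L (Real.sin (x + t) ^ 2) ≤
      2 * satur L (Real.sin x ^ 2) + 2 * Real.sin t ^ 2 := by
  have h1 : (Real.sin (x - t) ^ 2 + Real.sin (x + t) ^ 2) / 2 ≤ Real.sin x ^ 2 + Real.sin t ^ 2 := by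
    rw [Real.sin_sub, Real.sin_add]
    have h2 := Real.sin_sq_add_cos_sq x
    have h3 := Real.sin_sq_add_cos_sq t
    nlinarith [sq_nonneg (Real.sin x * Real.sin t), sq_nonneg (Real.sin x), sq_nonneg (Real.sin t),
      mul_nonneg (sq_nonneg (Real.sin x)) (sq_nonneg (Real.sin t))]
  have h2 := satur_midpoint hL (sq_nonneg (Real.sin (x - t))) (sq_nonneg (Real.sin (x + t)))
  have h3 := satur_mono hL (by positivity) h1
  have h4 := satur_add_le hL (sq_nonneg (Real.sin x)) (sq_nonneg (Real.sin t))
  have h5 := satur_le hL (sq_nonneg (Real.sin t))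
  linarith

/-- A rotation making the weighted second harmonic of a family of angles real and nonnegative. -/
lemma exists_balanced_rotation {A : Type*} [Fintype A] {L : ℝ} (hL : 0 < L) (θ : A → ℝ) :
    ∃ τ : ℝ, ∑ v, (1 + L * Real.sin (θ v - τ) ^ 2)⁻¹ * Real.sin (2 * (θ v - τ)) = 0 ∧
      0 ≤ ∑ v, (1 + L * Real.sin (θ v - τ) ^ 2)⁻¹ * Real.cos (2 * (θ v - τ)) := by
  set f : ℝ → ℝ := fun τ => ∑ v, Real.log (1 + L * Real.sin (θ v - τ) ^ 2) with hf
  have hpos : ∀ x : ℝ, 0 < 1 + L * Real.sin x ^ 2 := fun x => by positivity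
  have hper : Function.Periodic f Real.pi := by
    intro τ
    simp only [hf]
    refine Finset.sum_congr rfl fun v _ => ?_
    rw [show θ v - (τ + Real.pi) = (θ v - τ) - Real.pi by ring, Real.sin_sub_pi]
    simp
  have hcont : Continuous f := by
    simp only [hf]
    exact continuous_finsetSum _ fun v _ => Continuous.log (by fun_prop) fun τ => (hpos _).ne'
  obtain ⟨τ, -, hτ⟩ := isCompact_Icc.exists_isMinOn (s := Set.Icc 0 Real.pi)
    ⟨0, by simp [Real.pi_pos.le]⟩ hcont.continuousOn
  have hmin : ∀ s, f τ ≤ f s := by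
    intro s
    obtain ⟨y, hy, hys⟩ := hper.exists_mem_Ico₀ Real.pi_pos s
    rw [hys]
    exact hτ ⟨hy.1, hy.2.le⟩
  refine ⟨τ, ?_, ?_⟩
  · have hd : HasDerivAt f (∑ v, -(L * ((1 + L * Real.sin (θ v - τ) ^ 2)⁻¹ *
        Real.sin (2 * (θ v - τ))))) τ := by
      simp only [hf]
      refine HasDerivAt.fun_sum fun v _ => ?_
      have h1 : HasDerivAt (fun τ => 1 + L * Real.sin (θ v - τ) ^ 2)
          (L * (2 * Real.sin (θ v - τ) * (Real.cos (θ v - τ) * (-1)))) τ := by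
        have h2 : HasDerivAt (fun τ => θ v - τ) (-1) τ := by
          simpa using (hasDerivAt_id τ).const_sub (θ v)
        have := ((h2.sin.fun_pow 2).const_mul L).const_add 1
        simpa using this
      have h3 := h1.log (hpos _).ne'
      refine h3.congr_deriv ?_
      rw [Real.sin_two_mul]; field_simp
    have hloc : IsLocalMin f τ := Filter.Eventually.of_forall hmin
    have := hloc.hasDerivAt_eq_zero hd
    rw [Finset.sum_neg_distrib, ← Finset.mul_sum, neg_eq_zero] at this
    exact (mul_eq_zero.1 this).resolve_left hL.ne'
  · have h := hmin (τ - Real.pi / 2)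
    simp only [hf] at h
    have h1 : ∀ v, Real.log (1 + L * Real.sin (θ v - (τ - Real.pi / 2)) ^ 2) ≤
        Real.log (1 + L * Real.sin (θ v - τ) ^ 2) +
          L * ((1 + L * Real.sin (θ v - τ) ^ 2)⁻¹ * Real.cos (2 * (θ v - τ))) := by
      intro v
      rw [show θ v - (τ - Real.pi / 2) = (θ v - τ) + Real.pi / 2 by ring, Real.sin_add_pi_div_two]
      set x := θ v - τ
      have h2 : 0 < 1 + L * Real.cos x ^ 2 := by positivity
      have h3 := Real.log_le_sub_one_of_pos (div_pos h2 (hpos x))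
      rw [Real.log_div h2.ne' (hpos x).ne'] at h3
      have h4 : (1 + L * Real.cos x ^ 2) / (1 + L * Real.sin x ^ 2) - 1 =
          L * ((1 + L * Real.sin x ^ 2)⁻¹ * Real.cos (2 * x)) := by
        rw [Real.cos_two_mul']; field_simp; ring
      linarith
    have h2 := h.trans (Finset.sum_le_sum fun v _ => h1 v)
    rw [Finset.sum_add_distrib, ← Finset.mul_sum] at h2
    have h3 : 0 ≤ L * ∑ v, (1 + L * Real.sin (θ v - τ) ^ 2)⁻¹ * Real.cos (2 * (θ v - τ)) := by
      linarith
    exact nonneg_of_mul_nonneg_right h3 hL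

lemma sum_inv_weight {A : Type*} [Fintype A] {L : ℝ} (hL : 0 ≤ L) (x : A → ℝ) :
    ∑ v, (1 + L * Real.sin (x v) ^ 2)⁻¹ =
      Fintype.card A - L * ∑ v, satur L (Real.sin (x v) ^ 2) := by
  have : ∀ v, (1 + L * Real.sin (x v) ^ 2)⁻¹ = 1 - L * satur L (Real.sin (x v) ^ 2) := fun v =>
    inv_eq_one_sub_satur hL (sq_nonneg _)
  simp_rw [this, Finset.sum_sub_distrib, ← Finset.mul_sum]; simp

lemma sum_weight_cos {A : Type*} [Fintype A] (L : ℝ) (x : A → ℝ) :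
    ∑ v, (1 + L * Real.sin (x v) ^ 2)⁻¹ * Real.cos (2 * x v) =
      ∑ v, (1 + L * Real.sin (x v) ^ 2)⁻¹ - 2 * ∑ v, satur L (Real.sin (x v) ^ 2) := by
  simp_rw [weight_cos, inv_mul_eq_satur, Finset.sum_sub_distrib, ← Finset.mul_sum]

lemma sum_satur_le {A : Type*} [Fintype A] {L : ℝ} (hL : 0 ≤ L) (x : A → ℝ) :
    (1 + L) * ∑ v, satur L (Real.sin (x v) ^ 2) ≤ Fintype.card A := by
  have : ∀ v, (1 + L) * satur L (Real.sin (x v) ^ 2) ≤ 1 := fun v => by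
    unfold satur
    have h1 := Real.sin_sq_le_one (x v)
    rw [mul_div_assoc', div_le_one (by positivity)]
    nlinarith
  rw [Finset.mul_sum]
  calc _ ≤ ∑ _v : A, (1 : ℝ) := Finset.sum_le_sum fun v _ => this v
    _ = _ := by simp

lemma bipartite_quadratic_ge {A B : Type*} [Fintype A] [Fintype B] {K : ℝ} (hK : 0 ≤ K)
    (x : A → ℝ) (y : B → ℝ)
    (hY : ∑ v, (1 + 2 * K * Real.sin (x v) ^ 2)⁻¹ * Real.sin (2 * x v) = 0)
    (hX : 0 ≤ ∑ v, (1 + 2 * K * Real.sin (x v) ^ 2)⁻¹ * Real.cos (2 * x v))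
    (p q T U S : ℝ) (hp : p = Fintype.card A) (hq : q = Fintype.card B)
    (hT : T = ∑ v, satur (2 * K) (Real.sin (x v) ^ 2))
    (hU : U = ∑ w, satur (2 * K) (Real.sin (y w) ^ 2))
    (hS : S = ∑ v, ∑ w, satur K (Real.sin (x v + y w) ^ 2)) :
    (q * T + p * U) / (4 * (1 + 2 * K)) ≤ S ∧
    (2 * (1 + K) * U ≤ q → q * T + p * U - (4 * K + 2) * (T * U) ≤ S) := by
  have hT0 : 0 ≤ T := hT ▸ Finset.sum_nonneg fun j _ => satur_nonneg (by positivity) (sq_nonneg _)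
  have hU0 : 0 ≤ U := hU ▸ Finset.sum_nonneg fun j _ => satur_nonneg (by positivity) (sq_nonneg _)
  have hle : ∑ v, ∑ w, (1 + 2 * K * Real.sin (x v) ^ 2)⁻¹ * (1 + 2 * K * Real.sin (y w) ^ 2)⁻¹ *
      Real.sin (x v + y w) ^ 2 ≤ S := hS ▸
    Finset.sum_le_sum fun v _ => Finset.sum_le_sum fun w _ => satur_sin_add_ge hK _ _
  rw [sum_mul_sin_add_sq (fun v => (1 + 2 * K * Real.sin (x v) ^ 2)⁻¹) x
    (fun w => (1 + 2 * K * Real.sin (y w) ^ 2)⁻¹) y, hY] at hle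
  rw [sum_weight_cos, sum_inv_weight (by positivity), ← hT, ← hp] at hX
  rw [sum_weight_cos, sum_weight_cos, sum_inv_weight (by positivity),
    sum_inv_weight (by positivity), ← hT, ← hU, ← hp, ← hq] at hle
  have hTp : (1 + 2 * K) * T ≤ p := by rw [hp, hT]; exact sum_satur_le (by positivity) x
  have hUq : (1 + 2 * K) * U ≤ q := by rw [hq, hU]; exact sum_satur_le (by positivity) y
  have hp0 : 0 ≤ p := by rw [hp]; positivity
  have hq0 : 0 ≤ q := by rw [hq]; positivity
  set O₁ := p - 2 * K * T with hO₁
  set O₂ := q - 2 * K * U with hO₂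
  have hO₁p : p ≤ (1 + 2 * K) * O₁ := by rw [hO₁]; nlinarith [mul_nonneg hK hT0]
  have hO₂q : q ≤ (1 + 2 * K) * O₂ := by rw [hO₂]; nlinarith [mul_nonneg hK hU0]
  have hO₁0 : 0 ≤ O₁ := by nlinarith
  have hO₂0 : 0 ≤ O₂ := by nlinarith
  refine ⟨?_, fun h => ?_⟩
  · rw [div_le_iff₀ (by positivity)]
    rcases le_total 0 (O₂ - 2 * U) with h | h
    · have h1 : O₁ * U + O₂ * T - 2 * (T * U) ≤ S := by nlinarith
      have h2 : (O₁ * U + O₂ * T) / 2 ≤ S := by nlinarith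
      have h3 : q * T ≤ (1 + 2 * K) * O₂ * T := by gcongr
      have h4 : p * U ≤ (1 + 2 * K) * O₁ * U := by gcongr
      have h6 := mul_le_mul_of_nonneg_left h2 (by positivity : 0 ≤ 1 + 2 * K)
      have h7 : 0 ≤ S * (1 + 2 * K) := by
        have : 0 ≤ S := le_trans (by positivity) h2
        positivity
      nlinarith
    · have h1 : O₁ * O₂ / 2 ≤ S := by nlinarith
      have h2 : q * T ≤ O₂ * O₁ * (1 + 2 * K) := by
        calc q * T ≤ ((1 + 2 * K) * O₂) * O₁ := by
              gcongr; linarith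
          _ = _ := by ring
      have h3 : p * U ≤ O₂ * O₁ * (1 + 2 * K) := by
        have : U ≤ O₂ := by rw [hO₂]; linarith
        calc p * U ≤ ((1 + 2 * K) * O₁) * O₂ := by gcongr
          _ = _ := by ring
      have h6 := mul_le_mul_of_nonneg_left h1 (by positivity : 0 ≤ 1 + 2 * K)
      nlinarith
  · have h0 : 0 ≤ O₂ - 2 * U := by rw [hO₂]; linarith
    nlinarith

/-- The weighted saturated energy of a bipartite family of angles, seen from the rotation `t`. -/
noncomputable def bipEnergy (L : ℝ) {p q : ℕ} (θ : Fin p ⊕ Fin q → ℝ) (t : ℝ) : ℝ :=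
  q * ∑ v, satur L (Real.sin (θ (Sum.inl v) - t) ^ 2) +
    p * ∑ w, satur L (Real.sin (θ (Sum.inr w) + t) ^ 2)

lemma bipEnergy_nonneg {L : ℝ} (hL : 0 ≤ L) {p q : ℕ} (θ : Fin p ⊕ Fin q → ℝ) (t : ℝ) :
    0 ≤ bipEnergy L θ t := by
  have h1 : 0 ≤ ∑ v, satur L (Real.sin (θ (Sum.inl v) - t) ^ 2) :=
    Finset.sum_nonneg fun j _ => satur_nonneg hL (sq_nonneg _)
  have h2 : 0 ≤ ∑ w, satur L (Real.sin (θ (Sum.inr w) + t) ^ 2) :=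
    Finset.sum_nonneg fun j _ => satur_nonneg hL (sq_nonneg _)
  unfold bipEnergy; positivity

lemma bipEnergy_periodic (L : ℝ) {p q : ℕ} (θ : Fin p ⊕ Fin q → ℝ) :
    Function.Periodic (bipEnergy L θ) Real.pi := by
  intro t
  unfold bipEnergy
  simp [← sub_sub, ← add_assoc, Real.sin_sub_pi, Real.sin_add_pi]

lemma continuous_bipEnergy {L : ℝ} (hL : 0 ≤ L) {p q : ℕ} :
    Continuous fun x : (Fin p ⊕ Fin q → ℝ) × ℝ => bipEnergy L x.1 x.2 := by
  unfold bipEnergy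
  have h1 : ∀ v : Fin p, Continuous fun x : (Fin p ⊕ Fin q → ℝ) × ℝ =>
      satur L (Real.sin (x.1 (Sum.inl v) - x.2) ^ 2) := fun v =>
    (continuous_satur_sin_sq hL).comp (by fun_prop)
  have h2 : ∀ v : Fin q, Continuous fun x : (Fin p ⊕ Fin q → ℝ) × ℝ =>
      satur L (Real.sin (x.1 (Sum.inr v) + x.2) ^ 2) := fun v =>
    (continuous_satur_sin_sq hL).comp (by fun_prop)
  exact (continuous_const.mul (continuous_finsetSum _ fun v _ => h1 v)).add
    (continuous_const.mul (continuous_finsetSum _ fun v _ => h2 v))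

lemma continuous_bipEnergy_add {L : ℝ} (hL : 0 ≤ L) {p q : ℕ} (θ : Fin p ⊕ Fin q → ℝ) (τ : ℝ) :
    Continuous fun t : ℝ => bipEnergy L θ (τ + t) := by
  unfold bipEnergy
  have h1 : ∀ v : Fin p, Continuous fun t : ℝ =>
      satur L (Real.sin (θ (Sum.inl v) - (τ + t)) ^ 2) := fun v =>
    (continuous_satur_sin_sq hL).comp (by fun_prop)
  have h2 : ∀ v : Fin q, Continuous fun t : ℝ =>
      satur L (Real.sin (θ (Sum.inr v) + (τ + t)) ^ 2) := fun v =>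
    (continuous_satur_sin_sq hL).comp (by fun_prop)
  exact (continuous_const.mul (continuous_finsetSum _ fun v _ => h1 v)).add
    (continuous_const.mul (continuous_finsetSum _ fun v _ => h2 v))

lemma bipEnergy_sub_add_le {L : ℝ} (hL : 0 ≤ L) {p q : ℕ} (θ : Fin p ⊕ Fin q → ℝ) (τ t : ℝ) :
    bipEnergy L θ (τ - t) + bipEnergy L θ (τ + t) ≤ 2 * bipEnergy L θ τ + 4 * (p * q * t ^ 2) := by
  have hs : Real.sin t ^ 2 ≤ t ^ 2 := sq_le_sq.2 Real.abs_sin_le_abs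
  have h1 : ∑ v, satur L (Real.sin (θ (Sum.inl v) - (τ - t)) ^ 2) +
      ∑ v, satur L (Real.sin (θ (Sum.inl v) - (τ + t)) ^ 2) ≤
      2 * ∑ v, satur L (Real.sin (θ (Sum.inl v) - τ) ^ 2) + p * (2 * t ^ 2) := by
    rw [← Finset.sum_add_distrib, Finset.mul_sum]
    have : (p : ℝ) * (2 * t ^ 2) = ∑ _v : Fin p, 2 * t ^ 2 := by simp
    rw [this, ← Finset.sum_add_distrib]
    refine Finset.sum_le_sum fun v _ => ?_
    have := satur_sin_sub_add_le hL (θ (Sum.inl v) - τ) t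
    rw [show θ (Sum.inl v) - τ - t = θ (Sum.inl v) - (τ + t) by ring,
      show θ (Sum.inl v) - τ + t = θ (Sum.inl v) - (τ - t) by ring] at this
    linarith
  have h2 : ∑ v, satur L (Real.sin (θ (Sum.inr v) + (τ - t)) ^ 2) +
      ∑ v, satur L (Real.sin (θ (Sum.inr v) + (τ + t)) ^ 2) ≤
      2 * ∑ v, satur L (Real.sin (θ (Sum.inr v) + τ) ^ 2) + q * (2 * t ^ 2) := by
    rw [← Finset.sum_add_distrib, Finset.mul_sum]
    have : (q : ℝ) * (2 * t ^ 2) = ∑ _v : Fin q, 2 * t ^ 2 := by simp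
    rw [this, ← Finset.sum_add_distrib]
    refine Finset.sum_le_sum fun v _ => ?_
    have := satur_sin_sub_add_le hL (θ (Sum.inr v) + τ) t
    rw [add_sub_assoc, add_assoc] at this
    linarith
  unfold bipEnergy
  have h3 := mul_le_mul_of_nonneg_left h1 (Nat.cast_nonneg (α := ℝ) q)
  have h4 := mul_le_mul_of_nonneg_left h2 (Nat.cast_nonneg (α := ℝ) p)
  linarith

lemma exp_bipEnergy_le {L a : ℝ} (hL : 0 ≤ L) (ha : 0 ≤ a) {p q : ℕ} (hp : 0 < p) (hq : 0 < q)
    (θ : Fin p ⊕ Fin q → ℝ) (τ : ℝ) :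
    Real.exp (-(a * bipEnergy L θ τ)) ≤ Real.exp (2 * a) / 2 * Real.sqrt (p * q) *
      ∫ t in Set.Ioc (-(Real.pi / 2)) (Real.pi / 2), Real.exp (-(a * bipEnergy L θ t)) := by
  have hpq : 1 ≤ (p : ℝ) * q := by exact_mod_cast Nat.mul_pos hp hq
  set r : ℝ := 1 / Real.sqrt (p * q) with hr
  have hs1 : 1 ≤ Real.sqrt (p * q) := Real.one_le_sqrt.2 hpq
  have hr0 : 0 < r := by positivity
  have hr1 : r ≤ 1 := by rw [hr, div_le_one (by linarith)]; exact hs1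
  have hrsq : p * q * r ^ 2 = 1 := by
    rw [hr, div_pow, Real.sq_sqrt (by positivity)]; field_simp
  set f : ℝ → ℝ := fun t => Real.exp (-(a * bipEnergy L θ (τ + t))) with hf
  have hcont : Continuous f := by
    have := continuous_bipEnergy_add hL θ τ
    exact Real.continuous_exp.comp (continuous_const.mul this).neg
  have hshift : ∫ t in Set.Ioc (-(Real.pi / 2)) (Real.pi / 2), f t =
      ∫ t in Set.Ioc (-(Real.pi / 2)) (Real.pi / 2), Real.exp (-(a * bipEnergy L θ t)) := by
    have hper : Function.Periodic (fun t => Real.exp (-(a * bipEnergy L θ t))) Real.pi :=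
      fun t => by dsimp only; rw [bipEnergy_periodic]
    rw [← setIntegral_shift_of_periodic hper τ]
    simp only [hf, add_comm]
  rw [← hshift]
  have hsub : ∫ t in (-r)..r, f t ≤ ∫ t in Set.Ioc (-(Real.pi / 2)) (Real.pi / 2), f t := by
    rw [intervalIntegral.integral_of_le (by linarith)]
    refine setIntegral_mono_set ?_ ?_ ?_
    · exact hcont.integrableOn_Ioc
    · exact Filter.Eventually.of_forall fun t => (Real.exp_pos _).le
    · refine (Set.Ioc_subset_Ioc ?_ ?_).eventuallyLE <;> linarith [Real.pi_gt_three]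
  have hneg : ∫ t in (-r)..r, f (-t) = ∫ t in (-r)..r, f t := by
    rw [intervalIntegral.integral_comp_neg]; simp
  have hcont' : Continuous fun t => f (-t) := hcont.comp continuous_neg
  have hsum : 2 * ∫ t in (-r)..r, f t = ∫ t in (-r)..r, (f t + f (-t)) := by
    rw [intervalIntegral.integral_add (hcont.intervalIntegrable _ _)
      (hcont'.intervalIntegrable _ _), hneg]; ring
  have hlow : ∫ _t in (-r)..r, 2 * Real.exp (-(a * bipEnergy L θ τ) - 2 * a) ≤
      ∫ t in (-r)..r, (f t + f (-t)) := by
    refine intervalIntegral.integral_mono_on (by linarith) (by simp)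
      ((hcont.add hcont').intervalIntegrable _ _) fun t ht => ?_
    simp only [hf]
    have h1 := bipEnergy_sub_add_le hL θ τ t
    have ht2 : t ^ 2 ≤ r ^ 2 := sq_le_sq' (by linarith [ht.1]) ht.2
    have h2 : (p : ℝ) * q * t ^ 2 ≤ 1 := by rw [← hrsq]; gcongr
    rw [← sub_eq_add_neg τ t]
    set x := bipEnergy L θ (τ + t)
    set y := bipEnergy L θ (τ - t)
    have h3 : Real.exp (-(a * bipEnergy L θ τ) - 2 * a) ≤
        Real.exp (-(a * x) / 2 + -(a * y) / 2) := by
      apply Real.exp_le_exp.2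
      nlinarith
    have h4 : Real.exp (-(a * x)) = Real.exp (-(a * x) / 2) ^ 2 := by
      rw [← Real.exp_nat_mul]; congr 1; push_cast; ring
    have h5 : Real.exp (-(a * y)) = Real.exp (-(a * y) / 2) ^ 2 := by
      rw [← Real.exp_nat_mul]; congr 1; push_cast; ring
    rw [Real.exp_add] at h3
    rw [h4, h5]
    nlinarith [sq_nonneg (Real.exp (-(a * x) / 2) - Real.exp (-(a * y) / 2))]
  rw [intervalIntegral.integral_const, smul_eq_mul] at hlow
  have hfin : 2 * r * Real.exp (-(a * bipEnergy L θ τ) - 2 * a) ≤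
      ∫ t in Set.Ioc (-(Real.pi / 2)) (Real.pi / 2), f t := by linarith
  have e1 : Real.exp (-(a * bipEnergy L θ τ)) = Real.exp (2 * a) / 2 * Real.sqrt (p * q) *
      (2 * r * Real.exp (-(a * bipEnergy L θ τ) - 2 * a)) := by
    rw [Real.exp_sub, hr]; field_simp
  rw [e1]
  gcongr

lemma integral_halfBox_exp_bipEnergy (L a : ℝ) {p q : ℕ} (t : ℝ) :
    ∫ θ, Real.exp (-(a * bipEnergy L θ t)) ∂(halfBox (Fin p ⊕ Fin q)) =
      saturInt L (a * q) ^ p * saturInt L (a * p) ^ q := by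
  set g : Fin p ⊕ Fin q → ℝ → ℝ := Sum.elim
    (fun _ x => Real.exp (-(a * q * satur L (Real.sin (x + -t) ^ 2))))
    (fun _ x => Real.exp (-(a * p * satur L (Real.sin (x + t) ^ 2)))) with hg
  have h1 : ∀ θ : Fin p ⊕ Fin q → ℝ, Real.exp (-(a * bipEnergy L θ t)) = ∏ i, g i (θ i) := by
    intro θ
    rw [Fintype.prod_sum_type]
    simp only [hg, Sum.elim_inl, Sum.elim_inr]
    rw [← Real.exp_sum, ← Real.exp_sum, ← Real.exp_add]
    congr 1
    simp only [bipEnergy, Finset.sum_neg_distrib, ← Finset.mul_sum, sub_eq_add_neg]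
    ring
  simp_rw [h1]
  rw [halfBox, integral_fintype_prod_eq_prod, Fintype.prod_sum_type]
  simp only [hg, Sum.elim_inl, Sum.elim_inr, saturInt_shift]
  simp

lemma integrable_exp_bipEnergy {L a : ℝ} (hL : 0 ≤ L) (ha : 0 ≤ a) {p q : ℕ} :
    Integrable (fun x : (Fin p ⊕ Fin q → ℝ) × ℝ => Real.exp (-(a * bipEnergy L x.1 x.2)))
      ((halfBox (Fin p ⊕ Fin q)).prod
        (volume.restrict (Set.Ioc (-(Real.pi / 2)) (Real.pi / 2)))) := by
  have hc := continuous_bipEnergy hL (p := p) (q := q)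
  refine Integrable.of_bound (C := 1) (Real.continuous_exp.comp (continuous_const.mul hc).neg).aestronglyMeasurable
    (Filter.Eventually.of_forall fun x => ?_)
  rw [Real.norm_eq_abs, abs_of_pos (Real.exp_pos _), Real.exp_le_one_iff, neg_nonpos]
  exact mul_nonneg ha (bipEnergy_nonneg hL _ _)

lemma integral_integral_exp_bipEnergy {L a : ℝ} (hL : 0 ≤ L) (ha : 0 ≤ a) (p q : ℕ) :
    ∫ θ, (∫ t in Set.Ioc (-(Real.pi / 2)) (Real.pi / 2), Real.exp (-(a * bipEnergy L θ t)))
      ∂(halfBox (Fin p ⊕ Fin q)) = Real.pi * (saturInt L (a * q) ^ p * saturInt L (a * p) ^ q) := by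
  rw [integral_integral_swap (integrable_exp_bipEnergy hL ha)]
  simp_rw [integral_halfBox_exp_bipEnergy]
  rw [setIntegral_const]
  simp [Measure.real, Real.volume_Ioc, Real.pi_pos.le]

set_option maxHeartbeats 1000000 in
lemma exists_bipartite_integral_le {K : ℝ} (hK' : 0 < K) {δ : ℝ} (hδ : 0 < δ) :
    ∃ C : ℝ, 0 < C ∧ ∃ N₀ : ℕ, 0 < N₀ ∧ ∀ p q : ℕ, N₀ ≤ p + q → δ * (p + q) ≤ p →
      δ * (p + q) ≤ q →
      ∫ θ, Real.exp (-(∑ e : Fin p × Fin q,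
          satur K (Real.sin (θ (Sum.inl e.1) + θ (Sum.inr e.2)) ^ 2)) / 2)
        ∂(halfBox (Fin p ⊕ Fin q)) ≤
      C * Real.sqrt (p * q) * (Real.sqrt (2 * Real.pi / q) ^ p * Real.sqrt (2 * Real.pi / p) ^ q) := by
  have hK := hK'.le
  obtain ⟨C₁, hC₁, hJ⟩ := saturInt_pow_le (L := 2 * K) (by positivity)
  set c : ℝ := 1 / (4 * (1 + 2 * K)) with hc
  have hc0 : 0 < c := by positivity
  have hc1 : c / 4 ≤ 1 / 2 := by
    rw [hc, div_div, div_le_div_iff₀ (by positivity) (by norm_num)]; linarith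
  obtain ⟨T₀, hT₀, hthr⟩ := exists_threshold hc0
  set a₀ : ℝ := T₀ / δ with ha₀
  have ha₀0 : 0 ≤ a₀ := by positivity
  set M : ℝ := (4 * K + 2) * a₀ ^ 2 / 8 with hM
  set D : ℝ := Real.exp (2 * C₁ / δ) ^ 2 with hD
  set D' : ℝ := Real.exp (4 * C₁ / (c * δ)) ^ 2 with hD'
  refine ⟨Real.exp 1 / 2 * Real.pi * (Real.exp M * D + D'), by positivity,
    ⌈2 * (1 + K) * a₀ / δ⌉₊ + 1, by omega, fun p q hN hp hq => ?_⟩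
  have hNpos : (0 : ℝ) < (p : ℝ) + q := by exact_mod_cast (by omega : 0 < p + q)
  have hp0 : (0 : ℝ) < p := lt_of_lt_of_le (by positivity) hp
  have hq0 : (0 : ℝ) < q := lt_of_lt_of_le (by positivity) hq
  have hp0' : 0 < p := by exact_mod_cast hp0
  have hq0' : 0 < q := by exact_mod_cast hq0
  set m := Real.sqrt (p * q) with hm
  have hm0 : 0 < m := by positivity
  have hmsq : m ^ 2 = p * q := Real.sq_sqrt (by positivity)
  have hmδ : δ * (p + q) ≤ m := by
    apply Real.le_sqrt_of_sq_le
    rw [sq]; exact mul_le_mul hp hq (by positivity) hp0.le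
  have hmbig : 2 * (1 + K) * a₀ ≤ m := by
    have h1 : (⌈2 * (1 + K) * a₀ / δ⌉₊ : ℝ) ≤ (p : ℝ) + q := by exact_mod_cast (by omega)
    have h2 := (Nat.le_ceil _).trans h1
    rw [div_le_iff₀ hδ] at h2
    linarith
  have hL : 0 ≤ 2 * K := by positivity
  set ε := Real.exp (-(c / 4 * (a₀ * m))) with hε
  have hpt : ∀ θ : Fin p ⊕ Fin q → ℝ, Real.exp (-(∑ e : Fin p × Fin q,
          satur K (Real.sin (θ (Sum.inl e.1) + θ (Sum.inr e.2)) ^ 2)) / 2) ≤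
      Real.exp 1 / 2 * m * (Real.exp M * (∫ t in Set.Ioc (-(Real.pi / 2)) (Real.pi / 2),
        Real.exp (-(1 / 2 * bipEnergy (2 * K) θ t))) +
        ε * ∫ t in Set.Ioc (-(Real.pi / 2)) (Real.pi / 2),
        Real.exp (-(c / 4 * bipEnergy (2 * K) θ t))) := by
    intro θ
    have hA : ∃ τ, Real.exp (-(∑ e : Fin p × Fin q,
          satur K (Real.sin (θ (Sum.inl e.1) + θ (Sum.inr e.2)) ^ 2)) / 2) ≤
        Real.exp M * Real.exp (-(1 / 2 * bipEnergy (2 * K) θ τ)) +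
          ε * Real.exp (-(c / 4 * bipEnergy (2 * K) θ τ)) := by
      obtain ⟨τ, h1, h2⟩ := exists_balanced_rotation (by positivity : 0 < 2 * K)
        (fun v => θ (Sum.inl v))
      refine ⟨τ, ?_⟩
      rw [Fintype.sum_prod_type]
      have hsimp : ∀ (v : Fin p) (w : Fin q), θ (Sum.inl v) + θ (Sum.inr w) =
          (θ (Sum.inl v) - τ) + (θ (Sum.inr w) + τ) := fun v w => by ring
      simp_rw [hsimp]
      obtain ⟨h3, h4⟩ := bipartite_quadratic_ge hK (fun v => θ (Sum.inl v) - τ)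
        (fun w => θ (Sum.inr w) + τ) h1 h2 p q _ _ _ (by simp) (by simp) rfl rfl rfl
      have hT0 : 0 ≤ ∑ v, satur (2 * K) (Real.sin (θ (Sum.inl v) - τ) ^ 2) :=
        Finset.sum_nonneg fun j _ => satur_nonneg hL (sq_nonneg _)
      have hU0 : 0 ≤ ∑ v, satur (2 * K) (Real.sin (θ (Sum.inr v) + τ) ^ 2) :=
        Finset.sum_nonneg fun j _ => satur_nonneg hL (sq_nonneg _)
      rw [neg_div]
      set S := ∑ v : Fin p, ∑ w : Fin q,
        satur K (Real.sin (θ (Sum.inl v) - τ + (θ (Sum.inr w) + τ)) ^ 2)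
      have hE : bipEnergy (2 * K) θ τ =
        q * ∑ v, satur (2 * K) (Real.sin (θ (Sum.inl v) - τ) ^ 2) +
          p * ∑ w, satur (2 * K) (Real.sin (θ (Sum.inr w) + τ) ^ 2) := rfl
      rw [← hE] at h3 h4
      set T := ∑ v, satur (2 * K) (Real.sin (θ (Sum.inl v) - τ) ^ 2)
      set U := ∑ v, satur (2 * K) (Real.sin (θ (Sum.inr v) + τ) ^ 2)
      set A := bipEnergy (2 * K) θ τ
      have hA0 : 0 ≤ A := bipEnergy_nonneg hL _ _
      rcases le_total A (a₀ * m) with h | h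
      · have hU : 2 * (1 + K) * U ≤ q := by
          have h5 : p * U ≤ a₀ * m := by
            have := mul_nonneg hq0.le hT0
            linarith
          have h6 : p * (2 * (1 + K) * U) ≤ p * q := by
            rw [← hmsq]
            nlinarith
          exact le_of_mul_le_mul_left h6 hp0
        have h5 := h4 hU
        have h6 : 4 * (T * U) ≤ a₀ ^ 2 := by
          have h7 : 4 * (q * T * (p * U)) ≤ (a₀ * m) ^ 2 := by
            have : 4 * (q * T * (p * U)) ≤ A ^ 2 := by
              rw [hE]; nlinarith [sq_nonneg (q * T - p * U)]
            exact this.trans (by gcongr)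
          have h8 : (p * q) * (4 * (T * U)) ≤ (p * q) * a₀ ^ 2 := by
            rw [mul_pow, hmsq] at h7; linarith
          exact le_of_mul_le_mul_left h8 (by positivity)
        have : Real.exp (-(S / 2)) ≤ Real.exp M * Real.exp (-(1 / 2 * A)) := by
          rw [← Real.exp_add]
          apply Real.exp_le_exp.2
          have : (4 * K + 2) * (4 * (T * U)) ≤ (4 * K + 2) * a₀ ^ 2 := by gcongr
          rw [hM]; linarith
        have : 0 < ε * Real.exp (-(c / 4 * A)) := by positivity
        linarith
      · have : Real.exp (-(S / 2)) ≤ ε * Real.exp (-(c / 4 * A)) := by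
          rw [hε, ← Real.exp_add]
          apply Real.exp_le_exp.2
          have h5 : c * A ≤ S := by
            refine le_trans (le_of_eq ?_) h3
            rw [hc]; ring
          have : c / 4 * (a₀ * m) ≤ c / 4 * A := by gcongr
          linarith
        have : 0 < Real.exp M * Real.exp (-(1 / 2 * A)) := by positivity
        linarith
    obtain ⟨τ, hτ⟩ := hA
    have h1 := exp_bipEnergy_le hL (by norm_num : (0:ℝ) ≤ 1 / 2) hp0' hq0' θ τ
    have h2 := exp_bipEnergy_le hL (by positivity : 0 ≤ c / 4) hp0' hq0' θ τ
    have h3 : Real.exp (2 * (c / 4)) ≤ Real.exp 1 := Real.exp_le_exp.2 (by linarith)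
    have h4 : 0 ≤ ∫ t in Set.Ioc (-(Real.pi / 2)) (Real.pi / 2),
        Real.exp (-(c / 4 * bipEnergy (2 * K) θ t)) := integral_nonneg fun _ => (Real.exp_pos _).le
    rw [show (2 : ℝ) * (1 / 2) = 1 by norm_num] at h1
    have h5 : Real.exp (-(c / 4 * bipEnergy (2 * K) θ τ)) ≤ Real.exp 1 / 2 * m *
        ∫ t in Set.Ioc (-(Real.pi / 2)) (Real.pi / 2),
        Real.exp (-(c / 4 * bipEnergy (2 * K) θ t)) := h2.trans (by gcongr)
    calc _ ≤ _ := hτ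
      _ ≤ Real.exp M * (Real.exp 1 / 2 * m * ∫ t in Set.Ioc (-(Real.pi / 2)) (Real.pi / 2),
        Real.exp (-(1 / 2 * bipEnergy (2 * K) θ t))) + ε * (Real.exp 1 / 2 * m *
        ∫ t in Set.Ioc (-(Real.pi / 2)) (Real.pi / 2),
        Real.exp (-(c / 4 * bipEnergy (2 * K) θ t))) := by gcongr
      _ = _ := by ring
  have hi1 : Integrable (fun θ : Fin p ⊕ Fin q → ℝ => ∫ t in Set.Ioc (-(Real.pi / 2)) (Real.pi / 2),
      Real.exp (-(1 / 2 * bipEnergy (2 * K) θ t))) (halfBox (Fin p ⊕ Fin q)) :=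
    (integrable_exp_bipEnergy hL (by norm_num)).integral_prod_left
  have hi2 : Integrable (fun θ : Fin p ⊕ Fin q → ℝ => ∫ t in Set.Ioc (-(Real.pi / 2)) (Real.pi / 2),
      Real.exp (-(c / 4 * bipEnergy (2 * K) θ t))) (halfBox (Fin p ⊕ Fin q)) :=
    (integrable_exp_bipEnergy hL (by positivity)).integral_prod_left
  have hFi : Integrable (fun θ : Fin p ⊕ Fin q → ℝ =>
      Real.exp (-(∑ e : Fin p × Fin q,
          satur K (Real.sin (θ (Sum.inl e.1) + θ (Sum.inr e.2)) ^ 2)) / 2))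
      (halfBox (Fin p ⊕ Fin q)) := by
    have := integrable_halfBox_exp_satur (I := Fin p ⊕ Fin q) (a := 1 / 2) hK (by norm_num)
      (fun (e : Fin p × Fin q) θ => θ (Sum.inl e.1) + θ (Sum.inr e.2)) (fun e => by fun_prop)
    refine this.congr (Filter.Eventually.of_forall fun θ => ?_)
    dsimp only; congr 1; ring
  have hGi : Integrable (fun θ : Fin p ⊕ Fin q → ℝ => Real.exp 1 / 2 * m * (Real.exp M *
      (∫ t in Set.Ioc (-(Real.pi / 2)) (Real.pi / 2),
        Real.exp (-(1 / 2 * bipEnergy (2 * K) θ t))) +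
        ε * ∫ t in Set.Ioc (-(Real.pi / 2)) (Real.pi / 2),
        Real.exp (-(c / 4 * bipEnergy (2 * K) θ t)))) (halfBox (Fin p ⊕ Fin q)) :=
    ((hi1.const_mul _).add (hi2.const_mul _)).const_mul _
  refine (integral_mono hFi hGi hpt).trans ?_
  rw [integral_const_mul, integral_add (hi1.const_mul _) (hi2.const_mul _), integral_const_mul,
    integral_const_mul, integral_integral_exp_bipEnergy hL (by norm_num),
    integral_integral_exp_bipEnergy hL (by positivity)]
  have hpq : (p : ℝ) / q ≤ 1 / δ := by
    rw [div_le_div_iff₀ hq0 hδ]; nlinarith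
  have hqp : (q : ℝ) / p ≤ 1 / δ := by
    rw [div_le_div_iff₀ hp0 hδ]; nlinarith
  have hs : ∀ (x y : ℕ), (0 : ℝ) < y → (x : ℝ) / y ≤ 1 / δ → saturInt (2 * K) (1 / 2 * y) ^ x ≤
      Real.sqrt (2 * Real.pi / y) ^ x * Real.exp (2 * C₁ / δ) := by
    intro x y hy hxy
    have h1 := hJ (1 / 2 * y) x (by positivity)
    have e1 : Real.pi / (1 / 2 * y : ℝ) = 2 * Real.pi / y := by field_simp
    rw [e1] at h1
    refine h1.trans (mul_le_mul_of_nonneg_left (Real.exp_le_exp.2 ?_) (by positivity))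
    calc C₁ * x / (1 / 2 * y) = 2 * C₁ * (x / y) := by field_simp
      _ ≤ 2 * C₁ * (1 / δ) := by gcongr
      _ = _ := by ring
  have hs' : ∀ (x y : ℕ), (0 : ℝ) < y → (x : ℝ) / y ≤ 1 / δ → saturInt (2 * K) (c / 4 * y) ^ x ≤
      Real.sqrt (2 / c) ^ x * Real.sqrt (2 * Real.pi / y) ^ x * Real.exp (4 * C₁ / (c * δ)) := by
    intro x y hy hxy
    have h1 := hJ (c / 4 * y) x (by positivity)
    have e1 : Real.pi / (c / 4 * y : ℝ) = (2 / c) * (2 * Real.pi / y) := by field_simp; ring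
    rw [e1, Real.sqrt_mul (by positivity), mul_pow] at h1
    refine h1.trans (mul_le_mul_of_nonneg_left (Real.exp_le_exp.2 ?_) (by positivity))
    calc C₁ * x / (c / 4 * y) = 4 * C₁ / c * (x / y) := by field_simp
      _ ≤ 4 * C₁ / c * (1 / δ) := by gcongr
      _ = _ := by field_simp
  have hεs : ε * (Real.sqrt (2 / c) ^ p * Real.sqrt (2 / c) ^ q) ≤ 1 := by
    have h1 : ε ≤ Real.exp (-(c / 4 * T₀)) ^ (p + q) := by
      rw [hε, ← Real.exp_nat_mul]
      apply Real.exp_le_exp.2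
      have : T₀ * (p + q) ≤ a₀ * m := by
        calc T₀ * (p + q) = a₀ * (δ * (p + q)) := by rw [ha₀]; field_simp
          _ ≤ _ := by gcongr
      push_cast
      nlinarith
    rw [← pow_add]
    calc _ ≤ Real.exp (-(c / 4 * T₀)) ^ (p + q) * Real.sqrt (2 / c) ^ (p + q) := by gcongr
      _ = (Real.sqrt (2 / c) * Real.exp (-(c / 4 * T₀))) ^ (p + q) := by rw [← mul_pow, mul_comm]
      _ ≤ 1 := pow_le_one₀ (by positivity) hthr
  set R := Real.sqrt (2 * Real.pi / q) ^ p with hR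
  set R' := Real.sqrt (2 * Real.pi / p) ^ q with hR'
  have hsat : ∀ a, 0 ≤ saturInt (2 * K) a := saturInt_nonneg _
  calc _ ≤ Real.exp 1 / 2 * m * (Real.exp M * (Real.pi * ((R * Real.exp (2 * C₁ / δ)) *
          (R' * Real.exp (2 * C₁ / δ)))) + ε * (Real.pi *
          ((Real.sqrt (2 / c) ^ p * R * Real.exp (4 * C₁ / (c * δ))) *
            (Real.sqrt (2 / c) ^ q * R' * Real.exp (4 * C₁ / (c * δ)))))) := by
        have a1 := hs p q hq0 hpq
        have a2 := hs q p hp0 hqp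
        have a3 := hs' p q hq0 hpq
        have a4 := hs' q p hp0 hqp
        gcongr
        all_goals exact pow_nonneg (hsat _) _
    _ = Real.exp 1 / 2 * m * Real.pi * (Real.exp M * D * (R * R') +
          (ε * (Real.sqrt (2 / c) ^ p * Real.sqrt (2 / c) ^ q)) * (D' * (R * R'))) := by
        rw [hD, hD']; ring
    _ ≤ Real.exp 1 / 2 * m * Real.pi * (Real.exp M * D * (R * R') + 1 * (D' * (R * R'))) := by
        gcongr
    _ = _ := by ring

lemma sqrt_two_mul_pi_div (q : ℝ) (hq : 0 < q) :
    Real.pi⁻¹ * Real.sqrt (2 * Real.pi / q) = Real.sqrt (2 / (Real.pi * q)) := by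
  have : 2 * Real.pi / q = Real.pi ^ 2 * (2 / (Real.pi * q)) := by field_simp
  rw [this, Real.sqrt_mul (by positivity), Real.sqrt_sq Real.pi_pos.le]
  field_simp

/-- The signed degrees of a complete bipartite graph. -/
noncomputable def bipDegProb {p q : ℕ} (r : Fin p → ℤ) (c : Fin q → ℤ) : ℝ :=
  degProb (fun e : Fin p × Fin q => (Sum.inl e.1 : Fin p ⊕ Fin q)) (fun e => Sum.inr e.2)
    (Sum.elim r c)

lemma bipDegProb_nonneg {p q : ℕ} (r : Fin p → ℤ) (c : Fin q → ℤ) : 0 ≤ bipDegProb r c :=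
  degProb_nonneg _ _ _

lemma signedDeg_bip_inl {p q : ℕ} (b : Fin p × Fin q → Bool) (v : Fin p) :
    signedDeg (fun e : Fin p × Fin q => (Sum.inl e.1 : Fin p ⊕ Fin q)) (fun e => Sum.inr e.2) b
      (Sum.inl v) = ∑ w, bsign (b (v, w)) := by
  simp only [signedDeg, Fintype.sum_prod_type]
  rw [Finset.sum_comm]
  simp

lemma signedDeg_bip_inr {p q : ℕ} (b : Fin p × Fin q → Bool) (w : Fin q) :
    signedDeg (fun e : Fin p × Fin q => (Sum.inl e.1 : Fin p ⊕ Fin q)) (fun e => Sum.inr e.2) b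
      (Sum.inr w) = ∑ v, bsign (b (v, w)) := by
  simp [signedDeg, Fintype.sum_prod_type]

lemma abs_sum_bsign_le {n : ℕ} (f : Fin n → Bool) : |∑ w, bsign (f w)| ≤ n := by
  have h0 : ∀ t : Bool, |bsign t| = 1 := by decide
  refine (Finset.abs_sum_le_sum_abs _ _).trans ?_
  simp [h0]

theorem exists_bipartite_degProb_le {δ : ℝ} (hδ : 0 < δ) :
    ∃ C : ℝ, 0 < C ∧ ∃ N₀ : ℕ, 0 < N₀ ∧ ∀ p q : ℕ, N₀ ≤ p + q → δ * (p + q) ≤ p →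
      δ * (p + q) ≤ q → ∀ (r : Fin p → ℤ) (c : Fin q → ℤ),
      bipDegProb r c ≤ if ∑ v, r v = ∑ w, c w then
        C * Real.sqrt (p * q) * (Real.exp ((∑ v, (r v : ℝ)) ^ 2 / (2 * (p * q))) *
          ((∏ v, dblGauss q (r v)) * ∏ w, dblGauss p (c w))) else 0 := by
  obtain ⟨C, hC, N₀, hN₀, h⟩ := exists_bipartite_integral_le coshLoss_pos hδ
  refine ⟨C, hC, N₀, hN₀, fun p q hN hp hq r c => ?_⟩
  have hI := h p q hN hp hq
  have hNpos : (0 : ℝ) < (p : ℝ) + q := by exact_mod_cast (by omega : 0 < p + q)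
  have hp0 : (0 : ℝ) < p := lt_of_lt_of_le (by positivity) hp
  have hq0 : (0 : ℝ) < q := lt_of_lt_of_le (by positivity) hq
  by_cases hb : ∃ b : Fin p × Fin q → Bool, ∀ i, signedDeg
      (fun e : Fin p × Fin q => (Sum.inl e.1 : Fin p ⊕ Fin q)) (fun e => Sum.inr e.2) b i =
        Sum.elim r c i
  swap
  · rw [bipDegProb, degProb_eq_zero (fun b hb' => hb ⟨b, hb'⟩)]
    split_ifs
    · have h1 : 0 ≤ ∏ v, dblGauss q (r v) := Finset.prod_nonneg fun i _ => dblGauss_nonneg _ _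
      have h2 : 0 ≤ ∏ w, dblGauss p (c w) := Finset.prod_nonneg fun i _ => dblGauss_nonneg _ _
      positivity
    · exact le_rfl
  obtain ⟨b, hb⟩ := hb
  have hr : ∀ v, r v = ∑ w, bsign (b (v, w)) := fun v => by
    have := hb (Sum.inl v)
    rw [signedDeg_bip_inl] at this; exact this.symm
  have hc : ∀ w, c w = ∑ v, bsign (b (v, w)) := fun w => by
    have := hb (Sum.inr w)
    rw [signedDeg_bip_inr] at this; exact this.symm
  have hsum : ∑ v, r v = ∑ w, c w := by
    simp_rw [hr, hc]; exact Finset.sum_comm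
  rw [if_pos hsum]
  have hr' : ∀ v, |(r v : ℝ)| ≤ q := fun v => by
    have : |r v| ≤ q := by rw [hr]; exact abs_sum_bsign_le _
    exact_mod_cast this
  have hc' : ∀ w, |(c w : ℝ)| ≤ p := fun w => by
    have : |c w| ≤ p := by rw [hc]; exact abs_sum_bsign_le _
    exact_mod_cast this
  set S : ℝ := ∑ v, (r v : ℝ) with hS
  have hS2 : S = ∑ w, (c w : ℝ) := by
    rw [hS]; exact_mod_cast hsum
  have hSle : |S| ≤ p * q := by
    refine (Finset.abs_sum_le_sum_abs _ _).trans ?_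
    calc ∑ v, |(r v : ℝ)| ≤ ∑ _v : Fin p, (q : ℝ) := Finset.sum_le_sum fun v _ => hr' v
      _ = _ := by simp
  set l : Fin p ⊕ Fin q → ℝ := Sum.elim (fun v => r v / q - S / (p * q)) (fun w => c w / p) with hl
  have hle : ∀ e : Fin p × Fin q, |l (Sum.inl e.1) + l (Sum.inr e.2)| ≤ 4 := by
    intro e
    simp only [hl, Sum.elim_inl, Sum.elim_inr]
    have h1 : |(r e.1 : ℝ) / q| ≤ 1 := by
      rw [abs_div, abs_of_pos hq0, div_le_one hq0]; exact hr' _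
    have h2 : |(c e.2 : ℝ) / p| ≤ 1 := by
      rw [abs_div, abs_of_pos hp0, div_le_one hp0]; exact hc' _
    have h3 : |S / (p * q)| ≤ 1 := by
      rw [abs_div, abs_of_pos (by positivity : (0 : ℝ) < p * q), div_le_one (by positivity)]
      exact hSle
    rw [abs_le] at *
    constructor <;> linarith
  have hF := degProb_le (fun e : Fin p × Fin q => (Sum.inl e.1 : Fin p ⊕ Fin q))
    (fun e => Sum.inr e.2) (Sum.elim r c) l hle
  set R2 : ℝ := ∑ v, (r v : ℝ) ^ 2 with hR2
  set C2 : ℝ := ∑ w, (c w : ℝ) ^ 2 with hC2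
  have hexp : -(∑ i, l i * (Sum.elim r c i : ℤ)) +
      (∑ e : Fin p × Fin q, (l (Sum.inl e.1) + l (Sum.inr e.2)) ^ 2) / 2 =
      S ^ 2 / (2 * (p * q)) + (-R2 / (2 * q) + -C2 / (2 * p)) := by
    rw [Fintype.sum_sum_type, Fintype.sum_prod_type]
    simp only [hl, Sum.elim_inl, Sum.elim_inr]
    have h1 : ∑ v, ((r v : ℝ) / q - S / (p * q)) * r v = R2 / q - S ^ 2 / (p * q) := by
      have : ∀ v, ((r v : ℝ) / q - S / (p * q)) * r v = r v ^ 2 / q - S / (p * q) * r v :=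
        fun v => by ring
      simp_rw [this]
      rw [Finset.sum_sub_distrib, ← Finset.sum_div, ← Finset.mul_sum, ← hS]; ring
    have h2 : ∑ w, (c w : ℝ) / p * c w = C2 / p := by
      rw [hC2, Finset.sum_div]; exact Finset.sum_congr rfl fun w _ => by ring
    have h3 : ∀ v w, ((r v : ℝ) / q - S / (p * q) + c w / p) ^ 2 =
        ((r v : ℝ) / q - S / (p * q)) ^ 2 + 2 / p * ((r v : ℝ) / q - S / (p * q)) * c w +
          (c w : ℝ) ^ 2 / p ^ 2 := fun v w => by ring
    have h4 : ∑ v, ((r v : ℝ) / q - S / (p * q)) = 0 := by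
      rw [Finset.sum_sub_distrib, ← Finset.sum_div, ← hS]; simp; field_simp; ring
    have h5 : ∑ v, ((r v : ℝ) / q - S / (p * q)) ^ 2 = R2 / q ^ 2 - S ^ 2 / (p * q ^ 2) := by
      have : ∀ v, ((r v : ℝ) / q - S / (p * q)) ^ 2 =
          r v ^ 2 / q ^ 2 - 2 * S / (p * q ^ 2) * r v + S ^ 2 / (p ^ 2 * q ^ 2) :=
        fun v => by field_simp; ring
      simp_rw [this]
      rw [Finset.sum_add_distrib, Finset.sum_sub_distrib, ← Finset.sum_div, ← Finset.mul_sum, ← hS]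
      simp; field_simp; ring
    simp_rw [h3, Finset.sum_add_distrib, ← Finset.mul_sum, ← Finset.sum_mul, ← Finset.mul_sum, h4,
      ← Finset.sum_div, ← hC2]
    rw [h1, h2]
    simp only [Finset.sum_const, Finset.card_univ, Fintype.card_fin, nsmul_eq_mul]
    rw [← Finset.mul_sum, h5]
    field_simp; ring
  have hprod1 : ∏ v, dblGauss q (r v) =
      Real.sqrt (2 / (Real.pi * q)) ^ p * Real.exp (-R2 / (2 * q)) := by
    unfold dblGauss
    rw [Finset.prod_mul_distrib, ← Real.exp_sum, ← Finset.sum_div, Finset.sum_neg_distrib,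
      Finset.prod_const, Finset.card_univ, Fintype.card_fin]
  have hprod2 : ∏ w, dblGauss p (c w) =
      Real.sqrt (2 / (Real.pi * p)) ^ q * Real.exp (-C2 / (2 * p)) := by
    unfold dblGauss
    rw [Finset.prod_mul_distrib, ← Real.exp_sum, ← Finset.sum_div, Finset.sum_neg_distrib,
      Finset.prod_const, Finset.card_univ, Fintype.card_fin]
  refine hF.trans ?_
  rw [hexp, Fintype.card_sum, Fintype.card_fin, Fintype.card_fin, hprod1, hprod2]
  rw [← sqrt_two_mul_pi_div q hq0, ← sqrt_two_mul_pi_div p hp0, Real.exp_add, Real.exp_add]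
  refine (mul_le_mul_of_nonneg_left (mul_le_mul_of_nonneg_left hI (by positivity))
    (by positivity)).trans (le_of_eq ?_)
  rw [mul_pow, mul_pow, inv_pow, inv_pow, pow_add, mul_inv]
  ring

section Estimates

open Set

/-- The standard Gaussian density. -/
noncomputable def stdPdf (x : ℝ) : ℝ := (Real.sqrt (2 * Real.pi))⁻¹ * Real.exp (-x ^ 2 / 2)

lemma stdPdf_pos (x : ℝ) : 0 < stdPdf x := by unfold stdPdf; positivity

@[fun_prop]
lemma continuous_stdPdf : Continuous stdPdf := by unfold stdPdf; fun_prop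

lemma stdPdf_eq (x : ℝ) : stdPdf x = gaussianPDFReal 0 1 x := by
  simp [stdPdf, gaussianPDFReal]

lemma stdPdf_neg (x : ℝ) : stdPdf (-x) = stdPdf x := by simp [stdPdf]

lemma integrable_stdPdf : Integrable stdPdf := by
  have : stdPdf = gaussianPDFReal 0 1 := funext stdPdf_eq
  rw [this]; exact integrable_gaussianPDFReal 0 1

lemma integral_stdPdf : ∫ x, stdPdf x = 1 := by
  have : stdPdf = gaussianPDFReal 0 1 := funext stdPdf_eq
  rw [this]; exact integral_gaussianPDFReal_eq_one 0 one_ne_zero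

lemma gaussTail_eq_Ici (t : ℝ) : gaussTail t = ∫ x in Ici t, stdPdf x := by
  have : stdPdf = gaussianPDFReal 0 1 := funext stdPdf_eq
  rw [this, gaussTail, gaussianReal_apply_eq_integral 0 one_ne_zero,
    ENNReal.toReal_ofReal (integral_nonneg fun x => gaussianPDFReal_nonneg _ _ _)]
  rfl

lemma gaussTail_eq (t : ℝ) : gaussTail t = ∫ x in Ioi t, stdPdf x := by
  rw [gaussTail_eq_Ici, integral_Ici_eq_integral_Ioi]

lemma gaussTail_sub (a b : ℝ) : gaussTail a - gaussTail b = ∫ x in a..b, stdPdf x := by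
  rw [gaussTail_eq, gaussTail_eq, intervalIntegral.integral_Ioi_sub_Ioi'
    integrable_stdPdf.integrableOn integrable_stdPdf.integrableOn]

lemma gaussTail_nonneg (t : ℝ) : 0 ≤ gaussTail t := by unfold gaussTail; positivity

lemma gaussTail_le_one (t : ℝ) : gaussTail t ≤ 1 := by
  unfold gaussTail
  exact ENNReal.toReal_le_of_le_ofReal (by norm_num) (by simpa using prob_le_one)

lemma hasDerivAt_gaussTail (t : ℝ) : HasDerivAt gaussTail (-stdPdf t) t := by
  have h : gaussTail = fun t => gaussTail 0 - ∫ x in (0:ℝ)..t, stdPdf x := by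
    ext t; rw [← gaussTail_sub]; ring
  rw [h]
  exact (continuous_stdPdf.integral_hasStrictDerivAt 0 t).hasDerivAt.const_sub _

@[fun_prop]
lemma continuous_gaussTail : Continuous gaussTail :=
  continuous_iff_continuousAt.2 fun t => (hasDerivAt_gaussTail t).continuousAt

lemma gaussTail_strictAnti : StrictAnti gaussTail :=
  strictAnti_of_deriv_neg fun t => by
    rw [(hasDerivAt_gaussTail t).deriv]; exact neg_neg_of_pos (stdPdf_pos t)

lemma gaussTail_anti : Antitone gaussTail := gaussTail_strictAnti.antitone

lemma gaussTail_pos (t : ℝ) : 0 < gaussTail t :=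
  (gaussTail_nonneg (t + 1)).trans_lt (gaussTail_strictAnti (by linarith))

lemma stdPdf_le (x : ℝ) : stdPdf x ≤ (Real.sqrt (2 * Real.pi))⁻¹ := by
  unfold stdPdf
  apply mul_le_of_le_one_right (by positivity)
  rw [Real.exp_le_one_iff]
  have := sq_nonneg x
  linarith

lemma stdPdf_le_half (x : ℝ) : stdPdf x ≤ 1 / 2 := by
  refine (stdPdf_le x).trans ?_
  rw [inv_le_comm₀ (by positivity) (by norm_num)]
  apply Real.le_sqrt_of_sq_le
  nlinarith [Real.pi_gt_three]

lemma gaussTail_sub_le {a b : ℝ} (h : a ≤ b) : gaussTail a - gaussTail b ≤ (b - a) / 2 := by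
  rw [gaussTail_sub]
  calc ∫ x in a..b, stdPdf x ≤ ∫ _x in a..b, (1 / 2 : ℝ) :=
        intervalIntegral.integral_mono_on h (continuous_stdPdf.intervalIntegrable _ _) (by simp)
          fun x _ => stdPdf_le_half x
    _ = _ := by simp; ring

lemma hasDerivAt_stdPdf (t : ℝ) : HasDerivAt stdPdf (-t * stdPdf t) t := by
  unfold stdPdf
  have h1 : HasDerivAt (fun x : ℝ => -x ^ 2 / 2) (-t) t := by
    have := ((hasDerivAt_pow 2 t).neg).div_const 2
    refine this.congr_deriv ?_
    simp; ring
  refine (h1.exp.const_mul _).congr_deriv ?_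
  ring

lemma integral_Ioi_mul_stdPdf (t : ℝ) : IntegrableOn (fun x => x * stdPdf x) (Ioi t) ∧
    ∫ x in Ioi t, x * stdPdf x = stdPdf t := by
  have hlim : Filter.Tendsto (fun x => -stdPdf x) Filter.atTop (nhds 0) := by
    have h1 : Filter.Tendsto (fun x : ℝ => -x ^ 2 / 2) Filter.atTop Filter.atBot := by
      have := (Filter.tendsto_pow_atTop (α := ℝ) (n := 2) (by norm_num)).atTop_div_const
        (by norm_num : (0:ℝ) < 2)
      simpa [neg_div] using this
    have := ((Real.tendsto_exp_atBot.comp h1).const_mul ((Real.sqrt (2 * Real.pi))⁻¹)).neg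
    simpa [stdPdf, Function.comp_def] using this
  have hinteg : Integrable fun x => x * stdPdf x := by
    have := (integrable_mul_exp_neg_mul_sq (b := 1 / 2) (by norm_num)).const_mul
      ((Real.sqrt (2 * Real.pi))⁻¹)
    refine this.congr (Filter.Eventually.of_forall fun x => ?_)
    simp only [stdPdf]; ring_nf
  refine ⟨hinteg.integrableOn, ?_⟩
  have := integral_Ioi_of_hasDerivAt_of_tendsto' (a := t) (f := fun x => -stdPdf x)
    (f' := fun x => x * stdPdf x) (m := 0)
    (fun x _ => by simpa using (hasDerivAt_stdPdf x).fun_neg) hinteg.integrableOn hlim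
  rw [this]; ring

lemma mul_gaussTail_le (t : ℝ) : t * gaussTail t ≤ stdPdf t := by
  obtain ⟨h1, h2⟩ := integral_Ioi_mul_stdPdf t
  rw [gaussTail_eq, ← h2, ← integral_const_mul]
  refine setIntegral_mono_on (integrable_stdPdf.integrableOn.const_mul _) h1 measurableSet_Ioi
    fun x hx => ?_
  exact mul_le_mul_of_nonneg_right (le_of_lt hx) (stdPdf_pos x).le

lemma gaussTail_neg (t : ℝ) : gaussTail (-t) = 1 - gaussTail t := by
  have h1 : ∫ x in Ioi (-t), stdPdf x = ∫ x in Iic t, stdPdf x := by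
    have := integral_comp_neg_Iic t stdPdf
    simp_rw [stdPdf_neg] at this
    exact this.symm
  rw [gaussTail_eq, h1, gaussTail_eq, ← integral_stdPdf,
    ← intervalIntegral.integral_Iic_add_Ioi (b := t) integrable_stdPdf.integrableOn
      integrable_stdPdf.integrableOn]
  ring

lemma gaussTail_zero : gaussTail 0 = 1 / 2 := by
  have := gaussTail_neg 0
  rw [neg_zero] at this; linarith

/-- `Q(t) ≤ ½ exp(-t²/2)` for `t ≥ 0`. -/
lemma gaussTail_le_half_exp {t : ℝ} (ht : 0 ≤ t) : gaussTail t ≤ Real.exp (-t ^ 2 / 2) / 2 := by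
  have h1 : gaussTail t = ∫ x in Ioi (0:ℝ), stdPdf (x + t) := by
    rw [gaussTail_eq, ← (measurePreserving_add_right volume t).setIntegral_preimage_emb
      (measurableEmbedding_addRight t)]
    simp
  have h2 : Real.exp (-t ^ 2 / 2) / 2 = ∫ x in Ioi (0:ℝ), Real.exp (-t ^ 2 / 2) * stdPdf x := by
    rw [integral_const_mul, ← gaussTail_eq, gaussTail_zero]; ring
  rw [h1, h2]
  refine setIntegral_mono_on (integrable_stdPdf.comp_add_right t).integrableOn
    (integrable_stdPdf.integrableOn.const_mul _) measurableSet_Ioi fun x hx => ?_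
  unfold stdPdf
  rw [mul_left_comm, ← Real.exp_add]
  gcongr
  nlinarith [mul_nonneg ht (le_of_lt hx)]

lemma exists_add_mul_gaussTail_le (B : ℝ) :
    ∃ C : ℝ, 0 < C ∧ ∀ x : ℝ, -B ≤ x → (x + B) * gaussTail x ≤ C * stdPdf x := by
  have hc : ContinuousOn (fun x => (x + B) * gaussTail x / stdPdf x) (Icc (-B) (|B| + 1)) :=
    (Continuous.div (by fun_prop) continuous_stdPdf fun x => (stdPdf_pos x).ne').continuousOn
  obtain ⟨M, hM⟩ := isCompact_Icc.bddAbove_image hc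
  refine ⟨max M (1 + |B|), by positivity, fun x hx => ?_⟩
  rcases le_total x (|B| + 1) with h | h
  · have : (x + B) * gaussTail x / stdPdf x ≤ M := hM ⟨x, ⟨hx, h⟩, rfl⟩
    rw [div_le_iff₀ (stdPdf_pos x)] at this
    exact this.trans (mul_le_mul_of_nonneg_right (le_max_left _ _) (stdPdf_pos x).le)
  · have h1 : x + B ≤ (1 + |B|) * x := by
      nlinarith [abs_nonneg B, le_abs_self B]
    have hQ := gaussTail_nonneg x
    calc (x + B) * gaussTail x ≤ (1 + |B|) * x * gaussTail x := by gcongr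
      _ = (1 + |B|) * (x * gaussTail x) := by ring
      _ ≤ (1 + |B|) * stdPdf x := by gcongr; exact mul_gaussTail_le x
      _ ≤ _ := mul_le_mul_of_nonneg_right (le_max_right _ _) (stdPdf_pos x).le

lemma two_mul_le_integral_of_add_ge {F : ℝ → ℝ} {r K : ℝ}
    (hF : ContinuousOn F (Icc (r - 1) (r + 1)))
    (h : ∀ t ∈ Icc (-1 : ℝ) 1, 2 * K ≤ F (r + t) + F (r - t)) :
    2 * K ≤ ∫ y in Ioc (r - 1) (r + 1), F y := by
  have e1 : ∫ y in Ioc (r - 1) (r + 1), F y = ∫ t in (-1 : ℝ)..1, F (r + t) := by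
    rw [intervalIntegral.integral_comp_add_left, intervalIntegral.integral_of_le (by linarith)]
    ring_nf
  have e2 : ∫ y in Ioc (r - 1) (r + 1), F y = ∫ t in (-1 : ℝ)..1, F (r - t) := by
    rw [intervalIntegral.integral_comp_sub_left, intervalIntegral.integral_of_le (by linarith)]
    ring_nf
  have c1 : IntervalIntegrable (fun t => F (r + t)) volume (-1) 1 := by
    apply ContinuousOn.intervalIntegrable
    rw [uIcc_of_le (by norm_num)]
    refine hF.comp (by fun_prop) fun t ht => ?_
    constructor <;> linarith [ht.1, ht.2]
  have c2 : IntervalIntegrable (fun t => F (r - t)) volume (-1) 1 := by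
    apply ContinuousOn.intervalIntegrable
    rw [uIcc_of_le (by norm_num)]
    refine hF.comp (by fun_prop) fun t ht => ?_
    constructor <;> linarith [ht.1, ht.2]
  have : ∫ _t in (-1 : ℝ)..1, 2 * K ≤ ∫ t in (-1 : ℝ)..1, (F (r + t) + F (r - t)) :=
    intervalIntegral.integral_mono_on (by norm_num) (by simp) (c1.add c2) h
  rw [intervalIntegral.integral_add c1 c2, ← e1, ← e2] at this
  simp at this
  linarith

/-- Summing cell bounds over integers of a fixed parity. -/
lemma sum_le_integral_of_cells {S : Finset ℤ} (hS : ∀ a ∈ S, ∀ b ∈ S, Even (a - b))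
    {f : ℤ → ℝ} {F : ℝ → ℝ} {Ω : Set ℝ} (hΩ : MeasurableSet Ω) (hF : IntegrableOn F Ω)
    (hF0 : ∀ y ∈ Ω, 0 ≤ F y)
    (hsub : ∀ a ∈ S, Ioc ((a : ℝ) - 1) (a + 1) ⊆ Ω)
    (hf : ∀ a ∈ S, f a ≤ ∫ y in Ioc ((a : ℝ) - 1) (a + 1), F y) :
    ∑ a ∈ S, f a ≤ ∫ y in Ω, F y := by
  refine (Finset.sum_le_sum hf).trans ?_
  rw [← integral_biUnion_finset S (fun _ _ => measurableSet_Ioc) ?_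
    fun a ha => hF.mono_set (hsub a ha)]
  · refine setIntegral_mono_set hF ?_ ?_
    · exact (ae_restrict_iff' hΩ).2 (Filter.Eventually.of_forall hF0)
    · exact (iUnion₂_subset hsub).eventuallyLE
  · intro a ha b hb hab
    have he := hS a ha b hb
    refine Set.disjoint_left.2 fun y h1 h2 => ?_
    obtain ⟨c, hc⟩ := he
    have h3 : (a : ℝ) < b + 2 := by linarith [h1.1, h2.2]
    have h4 : (b : ℝ) < a + 2 := by linarith [h2.1, h1.2]
    have h3' : a < b + 2 := by exact_mod_cast h3
    have h4' : b < a + 2 := by exact_mod_cast h4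
    omega

lemma add_exp_neg_ge (x : ℝ) : 2 ≤ Real.exp x + Real.exp (-x) := by
  have := Real.one_le_cosh x
  rw [Real.cosh_eq] at this; linarith

lemma dblGauss_add_ge {p : ℝ} (hp : 0 < p) (b x : ℝ) {t : ℝ} (ht : t ∈ Icc (-1 : ℝ) 1) :
    2 * (Real.exp (-(1 / (2 * p))) * dblGauss p x) ≤
      dblGauss p (x + t) * Real.exp (b * t) + dblGauss p (x - t) * Real.exp (-(b * t)) := by
  have h1 : -(1 / (2 * p)) ≤ -t ^ 2 / (2 * p) := by
    rw [neg_div, neg_le_neg_iff]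
    gcongr
    nlinarith [ht.1, ht.2]
  have h2 := add_exp_neg_ge (b * t - x * t / p)
  have e1 : dblGauss p (x + t) * Real.exp (b * t) =
      dblGauss p x * Real.exp (-t ^ 2 / (2 * p)) * Real.exp (b * t - x * t / p) := by
    unfold dblGauss
    rw [mul_assoc, mul_assoc, mul_assoc, ← Real.exp_add, ← Real.exp_add, ← Real.exp_add]
    congr 2; field_simp; ring
  have e2 : dblGauss p (x - t) * Real.exp (-(b * t)) =
      dblGauss p x * Real.exp (-t ^ 2 / (2 * p)) * Real.exp (-(b * t - x * t / p)) := by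
    unfold dblGauss
    rw [mul_assoc, mul_assoc, mul_assoc, ← Real.exp_add, ← Real.exp_add, ← Real.exp_add]
    congr 2; field_simp; ring
  rw [e1, e2, ← mul_add]
  have h3 := Real.exp_le_exp.2 h1
  have h4 := dblGauss_nonneg p x
  calc _ = dblGauss p x * Real.exp (-(1 / (2 * p))) * 2 := by ring
    _ ≤ _ := by gcongr

lemma gaussTail_shift (x u : ℝ) : gaussTail (x + u) = ∫ v in Ioi x, stdPdf (v + u) := by
  rw [gaussTail_eq, ← (measurePreserving_add_right volume u).setIntegral_preimage_emb
      (measurableEmbedding_addRight u)]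
  simp

lemma gaussTail_add_ge (x u b : ℝ) :
    2 * (Real.exp (-u ^ 2 / 2) * gaussTail x) ≤
      gaussTail (x + u) * Real.exp b + gaussTail (x - u) * Real.exp (-b) := by
  have i1 : IntegrableOn (fun v => stdPdf (v + u) * Real.exp b) (Ioi x) :=
    ((integrable_stdPdf.comp_add_right u).mul_const _).integrableOn
  have i2 : IntegrableOn (fun v => stdPdf (v + -u) * Real.exp (-b)) (Ioi x) :=
    ((integrable_stdPdf.comp_add_right (-u)).mul_const _).integrableOn
  rw [sub_eq_add_neg, gaussTail_shift, gaussTail_shift, gaussTail_eq, ← integral_mul_const,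
    ← integral_mul_const, ← integral_add i1 i2, ← integral_const_mul, ← integral_const_mul]
  refine integral_mono ((integrable_stdPdf.const_mul _).const_mul _).integrableOn (i1.add i2)
    fun v => ?_
  dsimp only
  have h2 := add_exp_neg_ge (b - v * u)
  have e1 : stdPdf (v + u) * Real.exp b =
      Real.exp (-u ^ 2 / 2) * stdPdf v * Real.exp (b - v * u) := by
    unfold stdPdf
    rw [mul_left_comm, mul_assoc, mul_assoc, ← Real.exp_add, ← Real.exp_add, ← Real.exp_add]
    ring_nf
  have e2 : stdPdf (v + -u) * Real.exp (-b) =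
      Real.exp (-u ^ 2 / 2) * stdPdf v * Real.exp (-(b - v * u)) := by
    unfold stdPdf
    rw [mul_left_comm, mul_assoc, mul_assoc, ← Real.exp_add, ← Real.exp_add, ← Real.exp_add]
    ring_nf
  rw [e1, e2, ← mul_add]
  have := stdPdf_pos v
  calc _ = Real.exp (-u ^ 2 / 2) * stdPdf v * 2 := by ring
    _ ≤ _ := by gcongr

/-- The weight of a vertex with outer degree `r`. -/
noncomputable def vtxWeight (p q s r : ℝ) : ℝ :=
  dblGauss q r * gaussTail ((s + |r|) / Real.sqrt p)

lemma vtxWeight_nonneg (p q s r : ℝ) : 0 ≤ vtxWeight p q s r :=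
  mul_nonneg (dblGauss_nonneg _ _) (gaussTail_nonneg _)

@[fun_prop]
lemma continuous_vtxWeight (p q s : ℝ) : Continuous (vtxWeight p q s) := by
  unfold vtxWeight; fun_prop

lemma vtxWeight_neg (p q s r : ℝ) : vtxWeight p q s (-r) = vtxWeight p q s r := by
  simp [vtxWeight, dblGauss]

lemma vtxWeight_le (p q s r : ℝ) : vtxWeight p q s r ≤ dblGauss q r :=
  mul_le_of_le_one_right (dblGauss_nonneg _ _) (gaussTail_le_one _)

lemma vtxWeight_add_ge {p q s r b t : ℝ} (hp : 0 < p) (hq : 0 < q) (hr : 1 ≤ |r|)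
    (ht : t ∈ Icc (-1 : ℝ) 1) :
    2 * (Real.exp (-((1 / p + 1 / q) / 2)) * (vtxWeight p q s r * Real.exp (b * r))) ≤
      vtxWeight p q s (r + t) * Real.exp (b * (r + t)) +
        vtxWeight p q s (r - t) * Real.exp (b * (r - t)) := by
  wlog h0 : 0 ≤ r generalizing r b t
  · have := this (r := -r) (b := -b) (t := -t) (by simpa using hr)
      ⟨by linarith [ht.2], by linarith [ht.1]⟩ (by linarith)
    rw [show -r + -t = -(r + t) by ring, show -r - -t = -(r - t) by ring] at this
    simpa only [vtxWeight_neg, neg_mul_neg] using this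
  rw [abs_of_nonneg h0] at hr
  unfold vtxWeight
  rw [abs_of_nonneg h0, abs_of_nonneg (by linarith [ht.1] : 0 ≤ r + t),
    abs_of_nonneg (by linarith [ht.2] : 0 ≤ r - t)]
  have hsp := Real.sqrt_pos.2 hp
  have hq1 := gaussTail_add_ge ((s + r) / Real.sqrt p) (t / Real.sqrt p) (b * t - r * t / q)
  have e1 : dblGauss q (r + t) = dblGauss q r * Real.exp (-t ^ 2 / (2 * q)) *
      Real.exp (- (r * t / q)) := by
    unfold dblGauss
    rw [mul_assoc, mul_assoc, ← Real.exp_add, ← Real.exp_add]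
    congr 2; field_simp; ring
  have e2 : dblGauss q (r - t) = dblGauss q r * Real.exp (-t ^ 2 / (2 * q)) *
      Real.exp (r * t / q) := by
    unfold dblGauss
    rw [mul_assoc, mul_assoc, ← Real.exp_add, ← Real.exp_add]
    congr 2; field_simp; ring
  have e3 : ((t / Real.sqrt p) ^ 2) = t ^ 2 / p := by rw [div_pow, Real.sq_sqrt hp.le]
  have hex : Real.exp (-((1 / p + 1 / q) / 2)) ≤
      Real.exp (-t ^ 2 / (2 * q)) * Real.exp (-(t / Real.sqrt p) ^ 2 / 2) := by
    rw [← Real.exp_add, Real.exp_le_exp, e3]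
    have ht2 : t ^ 2 ≤ 1 := by nlinarith [ht.1, ht.2]
    have h1 : t ^ 2 / p ≤ 1 / p := by gcongr
    have h2 : t ^ 2 / q ≤ 1 / q := by gcongr
    have : -t ^ 2 / (2 * q) = -(t ^ 2 / q) / 2 := by field_simp
    rw [this]; linarith
  have hD := dblGauss_nonneg q r
  have hT := gaussTail_nonneg ((s + r) / Real.sqrt p)
  have e4 : Real.exp (b * (r + t)) = Real.exp (b * r) * Real.exp (b * t) := by
    rw [← Real.exp_add]; ring_nf
  have e5 : Real.exp (b * (r - t)) = Real.exp (b * r) * Real.exp (-(b * t)) := by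
    rw [← Real.exp_add]; ring_nf
  have e6 : Real.exp (b * t - r * t / q) = Real.exp (b * t) * Real.exp (-(r * t / q)) := by
    rw [← Real.exp_add]; ring_nf
  have e7 : Real.exp (-(b * t - r * t / q)) = Real.exp (-(b * t)) * Real.exp (r * t / q) := by
    rw [← Real.exp_add]; ring_nf
  rw [e6, e7] at hq1
  rw [e1, e2, e4, e5,
    show (s + (r + t)) / Real.sqrt p = (s + r) / Real.sqrt p + t / Real.sqrt p by ring,
    show (s + (r - t)) / Real.sqrt p = (s + r) / Real.sqrt p - t / Real.sqrt p by ring]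
  calc _ ≤ 2 * ((Real.exp (-t ^ 2 / (2 * q)) * Real.exp (-(t / Real.sqrt p) ^ 2 / 2)) *
        (dblGauss q r * gaussTail ((s + r) / Real.sqrt p) * Real.exp (b * r))) := by gcongr
    _ = dblGauss q r * Real.exp (-t ^ 2 / (2 * q)) * Real.exp (b * r) *
        (2 * (Real.exp (-(t / Real.sqrt p) ^ 2 / 2) * gaussTail ((s + r) / Real.sqrt p))) := by
      ring
    _ ≤ _ := mul_le_mul_of_nonneg_left hq1 (by positivity)
    _ = _ := by ring

lemma dblGauss_eq {p : ℝ} (hp : 0 < p) (x : ℝ) :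
    dblGauss p x / 2 = (Real.sqrt p)⁻¹ * stdPdf (x / Real.sqrt p) := by
  unfold dblGauss stdPdf
  have h1 : Real.sqrt (2 / (Real.pi * p)) = 2 * ((Real.sqrt p)⁻¹ * (Real.sqrt (2 * Real.pi))⁻¹) := by
    rw [← mul_inv, ← Real.sqrt_mul hp.le, ← Real.sqrt_inv,
      show (2 : ℝ) / (Real.pi * p) = 2 ^ 2 * (p * (2 * Real.pi))⁻¹ by field_simp,
      Real.sqrt_mul (by positivity), Real.sqrt_sq (by norm_num)]
  rw [h1, div_pow, Real.sq_sqrt hp.le]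
  rw [show -x ^ 2 / (2 * p) = -(x ^ 2 / p) / 2 by field_simp]
  ring

lemma integral_comp_div_sqrt {q : ℝ} (hq : 0 < q) (f : ℝ → ℝ) :
    ∫ y, (Real.sqrt q)⁻¹ * f (y / Real.sqrt q) = ∫ x, f x := by
  have h := Real.sqrt_pos.2 hq
  rw [integral_const_mul, Measure.integral_comp_div, smul_eq_mul, abs_of_pos h,
    inv_mul_cancel_left₀ h.ne']

lemma integrable_dblGauss_half {p : ℝ} (hp : 0 < p) : Integrable fun y => dblGauss p y / 2 := by
  simp_rw [dblGauss_eq hp]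
  exact (integrable_stdPdf.comp_div (Real.sqrt_pos.2 hp).ne').const_mul _

lemma integral_dblGauss_half {p : ℝ} (hp : 0 < p) : ∫ y, dblGauss p y / 2 = 1 := by
  simp_rw [dblGauss_eq hp]
  rw [integral_comp_div_sqrt hp, integral_stdPdf]

lemma integral_Ioi_dblGauss_half {p : ℝ} (hp : 0 < p) (t : ℝ) :
    ∫ y in Ioi t, dblGauss p y / 2 = gaussTail (t / Real.sqrt p) := by
  have h := Real.sqrt_pos.2 hp
  simp_rw [dblGauss_eq hp]
  rw [gaussTail_eq, integral_const_mul]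
  have := integral_comp_mul_left_Ioi stdPdf t (inv_pos.2 h)
  simp_rw [div_eq_inv_mul]
  rw [this, smul_eq_mul, inv_inv, inv_mul_cancel_left₀ h.ne']

lemma integral_Ioi_dblGauss_half_sub {p : ℝ} (hp : 0 < p) (t z : ℝ) :
    ∫ y in Ioi t, dblGauss p (y - z) / 2 = gaussTail ((t - z) / Real.sqrt p) := by
  rw [← integral_Ioi_dblGauss_half hp,
    ← (measurePreserving_sub_right volume z).setIntegral_preimage_emb
      (measurableEmbedding_subRight z) (fun y => dblGauss p y / 2) (Ioi (t - z))]
  congr 2; ext; simp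

lemma dblGauss_mul_exp {q : ℝ} (hq : 0 < q) (t y : ℝ) :
    dblGauss q y / 2 * Real.exp (t * y) =
      Real.exp (q * t ^ 2 / 2) * (dblGauss q (y - q * t) / 2) := by
  unfold dblGauss
  have : Real.exp (-y ^ 2 / (2 * q)) * Real.exp (t * y) =
      Real.exp (q * t ^ 2 / 2) * Real.exp (-(y - q * t) ^ 2 / (2 * q)) := by
    rw [← Real.exp_add, ← Real.exp_add]
    congr 1; field_simp; ring
  linear_combination Real.sqrt (2 / (Real.pi * q)) / 2 * this

lemma integrable_dblGauss_mul_exp {q : ℝ} (hq : 0 < q) (t : ℝ) :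
    Integrable fun y => dblGauss q y / 2 * Real.exp (t * y) := by
  simp_rw [dblGauss_mul_exp hq]
  exact ((integrable_dblGauss_half hq).comp_sub_right _).const_mul _

lemma integral_dblGauss_mul_exp {q : ℝ} (hq : 0 < q) (t : ℝ) :
    ∫ y, dblGauss q y / 2 * Real.exp (t * y) = Real.exp (q * t ^ 2 / 2) := by
  simp_rw [dblGauss_mul_exp hq]
  rw [integral_const_mul, integral_sub_right_eq_self (fun y => dblGauss q y / 2),
    integral_dblGauss_half hq, mul_one]

/-- Sums of a discretised Gaussian over a fixed parity class above a threshold. -/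
lemma sum_dblGauss_le_gaussTail {p : ℝ} (hp : 0 < p) {S : Finset ℤ}
    (hS : ∀ a ∈ S, ∀ b ∈ S, Even (a - b)) {t : ℝ} (ht : ∀ a ∈ S, t ≤ a) (z : ℝ) :
    ∑ a ∈ S, dblGauss p (a - z) ≤
      Real.exp (1 / (2 * p)) * gaussTail ((t - 1 - z) / Real.sqrt p) := by
  rw [← integral_Ioi_dblGauss_half_sub hp, ← integral_const_mul]
  refine sum_le_integral_of_cells hS measurableSet_Ioi
    (((integrable_dblGauss_half hp).comp_sub_right z).const_mul _).integrableOn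
    (fun y _ => by have := dblGauss_nonneg p (y - z); positivity)
    (fun a ha y hy => lt_of_le_of_lt (by linarith [ht a ha]) hy.1) fun a ha => ?_
  have := two_mul_le_integral_of_add_ge (F := fun y => Real.exp (1 / (2 * p)) *
    (dblGauss p (y - z) / 2)) (r := a) (K := dblGauss p (a - z) / 2) (by fun_prop) ?_
  · linarith
  intro t ht
  have h := dblGauss_add_ge hp 0 (a - z) ht
  simp only [zero_mul, neg_zero, Real.exp_zero, mul_one] at h
  rw [show (a : ℝ) + t - z = a - z + t by ring, show (a : ℝ) - t - z = a - z - t by ring]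
  rw [Real.exp_neg] at h
  have hE := Real.exp_pos (1 / (2 * p))
  calc _ = Real.exp (1 / (2 * p)) * (2 * ((Real.exp (1 / (2 * p)))⁻¹ * dblGauss p (a - z))) / 2 := by
        field_simp
    _ ≤ Real.exp (1 / (2 * p)) * (dblGauss p (a - z + t) + dblGauss p (a - z - t)) / 2 := by
        gcongr
    _ = _ := by ring

lemma sum_dblGauss_mul_exp_le {q : ℝ} (hq : 0 < q) {S : Finset ℤ}
    (hS : ∀ a ∈ S, ∀ b ∈ S, Even (a - b)) (t : ℝ) :
    ∑ a ∈ S, dblGauss q a * Real.exp (t * a) ≤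
      Real.exp (1 / (2 * q)) * Real.exp (q * t ^ 2 / 2) := by
  rw [← integral_dblGauss_mul_exp hq, ← integral_const_mul, ← setIntegral_univ]
  refine sum_le_integral_of_cells hS MeasurableSet.univ
    ((integrable_dblGauss_mul_exp hq t).const_mul _).integrableOn
    (fun y _ => by have := dblGauss_nonneg q y; positivity)
    (fun a ha y hy => mem_univ _) fun a ha => ?_
  have := two_mul_le_integral_of_add_ge (F := fun y => Real.exp (1 / (2 * q)) *
    (dblGauss q y / 2 * Real.exp (t * y))) (r := a) (K := dblGauss q a * Real.exp (t * a) / 2)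
    (by fun_prop) ?_
  · linarith
  intro u hu
  have h := dblGauss_add_ge hq t a hu
  rw [Real.exp_neg] at h
  have hE := Real.exp_pos (1 / (2 * q))
  have e1 : Real.exp (t * (a + u)) = Real.exp (t * a) * Real.exp (t * u) := by
    rw [← Real.exp_add]; ring_nf
  have e2 : Real.exp (t * (a - u)) = Real.exp (t * a) * Real.exp (-(t * u)) := by
    rw [← Real.exp_add]; ring_nf
  rw [e1, e2]
  calc _ = Real.exp (1 / (2 * q)) * (2 * ((Real.exp (1 / (2 * q)))⁻¹ * dblGauss q a)) / 2
        * Real.exp (t * a) := by field_simp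
    _ ≤ Real.exp (1 / (2 * q)) * (dblGauss q (a + u) * Real.exp (t * u) +
          dblGauss q (a - u) * Real.exp (-(t * u))) / 2 * Real.exp (t * a) := by
        gcongr
    _ = _ := by ring

/-- The Gaussian average of `Q(a+b|x|)`, exponentially tilted by `τ`. -/
noncomputable def stdMass (a b τ : ℝ) : ℝ :=
  ∫ x, stdPdf x * gaussTail (a + b * |x|) * Real.exp (τ * x)

lemma integral_vtxWeight {p q : ℝ} (hp : 0 < p) (hq : 0 < q) (s t : ℝ) :
    ∫ y, vtxWeight p q s y / 2 * Real.exp (t * y) =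
      stdMass (s / Real.sqrt p) (Real.sqrt q / Real.sqrt p) (Real.sqrt q * t) := by
  have h := Real.sqrt_pos.2 hq
  unfold stdMass
  rw [← integral_comp_div_sqrt hq (fun x => stdPdf x * _ * _)]
  congr 1; ext y
  rw [vtxWeight, mul_div_right_comm, dblGauss_eq hq, abs_div, abs_of_pos h]
  rw [show s / Real.sqrt p + Real.sqrt q / Real.sqrt p * (|y| / Real.sqrt q) =
    (s + |y|) / Real.sqrt p by field_simp, show Real.sqrt q * t * (y / Real.sqrt q) = t * y by
    field_simp]
  ring

lemma integrable_vtxWeight {p q : ℝ} (hq : 0 < q) (s t : ℝ) :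
    Integrable fun y => vtxWeight p q s y / 2 * Real.exp (t * y) := by
  refine (integrable_dblGauss_mul_exp hq t).mono' (by fun_prop)
    (Filter.Eventually.of_forall fun y => ?_)
  have := vtxWeight_nonneg p q s y
  rw [Real.norm_of_nonneg (by positivity)]
  gcongr
  exact vtxWeight_le _ _ _ _

lemma integrable_stdPdf_mul_exp (τ : ℝ) : Integrable fun x => stdPdf x * Real.exp (τ * x) := by
  refine (integrable_dblGauss_mul_exp one_pos τ).congr (Filter.Eventually.of_forall fun y => ?_)
  simp [dblGauss_eq one_pos]

lemma integral_stdPdf_mul_exp (τ : ℝ) :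
    ∫ x, stdPdf x * Real.exp (τ * x) = Real.exp (τ ^ 2 / 2) := by
  have := integral_dblGauss_mul_exp one_pos τ
  simpa [dblGauss_eq one_pos] using this

lemma integrable_stdMass (a b τ : ℝ) :
    Integrable fun x => stdPdf x * gaussTail (a + b * |x|) * Real.exp (τ * x) := by
  refine (integrable_stdPdf_mul_exp τ).mono' (by fun_prop)
    (Filter.Eventually.of_forall fun y => ?_)
  have := stdPdf_pos y
  have := gaussTail_nonneg (a + b * |y|)
  rw [Real.norm_of_nonneg (by positivity)]
  gcongr
  exact mul_le_of_le_one_right (by positivity) (gaussTail_le_one _)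

lemma antitoneOn_exp_mul_gaussTail {B C a b e : ℝ} (hb : 0 < b)
    (h : ∀ x : ℝ, -B ≤ x → (x + B) * gaussTail x ≤ C * stdPdf x) (ha : |a| ≤ B)
    (he : 0 ≤ e) (heb : 2 * e * C ≤ b ^ 2) :
    AntitoneOn (fun x => Real.exp (e * x ^ 2) * gaussTail (a + b * x)) (Ici 0) := by
  have hd : ∀ x : ℝ, HasDerivAt (fun x => Real.exp (e * x ^ 2) * gaussTail (a + b * x))
      (Real.exp (e * x ^ 2) * (2 * e * x * gaussTail (a + b * x) - b * stdPdf (a + b * x))) x := by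
    intro x
    have h1 : HasDerivAt (fun x : ℝ => e * x ^ 2) (e * (2 * x)) x := by
      simpa using (hasDerivAt_pow 2 x).const_mul e
    have h2 : HasDerivAt (fun x : ℝ => a + b * x) b x := by
      simpa using ((hasDerivAt_id x).const_mul b).const_add a
    have h3 := (hasDerivAt_gaussTail (a + b * x)).comp x h2
    refine (h1.exp.mul h3).congr_deriv ?_
    simp only [Function.comp_def]; ring
  refine antitoneOn_of_deriv_nonpos (convex_Ici 0)
    (continuous_iff_continuousAt.2 fun x => (hd x).continuousAt).continuousOn
    (fun x _ => (hd x).differentiableAt.differentiableWithinAt) fun x hx => ?_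
  rw [interior_Ici] at hx
  have hx : 0 < x := hx
  rw [(hd x).deriv]
  refine mul_nonpos_of_nonneg_of_nonpos (Real.exp_pos _).le ?_
  have hbx : 0 < b * x := by positivity
  have ha' := abs_le.1 ha
  have h1 := h (a + b * x) (by linarith)
  have hQ := gaussTail_nonneg (a + b * x)
  have hp := stdPdf_pos (a + b * x)
  have h2 : b * x * gaussTail (a + b * x) ≤ C * stdPdf (a + b * x) :=
    le_trans (mul_le_mul_of_nonneg_right (by linarith) hQ) h1
  rw [sub_nonpos, ← mul_le_mul_iff_right₀ hb]
  calc b * (2 * e * x * gaussTail (a + b * x)) = 2 * e * (b * x * gaussTail (a + b * x)) := by ring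
    _ ≤ 2 * e * (C * stdPdf (a + b * x)) := by gcongr
    _ = 2 * e * C * stdPdf (a + b * x) := by ring
    _ ≤ b ^ 2 * stdPdf (a + b * x) := by gcongr
    _ = _ := by ring

/-- The law with density proportional to `φ(x) Q(a+b|x|)` is strictly sub-Gaussian. -/
lemma exists_stdMass_le (B : ℝ) {b₀ : ℝ} (hb₀ : 0 < b₀) :
    ∃ κ : ℝ, 0 < κ ∧ κ < 1 ∧ ∀ a b τ : ℝ, |a| ≤ B → b₀ ≤ b →
      stdMass a b τ ≤ Real.exp (κ * τ ^ 2 / 2) * stdMass a b 0 := by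
  obtain ⟨C, hC, hCB⟩ := exists_add_mul_gaussTail_le B
  set e : ℝ := b₀ ^ 2 / (2 * C) with he
  have he0 : 0 < e := by positivity
  set κ : ℝ := (1 + 2 * e)⁻¹ with hκ
  have hκ0 : 0 < κ := by positivity
  refine ⟨κ, hκ0, inv_lt_one_of_one_lt₀ (by linarith), fun a b τ ha hb => ?_⟩
  rcases eq_or_ne τ 0 with rfl | hτ
  · simp
  have hb' : 0 < b := hb₀.trans_le hb
  set g : ℝ → ℝ := fun x => Real.exp (e * x ^ 2) * gaussTail (a + b * x) with hg
  have hganti : AntitoneOn g (Ici 0) :=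
    antitoneOn_exp_mul_gaussTail hb' hCB ha he0.le (by
      rw [he]; field_simp
      gcongr)
  set D : ℝ → ℝ := fun x => dblGauss κ x / 2 with hD
  have hD0 : ∀ x, 0 ≤ D x := fun x => by have := dblGauss_nonneg κ x; simp only [hD]; positivity
  have hpdf : ∀ x, stdPdf x = Real.sqrt κ * D x * Real.exp (e * x ^ 2) := by
    intro x
    have hs := Real.sqrt_pos.2 hκ0
    simp only [hD]
    rw [dblGauss_eq hκ0, mul_inv_cancel_left₀ hs.ne']
    unfold stdPdf
    rw [mul_assoc, ← Real.exp_add, div_pow, Real.sq_sqrt hκ0.le, hκ]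
    congr 2; field_simp; ring
  set y : ℝ := Real.exp (κ * τ ^ 2 / 2) with hy
  have hy1 : 1 ≤ y := Real.one_le_exp (by positivity)
  set x₀ : ℝ := Real.arcosh y / |τ| with hx₀
  have hτ' := abs_pos.2 hτ
  have hx0 : 0 ≤ x₀ := div_nonneg (Real.arcosh_nonneg hy1) hτ'.le
  have hcx : Real.cosh (τ * x₀) = y := by
    rw [← Real.cosh_abs, abs_mul, abs_of_nonneg hx0, hx₀, mul_div_cancel₀ _ hτ'.ne',
      Real.cosh_arcosh hy1]
  have hsym : ∀ t, stdMass a b t = ∫ x, Real.sqrt κ * (D x * g |x| * Real.cosh (t * x)) := by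
    intro t
    have h1 : stdMass a b t = stdMass a b (-t) := by
      unfold stdMass
      rw [← integral_neg_eq_self]
      simp [stdPdf_neg]
    have h2 : stdMass a b t = (stdMass a b t + stdMass a b (-t)) / 2 := by rw [← h1]; ring
    rw [h2]
    unfold stdMass
    rw [← integral_add (integrable_stdMass a b t) (integrable_stdMass a b (-t)),
      ← integral_div]
    congr 1; ext x
    rw [hpdf, Real.cosh_eq, neg_mul, hg]
    simp only [sq_abs]
    ring
  have hicosh : ∀ t, Integrable fun x => D x * Real.cosh (t * x) := by
    intro t
    have := ((integrable_dblGauss_mul_exp hκ0 t).add (integrable_dblGauss_mul_exp hκ0 (-t))).div_const 2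
    refine this.congr (Filter.Eventually.of_forall fun x => ?_)
    simp only [Pi.add_apply, hD, Real.cosh_eq, neg_mul]
    ring
  have hiD : Integrable D := integrable_dblGauss_half hκ0
  have hicosh_val : ∫ x, D x * Real.cosh (τ * x) = y := by
    have : ∀ x, D x * Real.cosh (τ * x) = (dblGauss κ x / 2 * Real.exp (τ * x) +
        dblGauss κ x / 2 * Real.exp (-τ * x)) / 2 := fun x => by
      simp only [hD, Real.cosh_eq, neg_mul]; ring
    simp_rw [this]
    rw [integral_div, integral_add (integrable_dblGauss_mul_exp hκ0 τ)
      (integrable_dblGauss_mul_exp hκ0 (-τ)), integral_dblGauss_mul_exp hκ0,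
      integral_dblGauss_mul_exp hκ0, neg_sq, hy]
    ring
  have hgb : ∀ x, abs (g |x|) ≤ g 0 := by
    intro x
    have h0 : 0 ≤ g |x| := by
      have := gaussTail_nonneg (a + b * |x|)
      simp only [hg]; positivity
    rw [abs_of_nonneg h0]
    exact hganti (by simp) (by simp) (abs_nonneg x)
  have higcosh : ∀ t, Integrable fun x => D x * g |x| * Real.cosh (t * x) := by
    intro t
    refine ((hicosh t).const_mul (g 0)).mono' ?_ (Filter.Eventually.of_forall fun x => ?_)
    · simp only [hD, hg]
      exact (by fun_prop : Continuous _).aestronglyMeasurable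
    · have := hD0 x
      have hc := Real.cosh_pos (t * x)
      rw [norm_mul, norm_mul, Real.norm_of_nonneg this, Real.norm_of_nonneg hc.le,
        Real.norm_eq_abs, mul_comm (D x), mul_assoc]
      exact mul_le_mul_of_nonneg_right (hgb x) (by positivity)
  have hkey : ∀ x, D x * g |x| * Real.cosh (τ * x) - y * (D x * g |x| * Real.cosh (0 * x)) ≤
      g x₀ * (D x * Real.cosh (τ * x) - y * D x) := by
    intro x
    have h1 : (g |x| - g x₀) * (Real.cosh (τ * x) - y) ≤ 0 := by
      rcases le_total |x| x₀ with h | h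
      · refine mul_nonpos_of_nonneg_of_nonpos (sub_nonneg.2 (hganti (by simp) hx0 h)) ?_
        rw [sub_nonpos, ← hcx, Real.cosh_le_cosh, abs_mul, abs_mul, abs_of_nonneg hx0]
        gcongr
      · refine mul_nonpos_of_nonpos_of_nonneg (sub_nonpos.2 (hganti hx0 (by simp) h)) ?_
        rw [sub_nonneg, ← hcx, Real.cosh_le_cosh, abs_mul, abs_mul, abs_of_nonneg hx0]
        gcongr
    have h2 := mul_nonpos_of_nonneg_of_nonpos (hD0 x) h1
    rw [zero_mul, Real.cosh_zero]
    linarith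
  have hinteg := integral_mono (((higcosh τ).sub ((higcosh 0).const_mul y)))
    (((hicosh τ).sub (hiD.const_mul y)).const_mul (g x₀)) hkey
  simp only [Pi.sub_apply] at hinteg
  rw [integral_sub (higcosh τ) ((higcosh 0).const_mul y), integral_const_mul, integral_const_mul,
    integral_sub (hicosh τ) (hiD.const_mul y), hicosh_val, integral_const_mul,
    integral_dblGauss_half hκ0] at hinteg
  rw [hsym, hsym, integral_const_mul, integral_const_mul]
  have hs := Real.sqrt_nonneg κ
  have : ∫ x, D x * g |x| * Real.cosh (τ * x) ≤ y * ∫ x, D x * g |x| * Real.cosh (0 * x) := by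
    linarith
  calc _ ≤ Real.sqrt κ * (y * ∫ x, D x * g |x| * Real.cosh (0 * x)) := by gcongr
    _ = _ := by ring

/-- Total mass of the continuous vertex weight. -/
noncomputable def vtxMass (p q s : ℝ) : ℝ := ∫ y, vtxWeight p q s y / 2

lemma vtxMass_eq {p q : ℝ} (hp : 0 < p) (hq : 0 < q) (s : ℝ) :
    vtxMass p q s = stdMass (s / Real.sqrt p) (Real.sqrt q / Real.sqrt p) 0 := by
  have := integral_vtxWeight hp hq s 0
  simpa [vtxMass] using this

lemma stdMass_pos (a b : ℝ) : 0 < stdMass a b 0 := by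
  unfold stdMass
  have hp : ∀ x, 0 < stdPdf x * gaussTail (a + b * |x|) * Real.exp (0 * x) := fun x => by
    have := stdPdf_pos x
    have := gaussTail_pos (a + b * |x|)
    positivity
  rw [integral_pos_iff_support_of_nonneg (fun x => (hp x).le) (integrable_stdMass a b 0)]
  have : Function.support (fun x => stdPdf x * gaussTail (a + b * |x|) * Real.exp (0 * x)) =
      univ := by
    ext x; simpa using (hp x).ne'
  rw [this]; simp

lemma stdMass_anti {a a' b b' : ℝ} (ha : a ≤ a') (hb : b ≤ b') :
    stdMass a' b' 0 ≤ stdMass a b 0 := by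
  refine integral_mono (integrable_stdMass _ _ _) (integrable_stdMass _ _ _) fun x => ?_
  have := stdPdf_pos x
  dsimp only
  gcongr
  exact gaussTail_anti (by gcongr)

lemma vtxMass_pos {p q : ℝ} (hp : 0 < p) (hq : 0 < q) (s : ℝ) : 0 < vtxMass p q s := by
  rw [vtxMass_eq hp hq]; exact stdMass_pos _ _

lemma dblGauss_anti {q x y : ℝ} (hq : 0 < q) (h : |x| ≤ |y|) : dblGauss q y ≤ dblGauss q x := by
  unfold dblGauss
  have := sq_le_sq.2 h
  gcongr

lemma vtxWeight_anti {p q s x y : ℝ} (hq : 0 < q) (h : |x| ≤ |y|) :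
    vtxWeight p q s y ≤ vtxWeight p q s x := by
  unfold vtxWeight
  have h1 := dblGauss_anti hq h
  have h2 := dblGauss_nonneg q x
  have h3 := gaussTail_nonneg ((s + |y|) / Real.sqrt p)
  gcongr
  exact gaussTail_anti (by gcongr)

lemma dblGauss_zero_le {q : ℝ} (hq : 0 < q) : dblGauss q 0 ≤ (Real.sqrt q)⁻¹ := by
  refine (dblGauss_le hq.le 0).trans ?_
  rw [← Real.sqrt_inv]
  apply Real.sqrt_le_sqrt
  rw [div_le_iff₀ (by positivity)]
  field_simp
  linarith [Real.pi_gt_three]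

lemma vtxWeight_zero_sub_one_le {p q : ℝ} (hp : 0 < p) (hq : 1 ≤ q) (s : ℝ) :
    vtxWeight p q s 0 - vtxWeight p q s 1 ≤
      (Real.sqrt q)⁻¹ * ((Real.sqrt p)⁻¹ / 2 + (Real.sqrt q)⁻¹ / 2) := by
  have hq0 : 0 < q := by linarith
  have hsp := Real.sqrt_pos.2 hp
  have hsq := Real.sqrt_pos.2 hq0
  have h1 : gaussTail (s / Real.sqrt p) - gaussTail ((s + 1) / Real.sqrt p) ≤
      (Real.sqrt p)⁻¹ / 2 := by
    refine (gaussTail_sub_le (by gcongr; linarith)).trans (le_of_eq ?_)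
    field_simp; ring
  have h2 : dblGauss q 0 - dblGauss q 1 ≤ dblGauss q 0 * ((Real.sqrt q)⁻¹ / 2) := by
    have e1 : dblGauss q 1 = dblGauss q 0 * Real.exp (-(1 / (2 * q))) := by
      simp [dblGauss, neg_div]
    have h3 := Real.add_one_le_exp (-(1 / (2 * q)))
    have h4 : 1 / (2 * q) ≤ (Real.sqrt q)⁻¹ / 2 := by
      have : 1 / (2 * q) = q⁻¹ / 2 := by field_simp
      rw [this]
      have : q⁻¹ ≤ (Real.sqrt q)⁻¹ := by
        gcongr
        exact Real.sqrt_le_iff.2 ⟨hq0.le, by nlinarith⟩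
      linarith
    have h5 := dblGauss_nonneg q 0
    rw [e1]
    nlinarith
  have h3 := dblGauss_nonneg q 0
  have h4 := dblGauss_zero_le hq0
  have h5 := gaussTail_le_one ((s + 1) / Real.sqrt p)
  have h6 := gaussTail_nonneg ((s + 1) / Real.sqrt p)
  have h7 : 0 ≤ dblGauss q 0 - dblGauss q 1 := sub_nonneg.2 (dblGauss_anti hq0 (by simp))
  unfold vtxWeight
  rw [abs_zero, add_zero, abs_one]
  calc _ = dblGauss q 0 * (gaussTail (s / Real.sqrt p) - gaussTail ((s + 1) / Real.sqrt p)) +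
        (dblGauss q 0 - dblGauss q 1) * gaussTail ((s + 1) / Real.sqrt p) := by ring
    _ ≤ dblGauss q 0 * ((Real.sqrt p)⁻¹ / 2) + (dblGauss q 0 * ((Real.sqrt q)⁻¹ / 2)) * 1 := by
        gcongr
    _ = dblGauss q 0 * ((Real.sqrt p)⁻¹ / 2 + (Real.sqrt q)⁻¹ / 2) := by ring
    _ ≤ _ := by gcongr

lemma sum_vtxWeight_mul_exp_le {p q : ℝ} (hp : 0 < p) (hq : 1 ≤ q) (s t : ℝ) {S : Finset ℤ}
    (hS : ∀ a ∈ S, Even a) :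
    ∑ a ∈ S, vtxWeight p q s a * Real.exp (t * a) ≤
      Real.exp ((1 / p + 1 / q) / 2) * (∫ y, vtxWeight p q s y / 2 * Real.exp (t * y)) +
        (vtxWeight p q s 0 - vtxWeight p q s 1) := by
  have hq0 : 0 < q := by linarith
  set F : ℝ → ℝ := fun y => Real.exp ((1 / p + 1 / q) / 2) *
    (vtxWeight p q s y / 2 * Real.exp (t * y)) with hF
  have hE := Real.exp_pos ((1 / p + 1 / q) / 2)
  have hE1 : 1 ≤ Real.exp ((1 / p + 1 / q) / 2) := Real.one_le_exp (by positivity)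
  have hFi : Integrable F := (integrable_vtxWeight hq0 s t).const_mul _
  have hF0 : ∀ y, 0 ≤ F y := fun y => by
    have := vtxWeight_nonneg p q s y
    simp only [hF]; positivity
  have hFc : Continuous F := by simp only [hF]; fun_prop
  rw [← integral_const_mul, ← integral_add_compl (measurableSet_Ioc (a := (-1 : ℝ)) (b := 1)) hFi]
  have hne : ∑ a ∈ S.erase 0, vtxWeight p q s a * Real.exp (t * a) ≤
      ∫ y in (Ioc (-1 : ℝ) 1)ᶜ, F y := by
    have hodd : ∀ a ∈ S.erase 0, (a : ℝ) ≤ -2 ∨ 2 ≤ (a : ℝ) := by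
      intro a ha
      obtain ⟨c, hc⟩ := hS a (Finset.mem_of_mem_erase ha)
      have h0 := Finset.ne_of_mem_erase ha
      rcases lt_or_gt_of_ne h0 with h | h
      · left; have : a ≤ -2 := by omega
        exact_mod_cast this
      · right; have : 2 ≤ a := by omega
        exact_mod_cast this
    refine sum_le_integral_of_cells (fun a ha b hb => (hS a (Finset.mem_of_mem_erase ha)).sub
      (hS b (Finset.mem_of_mem_erase hb))) measurableSet_Ioc.compl hFi.integrableOn
      (fun y _ => hF0 y) ?_ fun a ha => ?_
    · intro a ha y hy hy'
      rcases hodd a ha with h | h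
      · linarith [hy.2, hy'.1]
      · linarith [hy.1, hy'.2]
    · have := two_mul_le_integral_of_add_ge (F := F) (r := a)
        (K := vtxWeight p q s a * Real.exp (t * a) / 2) hFc.continuousOn ?_
      · linarith
      intro u hu
      have h1 : 1 ≤ |(a : ℝ)| := by
        rcases hodd a ha with h | h
        · rw [abs_of_nonpos (by linarith)]; linarith
        · rw [abs_of_nonneg (by linarith)]; linarith
      have h := vtxWeight_add_ge (s := s) (b := t) hp hq0 h1 hu
      rw [Real.exp_neg] at h
      simp only [hF]
      calc _ = Real.exp ((1 / p + 1 / q) / 2) * (2 * ((Real.exp ((1 / p + 1 / q) / 2))⁻¹ *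
            (vtxWeight p q s a * Real.exp (t * a)))) / 2 := by field_simp
        _ ≤ _ := by
          refine (div_le_div_of_nonneg_right (mul_le_mul_of_nonneg_left h hE.le)
            (by norm_num)).trans (le_of_eq ?_)
          ring
  have hz : vtxWeight p q s 1 ≤ ∫ y in Ioc (-1 : ℝ) 1, F y := by
    have := two_mul_le_integral_of_add_ge (F := F) (r := 0)
        (K := vtxWeight p q s 1 / 2) hFc.continuousOn ?_
    · simp only [zero_sub, zero_add] at this
      linarith
    intro u hu
    simp only [hF, zero_add, zero_sub, vtxWeight_neg]
    have h1 := add_exp_neg_ge (t * u)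
    have h2 := vtxWeight_nonneg p q s u
    have h4 := vtxWeight_nonneg p q s 1
    have h3 : vtxWeight p q s 1 ≤ vtxWeight p q s u :=
      vtxWeight_anti hq0 (by rw [abs_one]; exact abs_le.2 hu)
    rw [mul_neg]
    calc _ = 1 * (vtxWeight p q s 1 / 2 * 2) := by ring
      _ ≤ Real.exp ((1 / p + 1 / q) / 2) * (vtxWeight p q s u / 2 *
          (Real.exp (t * u) + Real.exp (-(t * u)))) := by gcongr
      _ = _ := by ring
  have hle : ∑ a ∈ S, vtxWeight p q s a * Real.exp (t * a) ≤
      ∑ a ∈ S.erase 0, vtxWeight p q s a * Real.exp (t * a) + vtxWeight p q s 0 := by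
    by_cases h : (0 : ℤ) ∈ S
    · rw [← Finset.sum_erase_add _ _ h]; simp
    · rw [Finset.erase_eq_of_notMem h]
      linarith [vtxWeight_nonneg p q s 0]
  linarith

/-- Strictly sub-Gaussian bound for the discrete vertex weights. -/
lemma exists_sum_vtxWeight_mul_exp_le (B : ℝ) {b₀ : ℝ} (hb₀ : 0 < b₀) :
    ∃ κ C : ℝ, 0 < κ ∧ κ < 1 ∧ 0 < C ∧ ∀ p q s : ℝ, 1 ≤ p → 1 ≤ q → b₀ * p ≤ q → b₀ * q ≤ p →
      |s| ≤ B * Real.sqrt p → ∀ S : Finset ℤ, (∀ a ∈ S, Even a) → ∀ t : ℝ,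
      ∑ a ∈ S, vtxWeight p q s a * Real.exp (t * a) ≤
        Real.exp (C / p) * (Real.exp (κ * (q * t ^ 2) / 2) * vtxMass p q s) := by
  obtain ⟨κ, hκ, hκ1, hκs⟩ := exists_stdMass_le B (Real.sqrt_pos.2 hb₀)
  set c : ℝ := stdMass B (Real.sqrt b₀⁻¹) 0 with hc
  have hc0 : 0 < c := stdMass_pos _ _
  set d : ℝ := (Real.sqrt b₀)⁻¹ with hd
  have hd0 : 0 < d := inv_pos.2 (Real.sqrt_pos.2 hb₀)
  refine ⟨κ, (1 + b₀⁻¹) / 2 + d * (1 + d) / (2 * c), hκ, hκ1, by positivity,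
    fun p q s hp hq hpq hqp hs S hS t => ?_⟩
  have hp0 : 0 < p := by linarith
  have hq0 : 0 < q := by linarith
  have hsp := Real.sqrt_pos.2 hp0
  have hsq := Real.sqrt_pos.2 hq0
  have ha : |s / Real.sqrt p| ≤ B := by
    rw [abs_div, abs_of_pos hsp, div_le_iff₀ hsp]; exact hs
  have hb : Real.sqrt b₀ ≤ Real.sqrt q / Real.sqrt p := by
    rw [le_div_iff₀ hsp, ← Real.sqrt_mul hb₀.le]
    exact Real.sqrt_le_sqrt hpq
  have hb' : Real.sqrt q / Real.sqrt p ≤ Real.sqrt b₀⁻¹ := by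
    rw [div_le_iff₀ hsp, ← Real.sqrt_mul (by positivity)]
    apply Real.sqrt_le_sqrt
    rw [inv_mul_eq_div, le_div_iff₀ hb₀]; linarith
  have hI : c ≤ vtxMass p q s := by
    rw [vtxMass_eq hp0 hq0]
    exact stdMass_anti (abs_le.1 ha).2 hb'
  have hJ : ∫ y, vtxWeight p q s y / 2 * Real.exp (t * y) ≤
      Real.exp (κ * (q * t ^ 2) / 2) * vtxMass p q s := by
    rw [integral_vtxWeight hp0 hq0, vtxMass_eq hp0 hq0]
    have := hκs _ _ (Real.sqrt q * t) ha hb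
    rwa [mul_pow, Real.sq_sqrt hq0.le] at this
  have hq' : (Real.sqrt q)⁻¹ ≤ d * (Real.sqrt p)⁻¹ := by
    rw [hd, ← mul_inv, ← Real.sqrt_mul hb₀.le]
    exact inv_anti₀ (by positivity) (Real.sqrt_le_sqrt hpq)
  have herr : vtxWeight p q s 0 - vtxWeight p q s 1 ≤ d * (1 + d) / 2 / p := by
    refine (vtxWeight_zero_sub_one_le hp0 hq s).trans ?_
    calc _ ≤ d * (Real.sqrt p)⁻¹ * ((Real.sqrt p)⁻¹ / 2 + d * (Real.sqrt p)⁻¹ / 2) := by gcongr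
      _ = d * (1 + d) / 2 * ((Real.sqrt p)⁻¹ * (Real.sqrt p)⁻¹) := by ring
      _ = _ := by rw [← mul_inv, Real.mul_self_sqrt hp0.le]; rfl
  have hX1 : 1 ≤ Real.exp (κ * (q * t ^ 2) / 2) := Real.one_le_exp (by positivity)
  set X := Real.exp (κ * (q * t ^ 2) / 2) * vtxMass p q s with hX
  have hXc : c ≤ X := by rw [hX]; nlinarith
  have hX0 : 0 < X := hc0.trans_le hXc
  have herr2 : d * (1 + d) / 2 / p ≤ d * (1 + d) / (2 * c) / p * X := by
    calc d * (1 + d) / 2 / p = d * (1 + d) / (2 * c) / p * c := by field_simp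
      _ ≤ _ := by gcongr
  have hpq2 : (1 / p + 1 / q) / 2 ≤ (1 + b₀⁻¹) / 2 / p := by
    have : 1 / q ≤ b₀⁻¹ / p := by
      rw [div_le_div_iff₀ hq0 hp0, one_mul, ← div_eq_inv_mul, le_div_iff₀ hb₀]; linarith
    have e : (1 + b₀⁻¹) / 2 / p = (1 / p + b₀⁻¹ / p) / 2 := by ring
    rw [e]; linarith
  set u := (1 + b₀⁻¹) / 2 / p with hu
  set v := d * (1 + d) / (2 * c) / p with hv
  have hv0 : 0 ≤ v := by positivity
  have hu1 : 1 ≤ Real.exp u := Real.one_le_exp (by positivity)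
  calc _ ≤ Real.exp ((1 / p + 1 / q) / 2) * (∫ y, vtxWeight p q s y / 2 * Real.exp (t * y)) +
        (vtxWeight p q s 0 - vtxWeight p q s 1) := sum_vtxWeight_mul_exp_le hp0 hq s t hS
    _ ≤ Real.exp u * X + v * X := by
        have h0 : 0 ≤ ∫ y, vtxWeight p q s y / 2 * Real.exp (t * y) := integral_nonneg fun y => by
          have := vtxWeight_nonneg p q s y
          positivity
        gcongr
        exact herr.trans herr2
    _ ≤ Real.exp u * X + Real.exp u * v * X := by gcongr; nlinarith
    _ = Real.exp u * (v + 1) * X := by ring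
    _ ≤ Real.exp u * Real.exp v * X := by gcongr; exact Real.add_one_le_exp v
    _ = _ := by rw [← Real.exp_add, hu, hv, ← add_div]

lemma Icc_neg_succ (m : ℕ) : Finset.Icc (-((m + 1 : ℕ) : ℤ)) ((m + 1 : ℕ) : ℤ) =
    insert (-((m + 1 : ℕ) : ℤ)) (insert ((m + 1 : ℕ) : ℤ) (Finset.Icc (-(m : ℤ)) m)) := by
  ext j; simp only [Finset.mem_Icc, Finset.mem_insert]; push_cast; omega

lemma sum_Icc_neg_succ (m : ℕ) (f : ℤ → ℝ) :
    ∑ j ∈ Finset.Icc (-((m + 1 : ℕ) : ℤ)) ((m + 1 : ℕ) : ℤ), f j =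
      f (-((m + 1 : ℕ) : ℤ)) + (f ((m + 1 : ℕ) : ℤ) + ∑ j ∈ Finset.Icc (-(m : ℤ)) m, f j) := by
  rw [Icc_neg_succ, Finset.sum_insert, Finset.sum_insert]
  · simp
  · simp only [Finset.mem_Icc, Finset.mem_insert]; push_cast; omega

lemma sin_mul_sum_cos_Icc (m : ℕ) (θ : ℝ) :
    Real.sin θ * ∑ j ∈ Finset.Icc (-(m : ℤ)) m, Real.cos (2 * j * θ) =
      Real.sin ((2 * m + 1) * θ) := by
  induction m with
  | zero => simp
  | succ m ih =>
    rw [sum_Icc_neg_succ, mul_add, mul_add, ih]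
    push_cast
    rw [show 2 * -((m : ℝ) + 1) * θ = -(2 * (m + 1) * θ) by ring, Real.cos_neg]
    have h1 : Real.sin ((2 * (m + 1) + 1) * θ) = Real.sin (2 * (m + 1) * θ + θ) := by ring_nf
    have h2 : Real.sin ((2 * m + 1) * θ) = Real.sin (2 * (m + 1) * θ - θ) := by ring_nf
    rw [h1, h2, Real.sin_add, Real.sin_sub]; ring

lemma sum_sq_Icc (m : ℕ) :
    3 * ∑ j ∈ Finset.Icc (-(m : ℤ)) m, (j : ℝ) ^ 2 = m * (m + 1) * (2 * m + 1) := by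
  induction m with
  | zero => simp
  | succ m ih =>
    rw [sum_Icc_neg_succ, mul_add, mul_add, ih]; push_cast; ring

lemma sum_one_Icc (m : ℕ) : ∑ _j ∈ Finset.Icc (-(m : ℤ)) m, (1 : ℝ) = 2 * m + 1 := by
  have : ((m : ℤ) + 1 + m).toNat = 2 * m + 1 := by omega
  simp [this]

/-- Quantitative decay of the Dirichlet kernel. -/
lemma dirichlet_le {m : ℕ} {θ : ℝ} (hθ : |θ| ≤ Real.pi / 2) :
    |∑ j ∈ Finset.Icc (-(m : ℤ)) m, Real.cos (2 * j * θ)| ≤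
      (2 * m + 1) * (1 - min (1 / 2) (m ^ 2 * θ ^ 2 / 4)) := by
  set D := ∑ j ∈ Finset.Icc (-(m : ℤ)) m, Real.cos (2 * j * θ) with hD
  have hid := sin_mul_sum_cos_Icc m θ
  rw [← hD] at hid
  have hpi := Real.pi_pos
  by_cases hbig : 2 ≤ (2 * m + 1) * |Real.sin θ|
  · have hs : 0 < |Real.sin θ| := by
      by_contra h
      have : |Real.sin θ| = 0 := le_antisymm (not_lt.1 h) (abs_nonneg _)
      rw [this] at hbig; linarith
    have h1 : |Real.sin θ| * |D| ≤ 1 := by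
      rw [← abs_mul, hid]; exact Real.abs_sin_le_one _
    have h2 : |D| ≤ (2 * m + 1) / 2 := by
      rw [← mul_le_mul_iff_right₀ hs]; linarith
    have h3 := min_le_left (1 / 2 : ℝ) (m ^ 2 * θ ^ 2 / 4)
    have hm : (0 : ℝ) ≤ m := m.cast_nonneg
    nlinarith
  · push Not at hbig
    have hj : 2 / Real.pi * |θ| ≤ |Real.sin θ| := by
      exact Real.mul_abs_le_abs_sin hθ
    have hm : (0 : ℝ) ≤ m := m.cast_nonneg
    have hlt : (2 * m + 1) * |θ| < Real.pi := by
      have : (2 * m + 1) * (2 / Real.pi * |θ|) < 2 :=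
        lt_of_le_of_lt (mul_le_mul_of_nonneg_left hj (by positivity)) hbig
      have h2 : (2 * m + 1) * (2 / Real.pi * |θ|) = (2 * m + 1) * |θ| * 2 / Real.pi := by ring
      rw [h2, div_lt_iff₀ hpi] at this
      linarith
    have hD0 : 0 ≤ D := by
      rcases lt_trichotomy θ 0 with h | h | h
      · rw [abs_of_neg h] at hlt hθ
        have s1 : Real.sin θ < 0 := Real.sin_neg_of_neg_of_neg_pi_lt h (by linarith)
        have s2 : Real.sin ((2 * m + 1) * θ) ≤ 0 :=
          Real.sin_nonpos_of_nonpos_of_neg_pi_le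
            (mul_nonpos_of_nonneg_of_nonpos (by positivity) h.le) (by linarith)
        by_contra hn
        have := mul_pos_of_neg_of_neg s1 (not_le.1 hn)
        linarith
      · simp [hD, h]; 
      · rw [abs_of_pos h] at hlt hθ
        have s1 : 0 < Real.sin θ := Real.sin_pos_of_pos_of_lt_pi h (by linarith)
        have s2 : 0 ≤ Real.sin ((2 * m + 1) * θ) :=
          Real.sin_nonneg_of_nonneg_of_le_pi (by positivity) (by linarith)
        by_contra hn
        have := mul_neg_of_pos_of_neg s1 (not_le.1 hn)
        linarith
    rw [abs_of_nonneg hD0]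
    have h1 : D ≤ ∑ j ∈ Finset.Icc (-(m : ℤ)) m, (1 - 2 / Real.pi ^ 2 * (2 * j * θ) ^ 2) := by
      refine Finset.sum_le_sum fun j hj => Real.cos_le_one_sub_mul_cos_sq ?_
      have hj' : |(j : ℝ)| ≤ m := by
        rw [Finset.mem_Icc] at hj
        rw [abs_le]; constructor
        · exact_mod_cast hj.1
        · exact_mod_cast hj.2
      rw [abs_mul, abs_mul, abs_two]
      have := abs_nonneg θ
      nlinarith
    have h2 : ∑ j ∈ Finset.Icc (-(m : ℤ)) m, (1 - 2 / Real.pi ^ 2 * (2 * j * θ) ^ 2) =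
        (2 * m + 1) - 8 / Real.pi ^ 2 * θ ^ 2 * ∑ j ∈ Finset.Icc (-(m : ℤ)) m, (j : ℝ) ^ 2 := by
      rw [Finset.sum_sub_distrib, sum_one_Icc, Finset.mul_sum]
      congr 1
      exact Finset.sum_congr rfl fun j _ => by ring
    have h3 := sum_sq_Icc m
    have h4 := min_le_right (1 / 2 : ℝ) (m ^ 2 * θ ^ 2 / 4)
    have h5 : (3 : ℝ) / 4 ≤ 8 / Real.pi ^ 2 := by
      rw [div_le_div_iff₀ (by norm_num) (by positivity)]
      nlinarith [Real.pi_lt_d2, Real.pi_gt_three]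
    have h6 : (2 * m + 1) * (m ^ 2 * θ ^ 2 / 4) ≤
        8 / Real.pi ^ 2 * θ ^ 2 * ∑ j ∈ Finset.Icc (-(m : ℤ)) m, (j : ℝ) ^ 2 := by
      calc (2 * m + 1) * (m ^ 2 * θ ^ 2 / 4) ≤ 3 / 4 * θ ^ 2 * (m * (m + 1) * (2 * m + 1) / 3) := by
            have : 0 ≤ θ ^ 2 * m * (2 * m + 1) := by positivity
            nlinarith
        _ ≤ 8 / Real.pi ^ 2 * θ ^ 2 * (m * (m + 1) * (2 * m + 1) / 3) := by gcongr
        _ = _ := by rw [← h3]; ring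
    have h7 : (2 * (m : ℝ) + 1) * min (1 / 2) (m ^ 2 * θ ^ 2 / 4) ≤
        (2 * m + 1) * (m ^ 2 * θ ^ 2 / 4) := by gcongr
    linarith

open Complex in
lemma norm_sum_exp_le {J : Finset ℤ} {u : ℤ → ℝ} (hu : ∀ j, 0 ≤ u j) {m : ℕ} {c S θ : ℝ}
    (hS : ∑ j ∈ J, u j ≤ S) (hm : Finset.Icc (-(m : ℤ)) m ⊆ J) (hc : 0 ≤ c)
    (hcu : ∀ j ∈ Finset.Icc (-(m : ℤ)) m, c * S ≤ (2 * m + 1) * u j)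
    (hθ : |θ| ≤ Real.pi / 2) :
    ‖∑ j ∈ J, (u j : ℂ) * cexp (I * θ * (2 * j : ℤ))‖ ≤
      S * Real.exp (-c * min (1 / 2) (m ^ 2 * θ ^ 2 / 4)) := by
  set K := Finset.Icc (-(m : ℤ)) m with hK
  set M : ℝ := 2 * m + 1 with hM
  have hM0 : 0 < M := by positivity
  set a : ℝ := c * S / M with ha
  have hS0 : 0 ≤ S := (Finset.sum_nonneg fun j _ => hu j).trans hS
  have ha0 : 0 ≤ a := by positivity
  have hau : ∀ j ∈ K, a ≤ u j := fun j hj => by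
    rw [ha, div_le_iff₀ hM0]; linarith [hcu j hj]
  set e : ℤ → ℂ := fun j => cexp (I * θ * (2 * j : ℤ)) with he
  have hen : ∀ j, ‖e j‖ = 1 := fun j => by
    have : I * θ * (2 * j : ℤ) = ((θ * (2 * j : ℤ) : ℝ) : ℂ) * I := by push_cast; ring
    rw [he]; dsimp only; rw [this, Complex.norm_exp_ofReal_mul_I]
  have hsplit : ∑ j ∈ J, (u j : ℂ) * e j =
      ∑ j ∈ J, ((u j - if j ∈ K then a else 0 : ℝ) : ℂ) * e j + a * ∑ j ∈ K, e j := by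
    have : ∑ j ∈ K, (a : ℂ) * e j = ∑ j ∈ J, if j ∈ K then (a : ℂ) * e j else 0 := by
      rw [← Finset.sum_filter, Finset.filter_mem_eq_inter, Finset.inter_eq_right.2 hm]
    rw [Finset.mul_sum, this, ← Finset.sum_add_distrib]
    refine Finset.sum_congr rfl fun j _ => ?_
    split_ifs <;> push_cast <;> ring
  have h1 : ‖∑ j ∈ J, ((u j - if j ∈ K then a else 0 : ℝ) : ℂ) * e j‖ ≤ S - M * a := by
    refine (norm_sum_le _ _).trans ?_
    have : ∀ j ∈ J, ‖((u j - if j ∈ K then a else 0 : ℝ) : ℂ) * e j‖ =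
        u j - if j ∈ K then a else 0 := fun j _ => by
      rw [norm_mul, hen, mul_one, Complex.norm_real, Real.norm_of_nonneg]
      split_ifs with h
      · linarith [hau j h]
      · simpa using hu j
    rw [Finset.sum_congr rfl this, Finset.sum_sub_distrib, ← Finset.sum_filter,
      Finset.filter_mem_eq_inter, Finset.inter_eq_right.2 hm]
    have h : ∑ _j ∈ K, a = M * a := by
      rw [hM, ← sum_one_Icc m, Finset.sum_mul]; simp only [one_mul, hK]
    linarith
  have h2 : ∑ j ∈ K, e j = ((∑ j ∈ K, Real.cos (2 * j * θ) : ℝ) : ℂ) := by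
    have hneg : ∑ j ∈ K, e j = ∑ j ∈ K, e (-j) := by
      refine Finset.sum_nbij' (fun j => -j) (fun j => -j) ?_ ?_ ?_ ?_ ?_ <;>
        simp [hK] <;> intros <;> constructor <;> linarith
    have : ∑ j ∈ K, e j = ∑ j ∈ K, (e j + e (-j)) / 2 := by
      rw [← Finset.sum_div, Finset.sum_add_distrib, ← hneg]; ring
    rw [this]
    push_cast
    refine Finset.sum_congr rfl fun j _ => ?_
    rw [Complex.cos]
    simp only [he]
    congr 2 <;> · congr 1; push_cast; ring
  have h3 := dirichlet_le (m := m) hθ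
  rw [hsplit]
  refine (norm_add_le _ _).trans ?_
  rw [norm_mul, h2, Complex.norm_real, Complex.norm_real, Real.norm_of_nonneg ha0, Real.norm_eq_abs]
  set w := min (1 / 2) ((m : ℝ) ^ 2 * θ ^ 2 / 4) with hw
  have h4 := Real.add_one_le_exp (-c * w)
  calc _ ≤ (S - M * a) + a * (M * (1 - w)) := by gcongr
    _ = S * (-c * w + 1) := by rw [ha]; field_simp; ring
    _ ≤ _ := by gcongr

open Complex in
lemma pi_mul_sum_fiber_le {p : ℕ} {J : Finset ℤ} {u : ℤ → ℝ} (hu : ∀ j, 0 ≤ u j) (s : ℤ)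
    {b : ℝ → ℝ} (hb : ∀ θ : ℝ, |θ| ≤ Real.pi / 2 →
      ‖∑ j ∈ J, (u j : ℂ) * cexp (I * θ * (2 * j : ℤ))‖ ^ p ≤ b θ)
    (hbi : IntegrableOn b (Ioc (-(Real.pi / 2)) (Real.pi / 2))) :
    Real.pi * ∑ j ∈ (Fintype.piFinset fun _ : Fin p => J) with ∑ i, j i = s, ∏ i, u (j i) ≤
      ∫ θ in Ioc (-(Real.pi / 2)) (Real.pi / 2), b θ := by
  have hid : ((Real.pi * ∑ j ∈ (Fintype.piFinset fun _ : Fin p => J) with ∑ i, j i = s,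
      ∏ i, u (j i) : ℝ) : ℂ) = ∫ θ in Ioc (-(Real.pi / 2)) (Real.pi / 2),
        (∑ j ∈ J, (u j : ℂ) * cexp (I * θ * (2 * j : ℤ))) ^ p * cexp (I * θ * (2 * -s : ℤ)) := by
    have h1 : ∀ θ : ℝ, (∑ j ∈ J, (u j : ℂ) * cexp (I * θ * (2 * j : ℤ))) ^ p *
        cexp (I * θ * (2 * -s : ℤ)) = ∑ j ∈ Fintype.piFinset fun _ : Fin p => J,
          ((∏ i, u (j i) : ℝ) : ℂ) * cexp (I * θ * (2 * (∑ i, j i - s) : ℤ)) := by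
      intro θ
      rw [Finset.sum_pow', Finset.sum_mul]
      refine Finset.sum_congr rfl fun j _ => ?_
      rw [Finset.prod_mul_distrib, ← Complex.exp_sum, mul_assoc, ← Complex.exp_add]
      push_cast
      congr 2
      rw [← Finset.mul_sum, ← Finset.mul_sum]; ring
    simp_rw [h1]
    rw [integral_finsetSum]
    · simp_rw [integral_const_mul, integral_exp_int_even (even_two_mul _)]
      rw [Finset.sum_filter]
      push_cast
      rw [Finset.mul_sum]
      refine Finset.sum_congr rfl fun j _ => ?_
      by_cases h : ∑ i, j i = s
      · rw [if_pos h, if_pos (by rw [h]; ring)]; push_cast; ring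
      · rw [if_neg h, if_neg (by intro h'; exact h (by omega))]; simp
    · intro j _
      exact (Continuous.integrableOn_Ioc (by fun_prop))
  have hnn : 0 ≤ Real.pi * ∑ j ∈ (Fintype.piFinset fun _ : Fin p => J) with ∑ i, j i = s,
      ∏ i, u (j i) :=
    mul_nonneg Real.pi_pos.le (Finset.sum_nonneg fun j _ => Finset.prod_nonneg fun i _ => hu _)
  rw [← Real.norm_of_nonneg hnn, ← Complex.norm_real, hid]
  refine norm_integral_le_of_norm_le hbi ?_
  refine (ae_restrict_iff' measurableSet_Ioc).2 (Filter.Eventually.of_forall fun θ hθ => ?_)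
  rw [norm_mul, norm_pow]
  have : I * θ * (2 * -s : ℤ) = ((θ * (2 * -s : ℤ) : ℝ) : ℂ) * I := by push_cast; ring
  rw [this, Complex.norm_exp_ofReal_mul_I, mul_one]
  exact hb θ (abs_le.2 ⟨hθ.1.le, hθ.2⟩)

/-- A local limit upper bound for sums of integer weights. -/
lemma sum_fiber_le {p : ℕ} {J : Finset ℤ} {u : ℤ → ℝ} (hu : ∀ j, 0 ≤ u j) {m : ℕ} {c S : ℝ}
    (hp : 0 < p) (hm0 : 0 < m)
    (hS : ∑ j ∈ J, u j ≤ S) (hm : Finset.Icc (-(m : ℤ)) m ⊆ J) (hc : 0 < c)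
    (hcu : ∀ j ∈ Finset.Icc (-(m : ℤ)) m, c * S ≤ (2 * m + 1) * u j) (s : ℤ) :
    ∑ j ∈ (Fintype.piFinset fun _ : Fin p => J) with ∑ i, j i = s, ∏ i, u (j i) ≤
      S ^ p * (Real.exp (-(p * c / 2)) + 2 / (m * Real.sqrt (p * c))) := by
  have hS0 : 0 ≤ S := (Finset.sum_nonneg fun j _ => hu j).trans hS
  have hp' : (0 : ℝ) < p := by exact_mod_cast hp
  have hm' : (0 : ℝ) < m := by exact_mod_cast hm0
  set g : ℝ := p * c * m ^ 2 / 4 with hg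
  have hg0 : 0 < g := by positivity
  set b : ℝ → ℝ := fun θ => S ^ p * (Real.exp (-(p * c / 2)) + Real.exp (-g * θ ^ 2)) with hb
  have hgi : Integrable fun θ : ℝ => Real.exp (-g * θ ^ 2) := integrable_exp_neg_mul_sq hg0
  have hbi : IntegrableOn b (Ioc (-(Real.pi / 2)) (Real.pi / 2)) := by
    simp only [hb]
    exact Continuous.integrableOn_Ioc (by fun_prop)
  have hmain := pi_mul_sum_fiber_le (p := p) hu s (J := J) (b := b) ?_ hbi
  · have hinteg : ∫ θ in Ioc (-(Real.pi / 2)) (Real.pi / 2), b θ ≤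
        S ^ p * (Real.pi * Real.exp (-(p * c / 2)) + Real.sqrt (Real.pi / g)) := by
      simp only [hb]
      rw [integral_const_mul]
      gcongr
      rw [integral_add (by simp) hgi.integrableOn]
      have h1 : ∫ θ in Ioc (-(Real.pi / 2)) (Real.pi / 2), Real.exp (-g * θ ^ 2) ≤
          Real.sqrt (Real.pi / g) := by
        rw [← integral_gaussian]
        exact setIntegral_le_integral hgi (Filter.Eventually.of_forall fun θ => (Real.exp_pos _).le)
      have h2 : ∫ _θ in Ioc (-(Real.pi / 2)) (Real.pi / 2), Real.exp (-(p * c / 2)) =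
          Real.pi * Real.exp (-(p * c / 2)) := by
        have : Real.pi / 2 + Real.pi / 2 = Real.pi := by ring
        simp [this, Real.pi_pos.le]
      linarith
    have hsq : Real.sqrt (Real.pi / g) ≤ Real.pi * (2 / (m * Real.sqrt (p * c))) := by
      rw [Real.sqrt_le_left (by positivity), mul_pow, div_pow, mul_pow, Real.sq_sqrt (by positivity),
        hg]
      have : Real.pi / (p * c * m ^ 2 / 4) = Real.pi * (2 ^ 2 / (m ^ 2 * (p * c))) := by
        field_simp; norm_num
      rw [this]
      gcongr
      nlinarith [Real.pi_gt_three]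
    rw [← mul_le_mul_iff_right₀ Real.pi_pos]
    refine hmain.trans (hinteg.trans ?_)
    calc _ ≤ S ^ p * (Real.pi * Real.exp (-(p * c / 2)) +
          Real.pi * (2 / (m * Real.sqrt (p * c)))) := by gcongr
      _ = _ := by ring
  · intro θ hθ
    have h := norm_sum_exp_le hu hS hm hc.le hcu hθ
    refine (pow_le_pow_left₀ (norm_nonneg _) h p).trans ?_
    rw [mul_pow, ← Real.exp_nat_mul]
    simp only [hb]
    gcongr
    rcases le_total (1 / 2 : ℝ) (m ^ 2 * θ ^ 2 / 4) with h' | h'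
    · rw [min_eq_left h', show (p : ℝ) * (-c * (1 / 2)) = -(p * c / 2) by ring]
      linarith [Real.exp_pos (-g * θ ^ 2)]
    · rw [min_eq_right h', show (p : ℝ) * (-c * (m ^ 2 * θ ^ 2 / 4)) = -g * θ ^ 2 by
        rw [hg]; ring]
      linarith [Real.exp_pos (-(p * c / 2))]

lemma stdPdf_mul_exp_sq (κ g : ℝ) : stdPdf g * Real.exp (κ * g ^ 2 / 2) =
    (Real.sqrt (2 * Real.pi))⁻¹ * Real.exp (-((1 - κ) / 2) * g ^ 2) := by
  unfold stdPdf
  rw [mul_assoc, ← Real.exp_add]; ring_nf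

lemma integrable_stdPdf_mul_exp_sq {κ : ℝ} (hκ : κ < 1) :
    Integrable fun g => stdPdf g * Real.exp (κ * g ^ 2 / 2) := by
  simp_rw [stdPdf_mul_exp_sq]
  exact (integrable_exp_neg_mul_sq (by linarith)).const_mul _

lemma integral_stdPdf_mul_exp_sq {κ : ℝ} (hκ : κ < 1) :
    ∫ g, stdPdf g * Real.exp (κ * g ^ 2 / 2) = (Real.sqrt (1 - κ))⁻¹ := by
  have h : 0 < 1 - κ := by linarith
  simp_rw [stdPdf_mul_exp_sq]
  rw [integral_const_mul, integral_gaussian, ← Real.sqrt_inv, ← Real.sqrt_inv,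
    ← Real.sqrt_mul (by positivity)]
  congr 1
  field_simp

lemma sum_exp_sq_mul_prod_le {p : ℕ} {J : Finset ℤ} {u : ℤ → ℝ} (hu : ∀ j, 0 ≤ u j)
    {S κ a : ℝ} (hκ : κ < 1) (hp : 0 < p) (ha : 0 < a)
    (h : ∀ t, ∑ j ∈ J, u j * Real.exp (t * (2 * j)) ≤ S * Real.exp (κ * (a * t ^ 2) / 2)) :
    ∑ j ∈ Fintype.piFinset fun _ : Fin p => J,
      Real.exp ((∑ i, 2 * (j i : ℝ)) ^ 2 / (2 * (p * a))) * ∏ i, u (j i) ≤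
        S ^ p * (Real.sqrt (1 - κ))⁻¹ := by
  have hp0 : (0 : ℝ) < p := by exact_mod_cast hp
  have hpa : 0 < p * a := by positivity
  have h1 : ∀ g : ℝ, ∑ j ∈ Fintype.piFinset fun _ : Fin p => J,
      stdPdf g * Real.exp ((∑ i, 2 * (j i : ℝ)) / Real.sqrt (p * a) * g) * ∏ i, u (j i) ≤
        S ^ p * (stdPdf g * Real.exp (κ * g ^ 2 / 2)) := by
    intro g
    have h2 : ∑ j ∈ Fintype.piFinset fun _ : Fin p => J,
        stdPdf g * Real.exp ((∑ i, 2 * (j i : ℝ)) / Real.sqrt (p * a) * g) * ∏ i, u (j i) =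
          stdPdf g * (∑ j ∈ J, u j * Real.exp (g / Real.sqrt (p * a) * (2 * j))) ^ p := by
      rw [Finset.sum_pow', Finset.mul_sum]
      refine Finset.sum_congr rfl fun j _ => ?_
      have h5 : (∑ i, 2 * (j i : ℝ)) / Real.sqrt (p * a) * g =
          ∑ i, g / Real.sqrt (p * a) * (2 * (j i : ℝ)) := by
        rw [Finset.sum_div, Finset.sum_mul]
        exact Finset.sum_congr rfl fun i _ => by ring
      rw [Finset.prod_mul_distrib, ← Real.exp_sum, h5]
      ring
    rw [h2]
    have h3 : (∑ j ∈ J, u j * Real.exp (g / Real.sqrt (p * a) * (2 * j))) ^ p ≤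
        (S * Real.exp (κ * (a * (g / Real.sqrt (p * a)) ^ 2) / 2)) ^ p :=
      pow_le_pow_left₀ (Finset.sum_nonneg fun j _ => mul_nonneg (hu _) (Real.exp_pos _).le) (h _) p
    rw [mul_pow, ← Real.exp_nat_mul, div_pow, Real.sq_sqrt hpa.le] at h3
    rw [show (p : ℝ) * (κ * (a * (g ^ 2 / (p * a))) / 2) = κ * g ^ 2 / 2 by field_simp] at h3
    have := mul_le_mul_of_nonneg_left h3 (stdPdf_pos g).le
    linarith
  have hinteg : ∀ j ∈ Fintype.piFinset fun _ : Fin p => J, Integrable fun g =>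
      stdPdf g * Real.exp ((∑ i, 2 * (j i : ℝ)) / Real.sqrt (p * a) * g) * ∏ i, u (j i) :=
    fun j _ => (integrable_stdPdf_mul_exp _).mul_const _
  rw [← integral_stdPdf_mul_exp_sq hκ, ← integral_const_mul]
  have h4 := integral_mono (integrable_finsetSum _ hinteg)
    ((integrable_stdPdf_mul_exp_sq hκ).const_mul (S ^ p)) h1
  rw [integral_finsetSum _ hinteg] at h4
  refine le_trans (le_of_eq ?_) h4
  refine Finset.sum_congr rfl fun j _ => ?_
  rw [integral_mul_const, integral_stdPdf_mul_exp, div_pow, Real.sq_sqrt hpa.le]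
  congr 2
  field_simp

lemma vtxMass_le_one {p q : ℝ} (hp : 0 < p) (hq : 0 < q) (s : ℝ) : vtxMass p q s ≤ 1 := by
  rw [vtxMass_eq hp hq]
  unfold stdMass
  rw [← integral_stdPdf]
  refine integral_mono (integrable_stdMass _ _ _) integrable_stdPdf fun x => ?_
  simp only [zero_mul, Real.exp_zero, mul_one]
  exact mul_le_of_le_one_right (stdPdf_pos x).le (gaussTail_le_one _)

/-- Weighted number of pairs of even sequences with equal sums. -/
noncomputable def pairSum (p q : ℕ) (s s' : ℝ) : ℝ :=
  ∑ j ∈ Fintype.piFinset fun _ : Fin p => Finset.Icc (-(q : ℤ)) q,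
    ∑ j' ∈ (Fintype.piFinset fun _ : Fin q => Finset.Icc (-(p : ℤ)) p) with
        ∑ i, j' i = ∑ i, j i,
      Real.exp ((∑ i, 2 * (j i : ℝ)) ^ 2 / (2 * (p * q))) *
        ((∏ i, vtxWeight p q s (2 * j i)) * ∏ i, vtxWeight q p s' (2 * j' i))

lemma pairSum_le {p q : ℕ} {s s' S K κ : ℝ} (hp : 0 < p) (hq : 0 < q) (hκ : κ < 1)
    (h : ∀ t : ℝ, ∑ j ∈ Finset.Icc (-(q : ℤ)) q, vtxWeight p q s (2 * j) * Real.exp (t * (2 * j)) ≤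
      S * Real.exp (κ * (q * t ^ 2) / 2))
    (h' : ∀ m : ℤ, ∑ j' ∈ (Fintype.piFinset fun _ : Fin q => Finset.Icc (-(p : ℤ)) p) with
        ∑ i, j' i = m, ∏ i, vtxWeight q p s' (2 * j' i) ≤ K) :
    pairSum p q s s' ≤ S ^ p * (Real.sqrt (1 - κ))⁻¹ * K := by
  have hK : 0 ≤ K := (Finset.sum_nonneg fun j _ =>
    Finset.prod_nonneg fun i _ => vtxWeight_nonneg _ _ _ _).trans (h' 0)
  have hq0 : (0 : ℝ) < q := by exact_mod_cast hq
  unfold pairSum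
  have := sum_exp_sq_mul_prod_le (u := fun j => vtxWeight p q s (2 * j))
    (fun j => vtxWeight_nonneg _ _ _ _) hκ hp hq0 h
  refine le_trans ?_ (mul_le_mul_of_nonneg_right this hK)
  rw [Finset.sum_mul]
  refine Finset.sum_le_sum fun j _ => ?_
  simp_rw [← mul_assoc]
  rw [← Finset.mul_sum]
  have h2 : (0 : ℝ) ≤ ∏ i, vtxWeight p q s (2 * j i) :=
    Finset.prod_nonneg fun i _ => vtxWeight_nonneg _ _ _ _
  gcongr
  exact h' _

lemma sum_two_mul_eq (J : Finset ℤ) (f : ℤ → ℝ) :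
    ∑ a ∈ J.image (fun j => 2 * j), f a = ∑ j ∈ J, f (2 * j) :=
  Finset.sum_image fun a _ b _ h => by simpa using h

lemma vtxWeight_ge {p q s B b₀ x : ℝ} (hp : 0 < p) (hq : 0 < q) (hb₀ : 0 < b₀) (hpq : b₀ * q ≤ p)
    (hs : |s| ≤ B * Real.sqrt p) (hx : x ^ 2 ≤ q) :
    Real.sqrt (2 / Real.pi) * Real.exp (-2) * gaussTail (B + 2 * Real.sqrt b₀⁻¹) / Real.sqrt q ≤
      vtxWeight p q s (2 * x) := by
  have hsp := Real.sqrt_pos.2 hp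
  have h1 : (s + |2 * x|) / Real.sqrt p ≤ B + 2 * Real.sqrt b₀⁻¹ := by
    rw [div_le_iff₀ hsp, add_mul]
    have h2 : |x| ≤ Real.sqrt b₀⁻¹ * Real.sqrt p := by
      rw [← Real.sqrt_mul (by positivity)]
      apply Real.abs_le_sqrt
      rw [inv_mul_eq_div, le_div_iff₀ hb₀]
      nlinarith
    rw [abs_mul, abs_two]
    linarith [le_abs_self s]
  have h3 : Real.sqrt (2 / Real.pi) * Real.exp (-2) / Real.sqrt q ≤ dblGauss q (2 * x) := by
    unfold dblGauss
    rw [← div_div, Real.sqrt_div' (2 / Real.pi) hq.le, div_mul_eq_mul_div]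
    gcongr
    rw [neg_div, neg_le_neg_iff, div_le_iff₀ (by positivity)]
    nlinarith
  unfold vtxWeight
  calc _ = Real.sqrt (2 / Real.pi) * Real.exp (-2) / Real.sqrt q *
        gaussTail (B + 2 * Real.sqrt b₀⁻¹) := by ring
    _ ≤ _ := by
      gcongr
      · exact gaussTail_nonneg _
      · exact dblGauss_nonneg _ _
      · exact gaussTail_anti h1

lemma sqrt_le_natSqrt_succ (p : ℕ) : Real.sqrt p ≤ Nat.sqrt p + 1 := by
  rw [Real.sqrt_le_left (by positivity)]
  exact_mod_cast (Nat.lt_succ_sqrt' p).le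

lemma exp_neg_le_inv {x : ℝ} (hx : 0 < x) : Real.exp (-x) ≤ 1 / x := by
  rw [Real.exp_neg, one_div]
  exact inv_anti₀ hx (by linarith [Real.add_one_le_exp x])

lemma exists_fiber_vtxWeight_le (B : ℝ) {b₀ : ℝ} (hb₀ : 0 < b₀) :
    ∃ C : ℝ, 0 < C ∧ ∀ p q : ℕ, 0 < p → 0 < q → b₀ * p ≤ q → b₀ * q ≤ p → ∀ s : ℝ,
      |s| ≤ B * Real.sqrt p → ∀ m : ℤ,
      ∑ j ∈ (Fintype.piFinset fun _ : Fin p => Finset.Icc (-(q : ℤ)) q) with ∑ i, j i = m,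
        ∏ i, vtxWeight p q s (2 * j i) ≤ C / Real.sqrt (p * q) * vtxMass p q s ^ p := by
  obtain ⟨κ, C, -, -, hC, h⟩ := exists_sum_vtxWeight_mul_exp_le B hb₀
  set c₀ : ℝ := Real.sqrt (2 / Real.pi) * Real.exp (-2) * gaussTail (B + 2 * Real.sqrt b₀⁻¹)
    with hc₀
  have hc₀0 : 0 < c₀ := by
    have := gaussTail_pos (B + 2 * Real.sqrt b₀⁻¹)
    have := Real.pi_pos
    positivity
  set c : ℝ := c₀ * Real.exp (-C) with hc
  have hc0 : 0 < c := by positivity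
  refine ⟨Real.exp C * (2 / c / Real.sqrt b₀ + 4 / Real.sqrt c), by positivity, ?_⟩
  intro p q hp hq hpq hqp s hs m
  have hp0 : (0 : ℝ) < p := by exact_mod_cast hp
  have hq0 : (0 : ℝ) < q := by exact_mod_cast hq
  have hp1 : (1 : ℝ) ≤ p := by exact_mod_cast hp
  have hq1 : (1 : ℝ) ≤ q := by exact_mod_cast hq
  have hV := vtxMass_pos hp0 hq0 s
  set S : ℝ := Real.exp (C / p) * vtxMass p q s with hS
  set k : ℕ := Nat.sqrt q with hk
  have hk1 : 1 ≤ k := Nat.le_sqrt'.2 (by rw [one_pow]; exact hq)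
  have hk1' : (1 : ℝ) ≤ k := by exact_mod_cast hk1
  have hkq : Real.sqrt q ≤ k + 1 := sqrt_le_natSqrt_succ q
  have hsum : ∑ j ∈ Finset.Icc (-(q : ℤ)) q, vtxWeight p q s (2 * j) ≤ S := by
    have := h p q s hp1 hq1 hpq hqp hs ((Finset.Icc (-(q : ℤ)) q).image fun j => 2 * j)
      (by simp only [Finset.mem_image]; rintro a ⟨j, -, rfl⟩; exact even_two_mul j) 0
    rw [sum_two_mul_eq] at this
    simpa using this
  have hkk : (k : ℤ) ≤ q := by exact_mod_cast Nat.sqrt_le_self q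
  have hm := sum_fiber_le (p := p) (J := Finset.Icc (-(q : ℤ)) q)
    (u := fun j => vtxWeight p q s (2 * j)) (fun j => vtxWeight_nonneg _ _ _ _) hp hk1 hsum
    (Finset.Icc_subset_Icc (by omega) hkk) hc0 (fun j hj => ?_) m
  · refine hm.trans ?_
    have hSp : S ^ p = Real.exp C * vtxMass p q s ^ p := by
      rw [hS, mul_pow, ← Real.exp_nat_mul]
      congr 2
      field_simp
    have hpqs : 0 < Real.sqrt (p * q) := Real.sqrt_pos.2 (by positivity)
    have h1 : Real.exp (-(p * c / 2)) ≤ 2 / c / Real.sqrt b₀ / Real.sqrt (p * q) := by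
      refine (exp_neg_le_inv (by positivity)).trans ?_
      have : Real.sqrt b₀ * Real.sqrt (p * q) ≤ p := by
        rw [← Real.sqrt_mul hb₀.le, Real.sqrt_le_left hp0.le]
        nlinarith
      rw [show 1 / (p * c / 2) = 2 / c / p by field_simp, div_div _ (Real.sqrt b₀)]
      gcongr
    have h2 : 2 / (k * Real.sqrt (p * c)) ≤ 4 / Real.sqrt c / Real.sqrt (p * q) := by
      rw [Real.sqrt_mul hp0.le, Real.sqrt_mul hp0.le, div_div, div_le_div_iff₀ (by positivity)
        (by positivity)]
      have : Real.sqrt q ≤ 2 * k := by linarith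
      calc 2 * (Real.sqrt c * (Real.sqrt p * Real.sqrt q))
          ≤ 2 * (Real.sqrt c * (Real.sqrt p * (2 * k))) := by gcongr
        _ = _ := by ring
    rw [hSp]
    calc _ ≤ Real.exp C * vtxMass p q s ^ p *
          (2 / c / Real.sqrt b₀ / Real.sqrt (p * q) + 4 / Real.sqrt c / Real.sqrt (p * q)) := by
          gcongr
      _ = _ := by ring
  · have hj' : ((j : ℝ)) ^ 2 ≤ q := by
      have h1 : |j| ≤ k := abs_le.2 (Finset.mem_Icc.1 hj)
      have h2 : j ^ 2 ≤ (k : ℤ) ^ 2 := sq_le_sq' (abs_le.1 h1).1 (abs_le.1 h1).2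
      have h3 : (k : ℤ) ^ 2 ≤ q := by exact_mod_cast Nat.sqrt_le' q
      exact_mod_cast h2.trans h3
    have h4 := vtxWeight_ge hp0 hq0 hb₀ hqp hs hj'
    rw [← hc₀] at h4
    have h5 : c * S ≤ c₀ := by
      have h6 : S ≤ Real.exp C := by
        rw [hS]
        have := vtxMass_le_one hp0 hq0 s
        have : C / p ≤ C := div_le_self hC.le hp1
        calc _ ≤ Real.exp C * 1 := by gcongr
          _ = _ := mul_one _
      calc c * S ≤ c * Real.exp C := by gcongr
        _ = c₀ := by rw [hc, mul_assoc, ← Real.exp_add]; simp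
    refine h5.trans ?_
    have h7 : Real.sqrt q ≤ 2 * k + 1 := by linarith
    have h8 : 0 < Real.sqrt q := Real.sqrt_pos.2 hq0
    calc c₀ = Real.sqrt q * (c₀ / Real.sqrt q) := by field_simp
      _ ≤ _ := by gcongr

lemma exists_near_pairSum_le (B : ℝ) {b₀ : ℝ} (hb₀ : 0 < b₀) :
    ∃ C : ℝ, 0 < C ∧ ∀ p q : ℕ, 0 < p → 0 < q → b₀ * p ≤ q → b₀ * q ≤ p → ∀ s s' : ℝ,
      |s| ≤ B * Real.sqrt p → |s'| ≤ B * Real.sqrt q →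
      Real.sqrt (p * q) * pairSum p q s s' ≤ C * (vtxMass p q s ^ p * vtxMass q p s' ^ q) := by
  obtain ⟨κ, C, hκ, hκ1, hC, h⟩ := exists_sum_vtxWeight_mul_exp_le B hb₀
  obtain ⟨C', hC', h'⟩ := exists_fiber_vtxWeight_le B hb₀
  have hκ2 : 0 < Real.sqrt (1 - κ) := Real.sqrt_pos.2 (by linarith)
  refine ⟨Real.exp C * (Real.sqrt (1 - κ))⁻¹ * C', by positivity, ?_⟩
  intro p q hp hq hpq hqp s s' hs hs'
  have hp0 : (0 : ℝ) < p := by exact_mod_cast hp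
  have hq0 : (0 : ℝ) < q := by exact_mod_cast hq
  have hp1 : (1 : ℝ) ≤ p := by exact_mod_cast hp
  have hq1 : (1 : ℝ) ≤ q := by exact_mod_cast hq
  have hV := vtxMass_pos hp0 hq0 s
  have hV' := vtxMass_pos hq0 hp0 s'
  have key := pairSum_le (p := p) (q := q) (s := s) (s' := s')
    (S := Real.exp (C / p) * vtxMass p q s) hp hq hκ1 (fun t => ?_)
    (h' q p hq hp hqp hpq s' hs')
  · have hpqs : 0 < Real.sqrt (p * q) := Real.sqrt_pos.2 (by positivity)
    rw [mul_pow, ← Real.exp_nat_mul, show (p : ℝ) * (C / p) = C by field_simp,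
      mul_comm (q : ℝ)] at key
    calc _ ≤ Real.sqrt (p * q) * _ := mul_le_mul_of_nonneg_left key hpqs.le
      _ = _ := by field_simp
  · have := h p q s hp1 hq1 hpq hqp hs ((Finset.Icc (-(q : ℤ)) q).image fun j => 2 * j)
      (by simp only [Finset.mem_image]; rintro a ⟨j, -, rfl⟩; exact even_two_mul j) t
    rw [sum_two_mul_eq] at this
    push_cast at this
    refine this.trans (le_of_eq (by ring))

lemma sum_vtxWeight_mul_exp_le_exp {p q : ℝ} (hq : 0 < q) (s t : ℝ) (J : Finset ℤ) :
    ∑ j ∈ J, vtxWeight p q s (2 * j) * Real.exp (t * (2 * j)) ≤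
      Real.exp (1 / (2 * q)) * Real.exp (q * t ^ 2 / 2) := by
  have h := sum_dblGauss_mul_exp_le hq (S := J.image fun j => 2 * j) ?_ t
  · rw [sum_two_mul_eq J fun a => dblGauss q a * Real.exp (t * a)] at h
    push_cast at h
    refine le_trans (Finset.sum_le_sum fun j _ => ?_) h
    gcongr
    exact vtxWeight_le _ _ _ _
  · simp only [Finset.mem_image]
    rintro a ⟨j, -, rfl⟩ b ⟨k, -, rfl⟩
    exact (even_two_mul j).sub (even_two_mul k)

lemma sum_prod_mul_exp_le {p : ℕ} {q a s : ℝ} (hq : 0 < q) (J : Finset ℤ) (t : ℝ) :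
    ∑ j ∈ Fintype.piFinset fun _ : Fin p => J,
      Real.exp (t * ∑ i, 2 * (j i : ℝ)) * ∏ i, vtxWeight a q s (2 * j i) ≤
        Real.exp (p / (2 * q)) * Real.exp (p * q * t ^ 2 / 2) := by
  have h2 : ∑ j ∈ Fintype.piFinset fun _ : Fin p => J,
      Real.exp (t * ∑ i, 2 * (j i : ℝ)) * ∏ i, vtxWeight a q s (2 * j i) =
        (∑ j ∈ J, vtxWeight a q s (2 * j) * Real.exp (t * (2 * j))) ^ p := by
    rw [Finset.sum_pow']
    refine Finset.sum_congr rfl fun j _ => ?_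
    rw [Finset.prod_mul_distrib, ← Real.exp_sum, Finset.mul_sum]
    ring
  rw [h2]
  have h3 := pow_le_pow_left₀ (Finset.sum_nonneg fun j _ =>
    mul_nonneg (vtxWeight_nonneg _ _ _ _) (Real.exp_pos _).le)
    (sum_vtxWeight_mul_exp_le_exp (p := a) hq s t J) p
  refine h3.trans (le_of_eq ?_)
  rw [mul_pow, ← Real.exp_nat_mul, ← Real.exp_nat_mul]
  congr 2 <;> ring

lemma pairSum_nonneg (p q : ℕ) (s s' : ℝ) : 0 ≤ pairSum p q s s' :=
  Finset.sum_nonneg fun _ _ => Finset.sum_nonneg fun _ _ =>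
    mul_nonneg (Real.exp_pos _).le (mul_nonneg
      (Finset.prod_nonneg fun _ _ => vtxWeight_nonneg _ _ _ _)
      (Finset.prod_nonneg fun _ _ => vtxWeight_nonneg _ _ _ _))

lemma exists_far_pairSum_le {b₀ : ℝ} (hb₀ : 0 < b₀) :
    ∃ C : ℝ, 0 < C ∧ ∀ p q : ℕ, 0 < p → 0 < q → b₀ * p ≤ q → b₀ * q ≤ p → ∀ s s' : ℝ,
      Real.sqrt (p * q) * pairSum p q s s' ≤ C * (p * q) ^ 2 := by
  refine ⟨3 * Real.exp (1 / b₀), by positivity, ?_⟩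
  intro p q hp hq hpq hqp s s'
  have hp0 : (0 : ℝ) < p := by exact_mod_cast hp
  have hq0 : (0 : ℝ) < q := by exact_mod_cast hq
  have hp1 : (1 : ℝ) ≤ p := by exact_mod_cast hp
  have hq1 : (1 : ℝ) ≤ q := by exact_mod_cast hq
  have hpq1 : (1 : ℝ) ≤ p * q := by nlinarith
  have hK : ∀ m : ℤ, ∑ j' ∈ (Fintype.piFinset fun _ : Fin q => Finset.Icc (-(p : ℤ)) p) with
      ∑ i, j' i = m, ∏ i, vtxWeight q p s' (2 * j' i) ≤ Real.exp (1 / b₀ / 2) := by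
    intro m
    have h := sum_prod_mul_exp_le (p := q) (a := q) (s := s') hp0 (Finset.Icc (-(p : ℤ)) p) 0
    simp only [zero_mul, Real.exp_zero, one_mul, ne_eq, OfNat.ofNat_ne_zero, not_false_eq_true,
      zero_pow, mul_zero, zero_div, mul_one] at h
    refine (Finset.sum_le_sum_of_subset_of_nonneg (Finset.filter_subset _ _)
      fun _ _ _ => Finset.prod_nonneg fun i _ => vtxWeight_nonneg _ _ _ _).trans (h.trans ?_)
    rw [Real.exp_le_exp, div_div, div_le_div_iff₀ (by positivity) (by positivity)]
    nlinarith
  have hE : ∑ j ∈ Fintype.piFinset fun _ : Fin p => Finset.Icc (-(q : ℤ)) q,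
      Real.exp ((∑ i, 2 * (j i : ℝ)) ^ 2 / (2 * (p * q))) * ∏ i, vtxWeight p q s (2 * j i) ≤
        (2 * (p * q) + 1) * Real.exp (1 / b₀ / 2) := by
    have hmaps : ∀ j ∈ Fintype.piFinset fun _ : Fin p => Finset.Icc (-(q : ℤ)) q,
        ∑ i, j i ∈ Finset.Icc (-((p * q : ℕ) : ℤ)) (p * q : ℕ) := by
      intro j hj
      rw [Fintype.mem_piFinset] at hj
      have h1 : ∀ i ∈ Finset.univ, |j i| ≤ (q : ℤ) := fun i _ => abs_le.2 (Finset.mem_Icc.1 (hj i))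
      have h2 : |∑ i, j i| ≤ ∑ i, |j i| := Finset.abs_sum_le_sum_abs (fun i => j i) Finset.univ
      have h3 : ∑ i, |j i| ≤ ∑ _i : Fin p, (q : ℤ) := Finset.sum_le_sum h1
      rw [Finset.sum_const, Finset.card_univ, Fintype.card_fin, nsmul_eq_mul] at h3
      rw [Finset.mem_Icc, ← abs_le]
      push_cast
      exact h2.trans h3
    rw [← Finset.sum_fiberwise_of_maps_to hmaps]
    have hcard : ((Finset.Icc (-((p * q : ℕ) : ℤ)) (p * q : ℕ)).card : ℝ) = 2 * (p * q) + 1 := by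
      rw [Int.card_Icc]
      have : ((p * q : ℕ) : ℤ) + 1 - -((p * q : ℕ) : ℤ) = ((2 * (p * q) + 1 : ℕ) : ℤ) := by
        push_cast; ring
      rw [this, Int.toNat_natCast]; push_cast; ring
    rw [← hcard]
    refine le_trans (Finset.sum_le_sum (g := fun _ => Real.exp (1 / b₀ / 2)) fun m _ => ?_)
      (le_of_eq (by rw [Finset.sum_const, nsmul_eq_mul]))
    have h := sum_prod_mul_exp_le (p := p) (a := p) (s := s) hq0 (Finset.Icc (-(q : ℤ)) q)
      (2 * m / (p * q))
    have h1 : ∑ j ∈ (Fintype.piFinset fun _ : Fin p => Finset.Icc (-(q : ℤ)) q) with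
        ∑ i, j i = m, Real.exp (2 * m / (p * q) * ∑ i, 2 * (j i : ℝ)) *
          ∏ i, vtxWeight p q s (2 * j i) ≤ _ :=
      (Finset.sum_le_sum_of_subset_of_nonneg (Finset.filter_subset _ _)
        fun _ _ _ => mul_nonneg (Real.exp_pos _).le
          (Finset.prod_nonneg fun i _ => vtxWeight_nonneg _ _ _ _)).trans h
    have h2 : ∑ j ∈ (Fintype.piFinset fun _ : Fin p => Finset.Icc (-(q : ℤ)) q) with
        ∑ i, j i = m, Real.exp ((∑ i, 2 * (j i : ℝ)) ^ 2 / (2 * (p * q))) *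
          ∏ i, vtxWeight p q s (2 * j i) =
        Real.exp (-(p * q * (2 * m / (p * q)) ^ 2 / 2)) *
          ∑ j ∈ (Fintype.piFinset fun _ : Fin p => Finset.Icc (-(q : ℤ)) q) with
        ∑ i, j i = m, Real.exp (2 * m / (p * q) * ∑ i, 2 * (j i : ℝ)) *
          ∏ i, vtxWeight p q s (2 * j i) := by
      rw [Finset.mul_sum]
      refine Finset.sum_congr rfl fun j hj => ?_
      have hjm : ∑ i, 2 * (j i : ℝ) = 2 * m := by
        rw [← (Finset.mem_filter.1 hj).2]; push_cast; rw [Finset.mul_sum]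
      have e : Real.exp ((2 * m : ℝ) ^ 2 / (2 * (p * q))) =
          Real.exp (-(p * q * (2 * m / (p * q)) ^ 2 / 2)) *
            Real.exp (2 * m / (p * q) * (2 * m)) := by
        rw [← Real.exp_add]
        congr 1
        field_simp
        ring
      rw [hjm, e, mul_assoc]
    rw [h2]
    calc _ ≤ Real.exp (-(p * q * (2 * m / (p * q)) ^ 2 / 2)) *
          (Real.exp (p / (2 * q)) * Real.exp (p * q * (2 * m / (p * q)) ^ 2 / 2)) := by gcongr
      _ = Real.exp (p / (2 * q)) := by
          rw [mul_left_comm, ← Real.exp_add]; simp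
      _ ≤ _ := by
          rw [Real.exp_le_exp, div_div, div_le_div_iff₀ (by positivity) (by positivity)]
          nlinarith
  have hpair : pairSum p q s s' ≤ (2 * (p * q) + 1) * Real.exp (1 / b₀ / 2) *
      Real.exp (1 / b₀ / 2) := by
    unfold pairSum
    refine le_trans ?_ (mul_le_mul_of_nonneg_right hE (Real.exp_pos _).le)
    rw [Finset.sum_mul]
    refine Finset.sum_le_sum fun j _ => ?_
    simp_rw [← mul_assoc]
    rw [← Finset.mul_sum]
    have h2 : (0 : ℝ) ≤ ∏ i, vtxWeight p q s (2 * j i) :=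
      Finset.prod_nonneg fun i _ => vtxWeight_nonneg _ _ _ _
    gcongr
    exact hK _
  rw [mul_assoc, ← Real.exp_add, add_halves] at hpair
  have hsq : Real.sqrt (p * q) ≤ p * q := by
    rw [Real.sqrt_le_left (by positivity)]; nlinarith
  have hE0 := Real.exp_pos (1 / b₀)
  calc _ ≤ (p * q : ℝ) * ((2 * (p * q) + 1) * Real.exp (1 / b₀)) := by
        have : 0 ≤ (2 * (p * q : ℝ) + 1) * Real.exp (1 / b₀) := by positivity
        exact mul_le_mul hsq hpair (pairSum_nonneg _ _ _ _) (by positivity)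
    _ ≤ (p * q : ℝ) * ((3 * (p * q)) * Real.exp (1 / b₀)) := by gcongr; linarith
    _ = _ := by ring

/-- Probability that a random signing of the complete graph has all signed degrees at least `t`. -/
noncomputable def complProb (N : ℕ) (t : Fin N → ℤ) : ℝ :=
  ((Finset.univ.filter fun b : CEdge N → Bool =>
    ∀ i, t i ≤ signedDeg (fun e : CEdge N => e.1.1) (fun e => e.1.2) b i).card : ℝ) /
      2 ^ Fintype.card (CEdge N)

lemma complProb_nonneg (N : ℕ) (t : Fin N → ℤ) : 0 ≤ complProb N t := by
  unfold complProb; positivity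

lemma integrable_exp_mul_prod_gaussTail {I : Type*} [Fintype I] (a : I → ℝ) (b : ℝ) :
    Integrable fun z : ℝ => Real.exp (-z ^ 2 / 2) * ∏ i, gaussTail ((a i - z) / b) := by
  refine integrable_exp_neg_half_sq.mono' (by fun_prop) (Filter.Eventually.of_forall fun z => ?_)
  have h0 : 0 ≤ ∏ i, gaussTail ((a i - z) / b) := Finset.prod_nonneg fun i _ => gaussTail_nonneg _
  have h1 : ∏ i, gaussTail ((a i - z) / b) ≤ 1 :=
    Finset.prod_le_one (fun i _ => gaussTail_nonneg _) fun i _ => gaussTail_le_one _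
  rw [Real.norm_of_nonneg (by positivity)]
  exact mul_le_of_le_one_right (Real.exp_pos _).le h1

lemma exists_complProb_le : ∃ C : ℝ, 0 < C ∧ ∃ N₀ : ℕ, 0 < N₀ ∧ ∀ N : ℕ, N₀ ≤ N →
    ∀ t : Fin N → ℤ, complProb N t ≤
      C * ∫ z, Real.exp (-z ^ 2 / 2) * ∏ i, gaussTail ((t i - 1 - z) / Real.sqrt N) := by
  obtain ⟨C, hC, N₀, hN₀, h⟩ := exists_complete_degProb_le
  refine ⟨C * Real.exp (1 / 2), by positivity, N₀, hN₀, fun N hN t => ?_⟩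
  have hNpos : (0 : ℝ) < N := by exact_mod_cast hN₀.trans_le hN
  set D : (CEdge N → Bool) → Fin N → ℤ :=
    signedDeg (fun e : CEdge N => e.1.1) (fun e => e.1.2) with hD
  set A : Fin N → Finset ℤ := fun i =>
    (Finset.univ.image fun b : CEdge N → Bool => D b i).filter fun a => t i ≤ a with hA
  have hAeven : ∀ i, ∀ a ∈ A i, ∀ b ∈ A i, Even (a - b) := by
    intro i a ha b hb
    simp only [hA, Finset.mem_filter, Finset.mem_image] at ha hb
    obtain ⟨⟨x, -, rfl⟩, -⟩ := ha
    obtain ⟨⟨y, -, rfl⟩, -⟩ := hb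
    exact signedDeg_sub_even _ _ _ _ _
  have hAt : ∀ i, ∀ a ∈ A i, ((t i : ℤ) : ℝ) ≤ a := by
    intro i a ha
    exact_mod_cast (Finset.mem_filter.1 ha).2
  have h1 : complProb N t = ∑ d ∈ Fintype.piFinset A,
      degProb (fun e : CEdge N => e.1.1) (fun e => e.1.2) d := by
    unfold complProb degProb
    rw [← Finset.sum_div]
    congr 1
    rw [Finset.card_eq_sum_card_fiberwise (f := D) (t := Fintype.piFinset A)]
    · push_cast
      refine Finset.sum_congr rfl fun d hd => ?_
      congr 2
      ext b
      simp only [Finset.mem_filter, Finset.mem_univ, true_and]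
      constructor
      · rintro ⟨-, rfl⟩ i; rfl
      · intro hb
        have hbd : D b = d := funext hb
        refine ⟨fun i => ?_, hbd⟩
        have := Fintype.mem_piFinset.1 hd i
        have h2 := (Finset.mem_filter.1 this).2
        rw [← hbd] at h2
        exact h2
    · intro b hb
      simp only [Finset.coe_filter, Finset.mem_univ, true_and, Set.mem_ofPred_eq] at hb
      simp only [Finset.mem_coe, Fintype.mem_piFinset, hA, Finset.mem_filter, Finset.mem_image,
        Finset.mem_univ, true_and]
      exact fun i => ⟨⟨b, rfl⟩, hb i⟩
  have hinteg : ∀ d ∈ Fintype.piFinset A, Integrable fun z : ℝ =>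
      Real.exp (-z ^ 2 / 2) * ∏ i, dblGauss N (d i - z) :=
    fun d _ => integrable_exp_mul_prod_dblGauss hNpos.le fun i => (d i : ℝ)
  have h2 : ∀ z : ℝ, ∑ d ∈ Fintype.piFinset A,
      Real.exp (-z ^ 2 / 2) * ∏ i, dblGauss N (d i - z) ≤
        Real.exp (1 / 2) * (Real.exp (-z ^ 2 / 2) *
          ∏ i, gaussTail ((t i - 1 - z) / Real.sqrt N)) := by
    intro z
    rw [← Finset.mul_sum, ← Finset.prod_univ_sum A fun i a => dblGauss N (a - z)]
    have h3 : ∏ i, ∑ a ∈ A i, dblGauss N (a - z) ≤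
        ∏ i, Real.exp (1 / (2 * N)) * gaussTail ((t i - 1 - z) / Real.sqrt N) :=
      Finset.prod_le_prod (fun i _ => Finset.sum_nonneg fun a _ => dblGauss_nonneg _ _)
        fun i _ => sum_dblGauss_le_gaussTail hNpos (hAeven i) (hAt i) z
    rw [Finset.prod_mul_distrib, Finset.prod_const, Finset.card_univ, Fintype.card_fin,
      ← Real.exp_nat_mul, show (N : ℝ) * (1 / (2 * N)) = 1 / 2 by field_simp] at h3
    have := mul_le_mul_of_nonneg_left h3 (Real.exp_pos (-z ^ 2 / 2)).le
    linarith
  have h4 := integral_mono (integrable_finsetSum _ hinteg)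
    ((integrable_exp_mul_prod_gaussTail (fun i => (t i : ℝ) - 1) (Real.sqrt N)).const_mul
      (Real.exp (1 / 2))) h2
  rw [integral_finsetSum _ hinteg, integral_const_mul] at h4
  rw [h1]
  calc _ ≤ ∑ d ∈ Fintype.piFinset A,
        C * ∫ z, Real.exp (-z ^ 2 / 2) * ∏ i, dblGauss N (d i - z) :=
        Finset.sum_le_sum fun d _ => h N hN d
    _ ≤ _ := by
      rw [← Finset.mul_sum, mul_assoc]
      gcongr

/-- Probability that two random signed complete graphs and a random signed bipartite graph
between them satisfy the degree constraints of a pair of bisections. -/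
noncomputable def pairProb (p q : ℕ) (T : ℤ) : ℝ :=
  ((Finset.univ.filter fun x : (CEdge p → Bool) × (CEdge q → Bool) × (Fin p × Fin q → Bool) =>
    (∀ v, T + |∑ w, bsign (x.2.2 (v, w))| ≤
      signedDeg (fun e : CEdge p => e.1.1) (fun e => e.1.2) x.1 v) ∧
    (∀ w, T + |∑ v, bsign (x.2.2 (v, w))| ≤
      signedDeg (fun e : CEdge q => e.1.1) (fun e => e.1.2) x.2.1 w)).card : ℝ) /
    (2 ^ Fintype.card (CEdge p) * 2 ^ Fintype.card (CEdge q) * 2 ^ (p * q))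

lemma pairProb_eq (p q : ℕ) (T : ℤ) : pairProb p q T =
    (∑ Z : Fin p × Fin q → Bool, complProb p (fun v => T + |∑ w, bsign (Z (v, w))|) *
      complProb q (fun w => T + |∑ v, bsign (Z (v, w))|)) / 2 ^ (p * q) := by
  unfold pairProb complProb
  rw [Finset.card_eq_sum_card_fiberwise (f := fun x => x.2.2) (t := Finset.univ) (by simp)]
  push_cast
  rw [Finset.sum_div, Finset.sum_div]
  refine Finset.sum_congr rfl fun Z _ => ?_
  rw [div_mul_div_comm, div_div]
  congr 1
  rw [← Nat.cast_mul, ← Finset.card_product]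
  congr 1
  refine Finset.card_bij' (fun x _ => (x.1, x.2.1)) (fun y _ => (y.1, y.2, Z)) ?_ ?_ ?_ ?_
  · rintro ⟨x, y, z⟩ h
    simp only [Finset.mem_filter, Finset.mem_univ, true_and] at h
    obtain ⟨h, rfl⟩ := h
    simpa using h
  · rintro ⟨x, y⟩ h
    simpa using h
  · rintro ⟨x, y, z⟩ h
    simp only [Finset.mem_filter, Finset.mem_univ, true_and] at h
    obtain ⟨h, rfl⟩ := h
    rfl
  · rintro ⟨x, y⟩ h
    rfl

lemma even_sum_bsign {n : ℕ} (hn : Even n) (f : Fin n → Bool) :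
    ∃ j ∈ Finset.Icc (-(n : ℤ)) n, ∑ w, bsign (f w) = 2 * j := by
  have h1 : Even (∑ w, bsign (f w)) := by
    have h2 : Even (∑ w, (bsign (f w) - bsign true)) :=
      Finset.even_sum _ fun w _ => bsign_sub_even _ _
    rw [Finset.sum_sub_distrib] at h2
    have h3 : Even (∑ _w : Fin n, bsign true) := by simpa [bsign] using hn
    simpa using h2.add h3
  obtain ⟨j, hj⟩ := h1
  refine ⟨j, ?_, by omega⟩
  have := abs_le.1 (abs_sum_bsign_le f)
  rw [Finset.mem_Icc]; omega

lemma pairProb_le_sum {p q : ℕ} (hp : Even p) (hq : Even q) (T : ℤ) : pairProb p q T ≤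
    ∑ j ∈ Fintype.piFinset fun _ : Fin p => Finset.Icc (-(q : ℤ)) q,
      ∑ j' ∈ Fintype.piFinset fun _ : Fin q => Finset.Icc (-(p : ℤ)) p,
        bipDegProb (fun v => 2 * j v) (fun w => 2 * j' w) *
          (complProb p (fun v => T + |2 * j v|) * complProb q (fun w => T + |2 * j' w|)) := by
  rw [pairProb_eq, ← Finset.sum_product']
  set P := (Fintype.piFinset fun _ : Fin p => Finset.Icc (-(q : ℤ)) q) ×ˢ
    (Fintype.piFinset fun _ : Fin q => Finset.Icc (-(p : ℤ)) p) with hP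
  choose f hf hf' using fun (Z : Fin p × Fin q → Bool) (v : Fin p) =>
    even_sum_bsign hq fun w => Z (v, w)
  choose g hg hg' using fun (Z : Fin p × Fin q → Bool) (w : Fin q) =>
    even_sum_bsign hp fun v => Z (v, w)
  have hmaps : ∀ Z ∈ (Finset.univ : Finset (Fin p × Fin q → Bool)), (f Z, g Z) ∈ P := by
    intro Z _
    rw [hP, Finset.mem_product, Fintype.mem_piFinset, Fintype.mem_piFinset]
    exact ⟨hf Z, hg Z⟩
  rw [← Finset.sum_fiberwise_of_maps_to hmaps, Finset.sum_div]
  refine Finset.sum_le_sum fun x _ => ?_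
  have h1 : ∀ Z ∈ Finset.univ.filter (fun Z : Fin p × Fin q → Bool => (f Z, g Z) = x),
      complProb p (fun v => T + |∑ w, bsign (Z (v, w))|) *
      complProb q (fun w => T + |∑ v, bsign (Z (v, w))|) =
      complProb p (fun v => T + |2 * x.1 v|) * complProb q (fun w => T + |2 * x.2 w|) := by
    intro Z hZ
    obtain rfl := (Finset.mem_filter.1 hZ).2
    simp_rw [hf', hg']
  rw [Finset.sum_congr rfl h1, Finset.sum_const, nsmul_eq_mul, mul_div_right_comm]
  refine mul_le_mul_of_nonneg_right ?_ (mul_nonneg (complProb_nonneg _ _) (complProb_nonneg _ _))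
  unfold bipDegProb degProb
  rw [Fintype.card_prod, Fintype.card_fin, Fintype.card_fin]
  gcongr with Z _
  rintro rfl
  rintro (v | w)
  · rw [signedDeg_bip_inl, hf']; rfl
  · rw [signedDeg_bip_inr, hg']; rfl

noncomputable def pairIntegrand (p q : ℕ) (s : ℝ) (x : ℝ × ℝ) : ℝ :=
  Real.exp (-x.1 ^ 2 / 2) * Real.exp (-x.2 ^ 2 / 2) *
    (Real.sqrt (p * q) * pairSum p q (s - x.1) (s - x.2))

lemma pairIntegrand_eq (p q : ℕ) (s : ℝ) (x : ℝ × ℝ) : pairIntegrand p q s x =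
    ∑ j ∈ Fintype.piFinset fun _ : Fin p => Finset.Icc (-(q : ℤ)) q,
      ∑ j' ∈ (Fintype.piFinset fun _ : Fin q => Finset.Icc (-(p : ℤ)) p) with
          ∑ i, j' i = ∑ i, j i,
        Real.sqrt (p * q) * (Real.exp ((∑ i, 2 * (j i : ℝ)) ^ 2 / (2 * (p * q))) *
          ((∏ i, dblGauss q (2 * j i)) * ∏ i, dblGauss p (2 * j' i))) *
        ((Real.exp (-x.1 ^ 2 / 2) *
            ∏ i, gaussTail ((s + |2 * (j i : ℝ)| - x.1) / Real.sqrt p)) *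
          (Real.exp (-x.2 ^ 2 / 2) *
            ∏ i, gaussTail ((s + |2 * (j' i : ℝ)| - x.2) / Real.sqrt q))) := by
  unfold pairIntegrand pairSum vtxWeight
  rw [Finset.mul_sum, Finset.mul_sum]
  refine Finset.sum_congr rfl fun j _ => ?_
  rw [Finset.mul_sum, Finset.mul_sum]
  refine Finset.sum_congr rfl fun j' _ => ?_
  rw [Finset.prod_mul_distrib, Finset.prod_mul_distrib]
  simp_rw [sub_add_eq_add_sub]
  ring

lemma pairIntegrand_nonneg (p q : ℕ) (s : ℝ) (x : ℝ × ℝ) : 0 ≤ pairIntegrand p q s x :=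
  mul_nonneg (mul_pos (Real.exp_pos _) (Real.exp_pos _)).le
    (mul_nonneg (Real.sqrt_nonneg _) (pairSum_nonneg _ _ _ _))

lemma integral_pairIntegrand (p q : ℕ) (s : ℝ) : ∫ x, pairIntegrand p q s x =
    ∑ j ∈ Fintype.piFinset fun _ : Fin p => Finset.Icc (-(q : ℤ)) q,
      ∑ j' ∈ (Fintype.piFinset fun _ : Fin q => Finset.Icc (-(p : ℤ)) p) with
          ∑ i, j' i = ∑ i, j i,
        Real.sqrt (p * q) * (Real.exp ((∑ i, 2 * (j i : ℝ)) ^ 2 / (2 * (p * q))) *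
          ((∏ i, dblGauss q (2 * j i)) * ∏ i, dblGauss p (2 * j' i))) *
        ((∫ z, Real.exp (-z ^ 2 / 2) *
            ∏ i, gaussTail ((s + |2 * (j i : ℝ)| - z) / Real.sqrt p)) *
          ∫ z, Real.exp (-z ^ 2 / 2) *
            ∏ i, gaussTail ((s + |2 * (j' i : ℝ)| - z) / Real.sqrt q)) := by
  have hinteg : ∀ (j : Fin p → ℤ) (j' : Fin q → ℤ), Integrable fun x : ℝ × ℝ =>
      Real.sqrt (p * q) * (Real.exp ((∑ i, 2 * (j i : ℝ)) ^ 2 / (2 * (p * q))) *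
          ((∏ i, dblGauss q (2 * j i)) * ∏ i, dblGauss p (2 * j' i))) *
        ((Real.exp (-x.1 ^ 2 / 2) *
            ∏ i, gaussTail ((s + |2 * (j i : ℝ)| - x.1) / Real.sqrt p)) *
          (Real.exp (-x.2 ^ 2 / 2) *
            ∏ i, gaussTail ((s + |2 * (j' i : ℝ)| - x.2) / Real.sqrt q))) := fun j j' =>
    Integrable.const_mul (Integrable.mul_prod
      (integrable_exp_mul_prod_gaussTail (fun i => s + |2 * (j i : ℝ)|) (Real.sqrt p))
      (integrable_exp_mul_prod_gaussTail (fun i => s + |2 * (j' i : ℝ)|) (Real.sqrt q))) _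
  simp_rw [pairIntegrand_eq]
  rw [integral_finsetSum _ fun j _ => integrable_finsetSum _ fun j' _ => hinteg j j']
  refine Finset.sum_congr rfl fun j _ => ?_
  rw [integral_finsetSum _ fun j' _ => hinteg j j']
  refine Finset.sum_congr rfl fun j' _ => ?_
  rw [integral_const_mul]
  congr 1
  exact integral_prod_mul (fun z => Real.exp (-z ^ 2 / 2) *
      ∏ i, gaussTail ((s + |2 * (j i : ℝ)| - z) / Real.sqrt p))
    (fun z => Real.exp (-z ^ 2 / 2) * ∏ i, gaussTail ((s + |2 * (j' i : ℝ)| - z) / Real.sqrt q))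

theorem exists_pairProb_le {δ : ℝ} (hδ : 0 < δ) : ∃ C : ℝ, 0 < C ∧ ∃ N₀ : ℕ, 0 < N₀ ∧ ∀ p q : ℕ,
    N₀ ≤ p + q → δ * (p + q) ≤ p → δ * (p + q) ≤ q → Even p → Even q → ∀ T : ℤ,
    pairProb p q T ≤ C * ∫ x, pairIntegrand p q (T - 1) x := by
  obtain ⟨C₁, hC₁, N₁, hN₁, h₁⟩ := exists_complProb_le
  obtain ⟨C₂, hC₂, N₂, hN₂, h₂⟩ := exists_bipartite_degProb_le hδ
  refine ⟨C₂ * (C₁ * C₁), by positivity, max N₂ (⌈N₁ / δ⌉₊), by positivity, ?_⟩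
  intro p q hN hp hq hpe hqe T
  have hNp : N₁ ≤ p ∧ N₁ ≤ q := by
    have h3 : (N₁ / δ : ℝ) ≤ p + q := by
      refine (Nat.le_ceil _).trans ?_
      exact_mod_cast (le_max_right _ _).trans hN
    rw [div_le_iff₀ hδ, mul_comm] at h3
    exact ⟨by exact_mod_cast h3.trans hp, by exact_mod_cast h3.trans hq⟩
  refine (pairProb_le_sum hpe hqe T).trans ?_
  rw [integral_pairIntegrand, Finset.mul_sum]
  refine Finset.sum_le_sum fun j _ => ?_
  rw [Finset.mul_sum, Finset.sum_filter]
  refine Finset.sum_le_sum fun j' _ => ?_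
  have hb := h₂ p q ((le_max_left _ _).trans hN) hp hq (fun v => 2 * j v) (fun w => 2 * j' w)
  have hsum : (∑ v, 2 * j v = ∑ w, 2 * j' w) ↔ ∑ w, j' w = ∑ v, j v := by
    rw [← Finset.mul_sum, ← Finset.mul_sum]; omega
  have hP := h₁ p hNp.1 (fun v => T + |2 * j v|)
  have hQ := h₁ q hNp.2 (fun w => T + |2 * j' w|)
  by_cases h : ∑ w, j' w = ∑ v, j v
  · rw [if_pos (hsum.2 h)] at hb
    rw [if_pos h]
    push_cast at hb hP hQ
    have e : ∀ x y : ℝ, (T : ℝ) + x - 1 - y = T - 1 + x - y := fun x y => by ring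
    simp_rw [e] at hP hQ
    have hPQ := mul_le_mul hP hQ (complProb_nonneg _ _) ((complProb_nonneg _ _).trans hP)
    have := mul_le_mul hb hPQ (mul_nonneg (complProb_nonneg _ _) (complProb_nonneg _ _))
      ((bipDegProb_nonneg _ _).trans hb)
    refine this.trans (le_of_eq ?_)
    ring
  · rw [if_neg (fun h' => h (hsum.1 h'))] at hb
    rw [if_neg h, le_antisymm hb (bipDegProb_nonneg _ _), zero_mul]

lemma contDiff_stdPdf {n : WithTop ℕ∞} : ContDiff ℝ n stdPdf := by
  unfold stdPdf; fun_prop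

lemma contDiff_gaussTail {n : ℕ} : ContDiff ℝ n gaussTail := by
  have h : ContDiff ℝ (n + 1) gaussTail := by
    rw [contDiff_succ_iff_deriv]
    refine ⟨fun t => (hasDerivAt_gaussTail t).differentiableAt, by simp, ?_⟩
    have : deriv gaussTail = fun t => -stdPdf t := funext fun t => (hasDerivAt_gaussTail t).deriv
    rw [this]
    exact contDiff_stdPdf.neg
  exact h.of_le (by norm_cast; omega)

lemma stdPdf_mul_stdPdf (a b x : ℝ) : stdPdf x * stdPdf (a + b * x) =
    stdPdf (a / √(1 + b ^ 2)) * stdPdf (√(1 + b ^ 2) * x + a * b / √(1 + b ^ 2)) := by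
  unfold stdPdf
  have hD : √(1 + b ^ 2) ^ 2 = 1 + b ^ 2 := Real.sq_sqrt (by positivity)
  have hD0 : √(1 + b ^ 2) ≠ 0 := by positivity
  have hb : 1 + b ^ 2 ≠ 0 := by positivity
  rw [mul_mul_mul_comm, ← Real.exp_add, mul_mul_mul_comm, ← Real.exp_add]
  congr 2
  have : (√(1 + b ^ 2) * x + a * b / √(1 + b ^ 2)) ^ 2 =
      (1 + b ^ 2) * x ^ 2 + 2 * a * b * x + (a * b) ^ 2 / (1 + b ^ 2) := by
    rw [add_sq, mul_pow, hD, div_pow, hD]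
    field_simp
  rw [this, div_pow, hD]
  field_simp
  ring

lemma integral_Ioi_mul_stdPdf_add (m : ℝ) :
    ∫ x in Ioi (0 : ℝ), x * stdPdf (x + m) = stdPdf m - m * gaussTail m := by
  have h1 : ∫ x in Ioi (0 : ℝ), (x + m) * stdPdf (x + m) = stdPdf m := by
    have : ∫ x in Ioi m, x * stdPdf x = ∫ x in Ioi (0 : ℝ), (x + m) * stdPdf (x + m) := by
      rw [← (measurePreserving_add_right volume m).setIntegral_preimage_emb
        (measurableEmbedding_addRight m)]
      simp
    rw [← this, (integral_Ioi_mul_stdPdf m).2]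
  have h2 : ∫ x in Ioi (0 : ℝ), stdPdf (x + m) = gaussTail m := by
    rw [← gaussTail_shift, zero_add]
  have h3 : IntegrableOn (fun x => stdPdf (x + m)) (Ioi 0) :=
    (integrable_stdPdf.comp_add_right m).integrableOn
  have h4 : IntegrableOn (fun x => (x + m) * stdPdf (x + m)) (Ioi 0) := by
    have hinteg : Integrable fun x => x * stdPdf x := by
      have := (integrable_mul_exp_neg_mul_sq (b := 1 / 2) (by norm_num)).const_mul
        ((Real.sqrt (2 * Real.pi))⁻¹)
      refine this.congr (Filter.Eventually.of_forall fun x => ?_)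
      simp only [stdPdf]; ring_nf
    exact (hinteg.comp_add_right m).integrableOn
  rw [← h1, ← h2, ← integral_const_mul, ← integral_sub h4 (h3.const_mul m)]
  congr 1; ext x; ring

/-- Minus the derivative of `stdMass a b 0` in `a`. -/
noncomputable def massSlopeA (a b : ℝ) : ℝ :=
  2 * stdPdf (a / √(1 + b ^ 2)) * gaussTail (a * b / √(1 + b ^ 2)) / √(1 + b ^ 2)

/-- Minus the derivative of `stdMass a b 0` in `b`. -/
noncomputable def massSlopeB (a b : ℝ) : ℝ :=
  2 * stdPdf (a / √(1 + b ^ 2)) * (stdPdf (a * b / √(1 + b ^ 2)) -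
    a * b / √(1 + b ^ 2) * gaussTail (a * b / √(1 + b ^ 2))) / (1 + b ^ 2)

lemma integral_stdPdf_mul_stdPdf (a b : ℝ) :
    ∫ x, stdPdf x * stdPdf (a + b * |x|) = massSlopeA a b := by
  have hD0 : 0 < √(1 + b ^ 2) := by positivity
  have h1 : ∫ x, stdPdf x * stdPdf (a + b * |x|) =
      2 * ∫ x in Ioi (0 : ℝ), stdPdf x * stdPdf (a + b * x) := by
    rw [← integral_comp_abs (f := fun x => stdPdf x * stdPdf (a + b * x))]
    congr 1; ext x
    simp [stdPdf]
  rw [h1]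
  simp_rw [stdPdf_mul_stdPdf a b]
  rw [integral_const_mul, integral_comp_mul_left_Ioi
    (fun y => stdPdf (y + a * b / √(1 + b ^ 2))) 0 hD0, mul_zero, ← gaussTail_shift, zero_add,
    massSlopeA, smul_eq_mul]
  field_simp

lemma integral_abs_mul_stdPdf_mul_stdPdf (a b : ℝ) :
    ∫ x, |x| * (stdPdf x * stdPdf (a + b * |x|)) = massSlopeB a b := by
  have hD0 : 0 < √(1 + b ^ 2) := by positivity
  have hD : √(1 + b ^ 2) ^ 2 = 1 + b ^ 2 := Real.sq_sqrt (by positivity)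
  have h1 : ∫ x, |x| * (stdPdf x * stdPdf (a + b * |x|)) =
      2 * ∫ x in Ioi (0 : ℝ), x * (stdPdf x * stdPdf (a + b * x)) := by
    rw [← integral_comp_abs (f := fun x => x * (stdPdf x * stdPdf (a + b * x)))]
    congr 1; ext x
    simp [stdPdf]
  have h2 : ∀ x, x * (stdPdf x * stdPdf (a + b * x)) = stdPdf (a / √(1 + b ^ 2)) *
      (√(1 + b ^ 2))⁻¹ * ((√(1 + b ^ 2) * x) *
        stdPdf (√(1 + b ^ 2) * x + a * b / √(1 + b ^ 2))) := fun x => by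
    rw [stdPdf_mul_stdPdf a b]
    field_simp
  rw [h1]
  simp_rw [h2]
  rw [integral_const_mul, integral_comp_mul_left_Ioi
    (fun y => y * stdPdf (y + a * b / √(1 + b ^ 2))) 0 hD0, mul_zero,
    integral_Ioi_mul_stdPdf_add, massSlopeB, smul_eq_mul]
  generalize stdPdf (a * b / √(1 + b ^ 2)) - a * b / √(1 + b ^ 2) *
    gaussTail (a * b / √(1 + b ^ 2)) = W
  generalize stdPdf (a / √(1 + b ^ 2)) = V
  generalize √(1 + b ^ 2) = D at hD hD0
  rw [← hD]
  field_simp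

lemma integrable_abs_mul_stdPdf : Integrable fun x => |x| * stdPdf x := by
  have := (integrable_mul_exp_neg_mul_sq (b := 1 / 2) (by norm_num)).norm.const_mul
    ((Real.sqrt (2 * Real.pi))⁻¹)
  refine this.congr (Filter.Eventually.of_forall fun x => ?_)
  simp only [stdPdf, norm_mul, Real.norm_eq_abs, Real.abs_exp]; ring_nf

lemma hasFDerivAt_stdMass (v : ℝ × ℝ) :
    HasFDerivAt (fun v : ℝ × ℝ => stdMass v.1 v.2 0)
      ((-massSlopeA v.1 v.2) • ContinuousLinearMap.fst ℝ ℝ ℝ +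
        (-massSlopeB v.1 v.2) • ContinuousLinearMap.snd ℝ ℝ ℝ) v := by
  have hi0 : Integrable fun x => stdPdf x * stdPdf (v.1 + v.2 * |x|) := by
    refine integrable_stdPdf.mono' (by fun_prop) (Filter.Eventually.of_forall fun x => ?_)
    have := stdPdf_pos x
    have := stdPdf_pos (v.1 + v.2 * |x|)
    rw [Real.norm_of_nonneg (by positivity)]
    exact mul_le_of_le_one_right (by positivity) ((stdPdf_le_half _).trans (by norm_num))
  have hi1 : Integrable fun x => |x| * (stdPdf x * stdPdf (v.1 + v.2 * |x|)) := by
    refine integrable_abs_mul_stdPdf.mono' (by fun_prop) (Filter.Eventually.of_forall fun x => ?_)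
    have := stdPdf_pos x
    have := stdPdf_pos (v.1 + v.2 * |x|)
    rw [Real.norm_of_nonneg (by positivity), ← mul_assoc]
    exact mul_le_of_le_one_right (by positivity) ((stdPdf_le_half _).trans (by norm_num))
  let F' : ℝ × ℝ → ℝ → (ℝ × ℝ →L[ℝ] ℝ) := fun v x =>
    (stdPdf x * stdPdf (v.1 + v.2 * |x|)) • (-ContinuousLinearMap.fst ℝ ℝ ℝ) +
      (|x| * (stdPdf x * stdPdf (v.1 + v.2 * |x|))) • (-ContinuousLinearMap.snd ℝ ℝ ℝ)
  have hF' : AEStronglyMeasurable (F' v) volume :=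
    (hi0.aestronglyMeasurable.smul_const (-ContinuousLinearMap.fst ℝ ℝ ℝ)).add
      (hi1.aestronglyMeasurable.smul_const (-ContinuousLinearMap.snd ℝ ℝ ℝ))
  have key := hasFDerivAt_integral_of_dominated_of_fderiv_le (𝕜 := ℝ) (μ := volume) (x₀ := v)
    (s := univ)
    (F := fun v : ℝ × ℝ => fun x => stdPdf x * gaussTail (v.1 + v.2 * |x|) * Real.exp (0 * x))
    (F' := F')
    (bound := fun x => stdPdf x + |x| * stdPdf x) Filter.univ_mem
    (Filter.Eventually.of_forall fun v => (integrable_stdMass _ _ _).aestronglyMeasurable)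
    (integrable_stdMass _ _ _)
    hF' ?_
    (integrable_stdPdf.add integrable_abs_mul_stdPdf) ?_
  · have e : ∫ x, F' v x = (-massSlopeA v.1 v.2) • ContinuousLinearMap.fst ℝ ℝ ℝ +
        (-massSlopeB v.1 v.2) • ContinuousLinearMap.snd ℝ ℝ ℝ := by
      simp only [F']
      rw [integral_add (hi0.smul_const _) (hi1.smul_const _), integral_smul_const,
        integral_smul_const, integral_stdPdf_mul_stdPdf, integral_abs_mul_stdPdf_mul_stdPdf,
        smul_neg, smul_neg]
      ext <;> simp
    rw [← e]
    exact key
  · refine Filter.Eventually.of_forall fun x w _ => ?_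
    have h0 := stdPdf_pos x
    have h1 := stdPdf_pos (w.1 + w.2 * |x|)
    have h2 : stdPdf x * stdPdf (w.1 + w.2 * |x|) ≤ stdPdf x :=
      mul_le_of_le_one_right (by positivity) ((stdPdf_le_half _).trans (by norm_num))
    refine (norm_add_le _ _).trans (add_le_add ?_ ?_)
    · rw [norm_smul, norm_neg, Real.norm_of_nonneg (by positivity)]
      exact (mul_le_of_le_one_right (by positivity) (ContinuousLinearMap.norm_fst_le ..)).trans h2
    · rw [norm_smul, norm_neg, Real.norm_of_nonneg (by positivity)]
      exact (mul_le_of_le_one_right (by positivity) (ContinuousLinearMap.norm_snd_le ..)).trans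
        (by gcongr)
  · refine Filter.Eventually.of_forall fun x w _ => ?_
    have h1 : HasFDerivAt (fun w : ℝ × ℝ => w.1 + w.2 * |x|)
        (ContinuousLinearMap.fst ℝ ℝ ℝ + |x| • ContinuousLinearMap.snd ℝ ℝ ℝ) w :=
      (hasFDerivAt_fst).add ((hasFDerivAt_snd).mul_const _)
    have h2 := ((hasDerivAt_gaussTail (w.1 + w.2 * |x|)).comp_hasFDerivAt w h1).const_mul (stdPdf x)
    simp only [zero_mul, Real.exp_zero, mul_one]
    refine h2.congr_fderiv ?_
    ext <;> simp [F'] <;> ring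

lemma contDiff_sqrt_one_add_sq {n : ℕ} : ContDiff ℝ n fun v : ℝ × ℝ => √(1 + v.2 ^ 2) :=
  ContDiff.sqrt (by fun_prop) fun v => by positivity

lemma contDiff_massSlopeA {n : ℕ} : ContDiff ℝ n fun v : ℝ × ℝ => massSlopeA v.1 v.2 := by
  have hs := contDiff_sqrt_one_add_sq (n := n)
  have h0 : ∀ v : ℝ × ℝ, √(1 + v.2 ^ 2) ≠ 0 := fun v => by positivity
  unfold massSlopeA
  exact ((contDiff_const.mul (contDiff_stdPdf.comp (contDiff_fst.div hs h0))).mul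
    (contDiff_gaussTail.comp ((contDiff_fst.mul contDiff_snd).div hs h0))).div hs h0

lemma contDiff_massSlopeB {n : ℕ} : ContDiff ℝ n fun v : ℝ × ℝ => massSlopeB v.1 v.2 := by
  have hs := contDiff_sqrt_one_add_sq (n := n)
  have h0 : ∀ v : ℝ × ℝ, √(1 + v.2 ^ 2) ≠ 0 := fun v => by positivity
  have hm : ContDiff ℝ n fun v : ℝ × ℝ => v.1 * v.2 / √(1 + v.2 ^ 2) :=
    (contDiff_fst.mul contDiff_snd).div hs h0
  unfold massSlopeB
  exact ((contDiff_const.mul (contDiff_stdPdf.comp (contDiff_fst.div hs h0))).mul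
    ((contDiff_stdPdf.comp hm).sub (hm.mul (contDiff_gaussTail.comp hm)))).div (by fun_prop)
      fun v => by positivity

lemma contDiff_stdMass {n : ℕ} : ContDiff ℝ n fun v : ℝ × ℝ => stdMass v.1 v.2 0 := by
  have h : ContDiff ℝ (n + 1) fun v : ℝ × ℝ => stdMass v.1 v.2 0 :=
    contDiff_succ_iff_hasFDerivAt.2 ⟨_, (contDiff_massSlopeA.neg.smul contDiff_const).add
      (contDiff_massSlopeB.neg.smul contDiff_const), hasFDerivAt_stdMass⟩
  exact h.of_le (by norm_cast; omega)

lemma stdMass_zero_right (a : ℝ) : stdMass a 0 0 = gaussTail a := by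
  simp [stdMass, integral_mul_const, integral_stdPdf]

lemma fB_eq (γ α : ℝ) {β : ℝ} (h0 : 0 < β) :
    fB γ β α = stdMass (√2 * (γ + α) / √β) (√((1 - β) / β)) 0 := by
  have hβ := Real.sqrt_pos.2 h0
  have h2 : (0 : ℝ) < √2 := by positivity
  have hm : MeasurableSet {p : ℝ × ℝ | γ + α ≤ √(β / 2) * p.1 + √((1 - β) / 2) * p.2 ∧
      γ + α ≤ √(β / 2) * p.1 - √((1 - β) / 2) * p.2} := by
    rw [ofPred_and]
    exact (measurableSet_le (by fun_prop) (by fun_prop)).inter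
      (measurableSet_le (by fun_prop) (by fun_prop))
  have hslice : ∀ y : ℝ, (fun x => (x, y)) ⁻¹'
      {p : ℝ × ℝ | γ + α ≤ √(β / 2) * p.1 + √((1 - β) / 2) * p.2 ∧
      γ + α ≤ √(β / 2) * p.1 - √((1 - β) / 2) * p.2} =
      {x | √2 * (γ + α) / √β + √((1 - β) / β) * |y| ≤ x} := fun y => by
    ext x
    simp only [mem_preimage, Set.mem_ofPred_eq]
    rw [Real.sqrt_div h0.le, Real.sqrt_div' (1 - β) h0.le, Real.sqrt_div' (1 - β) zero_le_two,
      show √2 * (γ + α) / √β + √(1 - β) / √β * |y| = (√2 * (γ + α) + √(1 - β) * |y|) / √β by ring,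
      div_le_iff₀ hβ]
    have e1 : γ + α ≤ √β / √2 * x + √(1 - β) / √2 * y ↔
        √2 * (γ + α) - √(1 - β) * y ≤ x * √β := by
      rw [show √β / √2 * x + √(1 - β) / √2 * y = (x * √β + √(1 - β) * y) / √2 by ring,
        le_div_iff₀ h2]
      constructor <;> intro h <;> linarith
    have e2 : γ + α ≤ √β / √2 * x - √(1 - β) / √2 * y ↔
        √2 * (γ + α) + √(1 - β) * y ≤ x * √β := by
      rw [show √β / √2 * x - √(1 - β) / √2 * y = (x * √β - √(1 - β) * y) / √2 by ring,
        le_div_iff₀ h2]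
      constructor <;> intro h <;> linarith
    rw [e1, e2]
    rcases abs_cases y with ⟨h, hy⟩ | ⟨h, hy⟩ <;> rw [h] <;>
      have := Real.sqrt_nonneg (1 - β)
    · constructor
      · rintro ⟨_, h⟩; exact h
      · intro h; exact ⟨by nlinarith, h⟩
    · constructor
      · rintro ⟨h, _⟩; linarith
      · intro h; exact ⟨by linarith, by nlinarith⟩
  unfold fB gauss2
  rw [Measure.prod_apply_symm hm]
  simp_rw [hslice]
  have e : ∀ y : ℝ, (gaussianReal 0 1) {x | √2 * (γ + α) / √β + √((1 - β) / β) * |y| ≤ x} =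
      ENNReal.ofReal (gaussTail (√2 * (γ + α) / √β + √((1 - β) / β) * |y|)) := fun y => by
    rw [gaussTail, ENNReal.ofReal_toReal (measure_ne_top _ _)]
  simp_rw [e]
  rw [← integral_eq_lintegral_of_nonneg_ae
    (Filter.Eventually.of_forall fun y => gaussTail_nonneg _) (by fun_prop),
    integral_gaussianReal_eq_integral_smul one_ne_zero]
  unfold stdMass
  congr 1; ext x
  simp [← stdPdf_eq]

lemma fB_pos (γ α : ℝ) {β : ℝ} (h0 : 0 < β) : 0 < fB γ β α := by
  rw [fB_eq γ α h0]; exact stdMass_pos _ _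

lemma fB_one (γ α : ℝ) : fB γ 1 α = gaussTail (√2 * (γ + α)) := by
  rw [fB_eq γ α one_pos]; simp [stdMass_zero_right]

lemma fB_le_one (γ β α : ℝ) : fB γ β α ≤ 1 := by
  unfold fB gauss2
  exact ENNReal.toReal_le_of_le_ofReal (by norm_num) (by simpa using prob_le_one)

lemma vtxMass_eq_fB (γ α : ℝ) {n k : ℝ} (hk : 0 < k) (hkn : k < n) :
    vtxMass (2 * k) (2 * (n - k)) (2 * √n * (γ + α)) = fB γ (k / n) α := by
  have hn : 0 < n := hk.trans hkn
  rw [vtxMass_eq (by linarith) (by linarith), fB_eq γ α (by positivity)]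
  have h2 : √2 ^ 2 = 2 := Real.sq_sqrt zero_le_two
  congr 1
  · rw [Real.sqrt_mul zero_le_two, Real.sqrt_div hk.le]
    have := Real.sqrt_pos.2 hk
    field_simp
    rw [h2, mul_comm]
  · rw [← Real.sqrt_div (by linarith)]
    congr 1
    field_simp

/-- The Gaussian lens bound coming from `h(b) = stdMass (s√(1+b²)) b 0` with
`h'(b) = -exp(-s²(1+b²)/2)/(π(1+b²))`. -/
lemma hasDerivAt_stdMass_curve (s b : ℝ) :
    HasDerivAt (fun b => stdMass (s * √(1 + b ^ 2)) b 0)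
      (-(Real.exp (-s ^ 2 * (1 + b ^ 2) / 2) / (Real.pi * (1 + b ^ 2)))) b := by
  have hD0 : 0 < √(1 + b ^ 2) := by positivity
  have hD : √(1 + b ^ 2) ^ 2 = 1 + b ^ 2 := Real.sq_sqrt (by positivity)
  have h1 : HasDerivAt (fun b : ℝ => √(1 + b ^ 2)) (b / √(1 + b ^ 2)) b := by
    have h := ((hasDerivAt_pow 2 b).const_add 1).sqrt (by positivity)
    refine h.congr_deriv ?_
    simp; ring
  have h2 : HasDerivAt (fun b : ℝ => (s * √(1 + b ^ 2), b)) (s * (b / √(1 + b ^ 2)), 1) b :=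
    (h1.const_mul s).prodMk (hasDerivAt_id b)
  have h3 := (hasFDerivAt_stdMass (s * √(1 + b ^ 2), b)).comp_hasDerivAt
    (f := fun b : ℝ => (s * √(1 + b ^ 2), b)) b h2
  refine h3.congr_deriv ?_
  have e1 : s * √(1 + b ^ 2) * b / √(1 + b ^ 2) = s * b := by field_simp
  have e2 : s * √(1 + b ^ 2) / √(1 + b ^ 2) = s := by field_simp
  simp only [massSlopeA, massSlopeB, e1, e2, add_apply, smul_apply,
    ContinuousLinearMap.coe_fst', ContinuousLinearMap.coe_snd', smul_eq_mul, mul_one]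
  have e3 : stdPdf s * stdPdf (s * b) = Real.exp (-s ^ 2 * (1 + b ^ 2) / 2) / (2 * Real.pi) := by
    unfold stdPdf
    rw [mul_mul_mul_comm, ← Real.exp_add, ← mul_inv, Real.mul_self_sqrt (by positivity),
      show -s ^ 2 / 2 + -(s * b) ^ 2 / 2 = -s ^ 2 * (1 + b ^ 2) / 2 by ring]
    ring
  have e4 : Real.exp (-s ^ 2 * (1 + b ^ 2) / 2) = 2 * Real.pi * (stdPdf s * stdPdf (s * b)) := by
    rw [e3]; field_simp
  rw [e4]
  generalize √(1 + b ^ 2) = D at hD hD0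
  rw [← hD]
  field_simp
  ring

lemma stdMass_curve_le (s : ℝ) {b : ℝ} (hb : 0 ≤ b) :
    stdMass (s * √(1 + b ^ 2)) b 0 ≤
      gaussTail s - b * (Real.exp (-s ^ 2 * (1 + b ^ 2) / 2) / (Real.pi * (1 + b ^ 2))) := by
  set c := Real.exp (-s ^ 2 * (1 + b ^ 2) / 2) / (Real.pi * (1 + b ^ 2))
  have hanti : AntitoneOn (fun u => stdMass (s * √(1 + u ^ 2)) u 0 + c * u) (Icc 0 b) := by
    have hd : ∀ u, HasDerivAt (fun u => stdMass (s * √(1 + u ^ 2)) u 0 + c * u)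
        (-(Real.exp (-s ^ 2 * (1 + u ^ 2) / 2) / (Real.pi * (1 + u ^ 2))) + c * 1) u := fun u =>
      (hasDerivAt_stdMass_curve s u).add ((hasDerivAt_id u).const_mul c)
    refine antitoneOn_of_deriv_nonpos (convex_Icc 0 b)
      (fun u _ => (hd u).continuousAt.continuousWithinAt)
      (fun u _ => (hd u).differentiableAt.differentiableWithinAt) fun u hu => ?_
    rw [interior_Icc] at hu
    rw [(hd u).deriv]
    have hub : u ^ 2 ≤ b ^ 2 := by have := hu.1; have := hu.2; gcongr
    have : c ≤ Real.exp (-s ^ 2 * (1 + u ^ 2) / 2) / (Real.pi * (1 + u ^ 2)) := by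
      simp only [c]
      gcongr ?_ / (_ * (1 + ?_))
      rw [Real.exp_le_exp]
      nlinarith [sq_nonneg s]
    linarith
  have := hanti (left_mem_Icc.2 hb) (right_mem_Icc.2 hb) hb
  simp only [ne_eq, OfNat.ofNat_ne_zero, not_false_eq_true, zero_pow, add_zero, Real.sqrt_one,
    mul_one, mul_zero, stdMass_zero_right] at this
  linarith

/-- Near `β = 0` the lens probability `f(1-β,α)` loses a term of order `√β`. -/
lemma fB_one_sub_le (γ α : ℝ) {β : ℝ} (h0 : 0 ≤ β) (h1 : β < 1) :
    fB γ (1 - β) α ≤ gaussTail (√2 * (γ + α)) -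
      √(β * (1 - β)) / Real.pi * Real.exp (-(γ + α) ^ 2 / (1 - β)) := by
  have h1' : 0 < 1 - β := by linarith
  have hb := stdMass_curve_le (√2 * (γ + α)) (Real.sqrt_nonneg (β / (1 - β)))
  rw [Real.sq_sqrt (by positivity), show 1 + β / (1 - β) = 1 / (1 - β) by field_simp; ring,
    Real.sqrt_div zero_le_one, Real.sqrt_one] at hb
  rw [fB_eq γ α h1', show 1 - (1 - β) = β by ring, div_eq_mul_one_div _ (√(1 - β))]
  refine hb.trans (le_of_eq ?_)
  rw [show -(√2 * (γ + α)) ^ 2 * (1 / (1 - β)) / 2 = -(γ + α) ^ 2 / (1 - β) by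
    rw [mul_pow, Real.sq_sqrt zero_le_two]; ring]
  congr 1
  rw [Real.sqrt_div h0, Real.sqrt_mul h0]
  have h3 : √(1 - β) ^ 2 = 1 - β := Real.sq_sqrt h1'.le
  have h4 := Real.sqrt_pos.2 h1'
  nth_rewrite 3 [← h3]
  field_simp

lemma exp_mul_F2 (γ : ℝ) {n k : ℕ} (hk : 0 < k) (hkn : k < n) (α₁ α₂ : ℝ) :
    Real.exp (n * F2 γ (k / n) α₁ α₂) =
      4 ^ n / (((k : ℝ) / n) ^ k * (1 - (k : ℝ) / n) ^ (n - k)) ^ 2 *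
        (Real.exp (-(2 * n * α₁ ^ 2)) * Real.exp (-(2 * n * α₂ ^ 2)) *
          (fB γ (k / n) α₁ ^ (2 * k) * fB γ (1 - k / n) α₂ ^ (2 * (n - k)))) := by
  have hn0 : (0 : ℝ) < n := by exact_mod_cast hk.trans hkn
  have hk0 : (0 : ℝ) < k := by exact_mod_cast hk
  have hkn' : (k : ℝ) < n := by exact_mod_cast hkn
  have h1 : 0 < (k : ℝ) / n := by positivity
  have h2 : 0 < 1 - (k : ℝ) / n := by rw [sub_pos, div_lt_one hn0]; exact hkn'
  have f1 := fB_pos γ α₁ h1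
  have f2 := fB_pos γ α₂ h2
  have hsub : ((n - k : ℕ) : ℝ) = n - k := Nat.cast_sub hkn.le
  have hpos : 0 < 4 ^ n / (((k : ℝ) / n) ^ k * (1 - (k : ℝ) / n) ^ (n - k)) ^ 2 *
        (Real.exp (-(2 * n * α₁ ^ 2)) * Real.exp (-(2 * n * α₂ ^ 2)) *
          (fB γ (k / n) α₁ ^ (2 * k) * fB γ (1 - k / n) α₂ ^ (2 * (n - k)))) := by positivity
  rw [← Real.exp_log hpos]
  congr 1
  rw [Real.log_mul (by positivity) (by positivity), Real.log_div (by positivity) (by positivity),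
    Real.log_mul (by positivity) (by positivity), Real.log_mul (by positivity) (by positivity),
    Real.log_mul (by positivity) (by positivity), Real.log_exp, Real.log_exp,
    Real.log_pow, Real.log_pow, Real.log_pow, Real.log_pow,
    Real.log_mul (by positivity) (by positivity), Real.log_pow, Real.log_pow,
    show (4 : ℝ) = 2 ^ 2 by norm_num, Real.log_pow]
  unfold F2
  push_cast
  rw [hsub]
  field_simp
  ring

lemma integrable_exp_quarter : Integrable (fun x : ℝ × ℝ =>
    Real.exp (-x.1 ^ 2 / 4) * Real.exp (-x.2 ^ 2 / 4)) := by
  have : Integrable fun x : ℝ => Real.exp (-x ^ 2 / 4) := by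
    refine (integrable_exp_neg_mul_sq (b := 1 / 4) (by norm_num)).congr
      (Filter.Eventually.of_forall fun x => ?_)
    simp only; ring_nf
  exact this.mul_prod this

/-- The two-cut probability is controlled by integrating any upper bound of `exp (n F₂)`. -/
lemma exists_pairProb_le_integral {δ : ℝ} (hδ : 0 < δ) (Γ : ℝ) :
    ∃ C : ℝ, 0 < C ∧ ∃ N : ℕ, ∀ n k : ℕ, N ≤ n → 0 < n → k ≤ n → δ * n ≤ k → δ * n ≤ (n - k : ℕ) →
      ∀ γ : ℝ, |γ| ≤ Γ → ∀ T : ℤ, (T : ℝ) = 2 * (γ * √n) + 1 →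
      ∀ g : ℝ × ℝ → ℝ, Integrable g → (∀ x, 0 ≤ g x) →
        (∀ x : ℝ × ℝ, x.1 ^ 2 + x.2 ^ 2 ≤ 16 * n →
          Real.exp (n * F2 γ (k / n) (-x.1 / (2 * √n)) (-x.2 / (2 * √n))) ≤ g x) →
        pairProb (2 * k) (2 * (n - k)) T ≤
          C * ((((k : ℝ) / n) ^ k * (1 - (k : ℝ) / n) ^ (n - k)) ^ 2 / 4 ^ n * ∫ x, g x) +
            C * ((n : ℝ) ^ 4 * Real.exp (-(4 * n))) := by
  obtain ⟨C₁, hC₁, N, hN, h1⟩ := exists_pairProb_le hδ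
  obtain ⟨C₂, hC₂, h2⟩ := exists_near_pairSum_le ((2 * |Γ| + 4) / √(2 * δ)) hδ
  obtain ⟨C₃, hC₃, h3⟩ := exists_far_pairSum_le hδ
  set J := ∫ x : ℝ × ℝ, Real.exp (-x.1 ^ 2 / 4) * Real.exp (-x.2 ^ 2 / 4) with hJ
  have hJ0 : 0 ≤ J := integral_nonneg fun x => by positivity
  refine ⟨C₁ * C₂ + C₁ * C₃ * J, by positivity, N, ?_⟩
  intro n k hNn hn hkn hk hl γ hγ T hT g hg hg0 hgF
  have hn0 : (0 : ℝ) < n := by exact_mod_cast hn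
  have hsn := Real.sqrt_pos.2 hn0
  have hk0 : 0 < k := by
    have : (0 : ℝ) < k := lt_of_lt_of_le (by positivity) hk
    exact_mod_cast this
  have hl0 : 0 < n - k := by
    have : (0 : ℝ) < (n - k : ℕ) := lt_of_lt_of_le (by positivity) hl
    exact_mod_cast this
  have hkn' : k < n := by omega
  have hsum : ((k : ℝ)) + (n - k : ℕ) = n := by rw [Nat.cast_sub hkn]; ring
  have hk0' : (0 : ℝ) < k := by exact_mod_cast hk0
  have hl0' : (0 : ℝ) < (n - k : ℕ) := by exact_mod_cast hl0
  set W := (((k : ℝ) / n) ^ k * (1 - (k : ℝ) / n) ^ (n - k)) ^ 2 / 4 ^ n with hW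
  have h1β : 0 < 1 - (k : ℝ) / n := by
    rw [sub_pos, div_lt_one hn0]; exact_mod_cast hkn'
  have hW0 : 0 < W := by positivity
  have hsum2 : ((2 * k : ℕ) : ℝ) + ((2 * (n - k) : ℕ) : ℝ) = 2 * n := by push_cast; linarith
  have hP := h1 (2 * k) (2 * (n - k)) (by omega) (by rw [hsum2]; push_cast; linarith)
    (by rw [hsum2]; push_cast; linarith) (even_two_mul _) (even_two_mul _) T
  have hb1 : δ * ((2 * k : ℕ) : ℝ) ≤ ((2 * (n - k) : ℕ) : ℝ) := by
    push_cast
    have : δ * (k : ℝ) ≤ δ * n := mul_le_mul_of_nonneg_left (by linarith) hδ.le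
    linarith
  have hb2 : δ * ((2 * (n - k) : ℕ) : ℝ) ≤ ((2 * k : ℕ) : ℝ) := by
    push_cast
    have : δ * ((n - k : ℕ) : ℝ) ≤ δ * n := mul_le_mul_of_nonneg_left (by linarith) hδ.le
    linarith
  have hpt : ∀ x : ℝ × ℝ, pairIntegrand (2 * k) (2 * (n - k)) (T - 1) x ≤
      C₂ * W * g x + C₃ * ((n : ℝ) ^ 4 * Real.exp (-(4 * n))) *
        (Real.exp (-x.1 ^ 2 / 4) * Real.exp (-x.2 ^ 2 / 4)) := fun x => by
    unfold pairIntegrand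
    have hgx := hg0 x
    by_cases hx : x.1 ^ 2 + x.2 ^ 2 ≤ 16 * n
    · have hnear : ∀ (y : ℝ) (m : ℕ), δ * n ≤ m → y ^ 2 ≤ 16 * n →
          |(T : ℝ) - 1 - y| ≤ (2 * |Γ| + 4) / √(2 * δ) * √((2 * m : ℕ) : ℝ) := by
        intro y m hm hy
        have hy' : |y| ≤ 4 * √n := by
          rw [show 4 * √(n : ℝ) = √(16 * n) by
            rw [Real.sqrt_mul (by norm_num), show (16 : ℝ) = 4 ^ 2 by norm_num,
              Real.sqrt_sq (by norm_num)]]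
          exact Real.abs_le_sqrt hy
        have hm' : √(2 * δ) * √n ≤ √((2 * m : ℕ) : ℝ) := by
          rw [← Real.sqrt_mul (by positivity)]
          apply Real.sqrt_le_sqrt
          push_cast; linarith
        have h2δ : 0 < √(2 * δ) := Real.sqrt_pos.2 (by linarith)
        have hγ' : |γ| ≤ |Γ| := hγ.trans (le_abs_self _)
        calc |(T : ℝ) - 1 - y| ≤ |(T : ℝ) - 1| + |y| := abs_sub _ _
          _ ≤ 2 * (|Γ| * √n) + 4 * √n := by
              gcongr
              rw [hT, add_sub_cancel_right, abs_mul, abs_mul, abs_of_pos hsn, abs_two]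
              gcongr
          _ = (2 * |Γ| + 4) / √(2 * δ) * (√(2 * δ) * √n) := by field_simp
          _ ≤ _ := by gcongr
      have hs1 := hnear x.1 k hk (by nlinarith [sq_nonneg x.2])
      have hs2 := hnear x.2 (n - k) hl (by nlinarith [sq_nonneg x.1])
      have hmain := h2 (2 * k) (2 * (n - k)) (by omega) (by omega) hb1 hb2 (T - 1 - x.1)
        (T - 1 - x.2) hs1 hs2
      have hv1 : vtxMass ((2 * k : ℕ) : ℝ) ((2 * (n - k) : ℕ) : ℝ) (T - 1 - x.1) =
          fB γ (k / n) (-x.1 / (2 * √n)) := by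
        rw [← vtxMass_eq_fB γ _ hk0' (by exact_mod_cast hkn')]
        congr 1
        · push_cast; ring
        · push_cast [Nat.cast_sub hkn]; ring
        · rw [hT]; field_simp; ring
      have hv2 : vtxMass ((2 * (n - k) : ℕ) : ℝ) ((2 * k : ℕ) : ℝ) (T - 1 - x.2) =
          fB γ (1 - k / n) (-x.2 / (2 * √n)) := by
        have e : (1 : ℝ) - k / n = ((n - k : ℕ) : ℝ) / n := by
          rw [Nat.cast_sub hkn]; field_simp
        rw [e, ← vtxMass_eq_fB γ _ hl0' (by linarith)]
        congr 1
        · push_cast; ring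
        · push_cast [Nat.cast_sub hkn]; ring
        · rw [hT]; field_simp; ring
      rw [hv1, hv2] at hmain
      have hF := hgF x hx
      rw [exp_mul_F2 γ hk0 hkn'] at hF
      have hsq : ∀ y : ℝ, -(2 * n * (-y / (2 * √n)) ^ 2) = -y ^ 2 / 2 := fun y => by
        rw [div_pow, mul_pow, Real.sq_sqrt hn0.le]; field_simp
      rw [hsq, hsq] at hF
      set V := Real.exp (-x.1 ^ 2 / 2) * Real.exp (-x.2 ^ 2 / 2) *
        (fB γ (k / n) (-x.1 / (2 * √n)) ^ (2 * k) *
          fB γ (1 - k / n) (-x.2 / (2 * √n)) ^ (2 * (n - k))) with hV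
      have hVW : V ≤ W * g x := by
        have : V = W * (4 ^ n / (((k : ℝ) / n) ^ k * (1 - (k : ℝ) / n) ^ (n - k)) ^ 2 * V) := by
          have hD : 0 < (((k : ℝ) / n) ^ k * (1 - (k : ℝ) / n) ^ (n - k)) ^ 2 := by positivity
          rw [hW]
          generalize (((k : ℝ) / n) ^ k * (1 - (k : ℝ) / n) ^ (n - k)) ^ 2 = D at hD
          generalize V = V'
          field_simp
        rw [this]
        gcongr
      calc _ ≤ Real.exp (-x.1 ^ 2 / 2) * Real.exp (-x.2 ^ 2 / 2) * (C₂ * _) := by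
            gcongr
        _ = C₂ * V := by rw [hV]; ring
        _ ≤ C₂ * (W * g x) := by gcongr
        _ ≤ _ := by
            rw [mul_assoc]
            exact le_add_of_nonneg_right (by positivity)
    · push Not at hx
      have hmain := h3 (2 * k) (2 * (n - k)) (by omega) (by omega) hb1 hb2 (T - 1 - x.1)
        (T - 1 - x.2)
      have hpq : (((2 * k : ℕ) : ℝ) * ((2 * (n - k) : ℕ) : ℝ)) ^ 2 ≤ (n : ℝ) ^ 4 := by
        rw [show (n : ℝ) ^ 4 = (n ^ 2) ^ 2 by ring]
        push_cast
        gcongr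
        rw [← hsum]
        nlinarith [sq_nonneg ((k : ℝ) - (n - k : ℕ))]
      have he : Real.exp (-x.1 ^ 2 / 2) * Real.exp (-x.2 ^ 2 / 2) ≤ Real.exp (-(4 * n)) *
          (Real.exp (-x.1 ^ 2 / 4) * Real.exp (-x.2 ^ 2 / 4)) := by
        rw [← Real.exp_add, ← Real.exp_add, ← Real.exp_add]
        rw [Real.exp_le_exp]
        linarith
      calc _ ≤ (Real.exp (-(4 * n)) * (Real.exp (-x.1 ^ 2 / 4) * Real.exp (-x.2 ^ 2 / 4))) *
            (C₃ * (n : ℝ) ^ 4) := by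
            refine mul_le_mul he (hmain.trans (by gcongr)) ?_ (by positivity)
            exact mul_nonneg (Real.sqrt_nonneg _) (pairSum_nonneg _ _ _ _)
        _ = C₃ * ((n : ℝ) ^ 4 * Real.exp (-(4 * n))) *
            (Real.exp (-x.1 ^ 2 / 4) * Real.exp (-x.2 ^ 2 / 4)) := by ring
        _ ≤ _ := le_add_of_nonneg_left (by positivity)
  have hI1 : Integrable fun x => C₂ * W * g x := hg.const_mul _
  have hI2 : Integrable fun x : ℝ × ℝ => C₃ * ((n : ℝ) ^ 4 * Real.exp (-(4 * n))) *
        (Real.exp (-x.1 ^ 2 / 4) * Real.exp (-x.2 ^ 2 / 4)) := integrable_exp_quarter.const_mul _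
  have hinteg : ∫ x, pairIntegrand (2 * k) (2 * (n - k)) (T - 1) x ≤
      C₂ * W * (∫ x, g x) + C₃ * ((n : ℝ) ^ 4 * Real.exp (-(4 * n))) * J := by
    rw [hJ, ← integral_const_mul, ← integral_const_mul, ← integral_add hI1 hI2]
    exact integral_mono_of_nonneg (Filter.Eventually.of_forall fun x => pairIntegrand_nonneg _ _ _ _)
      (hI1.add hI2) (Filter.Eventually.of_forall hpt)
  have hG0 : 0 ≤ ∫ x, g x := integral_nonneg hg0
  have hE : 0 < (n : ℝ) ^ 4 * Real.exp (-(4 * n)) := by positivity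
  calc _ ≤ C₁ * (C₂ * W * (∫ x, g x) + C₃ * ((n : ℝ) ^ 4 * Real.exp (-(4 * n))) * J) :=
        hP.trans (by gcongr)
    _ = C₁ * C₂ * (W * ∫ x, g x) + C₁ * C₃ * J * ((n : ℝ) ^ 4 * Real.exp (-(4 * n))) := by ring
    _ ≤ _ := by
        gcongr
        · have : 0 ≤ C₁ * C₃ * J := by positivity
          linarith
        · have : 0 ≤ C₁ * C₂ := by positivity
          linarith

/-- `A` is one side of a bisection of `G` in which every vertex has at least `γ√n` more
neighbours on its own side. -/
def IsFriendly (n : ℕ) (γ : ℝ) (G : SimpleGraph (Fin (2 * n))) (A : Finset (Fin (2 * n))) : Prop :=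
  A.card = n ∧
    (∀ v ∈ A, (degIn G v Aᶜ : ℝ) + γ * Real.sqrt n ≤ (degIn G v A : ℝ)) ∧
    (∀ v ∈ (Aᶜ : Finset (Fin (2 * n))),
      (degIn G v A : ℝ) + γ * Real.sqrt n ≤ (degIn G v Aᶜ : ℝ))

lemma bsign_not (a : Bool) : bsign (!a) = -bsign a := by cases a <;> decide

lemma bsign_mul_self (a : Bool) : bsign a * bsign a = 1 := by cases a <;> decide

lemma signedDeg_complete {N : ℕ} (h : Fin N → Fin N → Bool) (hs : ∀ i j, h i j = h j i)
    (v : Fin N) :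
    signedDeg (fun e : CEdge N => e.1.1) (fun e => e.1.2) (fun e => h e.1.1 e.1.2) v =
      ∑ j, bsign (h v j) - bsign (h v v) := by
  have h1 := sum_CEdge (fun i j : Fin N => ((bsign (h i j) : ℤ) : ℝ) *
    ((if i = v then 1 else 0) + (if j = v then 1 else 0))) fun i j => by
      rw [hs i j, add_comm]
  have h2 : ∑ i, ∑ j, ((bsign (h i j) : ℤ) : ℝ) * ((if i = v then 1 else 0) +
      (if j = v then 1 else 0)) = 2 * ∑ j, ((bsign (h v j) : ℤ) : ℝ) := by
    simp only [mul_add, Finset.sum_add_distrib, mul_ite, mul_one, mul_zero, Finset.sum_ite_eq',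
      Finset.mem_univ, if_true]
    rw [Finset.sum_comm]
    simp only [Finset.sum_ite_eq', Finset.mem_univ, if_true]
    rw [two_mul]
    congr 1
    exact Finset.sum_congr rfl fun i _ => by rw [hs]
  have h3 : ∑ i, ((bsign (h i i) : ℤ) : ℝ) * ((if i = v then 1 else 0) +
      (if i = v then 1 else 0)) = 2 * ((bsign (h v v) : ℤ) : ℝ) := by
    simp [mul_add, Finset.sum_add_distrib, two_mul]
  rw [h2, h3] at h1
  have h4 : ((signedDeg (fun e : CEdge N => e.1.1) (fun e => e.1.2)
      (fun e => h e.1.1 e.1.2) v : ℤ) : ℝ) = ((∑ j, bsign (h v j) - bsign (h v v) : ℤ) : ℝ) := by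
    unfold signedDeg
    push_cast
    rw [h1]; ring
  exact_mod_cast h4

open Classical in
lemma degIn_eq {n : ℕ} (G : SimpleGraph (Fin n)) (v : Fin n) (S : Finset (Fin n)) :
    (degIn G v S : ℤ) = ∑ w, if w ∈ S ∧ G.Adj v w then 1 else 0 := by
  unfold degIn
  rw [Nat.card_eq_fintype_card, Fintype.card_subtype, Finset.card_filter]
  push_cast
  rfl

open Classical in
lemma IsFriendly.two_mul_le {n : ℕ} {γ : ℝ} {G : SimpleGraph (Fin (2 * n))}
    {A : Finset (Fin (2 * n))} (hA : IsFriendly n γ G A) {z : ℤ} (hz : γ * √n = z)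
    (v : Fin (2 * n)) :
    2 * z ≤ ∑ w, bsign (decide (G.Adj v w) == (decide (v ∈ A) == decide (w ∈ A))) := by
  obtain ⟨hc, h1, h2⟩ := hA
  have hbal : ∑ w, bsign (decide (w ∈ A)) = 0 := by
    have : ∀ w, bsign (decide (w ∈ A)) = 2 * (if w ∈ A then 1 else 0) - 1 := fun w => by
      by_cases h : w ∈ A <;> simp [h, bsign]
    simp_rw [this]
    rw [Finset.sum_sub_distrib, ← Finset.mul_sum]
    simp [hc]
  have hsum : ∑ w, bsign (decide (G.Adj v w) == (decide (v ∈ A) == decide (w ∈ A))) =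
      2 * (bsign (decide (v ∈ A)) * ((degIn G v A : ℤ) - degIn G v Aᶜ)) := by
    have : ∀ w, bsign (decide (G.Adj v w) == (decide (v ∈ A) == decide (w ∈ A))) =
        2 * (bsign (decide (v ∈ A)) * ((if w ∈ A ∧ G.Adj v w then 1 else 0) -
          (if w ∈ Aᶜ ∧ G.Adj v w then 1 else 0))) -
            bsign (decide (v ∈ A)) * bsign (decide (w ∈ A)) := fun w => by
      by_cases h : w ∈ A <;> by_cases h' : G.Adj v w <;> by_cases h'' : v ∈ A <;>
        simp [h, h', h'', bsign]
    simp_rw [this]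
    rw [Finset.sum_sub_distrib, ← Finset.mul_sum, ← Finset.mul_sum, ← Finset.mul_sum, hbal,
      Finset.sum_sub_distrib, ← degIn_eq, ← degIn_eq]
    ring
  rw [hsum]
  by_cases hv : v ∈ A
  · have := h1 v hv
    rw [hz] at this
    have : (degIn G v Aᶜ : ℤ) + z ≤ degIn G v A := by exact_mod_cast this
    simp [hv, bsign]; linarith
  · have := h2 v (by simpa using hv)
    rw [hz] at this
    have : (degIn G v A : ℤ) + z ≤ degIn G v Aᶜ := by exact_mod_cast this
    simp [hv, bsign]; linarith

lemma card_CEdge (N : ℕ) : Fintype.card (CEdge N) = N.choose 2 := by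
  rw [Fintype.card_subtype]
  have h := sum_CEdge (N := N) (fun _ _ => 1) fun _ _ => rfl
  simp only [Finset.sum_const, Finset.card_univ, Fintype.card_fin, nsmul_eq_mul, mul_one] at h
  rw [Fintype.card_subtype] at h
  have h2 := Nat.cast_choose_two ℝ N
  have : ((Finset.univ.filter fun p : Fin N × Fin N => p.1 < p.2).card : ℝ) = N.choose 2 := by
    rw [h, h2]; ring
  exact_mod_cast this

lemma choose_two_add (p q : ℕ) : (p + q).choose 2 = p.choose 2 + q.choose 2 + p * q := by
  have h : ((p + q).choose 2 : ℝ) = p.choose 2 + q.choose 2 + p * q := by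
    rw [Nat.cast_choose_two, Nat.cast_choose_two, Nat.cast_choose_two]; push_cast; ring
  exact_mod_cast h

open Classical in
/-- Graphs with two prescribed friendly bisections are no more frequent than `pairProb`. -/
lemma card_friendly_pair_le {n p q : ℕ} {γ : ℝ} {z : ℤ} (hz : γ * √n = z)
    {A B : Finset (Fin (2 * n))} (e : Fin p ⊕ Fin q ≃ Fin (2 * n))
    (hP : ∀ i, e (Sum.inl i) ∈ A ↔ e (Sum.inl i) ∈ B)
    (hQ : ∀ j, e (Sum.inr j) ∈ A ↔ e (Sum.inr j) ∉ B) :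
    ((Finset.univ.filter fun G : SimpleGraph (Fin (2 * n)) =>
      IsFriendly n γ G A ∧ IsFriendly n γ G B).card : ℝ) / 2 ^ (2 * n).choose 2 ≤
        pairProb p q (2 * z + 1) := by
  have hpq : p + q = 2 * n := by
    have := Fintype.card_congr e
    simpa using this
  have hden : (2 : ℝ) ^ Fintype.card (CEdge p) * 2 ^ Fintype.card (CEdge q) * 2 ^ (p * q) =
      2 ^ (2 * n).choose 2 := by
    rw [card_CEdge, card_CEdge, ← pow_add, ← pow_add, ← hpq, choose_two_add]
  unfold pairProb
  rw [hden]
  gcongr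
  let X : SimpleGraph (Fin (2 * n)) → Fin (2 * n) → Fin (2 * n) → Bool := fun G v w =>
    decide (G.Adj v w) == (decide (v ∈ A) == decide (w ∈ A))
  have hXs : ∀ G v w, X G v w = X G w v := fun G v w => by
    simp only [X, G.adj_comm v w, Bool.beq_comm (a := decide (v ∈ A))]
  have hXd : ∀ G v, bsign (X G v v) = -1 := fun G v => by simp [X, bsign]
  let f : SimpleGraph (Fin (2 * n)) → (CEdge p → Bool) × (CEdge q → Bool) × (Fin p × Fin q → Bool) :=
    fun G => (fun c => X G (e (Sum.inl c.1.1)) (e (Sum.inl c.1.2)),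
      fun c => X G (e (Sum.inr c.1.1)) (e (Sum.inr c.1.2)),
      fun c => X G (e (Sum.inl c.1)) (e (Sum.inr c.2)))
  refine Finset.card_le_card_of_injOn f ?_ ?_
  · intro G hG
    have hG' := (Finset.mem_filter.1 hG).2
    have hA := hG'.1.two_mul_le hz
    have hB := hG'.2.two_mul_le hz
    have hsplit : ∀ g : Fin (2 * n) → ℤ, ∑ w, g w =
        ∑ i, g (e (Sum.inl i)) + ∑ j, g (e (Sum.inr j)) := fun g => by
      rw [← e.sum_comp, Fintype.sum_sum_type]
    have hBX : ∀ v w, bsign (decide (G.Adj v w) == (decide (v ∈ B) == decide (w ∈ B))) =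
        bsign (X G v w) * (bsign (decide (v ∈ A)) * bsign (decide (v ∈ B))) *
          (bsign (decide (w ∈ A)) * bsign (decide (w ∈ B))) := fun v w => by
      by_cases h1 : v ∈ A <;> by_cases h2 : v ∈ B <;> by_cases h3 : w ∈ A <;>
        by_cases h4 : w ∈ B <;> by_cases h5 : G.Adj v w <;> simp [X, h1, h2, h3, h4, h5, bsign]
    have hP' : ∀ i, bsign (decide (e (Sum.inl i) ∈ A)) * bsign (decide (e (Sum.inl i) ∈ B)) = 1 :=
      fun i => by
        rw [show decide (e (Sum.inl i) ∈ A) = decide (e (Sum.inl i) ∈ B) by simp [hP i]]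
        exact bsign_mul_self _
    have hQ' : ∀ j, bsign (decide (e (Sum.inr j) ∈ A)) * bsign (decide (e (Sum.inr j) ∈ B)) = -1 :=
      fun j => by
        rw [show decide (e (Sum.inr j) ∈ A) = !decide (e (Sum.inr j) ∈ B) by simp [hQ j], bsign_not,
          neg_mul, bsign_mul_self]
    refine Finset.mem_coe.2 (Finset.mem_filter.2 ⟨Finset.mem_univ _, fun v => ?_, fun w => ?_⟩)
    · have hd := signedDeg_complete (fun i j => X G (e (Sum.inl i)) (e (Sum.inl j)))
        (fun i j => hXs _ _ _) v
      have h1 := hA (e (Sum.inl v))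
      have h2 := hB (e (Sum.inl v))
      simp_rw [hBX, hsplit, hP', hQ'] at h2
      rw [hsplit] at h1
      simp only [f]
      rw [hd, hXd]
      simp only [mul_one, mul_neg, Finset.sum_neg_distrib] at h2
      simp only [X] at h1 h2 ⊢
      rcases abs_cases (∑ w, bsign (X G (e (Sum.inl v)) (e (Sum.inr w)))) with ⟨h, _⟩ | ⟨h, _⟩ <;>
        simp only [X] at h <;> rw [h] <;> linarith
    · have hd := signedDeg_complete (fun i j => X G (e (Sum.inr i)) (e (Sum.inr j)))
        (fun i j => hXs _ _ _) w
      have h1 := hA (e (Sum.inr w))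
      have h2 := hB (e (Sum.inr w))
      simp_rw [hBX, hsplit, hP', hQ'] at h2
      rw [hsplit] at h1
      have hsw : ∑ v, bsign (X G (e (Sum.inl v)) (e (Sum.inr w))) =
          ∑ v, bsign (X G (e (Sum.inr w)) (e (Sum.inl v))) :=
        Finset.sum_congr rfl fun v _ => by rw [hXs]
      simp only [f]
      rw [hd, hXd, hsw]
      simp only [mul_one, mul_neg, neg_neg, Finset.sum_neg_distrib] at h2
      simp only [X] at h1 h2 ⊢
      rcases abs_cases (∑ v, bsign (X G (e (Sum.inr w)) (e (Sum.inl v)))) with ⟨h, _⟩ | ⟨h, _⟩ <;>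
        simp only [X] at h <;> rw [h] <;> linarith
  · intro G _ H _ hGH
    have hcan : ∀ v w, X G v w = X H v w → (G.Adj v w ↔ H.Adj v w) := fun v w h => by
      by_cases h1 : v ∈ A <;> by_cases h2 : w ∈ A <;> simpa [X, h1, h2] using h
    simp only [f, Prod.mk.injEq] at hGH
    obtain ⟨g1, g2, g3⟩ := hGH
    ext v w
    obtain ⟨v, rfl⟩ := e.surjective v
    obtain ⟨w, rfl⟩ := e.surjective w
    rcases v with i | i <;> rcases w with j | j
    · rcases lt_trichotomy i j with h | h | h
      · exact hcan _ _ (congr_fun g1 ⟨(i, j), h⟩)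
      · subst h; simp
      · rw [G.adj_comm, H.adj_comm]
        exact hcan _ _ (congr_fun g1 ⟨(j, i), h⟩)
    · exact hcan _ _ (congr_fun g3 (i, j))
    · rw [G.adj_comm, H.adj_comm]
      exact hcan _ _ (congr_fun g3 (j, i))
    · rcases lt_trichotomy i j with h | h | h
      · exact hcan _ _ (congr_fun g2 ⟨(i, j), h⟩)
      · subst h; simp
      · rw [G.adj_comm, H.adj_comm]
        exact hcan _ _ (congr_fun g2 ⟨(j, i), h⟩)

open Classical in
lemma Xgamma_eq_sum (n : ℕ) (γ : ℝ) (G : SimpleGraph (Fin (2 * n))) : (Xgamma n γ G : ℝ) =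
    ∑ A : Finset (Fin (2 * n)), if IsFriendly n γ G A then 1 else 0 := by
  have h : Xgamma n γ G = Nat.card {A : Finset (Fin (2 * n)) // IsFriendly n γ G A} := rfl
  rw [h, Nat.card_eq_fintype_card, Fintype.card_subtype, Finset.card_filter]
  push_cast
  rfl

open Classical in
lemma EXgamma_eq (n : ℕ) (γ : ℝ) : EXgamma n γ =
    ∑ A : Finset (Fin (2 * n)), ((Finset.univ.filter fun G : SimpleGraph (Fin (2 * n)) =>
      IsFriendly n γ G A).card : ℝ) / 2 ^ (2 * n).choose 2 := by
  unfold EXgamma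
  rw [← Finset.sum_div]
  congr 1
  simp_rw [Xgamma_eq_sum]
  rw [Finset.sum_comm]
  refine Finset.sum_congr rfl fun A _ => ?_
  rw [Finset.card_filter]
  push_cast
  rfl

open Classical in
lemma EXgammaSq_eq (n : ℕ) (γ : ℝ) : EXgammaSq n γ =
    ∑ A : Finset (Fin (2 * n)), ∑ B : Finset (Fin (2 * n)),
      ((Finset.univ.filter fun G : SimpleGraph (Fin (2 * n)) =>
        IsFriendly n γ G A ∧ IsFriendly n γ G B).card : ℝ) / 2 ^ (2 * n).choose 2 := by
  unfold EXgammaSq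
  simp_rw [← Finset.sum_div]
  congr 1
  have h : ∀ G : SimpleGraph (Fin (2 * n)), (Xgamma n γ G : ℝ) ^ 2 =
      ∑ A : Finset (Fin (2 * n)), ∑ B : Finset (Fin (2 * n)),
        if IsFriendly n γ G A ∧ IsFriendly n γ G B then 1 else 0 := fun G => by
    rw [Xgamma_eq_sum, sq, Finset.sum_mul_sum]
    refine Finset.sum_congr rfl fun A _ => Finset.sum_congr rfl fun B _ => ?_
    by_cases h1 : IsFriendly n γ G A <;> by_cases h2 : IsFriendly n γ G B <;> simp [h1, h2]
  simp_rw [h]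
  rw [Finset.sum_comm]
  refine Finset.sum_congr rfl fun A _ => ?_
  rw [Finset.sum_comm]
  refine Finset.sum_congr rfl fun B _ => ?_
  rw [Finset.card_filter]
  push_cast
  rfl

lemma card_overlap_le {n : ℕ} {A : Finset (Fin (2 * n))} (hA : A.card = n) {k : ℕ} (hk : k ≤ n) :
    ((Finset.univ.filter fun B : Finset (Fin (2 * n)) => B.card = n ∧ (A ∩ B).card = k).card) ≤
      n.choose k ^ 2 := by
  have h : (Finset.powersetCard k A ×ˢ Finset.powersetCard (n - k) Aᶜ).card = n.choose k ^ 2 := by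
    rw [Finset.card_product, Finset.card_powersetCard, Finset.card_powersetCard,
      Finset.card_compl, hA, Fintype.card_fin, show 2 * n - n = n by omega, Nat.choose_symm hk, sq]
  rw [← h]
  refine Finset.card_le_card_of_injOn (fun B => (A ∩ B, B \ A)) ?_ ?_
  · intro B hB
    obtain ⟨h1, h2⟩ := (Finset.mem_filter.1 hB).2
    refine Finset.mem_coe.2 (Finset.mem_product.2 ⟨Finset.mem_powersetCard.2
      ⟨Finset.inter_subset_left, h2⟩, Finset.mem_powersetCard.2 ⟨?_, ?_⟩⟩)
    · intro x hx; simpa using (Finset.mem_sdiff.1 hx).2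
    · have := Finset.card_sdiff_add_card_inter B A
      rw [Finset.inter_comm B A] at this
      simp only; omega
  · intro B _ B' _ hBB
    simp only [Prod.mk.injEq] at hBB
    ext x
    have h1 := congrArg (x ∈ ·) hBB.1
    have h2 := congrArg (x ∈ ·) hBB.2
    simp only [Finset.mem_inter, Finset.mem_sdiff, eq_iff_iff] at h1 h2
    tauto

lemma exists_equiv_of_overlap {n k : ℕ} {A B : Finset (Fin (2 * n))} (hA : A.card = n)
    (hB : B.card = n) (hk : (A ∩ B).card = k) :
    ∃ e : Fin (2 * k) ⊕ Fin (2 * (n - k)) ≃ Fin (2 * n),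
      (∀ i, e (Sum.inl i) ∈ A ↔ e (Sum.inl i) ∈ B) ∧
      (∀ j, e (Sum.inr j) ∈ A ↔ e (Sum.inr j) ∉ B) := by
  have hkn : k ≤ n := by
    have := Finset.card_le_card (Finset.inter_subset_left (s₁ := A) (s₂ := B))
    omega
  have hQ : Fintype.card {v // ¬ (v ∈ A ↔ v ∈ B)} = 2 * (n - k) := by
    rw [Fintype.card_subtype, show (Finset.univ.filter fun v => ¬ (v ∈ A ↔ v ∈ B)) =
      (A \ B) ∪ (B \ A) by ext x; simp; tauto, Finset.card_union_of_disjoint]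
    · have h1 := Finset.card_sdiff_add_card_inter A B
      have h2 := Finset.card_sdiff_add_card_inter B A
      rw [Finset.inter_comm B A] at h2
      omega
    · exact disjoint_sdiff_sdiff
  have hP : Fintype.card {v // v ∈ A ↔ v ∈ B} = 2 * k := by
    have := Fintype.card_subtype_compl fun v => (v ∈ A ↔ v ∈ B)
    have h2 := Fintype.card_subtype_le fun v => (v ∈ A ↔ v ∈ B)
    rw [hQ, Fintype.card_fin] at this
    rw [Fintype.card_fin] at h2
    omega
  let e₁ := (Fintype.equivFinOfCardEq hP).symm
  let e₂ := (Fintype.equivFinOfCardEq hQ).symm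
  refine ⟨(Equiv.sumCongr e₁ e₂).trans (Equiv.sumCompl _), fun i => ?_, fun j => ?_⟩
  · simpa using (e₁ i).2
  · have := (e₂ j).2
    simp only [Equiv.trans_apply, Equiv.sumCongr_apply, Sum.map_inr, Equiv.sumCompl_apply_inr]
    tauto

open Classical in
/-- Second moment split according to the overlap of the two bisections. -/
lemma EXgammaSq_le {n : ℕ} {γ : ℝ} {z : ℤ} (hz : γ * √n = z) {K : Finset ℕ}
    (hK : K ⊆ Finset.range (n + 1)) : EXgammaSq n γ ≤
      (∑ k ∈ Finset.range (n + 1) \ K, (n.choose k : ℝ) ^ 2) * EXgamma n γ +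
        (2 * n).choose n * ∑ k ∈ K, (n.choose k : ℝ) ^ 2 *
          pairProb (2 * k) (2 * (n - k)) (2 * z + 1) := by
  set pA : Finset (Fin (2 * n)) → ℝ := fun A =>
    ((Finset.univ.filter fun G : SimpleGraph (Fin (2 * n)) =>
      IsFriendly n γ G A).card : ℝ) / 2 ^ (2 * n).choose 2 with hpA
  set pAB : Finset (Fin (2 * n)) → Finset (Fin (2 * n)) → ℝ := fun A B =>
    ((Finset.univ.filter fun G : SimpleGraph (Fin (2 * n)) =>
      IsFriendly n γ G A ∧ IsFriendly n γ G B).card : ℝ) / 2 ^ (2 * n).choose 2 with hpAB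
  have hA0 : ∀ A, 0 ≤ pA A := fun A => by positivity
  have hABA : ∀ A B, pAB A B ≤ pA A := fun A B => by
    simp only [hpA, hpAB]
    gcongr with G
    exact fun h => h.1
  have hz1 : ∀ A B, A.card ≠ n → pAB A B = 0 := fun A B h => by
    simp only [hpAB]
    rw [Finset.filter_false_of_mem fun G _ hG => h hG.1.1]
    simp
  have hz2 : ∀ A B, B.card ≠ n → pAB A B = 0 := fun A B h => by
    simp only [hpAB]
    rw [Finset.filter_false_of_mem fun G _ hG => h hG.2.1]
    simp
  have hpp : ∀ k, 0 ≤ pairProb (2 * k) (2 * (n - k)) (2 * z + 1) := fun k => by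
    unfold pairProb; positivity
  have hpairs : ∀ A B, A.card = n → B.card = n →
      pAB A B ≤ pairProb (2 * (A ∩ B).card) (2 * (n - (A ∩ B).card)) (2 * z + 1) :=
    fun A B h1 h2 => by
      obtain ⟨e, h3, h4⟩ := exists_equiv_of_overlap h1 h2 rfl
      exact card_friendly_pair_le hz e h3 h4
  have hrow : ∀ A, ∑ B, pAB A B ≤
      (∑ k ∈ Finset.range (n + 1) \ K, (n.choose k : ℝ) ^ 2) * pA A +
        (if A.card = n then 1 else 0) * ∑ k ∈ K, (n.choose k : ℝ) ^ 2 *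
          pairProb (2 * k) (2 * (n - k)) (2 * z + 1) := fun A => by
    by_cases hA : A.card = n
    swap
    · rw [Finset.sum_eq_zero fun B _ => hz1 A B hA]
      have := hA0 A
      simp only [hA, if_false, zero_mul, add_zero]
      positivity
    have hfib : ∑ B, pAB A B = ∑ k ∈ Finset.range (n + 1),
        ∑ B with B.card = n ∧ (A ∩ B).card = k, pAB A B := by
      have h1 : ∑ B, pAB A B = ∑ B with B.card = n, pAB A B :=
        (Finset.sum_filter_of_ne fun B _ h => by by_contra h'; exact h (hz2 A B h')).symm
      rw [h1, ← Finset.sum_fiberwise_of_maps_to (s := Finset.univ.filter fun B => B.card = n)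
        (t := Finset.range (n + 1)) (g := fun B => (A ∩ B).card)]
      · refine Finset.sum_congr rfl fun k _ => ?_
        rw [Finset.filter_filter]
      · intro B _
        have := Finset.card_le_card (Finset.inter_subset_left (s₁ := A) (s₂ := B))
        rw [Finset.mem_range]
        omega
    have hcount : ∀ k ∈ Finset.range (n + 1), ∀ c : ℝ, 0 ≤ c →
        (∀ B : Finset (Fin (2 * n)), B.card = n → (A ∩ B).card = k → pAB A B ≤ c) →
        ∑ B with B.card = n ∧ (A ∩ B).card = k, pAB A B ≤ (n.choose k : ℝ) ^ 2 * c := by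
      intro k hk c hc hB
      refine le_trans (Finset.sum_le_sum (g := fun _ => c) fun B hB' => ?_) ?_
      · have := (Finset.mem_filter.1 hB').2
        exact hB B this.1 this.2
      · rw [Finset.sum_const, nsmul_eq_mul]
        gcongr
        exact_mod_cast card_overlap_le hA (Nat.lt_succ_iff.1 (Finset.mem_range.1 hk))
    rw [hfib, ← Finset.sum_sdiff hK, Finset.sum_mul]
    simp only [hA, if_true, one_mul]
    gcongr with k hk k hk
    · exact hcount k (Finset.mem_sdiff.1 hk).1 _ (hA0 A) fun B _ _ => hABA A B
    · refine hcount k (hK hk) _ (hpp k) fun B hB hk' => ?_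
      rw [← hk']
      exact hpairs A B hA hB
  rw [EXgammaSq_eq, EXgamma_eq]
  refine (Finset.sum_le_sum fun A _ => hrow A).trans (le_of_eq ?_)
  rw [Finset.sum_add_distrib, ← Finset.mul_sum, ← Finset.sum_mul]
  congr 2
  have := Finset.card_powersetCard n (Finset.univ : Finset (Fin (2 * n)))
  rw [Finset.card_univ, Fintype.card_fin] at this
  rw [← this, Finset.sum_boole]
  congr 2
  ext A; simp [Finset.mem_powersetCard]

lemma factorial_bounds {m : ℕ} (hm : m ≠ 0) :
    √(2 * m) * (m / Real.exp 1) ^ m ≤ m.factorial ∧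
      (m.factorial : ℝ) ≤ 2 * (√(2 * m) * (m / Real.exp 1) ^ m) := by
  have hm0 : (0 : ℝ) < m := by exact_mod_cast Nat.pos_of_ne_zero hm
  have hp : 0 < √(2 * m) * (m / Real.exp 1) ^ m := by positivity
  have h : Stirling.stirlingSeq m = m.factorial / (√(2 * m) * (m / Real.exp 1) ^ m) := rfl
  have h1 : 1 ≤ Stirling.stirlingSeq m :=
    le_trans (Real.one_le_sqrt.2 (by linarith [Real.pi_gt_three]))
      (Stirling.sqrt_pi_le_stirlingSeq hm)
  have h2 : Stirling.stirlingSeq m ≤ 2 := by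
    obtain ⟨j, rfl⟩ := Nat.exists_eq_succ_of_ne_zero hm
    refine (Stirling.stirlingSeq'_antitone (Nat.zero_le j)).trans ?_
    simp only [Function.comp, Nat.succ_eq_add_one, zero_add, Stirling.stirlingSeq_one]
    rw [div_le_iff₀ (by positivity)]
    have := Real.exp_one_lt_d9
    have h3 : (1.4 : ℝ) ≤ √2 := Real.le_sqrt_of_sq_le (by norm_num)
    linarith
  rw [h] at h1 h2
  rw [le_div_iff₀ hp] at h1
  rw [div_le_iff₀ hp] at h2
  exact ⟨by linarith, h2⟩

lemma choose_mul_entropy_le {n k : ℕ} (hk : k ≠ 0) (hkn : k < n) :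
    ((n.choose k : ℝ) * (((k : ℝ) / n) ^ k * (1 - (k : ℝ) / n) ^ (n - k))) ^ 2 ≤
      2 * n / (k * (n - k : ℕ)) := by
  obtain ⟨l, rfl⟩ := Nat.exists_eq_add_of_lt hkn
  generalize hl' : l + 1 = l' at *
  have hl : l' ≠ 0 := by omega
  have e : k + l + 1 = k + l' := by omega
  rw [e, Nat.add_sub_cancel_left] at *
  have hk0 : (0 : ℝ) < k := by exact_mod_cast Nat.pos_of_ne_zero hk
  have hl0 : (0 : ℝ) < l' := by exact_mod_cast Nat.pos_of_ne_zero hl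
  have hn := (factorial_bounds (m := k + l') (by omega)).2
  have h1 := (factorial_bounds hk).1
  have h2 := (factorial_bounds hl).1
  have h3 := Nat.choose_mul_factorial_mul_factorial (Nat.le_add_right k l')
  rw [Nat.add_sub_cancel_left] at h3
  have h4 : ((k + l').choose k : ℝ) * k.factorial * l'.factorial = (k + l').factorial := by
    exact_mod_cast h3
  have h5 : 1 - (k : ℝ) / (k + l' : ℕ) = l' / (k + l' : ℕ) := by
    push_cast; field_simp; ring
  rw [h5]
  push_cast at *
  have hA : ((k + l').choose k : ℝ) * (√(2 * k) * (k / Real.exp 1) ^ k) *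
      (√(2 * l') * (l' / Real.exp 1) ^ l') ≤
      2 * (√(2 * (k + l')) * ((k + l') / Real.exp 1) ^ (k + l')) := by
    refine le_trans ?_ (h4.le.trans hn)
    gcongr
  have hB : ((k + l').choose k : ℝ) * (((k : ℝ) / (k + l')) ^ k * ((l' : ℝ) / (k + l')) ^ l') *
      (√(2 * k) * √(2 * l')) ≤ 2 * √(2 * (k + l')) := by
    have hp : 0 < ((k + l' : ℝ) / Real.exp 1) ^ (k + l') := by positivity
    refine le_of_mul_le_mul_right ?_ hp
    refine le_trans (le_of_eq ?_) (hA.trans (le_of_eq (by ring)))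
    rw [pow_add]
    simp only [div_pow]
    field_simp
  have hC := pow_le_pow_left₀ (by positivity) hB 2
  rw [mul_pow, mul_pow, mul_pow √(2 * (k : ℝ)), Real.sq_sqrt (by positivity),
    Real.sq_sqrt (by positivity), mul_pow 2 √_, Real.sq_sqrt (by positivity)] at hC
  rw [le_div_iff₀ (by positivity), mul_pow]
  nlinarith

lemma centralBinom_lower {n : ℕ} (hn : n ≠ 0) :
    (4 : ℝ) ^ n / (4 * √n) ≤ (2 * n).choose n := by
  have hn0 : (0 : ℝ) < n := by exact_mod_cast Nat.pos_of_ne_zero hn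
  have h1 := (factorial_bounds hn).2
  have h2 := (factorial_bounds (m := 2 * n) (by omega)).1
  have h3 := Nat.add_choose_mul_factorial_mul_factorial n n
  have h4 : ((2 * n).choose n : ℝ) * n.factorial * n.factorial = (2 * n).factorial := by
    rw [two_mul]; exact_mod_cast h3
  push_cast at *
  have hA : √(2 * (2 * n)) * (2 * n / Real.exp 1) ^ (2 * n) ≤ ((2 * n).choose n : ℝ) *
      (2 * (√(2 * n) * (n / Real.exp 1) ^ n)) * (2 * (√(2 * n) * (n / Real.exp 1) ^ n)) := by
    refine (h2.trans h4.ge).trans ?_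
    gcongr
  have hp : 0 < (n / Real.exp 1 : ℝ) ^ (2 * n) := by positivity
  have e1 : √(2 * (2 * n : ℝ)) = 2 * √n := by
    rw [← mul_assoc, Real.sqrt_mul (by norm_num), show (2 * 2 : ℝ) = 2 ^ 2 by norm_num,
      Real.sqrt_sq (by norm_num)]
  have e2 : (2 * n / Real.exp 1 : ℝ) ^ (2 * n) = 4 ^ n * (n / Real.exp 1) ^ (2 * n) := by
    rw [mul_div_assoc, mul_pow, pow_mul 2 2 n]; norm_num
  have e3 := Real.mul_self_sqrt (show 0 ≤ 2 * (n : ℝ) by positivity)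
  have e4 := Real.mul_self_sqrt hn0.le
  rw [e1, e2] at hA
  have hB : 2 * √n * 4 ^ n ≤ ((2 * n).choose n : ℝ) * (8 * n) := by
    refine le_of_mul_le_mul_right ?_ hp
    refine le_trans (le_of_eq (by ring)) (hA.trans (le_of_eq ?_))
    have : (n / Real.exp 1 : ℝ) ^ (2 * n) = (n / Real.exp 1) ^ n * (n / Real.exp 1) ^ n := by
      rw [two_mul, pow_add]
    rw [this]
    linear_combination 4 * ((2 * n).choose n : ℝ) * ((n / Real.exp 1 : ℝ) ^ n) ^ 2 * e3
  rw [div_le_iff₀ (by positivity)]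
  refine le_of_mul_le_mul_left ?_ (show 0 < 2 * √n by positivity)
  nlinarith

/-- The binomial coefficients near the two ends contribute at most exponentially little. -/
lemma exists_sum_choose_sq_le {η : ℝ} (hη : 0 < η) : ∃ δ : ℝ, 0 < δ ∧ δ ≤ 1 / 1000 ∧ ∀ n : ℕ,
    ∑ k ∈ (Finset.range (n + 1)).filter fun k : ℕ => ¬ (δ * n ≤ k ∧ δ * n ≤ (n - k : ℕ)),
      (n.choose k : ℝ) ^ 2 ≤ 2 * (1 + η) ^ n := by
  obtain ⟨x, hx0, hx1, hx⟩ : ∃ x : ℝ, 0 < x ∧ x < 1 ∧ (1 + x) ^ 2 < 1 + η := by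
    refine ⟨min (1 / 2) (η / 4), by positivity, by
      linarith [min_le_left (1 / 2 : ℝ) (η / 4)], ?_⟩
    have h0 : 0 < min (1 / 2 : ℝ) (η / 4) := by positivity
    nlinarith [min_le_left (1 / 2 : ℝ) (η / 4), min_le_right (1 / 2 : ℝ) (η / 4)]
  have hcont : Continuous fun δ : ℝ => (1 + x) ^ 2 * x ^ (-(2 * δ)) :=
    continuous_const.mul ((Real.continuous_const_rpow hx0.ne').comp
      (continuous_const.mul continuous_id).neg)
  have hev : ∀ᶠ δ : ℝ in nhds 0, (1 + x) ^ 2 * x ^ (-(2 * δ)) < 1 + η :=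
    hcont.continuousAt.eventually_lt continuousAt_const (by simpa using hx)
  obtain ⟨ε, hε, hball⟩ := Metric.eventually_nhds_iff.1 hev
  refine ⟨min (1 / 1000) (ε / 2), by positivity, min_le_left _ _, fun n => ?_⟩
  set δ := min (1 / 1000) (ε / 2) with hδ
  have hδ0 : 0 < δ := by positivity
  have hδx : (1 + x) ^ 2 * x ^ (-(2 * δ)) < 1 + η := by
    refine hball ?_
    rw [Real.dist_eq, sub_zero, abs_of_pos hδ0]
    linarith [min_le_right (1 / 1000) (ε / 2)]
  have hxd : 0 < x ^ (δ * n) := by positivity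
  have hsum : ∀ s : Finset ℕ, s ⊆ Finset.range (n + 1) → (∀ k ∈ s, (k : ℝ) ≤ δ * n) →
      ∑ k ∈ s, (n.choose k : ℝ) ^ 2 ≤ (1 + η) ^ n := by
    intro s hs hk
    have h1 : (∑ k ∈ s, (n.choose k : ℝ)) * x ^ (δ * n) ≤ (1 + x) ^ n := by
      rw [add_comm, add_pow, Finset.sum_mul]
      refine le_trans (Finset.sum_le_sum fun k hks => ?_)
        (Finset.sum_le_sum_of_subset_of_nonneg hs fun _ _ _ => by positivity)
      rw [one_pow, mul_one, mul_comm]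
      gcongr
      rw [← Real.rpow_natCast]
      exact Real.rpow_le_rpow_of_exponent_ge hx0 hx1.le (hk k hks)
    have h2 : ∑ k ∈ s, (n.choose k : ℝ) ^ 2 ≤ (∑ k ∈ s, (n.choose k : ℝ)) ^ 2 :=
      Finset.sum_sq_le_sq_sum_of_nonneg fun _ _ => by positivity
    rw [← le_div_iff₀ hxd] at h1
    refine h2.trans ((pow_le_pow_left₀ (Finset.sum_nonneg fun _ _ => by positivity) h1 2).trans ?_)
    refine le_trans (le_of_eq ?_) (pow_le_pow_left₀ (by positivity) hδx.le n)
    rw [mul_pow, ← Real.rpow_natCast (x ^ (-(2 * δ))), ← Real.rpow_mul hx0.le, div_pow,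
      ← pow_mul, ← pow_mul, mul_comm n 2, div_eq_mul_inv, ← Real.rpow_natCast (x ^ (δ * n)) 2,
      ← Real.rpow_mul hx0.le, ← Real.rpow_neg hx0.le]
    congr 2
    push_cast; ring
  have hsplit : (Finset.range (n + 1)).filter (fun k : ℕ => ¬ (δ * n ≤ k ∧ δ * n ≤ (n - k : ℕ))) ⊆
      (Finset.range (n + 1)).filter (fun k : ℕ => (k : ℝ) ≤ δ * n) ∪
      (Finset.range (n + 1)).filter (fun k : ℕ => ((n - k : ℕ) : ℝ) ≤ δ * n) := by
    intro k hk
    simp only [Finset.mem_union, Finset.mem_filter] at *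
    rcases not_and_or.1 hk.2 with h | h
    · exact Or.inl ⟨hk.1, (not_le.1 h).le⟩
    · exact Or.inr ⟨hk.1, (not_le.1 h).le⟩
  refine (Finset.sum_le_sum_of_subset_of_nonneg hsplit fun _ _ _ => by positivity).trans ?_
  refine (le_add_of_nonneg_right (Finset.sum_nonneg fun _ _ => by positivity)).trans
    (Finset.sum_union_inter.le.trans ?_)
  rw [two_mul]
  refine add_le_add (hsum _ (Finset.filter_subset _ _) fun k hk => (Finset.mem_filter.1 hk).2) ?_
  refine le_trans (le_of_eq ?_) (hsum ((Finset.range (n + 1)).filter fun k : ℕ => (k : ℝ) ≤ δ * n)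
    (Finset.filter_subset _ _) fun k hk => (Finset.mem_filter.1 hk).2)
  refine Finset.sum_nbij' (fun k => n - k) (fun k => n - k) ?_ ?_ ?_ ?_ ?_
  · intro k hk
    simp only [Finset.mem_filter, Finset.mem_range] at *
    exact ⟨by omega, hk.2⟩
  · intro k hk
    simp only [Finset.mem_filter, Finset.mem_range] at *
    refine ⟨by omega, ?_⟩
    rw [show n - (n - k) = k by omega]; exact hk.2
  · intro k hk
    simp only [Finset.mem_filter, Finset.mem_range] at hk
    show n - (n - k) = k
    omega
  · intro k hk
    simp only [Finset.mem_filter, Finset.mem_range] at hk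
    show n - (n - k) = k
    omega
  · intro k hk
    simp only [Finset.mem_filter, Finset.mem_range] at hk
    rw [Nat.choose_symm (by omega)]

/-- A negative definite second derivative gives quadratic decay around every nearby local
maximum, uniformly over affine perturbations of the function. -/
lemma exists_quadratic_decay {E : Type*} [NormedAddCommGroup E] [NormedSpace ℝ E]
    [FiniteDimensional ℝ E] {G : E → ℝ} {x₀ : E} (hG : ContDiffAt ℝ 2 G x₀)
    (hneg : ∀ v, v ≠ 0 → iteratedFDeriv ℝ 2 G x₀ ![v, v] < 0) :
    ∃ c > 0, ∃ r > 0, ∀ l : E →L[ℝ] ℝ, ∀ x ∈ Metric.ball x₀ r, ∀ p ∈ Metric.ball x₀ r,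
      IsLocalMax (fun q => G q + l q) x → G p + l p ≤ G x + l x - c * ‖p - x‖ ^ 2 := by
  set D := fderiv ℝ G with hD
  have hD1 : ContDiffAt ℝ 1 D x₀ := hG.fderiv_right (by norm_num)
  have hstrict : HasStrictFDerivAt D (fderiv ℝ D x₀) x₀ := hD1.hasStrictFDerivAt (by norm_num)
  set B := fderiv ℝ D x₀ with hB
  have hB2 : ∀ v, v ≠ 0 → B v v < 0 := fun v hv => by
    have := hneg v hv
    rwa [iteratedFDeriv_two_apply] at this
  obtain ⟨c, hc, hBc⟩ : ∃ c > 0, ∀ v, B v v ≤ -(2 * c) * ‖v‖ ^ 2 := by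
    have hcont : Continuous fun v => B v v := by fun_prop
    rcases (Metric.sphere (0 : E) 1).eq_empty_or_nonempty with he | hne
    · refine ⟨1, one_pos, fun v => ?_⟩
      by_cases hv : v = 0
      · simp [hv]
      · exfalso
        have : (‖v‖⁻¹ • v) ∈ Metric.sphere (0 : E) 1 := by
          simp [norm_smul, hv]
        rw [he] at this
        exact this
    · obtain ⟨w, hw, hmax⟩ := (isCompact_sphere (0 : E) 1).exists_isMaxOn hne hcont.continuousOn
      have hw0 : w ≠ 0 := by
        rintro rfl; simp at hw
      refine ⟨-(B w w) / 2, by linarith [hB2 w hw0], fun v => ?_⟩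
      by_cases hv : v = 0
      · simp [hv]
      · have hn : 0 < ‖v‖ := norm_pos_iff.2 hv
        have h1 : (‖v‖⁻¹ • v) ∈ Metric.sphere (0 : E) 1 := by
          simp [norm_smul, hv]
        have h2 : B (‖v‖⁻¹ • v) (‖v‖⁻¹ • v) ≤ B w w := hmax h1
        simp only [map_smul, FunLike.coe_smul, Pi.smul_apply, smul_eq_mul] at h2
        have h3 : B v v = ‖v‖ ^ 2 * (‖v‖⁻¹ * (‖v‖⁻¹ * B v v)) := by field_simp
        rw [h3]
        nlinarith [sq_nonneg ‖v‖, mul_le_mul_of_nonneg_left h2 (sq_nonneg ‖v‖)]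
  have hdiff : ∀ᶠ q in nhds x₀, DifferentiableAt ℝ G q :=
    (hG.eventually (by norm_num)).mono fun q hq => hq.differentiableAt (by norm_num)
  have hlip : ∀ᶠ q : E × E in nhds (x₀, x₀), ‖D q.1 - D q.2 - B (q.1 - q.2)‖ ≤ c * ‖q.1 - q.2‖ :=
    (hasStrictFDerivAt_iff_isLittleO.1 hstrict).bound hc
  rw [nhds_prod_eq, Filter.eventually_prod_iff] at hlip
  obtain ⟨P, hP, Q, hQ, hPQ⟩ := hlip
  obtain ⟨r, hr, hball⟩ := Metric.eventually_nhds_iff_ball.1 (hdiff.and (hP.and hQ))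
  refine ⟨c / 2, by positivity, r, hr, fun l x hx p hp hmax => ?_⟩
  set v := p - x with hv
  have hmem : ∀ s ∈ Icc (0 : ℝ) 1, x + s • v ∈ Metric.ball x₀ r := fun s hs => by
    have := (convex_ball x₀ r).add_smul_sub_mem hx hp hs
    exact this
  have hDx : D x + l = 0 := by
    have h1 : HasFDerivAt (fun q => G q + l q) (D x + l) x :=
      ((hball x hx).1.hasFDerivAt).add l.hasFDerivAt
    exact hmax.hasFDerivAt_eq_zero h1
  set h : ℝ → ℝ := fun s => G (x + s • v) + l (x + s • v) + c / 2 * s ^ 2 * ‖v‖ ^ 2 with hh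
  have hder : ∀ s ∈ Icc (0 : ℝ) 1,
      HasDerivAt h (D (x + s • v) v + l v + c * s * ‖v‖ ^ 2) s := fun s hs => by
    have hline : HasDerivAt (fun s : ℝ => x + s • v) v s := by
      simpa using ((hasDerivAt_id s).smul_const v).const_add x
    have h1 := ((hball _ (hmem s hs)).1.hasFDerivAt).comp_hasDerivAt s hline
    have h2 := (l.hasFDerivAt (x := x + s • v)).comp_hasDerivAt s hline
    have h3 : HasDerivAt (fun s : ℝ => c / 2 * s ^ 2 * ‖v‖ ^ 2) (c * s * ‖v‖ ^ 2) s := by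
      have := ((hasDerivAt_pow 2 s).const_mul (c / 2)).mul_const (‖v‖ ^ 2)
      refine this.congr_deriv ?_
      push_cast; ring
    exact (h1.add h2).add h3
  have hle : ∀ s ∈ Icc (0 : ℝ) 1, D (x + s • v) v + l v + c * s * ‖v‖ ^ 2 ≤ 0 := fun s hs => by
    have h1 := hPQ (hball _ (hmem s hs)).2.1 (hball _ hx).2.2
    simp only [add_sub_cancel_left, map_smul] at h1
    have h2 := (D (x + s • v) - D x - s • B v).le_opNorm v
    have h3 : (D (x + s • v) - D x - s • B v) v = D (x + s • v) v + l v - s * B v v := by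
      have : D x v = - l v := by
        have := congrArg (fun f : E →L[ℝ] ℝ => f v) hDx
        simp at this; linarith
      simp [this]
    rw [norm_smul, Real.norm_of_nonneg hs.1] at h1
    have h4 := mul_le_mul_of_nonneg_right h1 (norm_nonneg v)
    have h5 := mul_le_mul_of_nonneg_left (hBc v) hs.1
    have h6 := (le_abs_self _).trans (h2.trans h4)
    rw [h3] at h6
    linarith
  have hanti : AntitoneOn h (Icc 0 1) := by
    refine antitoneOn_of_deriv_nonpos (convex_Icc 0 1)
      (fun s hs => (hder s hs).continuousAt.continuousWithinAt)
      (fun s hs => (hder s (interior_subset hs)).differentiableAt.differentiableWithinAt)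
      fun s hs => ?_
    rw [(hder s (interior_subset hs)).deriv]
    exact hle s (interior_subset hs)
  have := hanti (left_mem_Icc.2 zero_le_one) (right_mem_Icc.2 zero_le_one) zero_le_one
  simp only [hh, one_smul, zero_smul, add_zero, hv, add_sub_cancel] at this
  nlinarith

lemma fB_shift (γ β α t : ℝ) : fB (γ + t) β α = fB γ β (α + t) := by
  unfold fB
  rw [show γ + t + α = γ + (α + t) by ring]

lemma F2_shift (γ β α₁ α₂ t : ℝ) : F2 (γ + t) β α₁ α₂ =
    F2 γ β (α₁ + t) (α₂ + t) + 4 * t * ((α₁ + t) + (α₂ + t)) - 4 * t ^ 2 := by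
  unfold F2
  rw [fB_shift, fB_shift]
  ring

lemma F2_symm (γ β α₁ α₂ : ℝ) : F2 γ (1 - β) α₁ α₂ = F2 γ β α₂ α₁ := by
  unfold F2
  rw [sub_sub_cancel]
  ring

lemma contDiffAt_F2 (γ : ℝ) {p : ℝ × ℝ × ℝ} (h0 : 0 < p.1) (h1 : p.1 < 1) :
    ContDiffAt ℝ 2 (fun p : ℝ × ℝ × ℝ => F2 γ p.1 p.2.1 p.2.2) p := by
  have h1' : 0 < 1 - p.1 := by linarith
  have hs : ContDiff ℝ 2 fun v : ℝ × ℝ => stdMass v.1 v.2 0 := contDiff_stdMass (n := 2)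
  have hb : ContDiffAt ℝ 2 (fun p : ℝ × ℝ × ℝ => p.1) p := contDiffAt_fst
  have hb' : ContDiffAt ℝ 2 (fun p : ℝ × ℝ × ℝ => 1 - p.1) p := contDiffAt_const.sub hb
  have ha₁ : ContDiffAt ℝ 2 (fun p : ℝ × ℝ × ℝ => p.2.1) p := by fun_prop
  have ha₂ : ContDiffAt ℝ 2 (fun p : ℝ × ℝ × ℝ => p.2.2) p := by fun_prop
  have hm : ∀ {b a : ℝ × ℝ × ℝ → ℝ}, ContDiffAt ℝ 2 b p → ContDiffAt ℝ 2 a p → 0 < b p →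
      b p < 1 → ContDiffAt ℝ 2 (fun q => Real.log
        (stdMass (√2 * (γ + a q) / √(b q)) (√((1 - b q) / b q)) 0)) p := by
    intro b a hb ha hb0 hb1
    have hb1' : 0 < 1 - b p := by linarith
    have e1 : ContDiffAt ℝ 2 (fun q => √2 * (γ + a q) / √(b q)) p :=
      (contDiffAt_const.mul (contDiffAt_const.add ha)).div (hb.sqrt hb0.ne')
        (Real.sqrt_pos.2 hb0).ne'
    have e2 : ContDiffAt ℝ 2 (fun q => √((1 - b q) / b q)) p :=
      ((contDiffAt_const.sub hb).div hb hb0.ne').sqrt (div_pos hb1' hb0).ne'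
    exact (hs.contDiffAt.comp p (e1.prodMk e2)).log (stdMass_pos _ _).ne'
  have key : ContDiffAt ℝ 2 (fun p : ℝ × ℝ × ℝ =>
      2 * Real.log 2 - 2 * p.1 * Real.log p.1 - 2 * (1 - p.1) * Real.log (1 - p.1)
        - 2 * p.2.1 ^ 2 - 2 * p.2.2 ^ 2
        + 2 * p.1 * Real.log
          (stdMass (√2 * (γ + p.2.1) / √p.1) (√((1 - p.1) / p.1)) 0)
        + 2 * (1 - p.1) * Real.log
          (stdMass (√2 * (γ + p.2.2) / √(1 - p.1)) (√((1 - (1 - p.1)) / (1 - p.1))) 0)) p :=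
    ((((((contDiffAt_const.sub ((contDiffAt_const.mul hb).mul (hb.log h0.ne'))).sub
      ((contDiffAt_const.mul hb').mul (hb'.log h1'.ne'))).sub
      (contDiffAt_const.mul (ha₁.pow 2))).sub (contDiffAt_const.mul (ha₂.pow 2))).add
      ((contDiffAt_const.mul hb).mul (hm hb ha₁ h0 h1))).add
      ((contDiffAt_const.mul hb').mul (hm hb' ha₂ h1' (by linarith))))
  refine key.congr_of_eventuallyEq ?_
  have hopen : ∀ᶠ q : ℝ × ℝ × ℝ in nhds p, 0 < q.1 ∧ q.1 < 1 :=
    (continuousAt_const.eventually_lt continuousAt_fst h0).and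
      (continuousAt_fst.eventually_lt continuousAt_const h1)
  filter_upwards [hopen] with q hq
  unfold F2
  rw [fB_eq γ _ hq.1, fB_eq γ _ (show 0 < 1 - q.1 by linarith [hq.2])]

lemma F1_eq (γ α : ℝ) : F1 γ α = Real.log 2 - α ^ 2 + Real.log (gaussTail (√2 * (γ + α))) := by
  unfold F1; rw [mul_comm]

lemma continuous_F1 : Continuous fun p : ℝ × ℝ => F1 p.1 p.2 := by
  simp_rw [F1_eq]
  exact (continuous_const.sub (continuous_snd.pow 2)).add
    ((continuous_gaussTail.comp (by fun_prop)).log fun p => (gaussTail_pos _).ne')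

lemma log_gaussTail_nonpos (t : ℝ) : Real.log (gaussTail t) ≤ 0 :=
  Real.log_nonpos (gaussTail_nonneg _) (gaussTail_le_one _)

lemma F1_le (γ α : ℝ) : F1 γ α ≤ Real.log 2 - α ^ 2 := by
  rw [F1_eq]; linarith [log_gaussTail_nonpos (√2 * (γ + α))]

lemma bddAbove_F1 (γ : ℝ) : BddAbove (range (F1 γ)) :=
  ⟨Real.log 2, by rintro _ ⟨α, rfl⟩; linarith [F1_le γ α, sq_nonneg α]⟩

/-- The maximizer of `F₁` exists and is bounded as soon as the supremum is not too negative. -/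
lemma exists_F1_max (γ : ℝ) (hM : -(1 / 10) ≤ ⨆ α, F1 γ α) :
    ∃ a : ℝ, |a| ≤ 1 ∧ (∀ α, F1 γ α ≤ F1 γ a) ∧ F1 γ a = ⨆ α, F1 γ α := by
  have hcont : Continuous (F1 γ) := continuous_F1.comp (by fun_prop : Continuous fun a => (γ, a))
  obtain ⟨a, ha, hmax⟩ := (isCompact_Icc (a := (-1 : ℝ)) (b := 1)).exists_isMaxOn
    ⟨0, by simp⟩ hcont.continuousOn
  have hlog : Real.log 2 < 0.7 := by linarith [Real.log_two_lt_d9]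
  have hall : ∀ α, F1 γ α ≤ F1 γ a := by
    by_contra! hcon
    obtain ⟨α, hα⟩ := hcon
    have : ⨆ α, F1 γ α ≤ max (F1 γ a) (-0.3) := ciSup_le fun b => by
      by_cases hb : b ∈ Icc (-1 : ℝ) 1
      · exact (hmax hb).trans (le_max_left _ _)
      · refine le_trans ?_ (le_max_right _ _)
        have : 1 < b ^ 2 := by
          rw [mem_Icc, not_and_or, not_le, not_le] at hb
          rcases hb with hb | hb <;> nlinarith
        linarith [F1_le γ b]
    have h1 : F1 γ α ≤ ⨆ α, F1 γ α := le_ciSup (bddAbove_F1 γ) α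
    rcases max_cases (F1 γ a) (-0.3) with h | h <;> rw [h.1] at this <;> linarith
  exact ⟨a, abs_le.2 ha, hall, le_antisymm (le_ciSup (bddAbove_F1 γ) a) (ciSup_le hall)⟩

/-- The part of Assumption (*) at a fixed `γ` that concerns the bulk `β ∈ [.001, .999]`. -/
def BulkAssumption (γ : ℝ) : Prop :=
  sSup {x : ℝ | ∃ β ∈ Set.Icc (0.001 : ℝ) 0.999, ∃ α₁ α₂ : ℝ, x = F2 γ β α₁ α₂}
        = 4 * (⨆ α : ℝ, F1 γ α) ∧
    ∀ αγ : ℝ, (∀ α : ℝ, F1 γ α ≤ F1 γ αγ) →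
      ((∀ v : ℝ × ℝ × ℝ, v ≠ 0 →
          iteratedFDeriv ℝ 2 (fun p : ℝ × ℝ × ℝ => F2 γ p.1 p.2.1 p.2.2)
            (1 / 2, αγ, αγ) ![v, v] < 0) ∧
       (∀ β ∈ Set.Icc (0.001 : ℝ) 0.999, ∀ α₁ α₂ : ℝ,
          F2 γ β α₁ α₂ ≤ F2 γ (1 / 2) αγ αγ ∧
          (F2 γ β α₁ α₂ = F2 γ (1 / 2) αγ αγ → (β, α₁, α₂) = (1 / 2, αγ, αγ))))

lemma BulkAssumption.F2_half {γ a : ℝ} (h : BulkAssumption γ) (ha : ∀ α, F1 γ α ≤ F1 γ a) :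
    F2 γ (1 / 2) a a = 4 * ⨆ α, F1 γ α := by
  rw [← h.1]
  symm
  apply IsGreatest.csSup_eq
  refine ⟨⟨1 / 2, ⟨by norm_num, by norm_num⟩, a, a, rfl⟩, ?_⟩
  rintro _ ⟨β, hβ, α₁, α₂, rfl⟩
  exact ((h.2 a ha).2 β hβ α₁ α₂).1

set_option maxHeartbeats 1600000 in
/-- Quadratic decay of `F₂` away from its maximizer, uniformly in `γ`. -/
lemma exists_uniform_decay {lo hi : ℝ} (hM : ∀ γ ∈ Icc lo hi, -(1 / 10) ≤ ⨆ α, F1 γ α)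
    (hB : ∀ γ ∈ Icc lo hi, BulkAssumption γ) :
    ∃ c > 0, ∀ γ ∈ Icc lo hi, ∃ a : ℝ, ∀ β ∈ Icc (0.001 : ℝ) 0.999, ∀ α₁ α₂ : ℝ,
      |α₁| ≤ 2 → |α₂| ≤ 2 → F2 γ β α₁ α₂ ≤
        4 * (⨆ α, F1 γ α) - c * ((β - 1 / 2) ^ 2 + (α₁ - a) ^ 2 + (α₂ - a) ^ 2) := by
  by_contra! hcon
  have hseq : ∀ m : ℕ, ∃ q : ℝ × ℝ × ℝ × ℝ × ℝ, q ∈ Icc lo hi ×ˢ Icc (-1 : ℝ) 1 ×ˢ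
      Icc (0.001 : ℝ) 0.999 ×ˢ Icc (-2 : ℝ) 2 ×ˢ Icc (-2 : ℝ) 2 ∧
      (∀ α, F1 q.1 α ≤ F1 q.1 q.2.1) ∧ F1 q.1 q.2.1 = (⨆ α, F1 q.1 α) ∧
      4 * F1 q.1 q.2.1 - 1 / ((m : ℝ) + 1) * ((q.2.2.1 - 1 / 2) ^ 2 +
        (q.2.2.2.1 - q.2.1) ^ 2 + (q.2.2.2.2 - q.2.1) ^ 2) <
        F2 q.1 q.2.2.1 q.2.2.2.1 q.2.2.2.2 := fun m => by
    obtain ⟨γ, hγ, h⟩ := hcon (1 / ((m : ℝ) + 1)) (by positivity)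
    obtain ⟨a, ha1, ha, haM⟩ := exists_F1_max γ (hM γ hγ)
    obtain ⟨β, hβ, α₁, α₂, h1, h2, h3⟩ := h a
    exact ⟨(γ, a, β, α₁, α₂), ⟨hγ, abs_le.1 ha1, hβ, abs_le.1 h1, abs_le.1 h2⟩, ha, haM, by
      simpa only [haM] using h3⟩
  choose q hqK hqa hqM hqF using hseq
  have hK : IsCompact (Icc lo hi ×ˢ Icc (-1 : ℝ) 1 ×ˢ
      Icc (0.001 : ℝ) 0.999 ×ˢ Icc (-2 : ℝ) 2 ×ˢ Icc (-2 : ℝ) 2) :=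
    isCompact_Icc.prod (isCompact_Icc.prod (isCompact_Icc.prod (isCompact_Icc.prod isCompact_Icc)))
  obtain ⟨⟨γ, a, β, α₁, α₂⟩, hlimK, φ, hφ, hlim⟩ := hK.tendsto_subseq hqK
  have l1 : Filter.Tendsto (fun m => (q (φ m)).1) Filter.atTop (nhds γ) :=
    (continuous_fst.tendsto _).comp hlim
  have l2 : Filter.Tendsto (fun m => (q (φ m)).2.1) Filter.atTop (nhds a) :=
    ((continuous_fst.comp continuous_snd).tendsto _).comp hlim
  have l3 : Filter.Tendsto (fun m => (q (φ m)).2.2.1) Filter.atTop (nhds β) :=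
    ((continuous_fst.comp (continuous_snd.comp continuous_snd)).tendsto _).comp hlim
  have l4 : Filter.Tendsto (fun m => (q (φ m)).2.2.2.1) Filter.atTop (nhds α₁) :=
    ((continuous_fst.comp (continuous_snd.comp (continuous_snd.comp continuous_snd))).tendsto
      _).comp hlim
  have l5 : Filter.Tendsto (fun m => (q (φ m)).2.2.2.2) Filter.atTop (nhds α₂) :=
    ((continuous_snd.comp (continuous_snd.comp (continuous_snd.comp continuous_snd))).tendsto
      _).comp hlim
  obtain ⟨hγ, ha1, hβ, -, -⟩ := hlimK
  simp only at hγ ha1 hβ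
  have hF1lim : ∀ {x : ℕ → ℝ} {y : ℝ}, Filter.Tendsto x Filter.atTop (nhds y) →
      Filter.Tendsto (fun m => F1 (q (φ m)).1 (x m)) Filter.atTop (nhds (F1 γ y)) :=
    fun hx => (continuous_F1.tendsto (γ, _)).comp (l1.prodMk_nhds hx)
  have ha : ∀ α, F1 γ α ≤ F1 γ a := fun α =>
    le_of_tendsto_of_tendsto' (hF1lim tendsto_const_nhds) (hF1lim l2) fun m => hqa _ _
  have hMa : F1 γ a = ⨆ α, F1 γ α := le_antisymm (le_ciSup (bddAbove_F1 γ) a) (ciSup_le ha)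
  set t : ℕ → ℝ := fun m => (q (φ m)).1 - γ with ht
  have lt : Filter.Tendsto t Filter.atTop (nhds 0) := by
    simpa using l1.sub_const γ
  have hF2 : ∀ m b x y, F2 (q (φ m)).1 b x y = F2 γ b (x + t m) (y + t m) +
      4 * t m * ((x + t m) + (y + t m)) - 4 * t m ^ 2 := fun m b x y => by
    rw [← F2_shift]; simp [ht]
  set p' : ℕ → ℝ × ℝ × ℝ := fun m =>
    ((q (φ m)).2.2.1, (q (φ m)).2.2.2.1 + t m, (q (φ m)).2.2.2.2 + t m) with hp'
  set x' : ℕ → ℝ × ℝ × ℝ := fun m => (1 / 2, (q (φ m)).2.1 + t m, (q (φ m)).2.1 + t m) with hx'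
  have l4' : Filter.Tendsto (fun m => (q (φ m)).2.2.2.1 + t m) Filter.atTop (nhds α₁) := by
    simpa using l4.add lt
  have l5' : Filter.Tendsto (fun m => (q (φ m)).2.2.2.2 + t m) Filter.atTop (nhds α₂) := by
    simpa using l5.add lt
  have l2' : Filter.Tendsto (fun m => (q (φ m)).2.1 + t m) Filter.atTop (nhds a) := by
    simpa using l2.add lt
  have lp : Filter.Tendsto p' Filter.atTop (nhds (β, α₁, α₂)) :=
    l3.prodMk_nhds (l4'.prodMk_nhds l5')
  have lx : Filter.Tendsto x' Filter.atTop (nhds (1 / 2, a, a)) :=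
    tendsto_const_nhds.prodMk_nhds (l2'.prodMk_nhds l2')
  set S : ℕ → ℝ := fun m => ((q (φ m)).2.2.1 - 1 / 2) ^ 2 +
    ((q (φ m)).2.2.2.1 - (q (φ m)).2.1) ^ 2 + ((q (φ m)).2.2.2.2 - (q (φ m)).2.1) ^ 2 with hS
  have lε : Filter.Tendsto (fun m => 1 / (((φ m : ℕ) : ℝ) + 1)) Filter.atTop (nhds 0) :=
    (tendsto_one_div_add_atTop_nhds_zero_nat (𝕜 := ℝ)).comp hφ.tendsto_atTop
  have hge : F2 γ (1 / 2) a a ≤ F2 γ β α₁ α₂ := by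
    rw [(hB γ hγ).F2_half ha, ← hMa]
    have hc := (contDiffAt_F2 γ (p := (β, α₁, α₂)) (by norm_num at hβ ⊢; linarith [hβ.1])
      (by norm_num at hβ ⊢; linarith [hβ.2])).continuousAt
    have r1 : Filter.Tendsto (fun m => F2 (q (φ m)).1 (q (φ m)).2.2.1 (q (φ m)).2.2.2.1
        (q (φ m)).2.2.2.2) Filter.atTop (nhds (F2 γ β α₁ α₂)) := by
      have h1 := ((hc.tendsto.comp lp).add ((lt.const_mul 4).mul (l4'.add l5'))).sub
        ((lt.pow 2).const_mul 4)
      simp only [Function.comp_def] at h1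
      simp_rw [hF2]
      simpa using h1
    have r2 : Filter.Tendsto (fun m => 4 * F1 (q (φ m)).1 (q (φ m)).2.1 -
        1 / (((φ m : ℕ) : ℝ) + 1) * S m) Filter.atTop (nhds (4 * F1 γ a)) := by
      have hSl := ((((l3.sub_const (1 / 2)).pow 2).add ((l4.sub l2).pow 2)).add
        ((l5.sub l2).pow 2))
      have := ((hF1lim l2).const_mul 4).sub (lε.mul hSl)
      rw [zero_mul, sub_zero] at this
      exact this
    exact le_of_tendsto_of_tendsto' r2 r1 fun m => (hqF (φ m)).le
  have hiii := (hB γ hγ).2 a ha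
  have hpx : (β, α₁, α₂) = (1 / 2, a, a) :=
    (hiii.2 β hβ α₁ α₂).2 (le_antisymm (hiii.2 β hβ α₁ α₂).1 hge)
  rw [hpx] at lp
  obtain ⟨c, hc, r, hr, hdec⟩ := exists_quadratic_decay
    (contDiffAt_F2 γ (p := (1 / 2, a, a)) (by norm_num) (by norm_num)) hiii.1
  have hev := ((lp.eventually (Metric.ball_mem_nhds _ hr)).and
    (lx.eventually (Metric.ball_mem_nhds _ hr))).and
    (lε.eventually (gt_mem_nhds (show 0 < c / 3 by positivity)))
  obtain ⟨m, ⟨hm1, hm2⟩, hm3⟩ := hev.exists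
  set l : ℝ × ℝ × ℝ →L[ℝ] ℝ := (4 * t m) • ((ContinuousLinearMap.fst ℝ ℝ ℝ +
    ContinuousLinearMap.snd ℝ ℝ ℝ).comp (ContinuousLinearMap.snd ℝ ℝ (ℝ × ℝ))) with hl
  have hlv : ∀ v : ℝ × ℝ × ℝ, l v = 4 * t m * (v.2.1 + v.2.2) := fun v => by
    simp [hl, mul_add]
  have hγm := (hqK (φ m)).1
  have hloc : IsLocalMax (fun v : ℝ × ℝ × ℝ => F2 γ v.1 v.2.1 v.2.2 + l v) (x' m) := by
    have hopen : ∀ᶠ v : ℝ × ℝ × ℝ in nhds (x' m), (0.001 : ℝ) < v.1 ∧ v.1 < 0.999 :=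
      (continuousAt_const.eventually_lt continuousAt_fst (by norm_num [hx'])).and
        (continuousAt_fst.eventually_lt continuousAt_const (by norm_num [hx']))
    filter_upwards [hopen] with v hv
    have h1 := (((hB _ hγm).2 _ (hqa (φ m))).2 v.1 ⟨hv.1.le, hv.2.le⟩ (v.2.1 - t m)
      (v.2.2 - t m)).1
    rw [hF2, hF2] at h1
    simp only [hlv, hx']
    simp only [sub_add_cancel] at h1
    linarith
  have hfin := hdec l (x' m) hm2 (p' m) hm1 hloc
  have hF := hqF (φ m)
  rw [hqM, ← (hB _ hγm).F2_half (hqa (φ m)), hF2, hF2] at hF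
  simp only [hlv, hx', hp'] at hfin
  have hnorm : S m ≤ 3 * ‖p' m - x' m‖ ^ 2 := by
    have e1 := norm_fst_le (p' m - x' m)
    have e0 := norm_snd_le (p' m - x' m)
    have e2 := (norm_fst_le (p' m - x' m).2).trans e0
    have e3 := (norm_snd_le (p' m - x' m).2).trans e0
    simp only [hp', hx', Prod.fst_sub, Prod.snd_sub, Real.norm_eq_abs, add_sub_add_right_eq_sub]
      at e1 e2 e3
    have e1' := pow_le_pow_left₀ (abs_nonneg _) e1 2
    have e2' := pow_le_pow_left₀ (abs_nonneg _) e2 2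
    have e3' := pow_le_pow_left₀ (abs_nonneg _) e3 2
    rw [sq_abs] at e1' e2' e3'
    simp only [hS, hp', hx', Prod.mk_sub_mk, add_sub_add_right_eq_sub] at e1' e2' e3' ⊢
    linarith
  have hS0 : 0 ≤ S m := by positivity
  simp only [hp', hx'] at hnorm
  change _ - 1 / (((φ m : ℕ) : ℝ) + 1) * S m < _ at hF
  nlinarith [mul_le_mul_of_nonneg_right hm3.le hS0, mul_le_mul_of_nonneg_left hnorm hc.le]

lemma exists_gaussTail_neg_eq {y : ℝ} (hy : 0 < y) :
    ∃ x ∈ Ioo (-y) 0, gaussTail (-y) = 1 / 2 + y * stdPdf x := by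
  obtain ⟨x, hx, h⟩ := exists_hasDerivAt_eq_slope gaussTail (fun t => -stdPdf t)
    (show -y < 0 by linarith) continuous_gaussTail.continuousOn
    fun t _ => hasDerivAt_gaussTail t
  refine ⟨x, hx, ?_⟩
  rw [gaussTail_zero, eq_div_iff (by linarith)] at h
  linarith

lemma inv_sqrt_two_pi_bounds : (0.398 : ℝ) ≤ (√(2 * Real.pi))⁻¹ ∧
    (√(2 * Real.pi))⁻¹ ≤ (0.399 : ℝ) := by
  have h1 := Real.pi_gt_d4
  have h2 := Real.pi_lt_d4
  have h3 : √(2 * Real.pi) ≤ 2.507 := Real.sqrt_le_iff.2 ⟨by norm_num, by norm_num; linarith⟩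
  have h4 : 2.5065 ≤ √(2 * Real.pi) := Real.le_sqrt_of_sq_le (by norm_num; linarith)
  constructor
  · rw [le_inv_comm₀ (by norm_num) (by linarith)]
    exact h3.trans (by norm_num)
  · rw [inv_le_comm₀ (by linarith) (by norm_num)]
    exact le_trans (by norm_num) h4

lemma gaussTail_neg_le {y : ℝ} (hy : 0 ≤ y) : gaussTail (-y) ≤ 1 / 2 + 0.399 * y := by
  rcases hy.eq_or_lt with rfl | hy
  · simp [gaussTail_zero]
  obtain ⟨x, -, h⟩ := exists_gaussTail_neg_eq hy
  have := (stdPdf_le x).trans inv_sqrt_two_pi_bounds.2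
  rw [h]; nlinarith

lemma le_gaussTail_neg {y : ℝ} (hy : 0 < y) (hy1 : y ≤ 1) :
    1 / 2 + y * (0.398 * (1 - y ^ 2 / 2)) ≤ gaussTail (-y) := by
  obtain ⟨x, hx, h⟩ := exists_gaussTail_neg_eq hy
  have h1 : 0.398 * (1 - y ^ 2 / 2) ≤ stdPdf x := by
    unfold stdPdf
    have e1 := Real.add_one_le_exp (-x ^ 2 / 2)
    have e2 : x ^ 2 ≤ y ^ 2 := by nlinarith [hx.1, hx.2]
    have e3 : 0 ≤ 1 - y ^ 2 / 2 := by nlinarith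
    exact mul_le_mul inv_sqrt_two_pi_bounds.1 (by linarith) e3 (by positivity)
  rw [h]; nlinarith

lemma IsGammaCrit.iSup_F1 {γ : ℝ} (h : IsGammaCrit γ) : ⨆ α, F1 γ α = 0 := by
  have h2 := h.2
  have hb : BddAbove (range fun α : ℝ =>
      -α ^ 2 + Real.log (gaussTail ((γ + α) * Real.sqrt 2))) :=
    ⟨0, by rintro _ ⟨α, rfl⟩; nlinarith [log_gaussTail_nonpos ((γ + α) * Real.sqrt 2),
      sq_nonneg α]⟩
  have e : ∀ α, F1 γ α = Real.log 2 + (-α ^ 2 + Real.log (gaussTail ((γ + α) * Real.sqrt 2))) :=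
    fun α => by unfold F1; ring
  simp_rw [e]
  rw [← h2, add_ciSup hb]

lemma IsGammaCrit.lower {γ : ℝ} (h : IsGammaCrit γ) : 0.19 ≤ γ := by
  by_contra! hlt
  have h1 : F1 γ (-0.43) ≤ 0 := by
    rw [← h.iSup_F1]; exact le_ciSup (bddAbove_F1 γ) _
  rw [F1_eq] at h1
  have hs : √2 * (γ + -0.43) ≤ -0.33 := by
    have : (1.41 : ℝ) ≤ √2 := Real.le_sqrt_of_sq_le (by norm_num)
    nlinarith
  have h2 := (le_gaussTail_neg (y := 0.33) (by norm_num) (by norm_num)).trans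
    (gaussTail_anti hs)
  have h3 : (0.62 : ℝ) ≤ gaussTail (√2 * (γ + -0.43)) := le_trans (by norm_num) h2
  have h4 := Real.log_le_log (by norm_num) h3
  have h5 : Real.log 2 + Real.log 0.62 = Real.log 1.24 := by
    rw [← Real.log_mul (by norm_num) (by norm_num)]; norm_num
  have h6 : 1 - (1.24 : ℝ)⁻¹ ≤ Real.log 1.24 := Real.one_sub_inv_le_log_of_pos (by norm_num)
  norm_num at h6 h1 h5 h4 ⊢
  linarith

lemma IsGammaCrit.iSup_F1_near {γc γ : ℝ} (h : IsGammaCrit γc) (hγ : |γ - γc| ≤ 1 / 10 ^ 25) :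
    -(1 / 10 ^ 20) ≤ ⨆ α, F1 γ α := by
  obtain ⟨a, ha1, -, ha⟩ := exists_F1_max γc (by rw [h.iSup_F1]; norm_num)
  rw [h.iSup_F1] at ha
  refine le_trans ?_ (le_ciSup (bddAbove_F1 γ) (a - (γ - γc)))
  have e : F1 γ (a - (γ - γc)) = F1 γc a + a ^ 2 - (a - (γ - γc)) ^ 2 := by
    rw [F1_eq, F1_eq, show γ + (a - (γ - γc)) = γc + a by ring]; ring
  rw [e, ha]
  generalize γ - γc = t at hγ
  have h1 : |a * t| ≤ 1 * (1 / 10 ^ 25) := by rw [abs_mul]; gcongr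
  have h2 : t ^ 2 ≤ (1 / 10 ^ 25) ^ 2 := by rw [← sq_abs]; gcongr
  have h3 := (abs_le.1 h1).1
  norm_num at h2 h3 ⊢
  nlinarith

lemma log_fB_one_sub_le (γ α : ℝ) {β : ℝ} (h0 : 0 ≤ β) (h1 : β < 1) :
    Real.log (fB γ (1 - β) α) ≤ Real.log (gaussTail (√2 * (γ + α))) -
      √(β * (1 - β)) / Real.pi * Real.exp (-(γ + α) ^ 2 / (1 - β)) /
        gaussTail (√2 * (γ + α)) := by
  have hf := fB_pos γ α (show 0 < 1 - β by linarith)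
  have hQ := gaussTail_pos (√2 * (γ + α))
  have h := fB_one_sub_le γ α h0 h1
  have h2 := Real.log_le_sub_one_of_pos (div_pos hf hQ)
  rw [Real.log_div hf.ne' hQ.ne'] at h2
  have h3 := div_le_div_of_nonneg_right h hQ.le
  rw [sub_div, div_self hQ.ne'] at h3
  linarith

/-- The entropy at small `β` is at most `0.2502 √β`. -/
lemma entropy_le {t : ℝ} (h0 : 0 < t) (h1 : t ≤ 0.03163) :
    -(t ^ 2 * Real.log (t ^ 2)) - (1 - t ^ 2) * Real.log (1 - t ^ 2) ≤ 0.2502 * t := by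
  have ht2 : t ^ 2 ≤ 0.03163 ^ 2 := by gcongr
  have h2 : 1 - (1 - t ^ 2)⁻¹ ≤ Real.log (1 - t ^ 2) :=
    Real.one_sub_inv_le_log_of_pos (by norm_num at ht2; linarith)
  have h3 : -t ^ 2 ≤ (1 - t ^ 2) * Real.log (1 - t ^ 2) := by
    have hp : 0 < 1 - t ^ 2 := by norm_num at ht2; linarith
    have := mul_le_mul_of_nonneg_left h2 hp.le
    rw [mul_sub, mul_inv_cancel₀ hp.ne'] at this
    linarith
  have h4 := Real.log_le_sub_one_of_pos (show 0 < (1 / 32) / t by positivity)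
  rw [Real.log_div (by norm_num) h0.ne', show (1 / 32 : ℝ) = (2 ^ 5)⁻¹ by norm_num,
    Real.log_inv, Real.log_pow] at h4
  have h5 : t * ((2 ^ 5)⁻¹ / t - 1) = 1 / 32 - t := by field_simp; norm_num; ring
  have h6 := mul_le_mul_of_nonneg_left h4 h0.le
  rw [h5] at h6
  rw [Real.log_pow]
  have h7 := mul_le_mul_of_nonneg_left Real.log_two_lt_d9.le h0.le
  push_cast at *
  have h8 : t * (-(t * Real.log t)) ≤ t * (1 / 32 - t + 5 * (t * 0.6931471808)) :=
    mul_le_mul_of_nonneg_left (by linarith) h0.le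
  have h9 : t * t ≤ t * 0.03163 := mul_le_mul_of_nonneg_left h1 h0.le
  have h10 : t * (t * t) ≤ t * (t * 0.03163) := mul_le_mul_of_nonneg_left h9 h0.le
  nlinarith

/-- Either the exponent is well below zero, or the Gaussian tail is large compared with its
Gaussian bound. -/
lemma sq_le_of_tail {γ u l : ℝ} (hγ : 0.18 ≤ γ) (hl : l = -Real.log (gaussTail (√2 * u)))
    (hcase : (u - γ) ^ 2 + 0.999 * l ≤ 0.7013) : u ^ 2 ≤ 0.999 * l + 0.15 := by
  have hQ := gaussTail_pos (√2 * u)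
  have hsq : (√2 : ℝ) ^ 2 = 2 := Real.sq_sqrt (by norm_num)
  rcases le_total 0 u with hu | hu
  · have h1 := gaussTail_le_half_exp (t := √2 * u) (by positivity)
    have h2 : gaussTail (√2 * u) ≤ Real.exp (-u ^ 2) := by
      refine h1.trans ?_
      rw [mul_pow, hsq, show -(2 * u ^ 2) / 2 = -u ^ 2 by ring]
      linarith [Real.exp_pos (-u ^ 2)]
    have h3 := Real.log_le_log hQ h2
    rw [Real.log_exp] at h3
    nlinarith [sq_nonneg (u - γ)]
  · have h1 := gaussTail_neg_le (y := √2 * (-u)) (mul_nonneg (by positivity) (by linarith))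
    rw [mul_neg, neg_neg] at h1
    have h2 := Real.log_le_sub_one_of_pos hQ
    have h3 : √2 ≤ (1.4143 : ℝ) := Real.sqrt_le_iff.2 ⟨by norm_num, by norm_num⟩
    have h4 : √2 * (-u) ≤ 1.4143 * (-u) := mul_le_mul_of_nonneg_right h3 (by linarith)
    have h5 : 1 / 2 - 0.5643058 * (-u) ≤ l := by
      rw [hl]; norm_num at h1 h4 ⊢; linarith
    by_cases hw : -u ≤ 0.57
    · nlinarith
    · exfalso
      push Not at hw
      nlinarith

set_option maxHeartbeats 800000 in
/-- Uniformly in `γ`, the exponent for small overlap is strictly below `2 sup F₁`. -/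
lemma exists_F2_edge_le {δ : ℝ} (hδ : 0 < δ) : ∃ c > 0, ∀ γ, 0.18 ≤ γ →
    -(1 / 10 ^ 20) ≤ (⨆ α, F1 γ α) → ∀ β ∈ Icc δ 0.001, ∀ α₁ α₂ : ℝ,
      F2 γ β α₁ α₂ ≤ 2 * (⨆ α, F1 γ α) - c := by
  refine ⟨min 0.0001 (0.0002 * √δ), by positivity, fun γ hγ hM β hβ α₁ α₂ => ?_⟩
  have hβ0 : 0 < β := hδ.trans_le hβ.1
  have hβ1 : β ≤ 0.001 := hβ.2
  set t := √β with ht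
  have ht0 : 0 < t := Real.sqrt_pos.2 hβ0
  have htβ : t ^ 2 = β := Real.sq_sqrt hβ0.le
  have ht1 : t ≤ 0.03163 := Real.sqrt_le_iff.2 ⟨by norm_num, by norm_num at hβ1 ⊢; linarith⟩
  have hent := entropy_le ht0 ht1
  rw [htβ] at hent
  have hf1 : Real.log (fB γ β α₁) ≤ 0 := Real.log_nonpos (fB_pos γ α₁ hβ0).le (fB_le_one _ _ _)
  have hfb := log_fB_one_sub_le γ α₂ hβ0.le (by norm_num at hβ1; linarith)
  set u := γ + α₂ with hu
  have hQ := gaussTail_pos (√2 * u)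
  set l := -Real.log (gaussTail (√2 * u)) with hl
  have hl0 : 0 ≤ l := by linarith [log_gaussTail_nonpos (√2 * u)]
  set E := √(β * (1 - β)) / Real.pi * Real.exp (-u ^ 2 / (1 - β)) / gaussTail (√2 * u) with hE
  have hb1 : 0.999 ≤ 1 - β := by norm_num at hβ1 ⊢; linarith
  have hb1' : 0 < 1 - β := by norm_num at hb1; linarith
  have hE0 : 0 ≤ E := by positivity
  have hF2 : F2 γ β α₁ α₂ ≤ 2 * Real.log 2 + 2 * (0.2502 * t) - 2 * α₂ ^ 2 -
      2 * (1 - β) * (l + E) := by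
    unfold F2
    have h1 := mul_nonneg hβ0.le (neg_nonneg.2 hf1)
    have h2 := mul_le_mul_of_nonneg_left hfb hb1'.le
    nlinarith [sq_nonneg α₁]
  have hlog := Real.log_two_lt_d9
  by_cases hcase : (u - γ) ^ 2 + 0.999 * l ≤ 0.7013
  swap
  · push Not at hcase
    rw [hu, add_sub_cancel_left] at hcase
    have h1 := min_le_left (0.0001 : ℝ) (0.0002 * √δ)
    have h2 : 0.999 * l ≤ (1 - β) * l := mul_le_mul_of_nonneg_right hb1 hl0
    have h3 : 0 ≤ (1 - β) * E := mul_nonneg hb1'.le hE0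
    have h4 : 2 * (1 - β) * (l + E) = 2 * ((1 - β) * l) + 2 * ((1 - β) * E) := by ring
    rw [h4] at hF2
    have h5 : (1 : ℝ) / 10 ^ 20 ≤ 0.00001 := by norm_num
    linarith
  have hu2 := sq_le_of_tail hγ hl hcase
  have hF1 : Real.log 2 - α₂ ^ 2 - l ≤ ⨆ α, F1 γ α := by
    refine le_trans (le_of_eq ?_) (le_ciSup (bddAbove_F1 γ) α₂)
    rw [F1_eq, hl]; ring
  have hl1 : l ≤ 0.7021 := by
    norm_num at hcase ⊢; nlinarith [sq_nonneg (u - γ)]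
  have hEl : t * 0.2727 ≤ (1 - β) * E := by
    have e1 : t * (1 - β) ≤ √(β * (1 - β)) := by
      rw [Real.sqrt_mul hβ0.le]
      refine mul_le_mul_of_nonneg_left (Real.le_sqrt_of_sq_le ?_) ht0.le
      nlinarith
    have e2 : (0.8595 : ℝ) ≤ Real.exp (-u ^ 2 / (1 - β)) / gaussTail (√2 * u) := by
      have : gaussTail (√2 * u) = Real.exp (-l) := by rw [hl, neg_neg, Real.exp_log hQ]
      rw [this, ← Real.exp_sub]
      have e3 : -(10 * 0.01502) ≤ -u ^ 2 / (1 - β) - -l := by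
        have : u ^ 2 / (1 - β) ≤ u ^ 2 / 0.999 := by gcongr
        have h2 : u ^ 2 / 0.999 ≤ l + 0.15 / 0.999 := by
          rw [div_le_iff₀ (by norm_num)]; norm_num at hu2 ⊢; linarith
        rw [neg_div]
        norm_num at this h2 ⊢
        linarith
      refine le_trans ?_ (Real.exp_le_exp.2 e3)
      have e4 : (1 - 0.01502 : ℝ) ≤ Real.exp (-0.01502) := by
        have := Real.add_one_le_exp (-0.01502 : ℝ); linarith
      rw [show (-(10 * 0.01502) : ℝ) = ((10 : ℕ) : ℝ) * (-0.01502) by norm_num, Real.exp_nat_mul]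
      exact le_trans (by norm_num) (pow_le_pow_left₀ (by norm_num) e4 10)
    have e5 : E = √(β * (1 - β)) / Real.pi *
        (Real.exp (-u ^ 2 / (1 - β)) / gaussTail (√2 * u)) := by rw [hE]; ring
    have e6 : t * (1 - β) / Real.pi * 0.8595 ≤ E := by
      rw [e5]; gcongr
    have e7 : t * 0.318 ≤ t / Real.pi := by
      rw [le_div_iff₀ Real.pi_pos, mul_assoc]
      exact mul_le_of_le_one_right ht0.le (by
        have := Real.pi_lt_d4; norm_num at this ⊢; linarith)
    have e8 : t * (1 - β) / Real.pi = t / Real.pi * (1 - β) := by ring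
    rw [e8] at e6
    have e9 : (0.998 : ℝ) ≤ (1 - β) * (1 - β) := by norm_num at hb1 ⊢; nlinarith
    calc t * 0.2727 ≤ t * 0.318 * 0.8595 * 0.998 := by linarith
      _ ≤ t / Real.pi * 0.8595 * ((1 - β) * (1 - β)) := by gcongr
      _ = (1 - β) * (t / Real.pi * (1 - β) * 0.8595) := by ring
      _ ≤ _ := mul_le_mul_of_nonneg_left e6 hb1'.le
  have hmin := min_le_right (0.0001 : ℝ) (0.0002 * √δ)
  have hδt : √δ ≤ t := Real.sqrt_le_sqrt hβ.1
  have hβl : β * l ≤ t * (0.03163 * 0.7021) := by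
    rw [← htβ, sq, mul_assoc]
    gcongr
  have h4 : 2 * (1 - β) * (l + E) = 2 * l - 2 * (β * l) + 2 * ((1 - β) * E) := by ring
  rw [h4] at hF2
  linarith

lemma neg_mul_log_le_one {β : ℝ} (h0 : 0 ≤ β) : -(β * Real.log β) ≤ 1 := by
  rcases h0.eq_or_lt with rfl | h0
  · simp
  · have h := mul_le_mul_of_nonneg_left (Real.one_sub_inv_le_log_of_pos h0) h0.le
    rw [mul_sub, mul_inv_cancel₀ h0.ne'] at h
    linarith

lemma bddAbove_F2 (γ : ℝ) :
    BddAbove {x : ℝ | ∃ β ∈ Set.Icc (0 : ℝ) 1, ∃ α₁ α₂ : ℝ, x = F2 γ β α₁ α₂} := by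
  refine ⟨2 * Real.log 2 + 4, ?_⟩
  rintro _ ⟨β, hβ, α₁, α₂, rfl⟩
  have h1 := neg_mul_log_le_one hβ.1
  have h2 := neg_mul_log_le_one (show 0 ≤ 1 - β by linarith [hβ.2])
  have hf : ∀ b α, Real.log (fB γ b α) ≤ 0 := fun b α =>
    Real.log_nonpos ENNReal.toReal_nonneg (fB_le_one _ _ _)
  have h3 := mul_nonneg hβ.1 (neg_nonneg.2 (hf β α₁))
  have h4 := mul_nonneg (show 0 ≤ 1 - β by linarith [hβ.2]) (neg_nonneg.2 (hf (1 - β) α₂))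
  unfold F2
  linarith [sq_nonneg α₁, sq_nonneg α₂]

lemma two_mul_iSup_F1_le (γ : ℝ) : 2 * (⨆ α, F1 γ α) ≤
    sSup {x : ℝ | ∃ β ∈ Set.Icc (0 : ℝ) 1, ∃ α₁ α₂ : ℝ, x = F2 γ β α₁ α₂} := by
  suffices h : (⨆ α, F1 γ α) ≤
      sSup {x : ℝ | ∃ β ∈ Set.Icc (0 : ℝ) 1, ∃ α₁ α₂ : ℝ, x = F2 γ β α₁ α₂} / 2 by linarith
  refine ciSup_le fun α => ?_
  rw [le_div_iff₀ two_pos]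
  refine le_csSup (bddAbove_F2 γ) ⟨0, ⟨le_rfl, zero_le_one⟩, 0, α, ?_⟩
  unfold F2
  rw [F1_eq, sub_zero, fB_one]
  simp
  ring

lemma BulkAssumption.four_mul_iSup_F1_le {γ : ℝ} (h : BulkAssumption γ)
    (hM : -(1 / 10) ≤ ⨆ α, F1 γ α) : 4 * (⨆ α, F1 γ α) ≤
      sSup {x : ℝ | ∃ β ∈ Set.Icc (0 : ℝ) 1, ∃ α₁ α₂ : ℝ, x = F2 γ β α₁ α₂} := by
  obtain ⟨a, -, ha, -⟩ := exists_F1_max γ hM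
  rw [← h.F2_half ha]
  exact le_csSup (bddAbove_F2 γ) ⟨1 / 2, ⟨by norm_num, by norm_num⟩, a, a, rfl⟩

/-- A discrete Gaussian sum of width `√n`. -/
lemma exists_sum_exp_le {c : ℝ} (hc : 0 < c) : ∃ C > 0, ∀ n : ℕ, 0 < n →
    ∑ k ∈ Finset.range (n + 1), Real.exp (-(n * (c * ((k : ℝ) / n - 1 / 2) ^ 2))) ≤ C * √n := by
  refine ⟨2 * Real.exp (3 * c / 4) * (1 + 1 / c), by positivity, fun n hn => ?_⟩
  have hn0 : (0 : ℝ) < n := by exact_mod_cast hn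
  have hs := Real.sqrt_pos.2 hn0
  have hs1 : 1 ≤ √n := Real.one_le_sqrt.2 (by exact_mod_cast hn)
  have hss := Real.sq_sqrt hn0.le
  set r := Real.exp (-(c / √n)) with hr
  have hr0 : 0 < r := Real.exp_pos _
  have hr1 : r < 1 := by
    rw [hr, ← Real.exp_zero]; exact Real.exp_lt_exp.2 (neg_lt_zero.2 (by positivity))
  have hterm : ∀ (k j : ℕ), (j : ℝ) - 1 / 2 ≤ |(k : ℝ) - n / 2| →
      Real.exp (-(n * (c * ((k : ℝ) / n - 1 / 2) ^ 2))) ≤ Real.exp (3 * c / 4) * r ^ j := by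
    intro k j hj
    rw [hr, ← Real.exp_nat_mul, ← Real.exp_add]
    refine Real.exp_le_exp.2 ?_
    set s := |(k : ℝ) - n / 2| / √n with hsdef
    have e1 : n * (c * ((k : ℝ) / n - 1 / 2) ^ 2) = c * s ^ 2 := by
      rw [hsdef, div_pow, sq_abs, hss]; field_simp
    have e2 : j / √n - 1 / 2 ≤ s := by
      have h1 := div_le_div_of_nonneg_right hj hs.le
      rw [sub_div] at h1
      have h2 : 1 / 2 / √n ≤ 1 / 2 := div_le_self (by norm_num) hs1
      linarith
    have e3 : s - 1 / 4 ≤ s ^ 2 := by nlinarith [sq_nonneg (s - 1 / 2)]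
    rw [e1]
    have e4 : (j : ℝ) * -(c / √n) = -(c * (j / √n)) := by ring
    rw [e4]
    nlinarith
  have hgeom : ∀ m : ℕ, ∑ j ∈ Finset.range m, r ^ j ≤ 1 + √n / c := fun m => by
    have h1 : ∑ j ∈ Finset.range m, r ^ j ≤ (1 - r)⁻¹ := by
      rw [← tsum_geometric_of_lt_one hr0.le hr1]
      exact (summable_geometric_of_lt_one hr0.le hr1).sum_le_tsum _ fun _ _ => by positivity
    refine h1.trans ?_
    have h2 : r * (1 + c / √n) ≤ 1 := by
      have := Real.add_one_le_exp (c / √n)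
      calc r * (1 + c / √n) ≤ r * Real.exp (c / √n) := by gcongr; linarith
        _ = 1 := by rw [hr, ← Real.exp_add]; simp
    rw [inv_le_iff_one_le_mul₀ (by linarith)]
    have h3 : (1 + √n / c) = √n / c * (1 + c / √n) := by field_simp; ring
    have h4 := mul_le_mul_of_nonneg_left h2 (show 0 ≤ √n / c by positivity)
    have h5 : √n / c * (r * (1 + c / √n)) = r * (1 + √n / c) := by rw [h3]; ring
    rw [h5] at h4
    nlinarith
  have hm : n / 2 ≤ n + 1 := by omega
  have hm1 : ((n / 2 : ℕ) : ℝ) ≤ n / 2 := Nat.cast_div_le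
  have hm2 : (n : ℝ) / 2 - 1 / 2 ≤ ((n / 2 : ℕ) : ℝ) := by
    have : (n : ℝ) ≤ 2 * (n / 2 : ℕ) + 1 := by exact_mod_cast (by omega : n ≤ 2 * (n / 2) + 1)
    linarith
  have hlow : ∑ k ∈ Finset.range (n / 2),
      Real.exp (-(n * (c * ((k : ℝ) / n - 1 / 2) ^ 2))) ≤
      Real.exp (3 * c / 4) * (1 + √n / c) := by
    rw [← Finset.sum_range_reflect]
    refine le_trans (Finset.sum_le_sum (g := fun j => Real.exp (3 * c / 4) * r ^ j)
      fun j hj => hterm _ _ ?_) ?_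
    · have hj' := Finset.mem_range.1 hj
      have : ((n / 2 - 1 - j : ℕ) : ℝ) + j + 1 = (n / 2 : ℕ) := by
        exact_mod_cast (by omega : (n / 2 - 1 - j) + j + 1 = n / 2)
      have := neg_le_abs (((n / 2 - 1 - j : ℕ) : ℝ) - n / 2)
      linarith
    · rw [← Finset.mul_sum]; gcongr; exact hgeom _
  have hhigh : ∑ k ∈ Finset.Ico (n / 2) (n + 1),
      Real.exp (-(n * (c * ((k : ℝ) / n - 1 / 2) ^ 2))) ≤
      Real.exp (3 * c / 4) * (1 + √n / c) := by
    rw [Finset.sum_Ico_eq_sum_range]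
    refine le_trans (Finset.sum_le_sum (g := fun j => Real.exp (3 * c / 4) * r ^ j)
      fun j hj => hterm _ _ ?_) ?_
    · have := le_abs_self (((n / 2 + j : ℕ) : ℝ) - n / 2)
      push_cast at this ⊢
      have h2 : (((n / 2 : ℕ) : ℝ)) = ((n / 2 : ℕ) : ℝ) := rfl
      refine le_trans ?_ this
      linarith
    · rw [← Finset.mul_sum]; gcongr; exact hgeom _
  rw [← Finset.sum_range_add_sum_Ico _ hm]
  refine (add_le_add hlow hhigh).trans ?_
  have : 1 + √n / c ≤ (1 + 1 / c) * √n := by rw [add_mul, one_mul, one_div, div_eq_inv_mul]; linarith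
  have h2 := mul_le_mul_of_nonneg_left this (Real.exp_pos (3 * c / 4)).le
  linarith

/-- Powers of `n` are absorbed by any exponential decay. -/
lemma pow_mul_exp_neg_le {c : ℝ} (hc : 0 < c) (j n : ℕ) :
    (n : ℝ) ^ j * Real.exp (-(c * n)) ≤ j.factorial / c ^ j := by
  have h := Real.pow_div_factorial_le_exp (c * n) (by positivity) j
  rw [Real.exp_neg, ← div_eq_mul_inv, div_le_iff₀ (Real.exp_pos _), div_mul_eq_mul_div,
    le_div_iff₀ (by positivity)]
  rw [mul_pow, div_le_iff₀ (by positivity)] at h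
  linarith

lemma integral_exp_shift {b : ℝ} (hb : 0 < b) (A s t : ℝ) :
    Integrable (fun x : ℝ × ℝ => A * (Real.exp (-b * (x.1 + s) ^ 2) *
      Real.exp (-b * (x.2 + t) ^ 2))) ∧
    ∫ x : ℝ × ℝ, A * (Real.exp (-b * (x.1 + s) ^ 2) * Real.exp (-b * (x.2 + t) ^ 2)) =
      A * (Real.pi / b) := by
  have hi : ∀ s, Integrable fun x : ℝ => Real.exp (-b * (x + s) ^ 2) := fun s =>
    (integrable_exp_neg_mul_sq hb).comp_add_right s
  have he : ∀ s, ∫ x : ℝ, Real.exp (-b * (x + s) ^ 2) = √(Real.pi / b) := fun s => by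
    rw [integral_add_right_eq_self fun x => Real.exp (-b * x ^ 2), integral_gaussian]
  refine ⟨((hi s).mul_prod (hi t)).const_mul A, ?_⟩
  rw [integral_const_mul]
  congr 1
  have h := integral_prod_mul (μ := (volume : Measure ℝ)) (ν := (volume : Measure ℝ))
    (fun x : ℝ => Real.exp (-b * (x + s) ^ 2)) fun x : ℝ => Real.exp (-b * (x + t) ^ 2)
  rw [he, he, Real.mul_self_sqrt (by positivity)] at h
  exact h

lemma integral_cauchy (A : ℝ) :
    Integrable (fun x : ℝ × ℝ => A * ((1 + x.1 ^ 2)⁻¹ * (1 + x.2 ^ 2)⁻¹)) ∧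
    ∫ x : ℝ × ℝ, A * ((1 + x.1 ^ 2)⁻¹ * (1 + x.2 ^ 2)⁻¹) = A * Real.pi ^ 2 := by
  refine ⟨(integrable_inv_one_add_sq.mul_prod integrable_inv_one_add_sq).const_mul A, ?_⟩
  rw [integral_const_mul]
  congr 1
  have h := integral_prod_mul (μ := (volume : Measure ℝ)) (ν := (volume : Measure ℝ))
    (fun x : ℝ => (1 + x ^ 2)⁻¹) fun x : ℝ => (1 + x ^ 2)⁻¹
  rw [integral_univ_inv_one_add_sq, ← sq] at h
  exact h

/-- Contribution of the overlap `k` to the second moment. -/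
lemma exists_overlap_le {lo hi δ : ℝ} (hδ : 0 < δ) (hlo : 0.18 ≤ lo)
    (hM : ∀ γ ∈ Icc lo hi, -(1 / 10 ^ 20) ≤ ⨆ α, F1 γ α)
    (hB : ∀ γ ∈ Icc lo hi, BulkAssumption γ) :
    ∃ C > 0, ∃ c > 0, ∃ N : ℕ, ∀ n k : ℕ, N ≤ n → 0 < n → k ≤ n → δ * n ≤ k →
      δ * n ≤ (n - k : ℕ) → ∀ γ ∈ Icc lo hi, ∀ T : ℤ, (T : ℝ) = 2 * (γ * √n) + 1 → ∀ S : ℝ,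
      2 * (⨆ α, F1 γ α) ≤ S → 4 * (⨆ α, F1 γ α) ≤ S →
      (n.choose k : ℝ) ^ 2 * pairProb (2 * k) (2 * (n - k)) T ≤
        C * (Real.exp (n * S) * (1 / (n * 4 ^ n)) *
          (Real.exp (-(n * (c * ((k : ℝ) / n - 1 / 2) ^ 2))) + n ^ 2 * Real.exp (-(c * n)))) +
        C * (4 ^ n * ((n : ℝ) ^ 4 * Real.exp (-(4 * n)))) := by
  have hM' : ∀ γ ∈ Icc lo hi, -(1 / 10) ≤ ⨆ α, F1 γ α := fun γ hγ =>
    le_trans (by norm_num) (hM γ hγ)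
  obtain ⟨c₁, hc₁, hdec⟩ := exists_uniform_decay hM' hB
  obtain ⟨c₂, hc₂, hedge⟩ := exists_F2_edge_le hδ
  obtain ⟨C, hC, N, hpair⟩ := exists_pairProb_le_integral hδ (|lo| + |hi|)
  refine ⟨C * (2 / δ ^ 2) * (4 * Real.pi / c₁ + 289 * Real.pi ^ 2) + C, by positivity,
    min c₁ c₂, by positivity, N, ?_⟩
  intro n k hN hn hkn hk hl γ hγ T hT S hS2 hS4
  have hn0 : (0 : ℝ) < n := by exact_mod_cast hn
  have hsn := Real.sqrt_pos.2 hn0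
  have hss := Real.sq_sqrt hn0.le
  have hk0 : (0 : ℝ) < k := lt_of_lt_of_le (by positivity) hk
  have hl0 : (0 : ℝ) < (n - k : ℕ) := lt_of_lt_of_le (by positivity) hl
  have hsub : ((n - k : ℕ) : ℝ) = n - k := Nat.cast_sub hkn
  have hγΓ : |γ| ≤ |lo| + |hi| := by
    rw [abs_le]
    constructor
    · linarith [hγ.1, neg_abs_le lo, abs_nonneg hi]
    · linarith [hγ.2, le_abs_self hi, abs_nonneg lo]
  have hp := hpair n k hN hn hkn hk hl γ hγΓ T hT
  set M := ⨆ α, F1 γ α with hMdef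
  have hkey : ∃ g : ℝ × ℝ → ℝ, Integrable g ∧ (∀ x, 0 ≤ g x) ∧
      (∀ x : ℝ × ℝ, x.1 ^ 2 + x.2 ^ 2 ≤ 16 * n →
        Real.exp (n * F2 γ (k / n) (-x.1 / (2 * √n)) (-x.2 / (2 * √n))) ≤ g x) ∧
      ∫ x, g x ≤ (4 * Real.pi / c₁ + 289 * Real.pi ^ 2) * (Real.exp (n * S) *
        (Real.exp (-(n * (min c₁ c₂ * ((k : ℝ) / n - 1 / 2) ^ 2))) +
          n ^ 2 * Real.exp (-(min c₁ c₂ * n)))) := by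
    by_cases hbulk : (k : ℝ) / n ∈ Icc (0.001 : ℝ) 0.999
    · obtain ⟨a, ha⟩ := hdec γ hγ
      have hinteg := integral_exp_shift (show 0 < c₁ / 4 by positivity)
        (Real.exp (n * (4 * M - c₁ * ((k : ℝ) / n - 1 / 2) ^ 2))) (2 * √n * a) (2 * √n * a)
      refine ⟨_, hinteg.1, fun x => by positivity, fun x hx => ?_, ?_⟩
      · rw [← Real.exp_add, ← Real.exp_add]
        refine Real.exp_le_exp.2 ?_
        have habs : ∀ y : ℝ, y ^ 2 ≤ 16 * n → |-y / (2 * √n)| ≤ 2 := fun y hy => by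
          refine abs_le_of_sq_le_sq ?_ two_pos.le
          rw [div_pow, mul_pow, hss, div_le_iff₀ (by positivity)]
          linarith
        have h := ha _ hbulk (-x.1 / (2 * √n)) (-x.2 / (2 * √n))
          (habs _ (by linarith [sq_nonneg x.2])) (habs _ (by linarith [sq_nonneg x.1]))
        have e : ∀ y : ℝ, n * (-y / (2 * √n) - a) ^ 2 = (y + 2 * √n * a) ^ 2 / 4 := fun y => by
          have : (y + 2 * √n * a) ^ 2 / 4 = √n ^ 2 * (-y / (2 * √n) - a) ^ 2 := by
            field_simp; ring
          rw [this, hss]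
        have h2 := mul_le_mul_of_nonneg_left h hn0.le
        have e1 := e x.1
        have e2 := e x.2
        refine h2.trans (le_of_eq ?_)
        linear_combination (-c₁) * e1 + (-c₁) * e2
      · rw [hinteg.2]
        have h1 : Real.exp (n * (4 * M - c₁ * ((k : ℝ) / n - 1 / 2) ^ 2)) ≤ Real.exp (n * S) *
            Real.exp (-(n * (min c₁ c₂ * ((k : ℝ) / n - 1 / 2) ^ 2))) := by
          rw [← Real.exp_add]
          refine Real.exp_le_exp.2 ?_
          have := mul_le_mul_of_nonneg_right (min_le_left c₁ c₂)
            (sq_nonneg ((k : ℝ) / n - 1 / 2))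
          nlinarith
        have h2 : Real.pi / (c₁ / 4) = 4 * Real.pi / c₁ := by field_simp
        rw [h2, mul_comm]
        refine mul_le_mul (le_add_of_nonneg_right (by positivity)) (h1.trans ?_) (by positivity)
          (by positivity)
        gcongr
        exact le_add_of_nonneg_right (by positivity)
    · have hF2 : ∀ α₁ α₂, F2 γ (k / n) α₁ α₂ ≤ 2 * M - c₂ := fun α₁ α₂ => by
        rw [mem_Icc, not_and_or, not_le, not_le] at hbulk
        have h1 : δ ≤ (k : ℝ) / n := by rwa [le_div_iff₀ hn0]
        have h2 : δ ≤ 1 - (k : ℝ) / n := by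
          rw [le_sub_iff_add_le, ← le_sub_iff_add_le', div_le_iff₀ hn0]
          rw [hsub] at hl; linarith
        rcases hbulk with h | h
        · exact hedge γ (hlo.trans hγ.1) (hM γ hγ) _ ⟨h1, h.le⟩ _ _
        · rw [← sub_sub_cancel 1 ((k : ℝ) / n), F2_symm]
          exact hedge γ (hlo.trans hγ.1) (hM γ hγ) _ ⟨h2, by norm_num at h ⊢; linarith⟩ _ _
      have hinteg := integral_cauchy (Real.exp (n * (2 * M - c₂)) * (1 + 16 * n) ^ 2)
      refine ⟨_, hinteg.1, fun x => by positivity, fun x hx => ?_, ?_⟩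
      · rw [mul_assoc]
        refine (Real.exp_le_exp.2 (mul_le_mul_of_nonneg_left (hF2 _ _) hn0.le)).trans
          (le_mul_of_one_le_right (Real.exp_pos _).le ?_)
        rw [← mul_inv, ← div_eq_mul_inv, one_le_div (by positivity), sq (1 + 16 * (n : ℝ))]
        exact mul_le_mul (by linarith [sq_nonneg x.2]) (by linarith [sq_nonneg x.1])
          (by positivity) (by positivity)
      · rw [hinteg.2]
        have h1 : Real.exp (n * (2 * M - c₂)) ≤
            Real.exp (n * S) * Real.exp (-(min c₁ c₂ * n)) := by
          rw [← Real.exp_add]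
          refine Real.exp_le_exp.2 ?_
          have := min_le_right c₁ c₂
          nlinarith
        have h2 : (1 + 16 * (n : ℝ)) ^ 2 ≤ 289 * n ^ 2 := by
          have : (1 : ℝ) ≤ n := by exact_mod_cast hn
          nlinarith
        calc Real.exp (n * (2 * M - c₂)) * (1 + 16 * n) ^ 2 * Real.pi ^ 2
            ≤ (Real.exp (n * S) * Real.exp (-(min c₁ c₂ * n))) * (289 * n ^ 2) * Real.pi ^ 2 := by
              gcongr
          _ = 289 * Real.pi ^ 2 * (Real.exp (n * S) * (n ^ 2 * Real.exp (-(min c₁ c₂ * n)))) := by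
              ring
          _ ≤ _ := by
              refine mul_le_mul (le_add_of_nonneg_left (by positivity)) ?_ (by positivity)
                (by positivity)
              gcongr
              exact le_add_of_nonneg_left (by positivity)
  obtain ⟨g, hgi, hg0, hgF, hgint⟩ := hkey
  have hp := hp g hgi hg0 hgF
  set X := Real.exp (n * S) * (Real.exp (-(n * (min c₁ c₂ * ((k : ℝ) / n - 1 / 2) ^ 2))) +
    n ^ 2 * Real.exp (-(min c₁ c₂ * n))) with hX
  have hX0 : 0 ≤ X := by positivity
  set B := 4 * Real.pi / c₁ + 289 * Real.pi ^ 2 with hBdef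
  have hent := choose_mul_entropy_le (n := n) (k := k) (by rintro rfl; simp at hk0) (by
    have : 0 < n - k := by exact_mod_cast hl0
    omega)
  have hent2 : 2 * (n : ℝ) / (k * (n - k : ℕ)) ≤ 2 / δ ^ 2 * (1 / n) := by
    calc 2 * (n : ℝ) / (k * (n - k : ℕ)) ≤ 2 * n / ((δ * n) * (δ * n)) := by gcongr
      _ = _ := by field_simp
  have hch : (n.choose k : ℝ) ^ 2 ≤ 4 ^ n := by
    have h1 : (n.choose k : ℝ) ≤ 2 ^ n := by exact_mod_cast Nat.choose_le_two_pow n k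
    calc (n.choose k : ℝ) ^ 2 ≤ (2 ^ n) ^ 2 := by gcongr
      _ = 4 ^ n := by rw [← pow_mul, mul_comm, pow_mul]; norm_num
  rw [mul_pow] at hent
  set ent := (((k : ℝ) / n) ^ k * (1 - (k : ℝ) / n) ^ (n - k)) ^ 2 with hentdef
  have hent0 : 0 ≤ ent := sq_nonneg _
  have hcp : (0 : ℝ) ≤ (n.choose k : ℝ) ^ 2 := sq_nonneg _
  calc (n.choose k : ℝ) ^ 2 * pairProb (2 * k) (2 * (n - k)) T
      ≤ (n.choose k : ℝ) ^ 2 * (C * (ent / 4 ^ n * ∫ x, g x) +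
          C * ((n : ℝ) ^ 4 * Real.exp (-(4 * n)))) := mul_le_mul_of_nonneg_left hp hcp
    _ = C * ((n.choose k : ℝ) ^ 2 * ent) * (1 / 4 ^ n) * (∫ x, g x) +
          C * ((n.choose k : ℝ) ^ 2 * ((n : ℝ) ^ 4 * Real.exp (-(4 * n)))) := by ring
    _ ≤ C * (2 / δ ^ 2 * (1 / n)) * (1 / 4 ^ n) * (B * X) +
          C * (4 ^ n * ((n : ℝ) ^ 4 * Real.exp (-(4 * n)))) := by
        refine add_le_add (mul_le_mul (mul_le_mul_of_nonneg_right
          (mul_le_mul_of_nonneg_left (hent.trans hent2) hC.le) (by positivity)) hgint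
          (integral_nonneg hg0) (by positivity)) ?_
        exact mul_le_mul_of_nonneg_left (mul_le_mul_of_nonneg_right hch (by positivity)) hC.le
    _ = C * (2 / δ ^ 2) * B * (X * (1 / (n * 4 ^ n))) +
          C * (4 ^ n * ((n : ℝ) ^ 4 * Real.exp (-(4 * n)))) := by
        field_simp
    _ ≤ (C * (2 / δ ^ 2) * B + C) * (X * (1 / (n * 4 ^ n))) +
          (C * (2 / δ ^ 2) * B + C) * (4 ^ n * ((n : ℝ) ^ 4 * Real.exp (-(4 * n)))) := by
        have hB0 : 0 < B := by positivity
        gcongr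
        · linarith
        · exact le_add_of_nonneg_left (by positivity)
    _ = _ := by rw [hX]; ring

lemma EXgamma_nonneg (n : ℕ) (γ : ℝ) : 0 ≤ EXgamma n γ := by
  unfold EXgamma; positivity

/-- The error term of the local limit estimate is dominated by the main term. -/
lemma pow_mul_exp_neg_le_main {n : ℕ} (hn : 0 < n) {S : ℝ} (hS : -(1 / 10) ≤ S) :
    ((n : ℝ) + 1) * (4 ^ n * ((n : ℝ) ^ 4 * Real.exp (-(4 * n)))) ≤
      1440 * √n * (Real.exp (n * S) * (1 / (n * 4 ^ n))) := by
  have hn1 : (1 : ℝ) ≤ n := by exact_mod_cast hn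
  have hn0 : (0 : ℝ) < n := by linarith
  have hs1 : 1 ≤ √(n : ℝ) := Real.one_le_sqrt.2 hn1
  have h16 : (4 : ℝ) ^ n * 4 ^ n * Real.exp (-(4 * n)) ≤ Real.exp (-(1 * n)) * Real.exp (n * S) := by
    have h4 : (4 : ℝ) ^ n * 4 ^ n = Real.exp (n * (4 * Real.log 2)) := by
      rw [← mul_pow, Real.exp_nat_mul, show 4 * Real.log 2 = ((4 : ℕ) : ℝ) * Real.log 2 by norm_num,
        Real.exp_nat_mul, Real.exp_log two_pos]
      norm_num
    rw [h4, ← Real.exp_add, ← Real.exp_add]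
    refine Real.exp_le_exp.2 ?_
    have := Real.log_two_lt_d9
    nlinarith
  have h6 := pow_mul_exp_neg_le (one_pos) 6 n
  have h6' : (n : ℝ) ^ 6 * Real.exp (-(1 * n)) ≤ 720 := by
    refine h6.trans (le_of_eq ?_)
    norm_num [Nat.factorial]
  calc ((n : ℝ) + 1) * (4 ^ n * ((n : ℝ) ^ 4 * Real.exp (-(4 * n))))
      ≤ (2 * n) * (4 ^ n * ((n : ℝ) ^ 4 * Real.exp (-(4 * n)))) :=
        mul_le_mul_of_nonneg_right (by linarith) (by positivity)
    _ = 2 * n ^ 6 * (4 ^ n * 4 ^ n * Real.exp (-(4 * n))) * (1 / (n * 4 ^ n)) := by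
        field_simp
    _ ≤ 2 * n ^ 6 * (Real.exp (-(1 * n)) * Real.exp (n * S)) * (1 / (n * 4 ^ n)) := by
        gcongr
    _ = 2 * (n ^ 6 * Real.exp (-(1 * n))) * (Real.exp (n * S) * (1 / (n * 4 ^ n))) := by ring
    _ ≤ 2 * 720 * (Real.exp (n * S) * (1 / (n * 4 ^ n))) := by
        exact mul_le_mul_of_nonneg_right (by linarith) (by positivity)
    _ ≤ 1440 * √n * (Real.exp (n * S) * (1 / (n * 4 ^ n))) :=
        mul_le_mul_of_nonneg_right (by linarith) (by positivity)

end Estimates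

/-- second moment. Assuming Assumption (*), for every `η > 0` there are
`C(η) > 0` and `n₀` so that for all `n ≥ n₀` and `γ ∈ [γ_crit − 10⁻²⁵, γ_crit + 10⁻²⁵]`
with `γ√n ∈ ℤ`:
`E[X_γ²] ≤ C(η) · ((1+η)ⁿ E[X_γ] + 16⁻ⁿ C(2n,n)² exp(n · sup_{β,α₁,α₂} F₂))`. -/
theorem second_moment_friendly_bisections
    (γcrit : ℝ) (hγ : IsGammaCrit γcrit) (hstar : AssumptionStar γcrit) :
    ∀ η : ℝ, 0 < η → ∃ C : ℝ, 0 < C ∧ ∃ n₀ : ℕ, ∀ n : ℕ, n₀ ≤ n →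
      ∀ γ ∈ Set.Icc (γcrit - (10 : ℝ) ^ (-25 : ℤ)) (γcrit + (10 : ℝ) ^ (-25 : ℤ)),
        (∃ z : ℤ, γ * Real.sqrt n = (z : ℝ)) →
        EXgammaSq n γ ≤
          C * ((1 + η) ^ n * EXgamma n γ +
            (((2 * n).choose n : ℝ)) ^ 2 / 16 ^ n *
              Real.exp (n *
                sSup {x : ℝ |
                  ∃ β ∈ Set.Icc (0 : ℝ) 1, ∃ α₁ α₂ : ℝ, x = F2 γ β α₁ α₂})) := by
  intro η hη
  have hε : (10 : ℝ) ^ (-25 : ℤ) = 1 / 10 ^ 25 := by norm_num [zpow_neg]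
  have hM : ∀ γ ∈ Set.Icc (γcrit - (10 : ℝ) ^ (-25 : ℤ)) (γcrit + (10 : ℝ) ^ (-25 : ℤ)),
      -(1 / 10 ^ 20) ≤ ⨆ α, F1 γ α := fun γ h => by
    refine hγ.iSup_F1_near ?_
    rw [hε] at h
    rw [abs_le]
    exact ⟨by linarith [h.1], by linarith [h.2]⟩
  have hB : ∀ γ ∈ Set.Icc (γcrit - (10 : ℝ) ^ (-25 : ℤ)) (γcrit + (10 : ℝ) ^ (-25 : ℤ)),
      BulkAssumption γ := fun γ h => (hstar γ h).2
  have hlo : 0.18 ≤ γcrit - (10 : ℝ) ^ (-25 : ℤ) := by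
    have := hγ.lower
    rw [hε]
    norm_num at this ⊢
    linarith
  obtain ⟨δ, hδ, -, hedge⟩ := exists_sum_choose_sq_le hη
  obtain ⟨C, hC, c, hc, N, hov⟩ := exists_overlap_le hδ hlo hM hB
  obtain ⟨C', hC', hsum⟩ := exists_sum_exp_le hc
  refine ⟨2 + 4 * (C * (C' + 12 / c ^ 3 + 1440)), by positivity, max N 1, ?_⟩
  intro n hn γ hγI hz
  obtain ⟨z, hz⟩ := hz
  have hN : N ≤ n := (le_max_left _ _).trans hn
  have hn : 0 < n := (le_max_right N 1).trans hn
  have hn1 : (1 : ℝ) ≤ n := by exact_mod_cast hn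
  have hn0 : (0 : ℝ) < n := by linarith
  have hs1 : 1 ≤ √(n : ℝ) := Real.one_le_sqrt.2 hn1
  have hM1 : -(1 / 10) ≤ ⨆ α, F1 γ α := le_trans (by norm_num) (hM γ hγI)
  set S := sSup {x : ℝ | ∃ β ∈ Set.Icc (0 : ℝ) 1, ∃ α₁ α₂ : ℝ, x = F2 γ β α₁ α₂} with hSdef
  have hS2 : 2 * (⨆ α, F1 γ α) ≤ S := two_mul_iSup_F1_le γ
  have hS4 : 4 * (⨆ α, F1 γ α) ≤ S := (hB γ hγI).four_mul_iSup_F1_le hM1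
  have hS : -(1 / 10) ≤ S := by
    have := hM γ hγI
    norm_num at this ⊢
    linarith
  set K := (Finset.range (n + 1)).filter fun k : ℕ => δ * n ≤ k ∧ δ * n ≤ (n - k : ℕ) with hK
  have hKr : K ⊆ Finset.range (n + 1) := Finset.filter_subset _ _
  have hsq := EXgammaSq_le hz hKr
  have hcompl : ∑ k ∈ Finset.range (n + 1) \ K, (n.choose k : ℝ) ^ 2 ≤ 2 * (1 + η) ^ n := by
    rw [hK, ← Finset.filter_not]
    exact hedge n
  set W := Real.exp (n * S) * (1 / (n * 4 ^ n)) with hW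
  have hW0 : 0 < W := by positivity
  have hpoly : ((n : ℝ) + 1) * (n ^ 2 * Real.exp (-(c * n))) ≤ 12 / c ^ 3 * √n := by
    have h3 := pow_mul_exp_neg_le hc 3 n
    calc ((n : ℝ) + 1) * (n ^ 2 * Real.exp (-(c * n)))
        ≤ (2 * n) * (n ^ 2 * Real.exp (-(c * n))) :=
          mul_le_mul_of_nonneg_right (by linarith) (by positivity)
      _ = 2 * (n ^ 3 * Real.exp (-(c * n))) := by ring
      _ ≤ 2 * ((Nat.factorial 3 : ℕ) / c ^ 3) := by gcongr
      _ = 12 / c ^ 3 * 1 := by norm_num [Nat.factorial]; ring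
      _ ≤ 12 / c ^ 3 * √n := by gcongr
  have hbulk : ∑ k ∈ K, (n.choose k : ℝ) ^ 2 * pairProb (2 * k) (2 * (n - k)) (2 * z + 1) ≤
      C * (C' + 12 / c ^ 3 + 1440) * (√n * W) := by
    calc ∑ k ∈ K, (n.choose k : ℝ) ^ 2 * pairProb (2 * k) (2 * (n - k)) (2 * z + 1)
        ≤ ∑ k ∈ K, (C * (W *
          (Real.exp (-(n * (c * ((k : ℝ) / n - 1 / 2) ^ 2))) + n ^ 2 * Real.exp (-(c * n)))) +
            C * (4 ^ n * ((n : ℝ) ^ 4 * Real.exp (-(4 * n))))) := by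
          refine Finset.sum_le_sum fun k hk => ?_
          rw [hK, Finset.mem_filter, Finset.mem_range] at hk
          exact hov n k hN hn (by omega) hk.2.1 hk.2.2 γ hγI _
            (by push_cast; rw [hz]) S hS2 hS4
      _ ≤ ∑ k ∈ Finset.range (n + 1), (C * (W *
          (Real.exp (-(n * (c * ((k : ℝ) / n - 1 / 2) ^ 2))) + n ^ 2 * Real.exp (-(c * n)))) +
            C * (4 ^ n * ((n : ℝ) ^ 4 * Real.exp (-(4 * n))))) :=
          Finset.sum_le_sum_of_subset_of_nonneg hKr fun k _ _ => by positivity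
      _ = C * W * (∑ k ∈ Finset.range (n + 1),
            Real.exp (-(n * (c * ((k : ℝ) / n - 1 / 2) ^ 2)))) +
          C * W * (((n : ℝ) + 1) * (n ^ 2 * Real.exp (-(c * n)))) +
          C * (((n : ℝ) + 1) * (4 ^ n * ((n : ℝ) ^ 4 * Real.exp (-(4 * n))))) := by
          rw [Finset.sum_add_distrib, ← Finset.mul_sum, ← Finset.mul_sum, Finset.sum_add_distrib]
          simp only [Finset.sum_const, Finset.card_range, nsmul_eq_mul]
          push_cast
          ring
      _ ≤ C * W * (C' * √n) + C * W * (12 / c ^ 3 * √n) + C * (1440 * √n * W) :=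
          add_le_add (add_le_add
            (mul_le_mul_of_nonneg_left (hsum n hn) (by positivity))
            (mul_le_mul_of_nonneg_left hpoly (by positivity)))
            (mul_le_mul_of_nonneg_left (pow_mul_exp_neg_le_main hn hS) hC.le)
      _ = C * (C' + 12 / c ^ 3 + 1440) * (√n * W) := by ring
  have hWle : √n * W ≤ 4 * (((2 * n).choose n : ℝ) / 16 ^ n * Real.exp (n * S)) := by
    have hcb := centralBinom_lower hn.ne'
    have h16 : (16 : ℝ) ^ n = 4 ^ n * 4 ^ n := by rw [← mul_pow]; norm_num
    have hss : √(n : ℝ) * √n = n := Real.mul_self_sqrt hn0.le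
    calc √n * W = 4 * ((4 : ℝ) ^ n / (4 * √n) / 16 ^ n * Real.exp (n * S)) := by
          rw [hW, h16]
          have : (1 : ℝ) / (n * 4 ^ n) = 1 / (√n * √n * 4 ^ n) := by rw [hss]
          rw [this]
          field_simp
      _ ≤ _ := by gcongr
  set D := C * (C' + 12 / c ^ 3 + 1440) with hD
  have hD0 : 0 < D := by positivity
  have hE := EXgamma_nonneg n γ
  have hP : 0 ≤ ((2 * n).choose n : ℝ) ^ 2 / 16 ^ n * Real.exp (n * S) := by positivity
  have hQ : 0 ≤ (1 + η) ^ n * EXgamma n γ := by positivity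
  calc EXgammaSq n γ
      ≤ 2 * (1 + η) ^ n * EXgamma n γ + ((2 * n).choose n : ℝ) *
        (D * (4 * (((2 * n).choose n : ℝ) / 16 ^ n * Real.exp (n * S)))) := by
        refine hsq.trans (add_le_add (mul_le_mul_of_nonneg_right hcompl hE) ?_)
        exact mul_le_mul_of_nonneg_left
          (hbulk.trans (mul_le_mul_of_nonneg_left hWle hD0.le)) (by positivity)
    _ = 2 * ((1 + η) ^ n * EXgamma n γ) +
        4 * D * (((2 * n).choose n : ℝ) ^ 2 / 16 ^ n * Real.exp (n * S)) := by ring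
    _ ≤ _ := by nlinarith [mul_nonneg hD0.le hQ]
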